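/- Let S be a compact, orientable, two-dimensional embedded C^∞ submanifold of ℝ³ without boundary. There exist constants c > 0 and h₀ ∈ (0,1), depending only on S and the quasi-uniformity constant γ₀, such that for every admissible quasi-uniform triangulation T_h with h ≤ h₀, the solution u of −Δ_S u + u = f and the lifted discrete solution U_h satisfy sup_{x ∈ S} |u(x) − U_h(x)| ≤ c h² |log h| ‖u‖_{W^{2,∞}(S)}, where ‖u‖_{W^{2,∞}(S)} is the supremum over S of |u| + |∇_S u| + |∇_S ∇_S u| (the tangential gradient applied componentwise to ∇_S u). -/

import Mathlib

open MeasureTheory Metric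
open scoped RealInnerProductSpace ENNReal NNReal

noncomputable section

/-- Ambient Euclidean space `ℝ³`. -/
abbrev E3 : Type := EuclideanSpace ℝ (Fin 3)

/-- The tangential gradient of `w : E3 → ℝ` along the set `A` at `x`, with values projected
onto the subspace `P`: the orthogonal projection onto `P` of the Riesz representative of the
derivative of `w` within `A` at `x`. -/
def tGrad (A : Set E3) (P : Submodule ℝ E3) (w : E3 → ℝ) (x : E3) : E3 :=
  (Submodule.orthogonalProjectionOnto P ((InnerProductSpace.toDual ℝ E3).symm (fderivWithin ℝ w A x)) : E3)

/-- A compact, orientable, two-dimensional embedded `C^∞` submanifold of `ℝ³` without boundary,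
described by a global smooth unit normal field `n` and local smooth regular defining functions. -/
structure SmoothSurface where
  S : Set E3
  n : E3 → E3
  compact : IsCompact S
  nonempty : S.Nonempty
  localLevel : ∀ x ∈ S, ∃ U : Set E3, ∃ F : E3 → ℝ, IsOpen U ∧ x ∈ U ∧
    ContDiff ℝ (⊤ : ℕ∞) F ∧ S ∩ U = {y ∈ U | F y = 0} ∧
    (∀ y ∈ U, gradient F y ≠ 0) ∧
    (∀ y, y ∈ S ∩ U → ∃ t : ℝ, gradient F y = t • n y)
  n_unit : ∀ x ∈ S, ‖n x‖ = 1
  n_smooth : ∃ U : Set E3, IsOpen U ∧ S ⊆ U ∧ ContDiffOn ℝ (⊤ : ℕ∞) n U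

namespace SmoothSurface

variable (Srf : SmoothSurface)

/-- The tangent plane of `S` at `x`, as the orthogonal complement of the normal. -/
def tangent (x : E3) : Submodule ℝ E3 := (ℝ ∙ Srf.n x)ᗮ

/-- The tangential gradient `∇_S w` on the surface. -/
def grad (w : E3 → ℝ) (x : E3) : E3 := tGrad Srf.S (Srf.tangent x) w x

/-- The bilinear form `a(v,w) = ∫_S (⟨∇_S v, ∇_S w⟩ + v w)` (w.r.t. 2-dimensional
Hausdorff measure on `S`). -/
def aForm (v w : E3 → ℝ) : ℝ :=
  ∫ x in Srf.S, (⟪Srf.grad v x, Srf.grad w x⟫ + v x * w x) ∂μH[2]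

end SmoothSurface

/-- The (closed, flat) triangle with vertices `t.1, t.2.1, t.2.2`. -/
def triOf (t : E3 × E3 × E3) : Set E3 := convexHull ℝ {t.1, t.2.1, t.2.2}

/-- The vertex set of a triangle. -/
def vertsOf (t : E3 × E3 × E3) : Set E3 := {t.1, t.2.1, t.2.2}

/-- The plane spanned by a triangle. -/
def planeOf (t : E3 × E3 × E3) : Set E3 := (affineSpan ℝ (vertsOf t) : Set E3)

/-- The direction (2-dimensional linear subspace) of the plane of a triangle. -/
def dirOf (t : E3 × E3 × E3) : Submodule ℝ E3 := (affineSpan ℝ (vertsOf t)).direction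

/-- The triangle-wise tangential gradient `∇_{S_h} w` on the triangle `t`. -/
def gradTri (t : E3 × E3 × E3) (w : E3 → ℝ) (x : E3) : E3 := tGrad (triOf t) (dirOf t) w x

/-- An admissible quasi-uniform triangulation `T_h` of the surface `Srf` with mesh parameter `h`
and quasi-uniformity constant `γ₀`, together with the nearest-point projection `a` defined on
a tubular neighbourhood `N` of the surface. -/
structure Triangulation (Srf : SmoothSurface) (γ₀ h : ℝ) where
  T : Finset (E3 × E3 × E3)
  a : E3 → E3
  N : Set E3
  T_nonempty : T.Nonempty
  indep : ∀ t ∈ T, AffineIndependent ℝ ![t.1, t.2.1, t.2.2]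
  verts_on : ∀ t ∈ T, vertsOf t ⊆ Srf.S
  meet : ∀ t ∈ T, ∀ t' ∈ T, t ≠ t' →
    triOf t ∩ triOf t' = ∅ ∨
    (∃ v, v ∈ vertsOf t ∩ vertsOf t' ∧ triOf t ∩ triOf t' = {v}) ∨
    (∃ v w, v ≠ w ∧ v ∈ vertsOf t ∩ vertsOf t' ∧ w ∈ vertsOf t ∩ vertsOf t' ∧
      triOf t ∩ triOf t' = segment ℝ v w)
  diam_le : ∀ t ∈ T, Metric.diam (triOf t) ≤ h
  disk : ∀ t ∈ T, ∃ y ∈ triOf t, closedBall y (γ₀ * h) ∩ planeOf t ⊆ triOf t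
  N_open : IsOpen N
  S_sub : Srf.S ⊆ N
  Sh_sub : (⋃ t ∈ T, triOf t) ⊆ N
  a_smooth : ContDiffOn ℝ (⊤ : ℕ∞) a N
  a_mem : ∀ x ∈ N, a x ∈ Srf.S
  a_nearest : ∀ x ∈ N, ∀ y ∈ Srf.S, dist x (a x) ≤ dist x y
  a_unique : ∀ x ∈ N, ∀ y ∈ Srf.S, dist x y = dist x (a x) → y = a x
  a_bij : Set.BijOn a (⋃ t ∈ T, triOf t) Srf.S

namespace Triangulation

variable {Srf : SmoothSurface} {γ₀ h : ℝ} (Tr : Triangulation Srf γ₀ h)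

/-- The polyhedral surface `S_h`, the union of the triangles. -/
def Sh : Set E3 := ⋃ t ∈ Tr.T, triOf t

/-- Membership in the finite element space `V_h` of continuous, piecewise affine functions
on `S_h` (as functions `E3 → ℝ`; only the values on `S_h` are relevant). -/
def IsVh (v : E3 → ℝ) : Prop :=
  ContinuousOn v Tr.Sh ∧
  ∀ t ∈ Tr.T, ∃ (L : E3 →ₗ[ℝ] ℝ) (c : ℝ), ∀ x ∈ triOf t, v x = L x + c


/-- The discrete bilinear form
`a_h(v,w) = ∫_{S_h} (⟨∇_{S_h} v, ∇_{S_h} w⟩ + v w)`, computed triangle by triangle. -/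
def ahForm (v w : E3 → ℝ) : ℝ :=
  ∑ t ∈ Tr.T, ∫ x in triOf t,
    (⟪gradTri t v x, gradTri t w x⟫ + v x * w x) ∂μH[2]

/-- The lift of a function on `S_h` to a function on `S` via the inverse of `a|_{S_h}`. -/
def liftS (w : E3 → ℝ) : E3 → ℝ := fun y => w (Function.invFunOn Tr.a Tr.Sh y)

/-- The lift of `f : S → ℝ` to `S_h` is `f ∘ a`. -/
def liftSh (f : E3 → ℝ) : E3 → ℝ := fun x => f (Tr.a x)

end Triangulation

/-- `f` is smooth in a neighbourhood of the set `A`. -/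
def SmoothNear (f : E3 → ℝ) (A : Set E3) : Prop :=
  ∃ V : Set E3, IsOpen V ∧ A ⊆ V ∧ ContDiffOn ℝ (⊤ : ℕ∞) f V

/-- `u` is the (weak, hence smooth) solution of `-Δ_S u + u = f` on the surface `Srf`. -/
def IsSolution (Srf : SmoothSurface) (f u : E3 → ℝ) : Prop :=
  SmoothNear u Srf.S ∧
  ∀ φ : E3 → ℝ, ContDiff ℝ (⊤ : ℕ∞) φ → Srf.aForm u φ = ∫ x in Srf.S, f x * φ x ∂μH[2]

/-- `uh` is the discrete Galerkin solution in `V_h` with data the lift `f ∘ a` of `f`. -/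
def Triangulation.IsDiscreteSolution {Srf : SmoothSurface} {γ₀ h : ℝ}
    (Tr : Triangulation Srf γ₀ h) (f uh : E3 → ℝ) : Prop :=
  Tr.IsVh uh ∧
  ∀ φh : E3 → ℝ, Tr.IsVh φh →
    Tr.ahForm uh φh = ∫ x in Tr.Sh, f (Tr.a x) * φh x ∂μH[2]

/-- Orthogonal projection onto the affine tangent plane of `S` at `z₀`. -/
def SmoothSurface.P0 (Srf : SmoothSurface) (z₀ : E3) (x : E3) : E3 :=
  z₀ + (Submodule.orthogonalProjectionOnto (Srf.tangent z₀) (x - z₀) : E3)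

/-- `r(x) = ‖P₀(x) − z₀‖`, the distance of the tangential projection of `x` to `z₀`. -/
def SmoothSurface.rfn (Srf : SmoothSurface) (z₀ : E3) (x : E3) : ℝ :=
  ‖Srf.P0 z₀ x - z₀‖

/-- The affine tangent plane `z₀ + T_{z₀}S`. -/
def SmoothSurface.tplane (Srf : SmoothSurface) (z₀ : E3) : Set E3 :=
  {x : E3 | x - z₀ ∈ Srf.tangent z₀}

/-- The disk `D = B₁₀₀(z₀)` in the affine tangent plane at `z₀`. -/
def SmoothSurface.disk100 (Srf : SmoothSurface) (z₀ : E3) : Set E3 :=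
  Srf.tplane z₀ ∩ closedBall z₀ 100

/-- `r₁ > 0` is a graph radius for `S`: uniformly in `z₀ ∈ S`, the piece `B_{2r₁}(z₀) ∩ S`
is a graph over the tangent plane at `z₀`, in particular `P₀` is injective on it. -/
def SmoothSurface.IsGraphRadius (Srf : SmoothSurface) (r₁ : ℝ) : Prop :=
  0 < r₁ ∧ r₁ ≤ 1 ∧ ∀ z₀ ∈ Srf.S, Set.InjOn (Srf.P0 z₀) (Srf.S ∩ closedBall z₀ (2 * r₁))

/-- `ζ` is an admissible smooth cutoff at `z₀`: supported in the ball of radius `3r₁/2`,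
equal to `1` on the ball of radius `r₁`, with `C²`-bounds at most `Cζ` (uniform in `z₀`). -/
def IsCutoff (z₀ : E3) (r₁ Cζ : ℝ) (ζ : E3 → ℝ) : Prop :=
  ContDiff ℝ (⊤ : ℕ∞) ζ ∧ tsupport ζ ⊆ closedBall z₀ (3 / 2 * r₁) ∧
  (∀ x ∈ closedBall z₀ r₁, ζ x = 1) ∧
  ∀ x : E3, |ζ x| + ‖fderiv ℝ ζ x‖ + ‖fderiv ℝ (fderiv ℝ ζ) x‖ ≤ Cζ

/-- `v` is the Neumann Green's function with pole `z₀` of `−Δ + 1` on the disk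
`D = B₁₀₀(z₀)` in the tangent plane at `z₀`: it is smooth away from the pole, satisfies
`∫_D (⟨∇v, ∇φ⟩ + v φ) = φ(z₀)` for every smooth test function, and differs from
`(1/2π) log‖· − z₀‖` by an `H²(D)`-function with norm at most `CG`. -/
def SmoothSurface.IsGreen (Srf : SmoothSurface) (z₀ : E3) (CG : ℝ) (v : E3 → ℝ) : Prop :=
  ContDiffOn ℝ (⊤ : ℕ∞) v (Srf.disk100 z₀ \ {z₀}) ∧
  (∀ φ : E3 → ℝ, ContDiff ℝ (⊤ : ℕ∞) φ →
    ∫ x in Srf.disk100 z₀,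
      (⟪tGrad (Srf.disk100 z₀) (Srf.tangent z₀) v x,
        tGrad (Srf.disk100 z₀) (Srf.tangent z₀) φ x⟫ + v x * φ x) ∂μH[2] = φ z₀) ∧
  (∫ x in Srf.disk100 z₀,
      ((v x - (1 / (2 * Real.pi)) * Real.log ‖x - z₀‖) ^ 2 +
        ‖fderivWithin ℝ (fun y => v y - (1 / (2 * Real.pi)) * Real.log ‖y - z₀‖)
            (Srf.disk100 z₀) x‖ ^ 2 +
        ‖fderivWithin ℝ
            (fun y => fderivWithin ℝ
              (fun y' => v y' - (1 / (2 * Real.pi)) * Real.log ‖y' - z₀‖)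
              (Srf.disk100 z₀) y)
            (Srf.disk100 z₀) x‖ ^ 2) ∂μH[2]) ≤ CG

/-- The approximate Green's function `g̃(x) = ζ(x) v(P₀(x))` on `S`. -/
def approxGreen (Srf : SmoothSurface) (z₀ : E3) (ζ v : E3 → ℝ) : E3 → ℝ :=
  fun x => ζ x * v (Srf.P0 z₀ x)

/-- The cut-off lifted logarithm `l̃(x) = ζ(x) log r(x)` on `S`. -/
def cutLog (Srf : SmoothSurface) (z₀ : E3) (ζ : E3 → ℝ) : E3 → ℝ :=
  fun x => ζ x * Real.log (Srf.rfn z₀ x)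

/-- `lh` is the discrete (Galerkin) projection of the function `w` on `S`:
`a_h(lh, v_h) = a(w, V_h)` for all `v_h ∈ V_h`, where `V_h` is the lift of `v_h` to `S`. -/
def Triangulation.IsDiscreteProjection {Srf : SmoothSurface} {γ₀ h : ℝ}
    (Tr : Triangulation Srf γ₀ h) (w lh : E3 → ℝ) : Prop :=
  Tr.IsVh lh ∧ ∀ vh : E3 → ℝ, Tr.IsVh vh → Tr.ahForm lh vh = Srf.aForm w (Tr.liftS vh)


section Development
open Set Filter Topology

section PartN1
/-! ### L² toolkit for bounded measurable functions -/
section toolkit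

variable {α : Type*} [MeasurableSpace α] {F : Type*} [NormedAddCommGroup F]

/-- bounded, a.e. strongly measurable functions -/
def BM (μ : Measure α) (f : α → F) : Prop :=
  AEStronglyMeasurable f μ ∧ ∃ C : ℝ, ∀ᵐ x ∂μ, ‖f x‖ ≤ C

/-- the L² norm -/
def nrm (μ : Measure α) (f : α → F) : ℝ := Real.sqrt (∫ x, ‖f x‖ ^ 2 ∂μ)

variable {μ : Measure α}

lemma BM.add {f g : α → F} (hf : BM μ f) (hg : BM μ g) : BM μ (fun x => f x + g x) := by
  obtain ⟨hf1, C, hC⟩ := hf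
  obtain ⟨hg1, D, hD⟩ := hg
  refine ⟨hf1.add hg1, C + D, ?_⟩
  filter_upwards [hC, hD] with x h1 h2
  exact (norm_add_le _ _).trans (add_le_add h1 h2)

lemma BM.neg {f : α → F} (hf : BM μ f) : BM μ (fun x => - f x) := by
  obtain ⟨hf1, C, hC⟩ := hf
  refine ⟨hf1.neg, C, ?_⟩
  filter_upwards [hC] with x h1
  simpa using h1

lemma BM.sub {f g : α → F} (hf : BM μ f) (hg : BM μ g) : BM μ (fun x => f x - g x) := by
  simpa [sub_eq_add_neg] using hf.add hg.neg

lemma BM.smul [NormedSpace ℝ F] {f : α → ℝ} {g : α → F} (hf : BM μ f) (hg : BM μ g) :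
    BM μ (fun x => f x • g x) := by
  obtain ⟨hf1, C, hC⟩ := hf
  obtain ⟨hg1, D, hD⟩ := hg
  refine ⟨hf1.smul hg1, C * D, ?_⟩
  filter_upwards [hC, hD] with x h1 h2
  rw [norm_smul]
  exact mul_le_mul h1 h2 (norm_nonneg _) ((norm_nonneg _).trans h1)

lemma BM.mul {f g : α → ℝ} (hf : BM μ f) (hg : BM μ g) :
    BM μ (fun x => f x * g x) := hf.smul hg

lemma BM.norm {f : α → F} (hf : BM μ f) : BM μ (fun x => ‖f x‖) := by
  obtain ⟨hf1, C, hC⟩ := hf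
  exact ⟨hf1.norm, C, by filter_upwards [hC] with x h1; simpa using h1⟩

lemma BM.abs {f : α → ℝ} (hf : BM μ f) : BM μ (fun x => |f x|) := hf.norm

lemma BM.const (c : F) : BM μ (fun _ => c) := ⟨aestronglyMeasurable_const, ‖c‖, by simp⟩

lemma BM.congr {f g : α → F} (hf : BM μ f) (h : f =ᵐ[μ] g) : BM μ g := by
  obtain ⟨hf1, C, hC⟩ := hf
  refine ⟨hf1.congr h, C, ?_⟩
  filter_upwards [hC, h] with x h1 h2
  rwa [← h2]

lemma BM.inner [InnerProductSpace ℝ F] {f g : α → F} (hf : BM μ f) (hg : BM μ g) :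
    BM μ (fun x => ⟪f x, g x⟫) := by
  obtain ⟨hf1, C, hC⟩ := hf
  obtain ⟨hg1, D, hD⟩ := hg
  refine ⟨hf1.inner hg1, C * D, ?_⟩
  filter_upwards [hC, hD] with x h1 h2
  exact (norm_inner_le_norm _ _).trans
    (mul_le_mul h1 h2 (norm_nonneg _) ((norm_nonneg _).trans h1))

lemma BM.pow {f : α → ℝ} (hf : BM μ f) (n : ℕ) : BM μ (fun x => f x ^ n) := by
  induction n with
  | zero => simpa using BM.const (1 : ℝ)
  | succ k ih => simpa [pow_succ] using ih.mul hf

lemma BM.integrable [IsFiniteMeasure μ] {f : α → F} (hf : BM μ f) :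
    Integrable f μ := by
  obtain ⟨hf1, C, hC⟩ := hf
  exact Integrable.of_bound hf1 C hC

lemma BM.sq_int [IsFiniteMeasure μ] {f : α → F} (hf : BM μ f) :
    Integrable (fun x => ‖f x‖ ^ 2) μ := (hf.norm.pow 2).integrable

lemma nrm_nonneg (f : α → F) : 0 ≤ nrm μ f := Real.sqrt_nonneg _

lemma nrm_sq (f : α → F) : nrm μ f ^ 2 = ∫ x, ‖f x‖ ^ 2 ∂μ :=
  Real.sq_sqrt (integral_nonneg fun x => by positivity)

lemma nrm_norm (f : α → F) : nrm μ (fun x => ‖f x‖) = nrm μ f := by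
  simp [nrm]

lemma nrm_mono {F' : Type*} [NormedAddCommGroup F'] [IsFiniteMeasure μ] {f : α → F} {g : α → F'}
    (hg : BM μ g) (h : ∀ᵐ x ∂μ, ‖f x‖ ≤ ‖g x‖) :
    nrm μ f ≤ nrm μ g := by
  refine Real.sqrt_le_sqrt ?_
  refine integral_mono_of_nonneg (Eventually.of_forall fun x => by positivity) hg.sq_int ?_
  filter_upwards [h] with x hx
  gcongr

lemma cs_nrm {F' : Type*} [NormedAddCommGroup F'] [IsFiniteMeasure μ] {f : α → F} {g : α → F'}
    (hf : BM μ f) (hg : BM μ g) :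
    ∫ x, ‖f x‖ * ‖g x‖ ∂μ ≤ nrm μ f * nrm μ g := by
  have key : ∀ t : ℝ, 0 ≤ nrm μ f ^ 2 * (t * t) + (- 2 * ∫ x, ‖f x‖ * ‖g x‖ ∂μ) * t + nrm μ g ^ 2 := by
    intro t
    have h1 : 0 ≤ ∫ x, (t * ‖f x‖ - ‖g x‖) ^ 2 ∂μ := integral_nonneg fun x => by positivity
    have h2 : ∫ x, (t * ‖f x‖ - ‖g x‖) ^ 2 ∂μ =
        ∫ x, ((t * t) * ‖f x‖ ^ 2 + (-2 * t) * (‖f x‖ * ‖g x‖) + ‖g x‖ ^ 2) ∂μ := by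
      congr 1; ext x; ring
    rw [h2, integral_add, integral_add, integral_const_mul, integral_const_mul] at h1
    · rw [nrm_sq, nrm_sq]; linarith
    · exact hf.sq_int.const_mul _
    · exact ((hf.norm.mul hg.norm).integrable).const_mul _
    · exact (hf.sq_int.const_mul _).add (((hf.norm.mul hg.norm).integrable).const_mul _)
    · exact hg.sq_int
  have := discrim_le_zero key
  rw [discrim] at this
  have h3 : (∫ x, ‖f x‖ * ‖g x‖ ∂μ) ^ 2 ≤ (nrm μ f * nrm μ g) ^ 2 := by nlinarith
  exact (le_abs_self _).trans (abs_le_of_sq_le_sq h3 (mul_nonneg (nrm_nonneg _) (nrm_nonneg _)))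

lemma cs_nrm_mul [IsFiniteMeasure μ] {f g : α → ℝ} (hf : BM μ f) (hg : BM μ g) :
    |∫ x, f x * g x ∂μ| ≤ nrm μ f * nrm μ g := by
  refine le_trans (abs_integral_le_integral_abs) ?_
  simpa [abs_mul] using cs_nrm hf hg

lemma nrm_add_le [IsFiniteMeasure μ] {f g : α → F}
    (hf : BM μ f) (hg : BM μ g) : nrm μ (fun x => f x + g x) ≤ nrm μ f + nrm μ g := by
  have h0 := nrm_nonneg (μ := μ) f
  have h1 := nrm_nonneg (μ := μ) g
  refine Real.sqrt_le_iff.mpr ⟨by positivity, ?_⟩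
  have h2 : ∫ x, ‖f x + g x‖ ^ 2 ∂μ ≤ ∫ x, (‖f x‖ ^ 2 + 2 * (‖f x‖ * ‖g x‖) + ‖g x‖ ^ 2) ∂μ := by
    refine integral_mono (hf.add hg).sq_int ?_ ?_
    · exact ((hf.sq_int).add ((hf.norm.mul hg.norm).integrable.const_mul _)).add hg.sq_int
    · intro x
      have := norm_add_le (f x) (g x)
      have h3 := norm_nonneg (f x + g x)
      simp only
      nlinarith
  rw [integral_add, integral_add, integral_const_mul] at h2
  · have e1 := nrm_sq (μ := μ) f
    have e2 := nrm_sq (μ := μ) g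
    have e3 := cs_nrm hf hg
    have e4 : (nrm μ f + nrm μ g) ^ 2 = nrm μ f ^ 2 + 2 * (nrm μ f * nrm μ g) + nrm μ g ^ 2 := by ring
    rw [e4, e1, e2]
    linarith
  · exact hf.sq_int
  · exact (hf.norm.mul hg.norm).integrable.const_mul _
  · exact (hf.sq_int).add ((hf.norm.mul hg.norm).integrable.const_mul _)
  · exact hg.sq_int

lemma nrm_neg (f : α → F) : nrm μ (fun x => - f x) = nrm μ f := by simp [nrm]

lemma nrm_sub_le [IsFiniteMeasure μ] {f g : α → F}
    (hf : BM μ f) (hg : BM μ g) : nrm μ (fun x => f x - g x) ≤ nrm μ f + nrm μ g := by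
  have := nrm_add_le hf hg.neg
  rw [nrm_neg] at this
  simpa [sub_eq_add_neg] using this

lemma nrm_const_smul [NormedSpace ℝ F] (c : ℝ) (f : α → F) :
    nrm μ (fun x => c • f x) = |c| * nrm μ f := by
  have : ∀ x, ‖c • f x‖ ^ 2 = c ^ 2 * ‖f x‖ ^ 2 := by
    intro x; rw [norm_smul, mul_pow, Real.norm_eq_abs, sq_abs]
  simp only [nrm, this]
  rw [integral_const_mul, Real.sqrt_mul (sq_nonneg c), Real.sqrt_sq_eq_abs]

lemma nrm_const_mul (c : ℝ) (f : α → ℝ) :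
    nrm μ (fun x => c * f x) = |c| * nrm μ f := nrm_const_smul c f

lemma nrm_le_of_bound [IsFiniteMeasure μ] {f : α → F} {C : ℝ} (hC : 0 ≤ C)
    (h : ∀ᵐ x ∂μ, ‖f x‖ ≤ C) : nrm μ f ≤ C * Real.sqrt (μ.real univ) := by
  have h1 : nrm μ f ≤ nrm μ (fun _ : α => C) := by
    refine nrm_mono (BM.const C) ?_
    filter_upwards [h] with x hx
    rwa [Real.norm_of_nonneg hC]
  refine h1.trans (le_of_eq ?_)
  simp only [nrm, integral_const, Real.norm_eq_abs, sq_abs, smul_eq_mul]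
  rw [Real.sqrt_mul (by positivity), Real.sqrt_sq hC, mul_comm]

/-- integrals against comparable measures -/
lemma integral_compare {ν : Measure α} {ε : ℝ} (hε : 0 ≤ ε) (hε1 : ε ≤ 1)
    (h1 : ν ≤ ENNReal.ofReal (1 + ε) • μ) (h2 : μ ≤ ENNReal.ofReal (1 + ε) • ν)
    {H : α → ℝ} (hH : Integrable H μ) :
    Integrable H ν ∧ |∫ x, H x ∂ν - ∫ x, H x ∂μ| ≤ 2 * ε * ∫ x, |H x| ∂μ := by
  have int1 : ∀ {H : α → ℝ}, Integrable H μ → Integrable H ν := fun {H} h =>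
    (h.smul_measure (c := ENNReal.ofReal (1 + ε)) ENNReal.ofReal_ne_top).mono_measure h1
  have pos : ∀ H : α → ℝ, Integrable H μ → (∀ x, 0 ≤ H x) →
      |∫ x, H x ∂ν - ∫ x, H x ∂μ| ≤ 2 * ε * ∫ x, H x ∂μ := by
    intro H hi hp
    have e1 : ∫ x, H x ∂ν ≤ (1 + ε) * ∫ x, H x ∂μ := by
      have := integral_mono_measure h1 (Eventually.of_forall hp)
        (hi.smul_measure (c := ENNReal.ofReal (1 + ε)) ENNReal.ofReal_ne_top)
      rwa [integral_smul_measure, ENNReal.toReal_ofReal (by linarith), smul_eq_mul] at this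
    have e2 : ∫ x, H x ∂μ ≤ (1 + ε) * ∫ x, H x ∂ν := by
      have := integral_mono_measure h2 (Eventually.of_forall hp)
        ((int1 hi).smul_measure (c := ENNReal.ofReal (1 + ε)) ENNReal.ofReal_ne_top)
      rwa [integral_smul_measure, ENNReal.toReal_ofReal (by linarith), smul_eq_mul] at this
    have e3 : 0 ≤ ∫ x, H x ∂μ := integral_nonneg hp
    rw [abs_le]
    constructor <;> nlinarith
  refine ⟨int1 hH, ?_⟩
  have hp := pos (fun x => max (H x) 0) hH.pos_part (fun x => le_max_right _ _)
  have hn := pos (fun x => max (- H x) 0) hH.neg_part (fun x => le_max_right _ _)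
  have d1 : ∀ κ : Measure α, Integrable H κ →
      ∫ x, H x ∂κ = ∫ x, max (H x) 0 ∂κ - ∫ x, max (-H x) 0 ∂κ := by
    intro κ hk
    rw [← integral_sub hk.pos_part hk.neg_part]
    congr 1; ext x
    rcases le_total (H x) 0 with h | h
    · rw [max_eq_right h, max_eq_left (by linarith)]; ring
    · rw [max_eq_left h, max_eq_right (by linarith)]; ring
  have d2 : ∫ x, |H x| ∂μ = ∫ x, max (H x) 0 ∂μ + ∫ x, max (-H x) 0 ∂μ := by
    rw [← integral_add hH.pos_part hH.neg_part]
    congr 1; ext x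
    rcases le_total (H x) 0 with h | h
    · rw [max_eq_right h, max_eq_left (by linarith), abs_of_nonpos h]; ring
    · rw [max_eq_left h, max_eq_right (by linarith), abs_of_nonneg h]; ring
  rw [d1 μ hH, d1 ν (int1 hH), d2]
  rw [abs_le] at hp hn ⊢
  constructor <;> linarith [hp.1, hp.2, hn.1, hn.2]

end toolkit

/-! ### Hausdorff measure and bi-Lipschitz maps -/
section biLip

variable {X : Type*} [MetricSpace X] [MeasurableSpace X] [BorelSpace X]

lemma haus_image_le {f : X → X} {A : Set X} {K : ℝ} (hK : 0 ≤ K)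
    (h : ∀ x ∈ A, ∀ y ∈ A, dist (f x) (f y) ≤ K * dist x y) :
    μH[2] (f '' A) ≤ ENNReal.ofReal (K ^ 2) * μH[2] A := by
  have h1 : LipschitzOnWith (Real.toNNReal K) f A :=
    LipschitzOnWith.of_dist_le_mul fun x hx y hy => by
      rw [Real.coe_toNNReal K hK]; exact h x hx y hy
  have := h1.hausdorffMeasure_image_le (d := 2) (by norm_num)
  refine this.trans (le_of_eq ?_)
  congr 1
  rw [ENNReal.ofReal_pow hK]
  norm_cast

lemma haus_le_image {f : X → X} {A : Set X} {K : ℝ} (hK : 0 ≤ K)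
    (h : ∀ x ∈ A, ∀ y ∈ A, dist x y ≤ K * dist (f x) (f y)) :
    μH[2] A ≤ ENNReal.ofReal (K ^ 2) * μH[2] (f '' A) := by
  rcases A.eq_empty_or_nonempty with rfl | ⟨x0, hx0⟩
  · simp
  haveI : Nonempty X := ⟨x0⟩
  have hinj : InjOn f A := fun x hx y hy hxy => by
    have := h x hx y hy
    rw [hxy, dist_self, mul_zero] at this
    exact dist_le_zero.mp this
  have hl : LeftInvOn (Function.invFunOn f A) f A := hinj.leftInvOn_invFunOn
  have e : A = Function.invFunOn f A '' (f '' A) := (hl.image_image).symm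
  conv_lhs => rw [e]
  refine haus_image_le hK ?_
  rintro _ ⟨x, hx, rfl⟩ _ ⟨y, hy, rfl⟩
  rw [hl hx, hl hy]
  exact h x hx y hy

lemma map_haus_le {f : X → X} (hf : Measurable f) {A : Set X} (hA : MeasurableSet A) {K : ℝ}
    (hK : 0 ≤ K) (h : ∀ x ∈ A, ∀ y ∈ A, dist x y ≤ K * dist (f x) (f y)) {B : Set X}
    (hB : ∀ x ∈ A, f x ∈ B) :
    (μH[2].restrict A).map f ≤ ENNReal.ofReal (K ^ 2) • (μH[2].restrict B) := by
  refine Measure.le_iff.mpr fun s hs => ?_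
  rw [Measure.map_apply hf hs, Measure.restrict_apply (hf hs), Measure.smul_apply,
    Measure.restrict_apply hs, smul_eq_mul]
  refine (haus_le_image (f := f) hK (A := f ⁻¹' s ∩ A) ?_).trans ?_
  · intro x hx y hy; exact h x hx.2 y hy.2
  · gcongr
    rintro _ ⟨x, hx, rfl⟩
    exact ⟨hx.1, hB x hx.2⟩

lemma le_map_haus {f : X → X} (hf : Measurable f) {A : Set X} (hA : MeasurableSet A) {K : ℝ}
    (hK : 0 ≤ K) (h : ∀ x ∈ A, ∀ y ∈ A, dist (f x) (f y) ≤ K * dist x y) {B : Set X}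
    (hB : B ⊆ f '' A) :
    μH[2].restrict B ≤ ENNReal.ofReal (K ^ 2) • ((μH[2].restrict A).map f) := by
  refine Measure.le_iff.mpr fun s hs => ?_
  rw [Measure.smul_apply, Measure.map_apply hf hs, Measure.restrict_apply (hf hs),
    Measure.restrict_apply hs, smul_eq_mul]
  refine le_trans (measure_mono ?_) (haus_image_le (f := f) hK (A := f ⁻¹' s ∩ A) ?_)
  · intro y hy
    obtain ⟨x, hx, rfl⟩ := hB hy.2
    exact ⟨x, ⟨hy.1, hx⟩, rfl⟩
  · intro x hx y hy; exact h x hx.2 y hy.2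

end biLip
end PartN1

section PartN2
/-- Geometric data attached to a surface: a globally smooth map agreeing with the nearest
point projection near the surface, with uniform bounds. -/
structure Geo (Srf : SmoothSurface) where
  a : E3 → E3
  ρ : ℝ
  L : ℝ
  ρ_pos : 0 < ρ
  ρ_le : ρ ≤ 1
  L_one : 1 ≤ L
  smooth : ContDiff ℝ (⊤ : ℕ∞) a
  bd : ∀ x, ‖fderiv ℝ a x‖ ≤ L
  lip : ∀ x y, ‖fderiv ℝ a x - fderiv ℝ a y‖ ≤ L * ‖x - y‖
  fix : ∀ s ∈ Srf.S, a s = s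
  near : ∀ s ∈ Srf.S, ∀ x, ‖x - s‖ < ρ → a x ∈ Srf.S
  proj : ∀ s ∈ Srf.S, ∀ v, fderiv ℝ a s v = v - ⟪Srf.n s, v⟫ • Srf.n s
  ahl : ∀ z ∈ Srf.S, ∀ r, 0 ≤ r → μH[2] (Srf.S ∩ closedBall z r) ≤ ENNReal.ofReal (L * r ^ 2)

lemma inner_gradient' (f : E3 → ℝ) (x k : E3) : ⟪gradient f x, k⟫ = fderiv ℝ f x k := by
  simp [gradient]

lemma norm_gradient' (f : E3 → ℝ) (x : E3) : ‖gradient f x‖ = ‖fderiv ℝ f x‖ := by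
  simp [gradient]

namespace Geo

variable {Srf : SmoothSurface} (G : Geo Srf)

/-- surface measure -/
def mu (_ : Geo Srf) : Measure E3 := μH[2].restrict Srf.S

/-- differential of a -/
def D (x : E3) : E3 →L[ℝ] E3 := fderiv ℝ G.a x

/-- tangential gradient of the extension -/
def gd (v : E3 → ℝ) (x : E3) : E3 := gradient (v ∘ G.a) x

/-- differentiability of the extension -/
def DA (v : E3 → ℝ) (x : E3) : Prop := DifferentiableAt ℝ (v ∘ G.a) x

lemma L_pos : 0 < G.L := lt_of_lt_of_le one_pos G.L_one

lemma diffA (x : E3) : DifferentiableAt ℝ G.a x := (G.smooth.differentiable (by simp)) x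

lemma hasD (x : E3) : HasFDerivAt G.a (G.D x) x := (G.diffA x).hasFDerivAt

lemma contA : Continuous G.a := G.smooth.continuous

lemma contD : Continuous G.D := G.smooth.continuous_fderiv (by simp)

lemma D_le (x k : E3) : ‖G.D x k‖ ≤ G.L * ‖k‖ :=
  (ContinuousLinearMap.le_opNorm _ _).trans (by gcongr; exact G.bd x)

lemma D_sub (x y k : E3) : ‖G.D x k - G.D y k‖ ≤ G.L * ‖x - y‖ * ‖k‖ := by
  have := ContinuousLinearMap.le_opNorm (G.D x - G.D y) k
  refine this.trans ?_
  gcongr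
  exact G.lip x y

lemma a_lip (x y : E3) : ‖G.a x - G.a y‖ ≤ G.L * ‖x - y‖ :=
  Convex.norm_image_sub_le_of_norm_fderiv_le (fun z _ => G.diffA z) (fun z _ => G.bd z)
    convex_univ (mem_univ y) (mem_univ x)

lemma a_shift (x x' y : E3) :
    ‖(G.a (x + y) - G.a x) - (G.a (x' + y) - G.a x')‖ ≤ G.L * ‖y‖ * ‖x - x'‖ := by
  have hd : ∀ z, HasFDerivAt (fun z => G.a (z + y) - G.a z) (G.D (z + y) - G.D z) z := by
    intro z
    exact ((hasFDerivAt_comp_add_right y).2 (G.hasD (z + y))).sub (G.hasD z)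
  refine Convex.norm_image_sub_le_of_norm_hasFDerivWithin_le (f := fun z => G.a (z + y) - G.a z)
    (fun z _ => (hd z).hasFDerivWithinAt) (fun z _ => ?_) convex_univ (mem_univ x') (mem_univ x)
  refine (G.lip (z + y) z).trans (le_of_eq ?_)
  simp

lemma a_taylor (x y : E3) : ‖G.a y - G.a x - G.D x (y - x)‖ ≤ G.L * ‖y - x‖ ^ 2 := by
  have := Convex.norm_image_sub_le_of_norm_hasFDerivWithin_le' (f := G.a) (f' := G.D)
    (φ := G.D x) (s := closedBall x ‖y - x‖) (C := G.L * ‖y - x‖)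
    (fun z _ => (G.hasD z).hasFDerivWithinAt) (fun z hz => ?_) (convex_closedBall _ _)
    (mem_closedBall_self (norm_nonneg _)) (y := y) (by simp [dist_eq_norm])
  · refine this.trans (le_of_eq (by ring))
  · refine (G.lip z x).trans ?_
    rw [mem_closedBall, dist_eq_norm] at hz
    have := G.L_pos
    gcongr

variable {G}

lemma D_apply {s : E3} (hs : s ∈ Srf.S) (v : E3) : G.D s v = v - ⟪Srf.n s, v⟫ • Srf.n s :=
  G.proj s hs v

lemma D_idem {s : E3} (hs : s ∈ Srf.S) (v : E3) : G.D s (G.D s v) = G.D s v := by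
  rw [D_apply hs (G.D s v), D_apply hs v]
  simp [inner_sub_right, inner_smul_right, Srf.n_unit s hs]

lemma D_symm {s : E3} (hs : s ∈ Srf.S) (v w : E3) : ⟪G.D s v, w⟫ = ⟪v, G.D s w⟫ := by
  rw [D_apply hs, D_apply hs]
  simp only [inner_sub_left, inner_sub_right, inner_smul_left, inner_smul_right,
    real_inner_comm]
  simp only [conj_trivial]
  ring

lemma D_norm_le {s : E3} (hs : s ∈ Srf.S) (v : E3) : ‖G.D s v‖ ≤ ‖v‖ := by
  have h : ‖G.D s v‖ ^ 2 ≤ ‖G.D s v‖ * ‖v‖ := by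
    rw [← real_inner_self_eq_norm_sq, D_symm hs, D_idem hs, real_inner_comm]
    exact real_inner_le_norm _ _
  by_contra hc
  push Not at hc
  nlinarith [norm_nonneg v, norm_nonneg (G.D s v)]

lemma Dn_norm_le {s : E3} (hs : s ∈ Srf.S) (v : E3) : ‖v - G.D s v‖ ≤ ‖v‖ := by
  rw [D_apply hs, sub_sub_cancel, norm_smul, Srf.n_unit s hs, mul_one]
  refine (norm_inner_le_norm _ _).trans ?_
  rw [Srf.n_unit s hs, one_mul]

/-- chords are almost tangential -/
lemma chord {s t : E3} (hs : s ∈ Srf.S) (ht : t ∈ Srf.S) :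
    ‖(t - s) - G.D s (t - s)‖ ≤ G.L * ‖t - s‖ ^ 2 := by
  have := G.a_taylor s t
  rwa [G.fix s hs, G.fix t ht] at this

lemma chord' {s t p : E3} (hs : s ∈ Srf.S) (ht : t ∈ Srf.S) :
    ‖(t - s) - G.D p (t - s)‖ ≤ G.L * (‖t - s‖ + ‖s - p‖) * ‖t - s‖ := by
  have h1 := chord (G := G) hs ht
  have h2 := G.D_sub s p (t - s)
  have : (t - s) - G.D p (t - s) = ((t - s) - G.D s (t - s)) + (G.D s (t - s) - G.D p (t - s)) := by
    abel
  rw [this]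
  refine (norm_add_le _ _).trans ?_
  nlinarith

lemma ev_mem {s : E3} (hs : s ∈ Srf.S) : ∀ᶠ z in 𝓝 s, G.a z ∈ Srf.S := by
  filter_upwards [ball_mem_nhds s G.ρ_pos] with z hz
  exact G.near s hs z (by simpa [dist_eq_norm] using hz)

lemma comp_hasFDerivAt {w : E3 → ℝ} {q : E3 → E3} {B : E3 →L[ℝ] E3} {x : E3}
    (hq : HasFDerivAt q B x) (hS : ∀ᶠ z in 𝓝 x, q z ∈ Srf.S) (hw : G.DA w (q x)) :
    HasFDerivAt (w ∘ q) ((fderiv ℝ (w ∘ G.a) (q x)).comp B) x := by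
  have h1 : HasFDerivAt ((w ∘ G.a) ∘ q) ((fderiv ℝ (w ∘ G.a) (q x)).comp B) x :=
    (DifferentiableAt.hasFDerivAt hw).comp x hq
  refine h1.congr_of_eventuallyEq ?_
  filter_upwards [hS] with z hz
  simp [G.fix _ hz]

lemma inner_gd (v : E3 → ℝ) (x k : E3) : ⟪G.gd v x, k⟫ = fderiv ℝ (v ∘ G.a) x k :=
  inner_gradient' _ _ _

lemma inner_gd_comp {w : E3 → ℝ} {q : E3 → E3} {B : E3 →L[ℝ] E3} {x : E3}
    (hq : HasFDerivAt q B x) (hS : ∀ᶠ z in 𝓝 x, q z ∈ Srf.S) (hw : G.DA w (q x)) (k : E3) :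
    fderiv ℝ (w ∘ q) x k = ⟪G.gd w (q x), B k⟫ := by
  rw [(comp_hasFDerivAt hq hS hw).fderiv, inner_gd]; rfl

/-- the derivative off the surface -/
lemma DA_off {w : E3 → ℝ} {x s : E3} (hs : s ∈ Srf.S) (hx : ‖x - s‖ < G.ρ)
    (hw : G.DA w (G.a x)) :
    HasFDerivAt (w ∘ G.a) ((fderiv ℝ (w ∘ G.a) (G.a x)).comp (G.D x)) x := by
  refine comp_hasFDerivAt (G.hasD x) ?_ hw
  have : ball s G.ρ ∈ 𝓝 x := isOpen_ball.mem_nhds (by simpa [dist_eq_norm] using hx)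
  filter_upwards [this] with z hz
  exact G.near s hs z (by simpa [dist_eq_norm] using hz)

lemma fderiv_off {w : E3 → ℝ} {x s : E3} (hs : s ∈ Srf.S) (hx : ‖x - s‖ < G.ρ)
    (hw : G.DA w (G.a x)) (k : E3) :
    fderiv ℝ (w ∘ G.a) x k = ⟪G.gd w (G.a x), G.D x k⟫ := by
  rw [(DA_off hs hx hw).fderiv, inner_gd]; rfl

lemma gd_eq_zero {v : E3 → ℝ} {x : E3} (h : ¬ G.DA v x) : G.gd v x = 0 := by
  unfold gd gradient
  rw [fderiv_zero_of_not_differentiableAt h]; simp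

lemma gd_tan (v : E3 → ℝ) {x : E3} (hx : x ∈ Srf.S) : G.D x (G.gd v x) = G.gd v x := by
  by_cases h : G.DA v x
  · refine ext_inner_right ℝ fun k => ?_
    rw [D_symm hx, inner_gd, inner_gd, fderiv_off (x := x) hx (by simpa using G.ρ_pos)
      (by rwa [G.fix x hx]), fderiv_off (x := x) hx (by simpa using G.ρ_pos)
      (by rwa [G.fix x hx]), D_idem hx]
  · rw [gd_eq_zero h, map_zero]

lemma gd_congr_ev {v w : E3 → ℝ} (h : EqOn v w Srf.S) {x : E3} (hx : x ∈ Srf.S) :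
    v ∘ G.a =ᶠ[𝓝 x] w ∘ G.a := by
  filter_upwards [ev_mem hx] with z hz using h hz

lemma gd_congr {v w : E3 → ℝ} (h : EqOn v w Srf.S) {x : E3} (hx : x ∈ Srf.S) :
    G.gd v x = G.gd w x := by
  unfold gd gradient
  rw [(gd_congr_ev h hx).fderiv_eq]

lemma DA_congr {v w : E3 → ℝ} (h : EqOn v w Srf.S) {x : E3} (hx : x ∈ Srf.S) :
    G.DA v x ↔ G.DA w x := (gd_congr_ev h hx).differentiableAt_iff

lemma DA_of_within {v : E3 → ℝ} {D' : E3 →L[ℝ] ℝ} {x : E3} (hx : x ∈ Srf.S)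
    (h : HasFDerivWithinAt v D' Srf.S x) : HasFDerivAt (v ∘ G.a) (D'.comp (G.D x)) x := by
  have h1 : HasFDerivWithinAt v D' Srf.S (G.a x) := by rwa [G.fix x hx]
  exact h1.comp_hasFDerivAt x (G.hasD x) (ev_mem hx)

lemma within_of_DA {v : E3 → ℝ} {x : E3} (hx : x ∈ Srf.S) (h : G.DA v x) :
    DifferentiableWithinAt ℝ v Srf.S x := by
  have h1 : DifferentiableWithinAt ℝ (v ∘ G.a) Srf.S x := DifferentiableAt.differentiableWithinAt h
  refine h1.congr (fun y hy => by simp [G.fix y hy]) (by simp [G.fix x hx])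

lemma gd_eq_grad (v : E3 → ℝ) {x : E3} (hx : x ∈ Srf.S) : Srf.grad v x = G.gd v x := by
  by_cases h : DifferentiableWithinAt ℝ v Srf.S x
  · have h1 := DA_of_within (G := G) hx h.hasFDerivWithinAt
    unfold SmoothSurface.grad tGrad gd gradient
    rw [h1.fderiv]
    refine ext_inner_right ℝ fun k => ?_
    rw [InnerProductSpace.toDual_symm_apply]
    have hP : ∀ w, ((Srf.tangent x).orthogonalProjectionOnto w : E3) = G.D x w := by
      intro w
      rw [D_apply hx]
      rw [Submodule.coe_orthogonalProjectionOnto_apply, SmoothSurface.tangent,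
        Submodule.starProjection_orthogonal_val,
        Submodule.starProjection_unit_singleton ℝ (Srf.n_unit x hx)]
    rw [hP, D_symm hx, InnerProductSpace.toDual_symm_apply]
    rfl
  · have h2 : ¬ G.DA v x := fun h' => h (within_of_DA hx h')
    rw [gd_eq_zero h2]
    unfold SmoothSurface.grad tGrad
    rw [fderivWithin_zero_of_not_differentiableWithinAt h]
    simp

lemma gd_add {v w : E3 → ℝ} {x : E3} (hv : G.DA v x) (hw : G.DA w x) :
    G.gd (fun y => v y + w y) x = G.gd v x + G.gd w x := by
  refine ext_inner_right ℝ fun k => ?_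
  rw [inner_add_left, inner_gd, inner_gd, inner_gd]
  have : (fun y => v y + w y) ∘ G.a = (v ∘ G.a) + (w ∘ G.a) := rfl
  rw [this, fderiv_add hv hw]; rfl

lemma gd_sub {v w : E3 → ℝ} {x : E3} (hv : G.DA v x) (hw : G.DA w x) :
    G.gd (fun y => v y - w y) x = G.gd v x - G.gd w x := by
  refine ext_inner_right ℝ fun k => ?_
  rw [inner_sub_left, inner_gd, inner_gd, inner_gd]
  have : (fun y => v y - w y) ∘ G.a = (v ∘ G.a) - (w ∘ G.a) := rfl
  rw [this, fderiv_sub hv hw]; rfl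

lemma gd_mul {v w : E3 → ℝ} {x : E3} (hx : x ∈ Srf.S) (hv : G.DA v x) (hw : G.DA w x) :
    G.gd (fun y => v y * w y) x = v x • G.gd w x + w x • G.gd v x := by
  refine ext_inner_right ℝ fun k => ?_
  rw [inner_add_left, inner_smul_left, inner_smul_left, inner_gd, inner_gd, inner_gd]
  have : (fun y => v y * w y) ∘ G.a = (v ∘ G.a) * (w ∘ G.a) := rfl
  rw [this, fderiv_mul hv hw]
  simp [G.fix x hx]

lemma gd_smul (c : ℝ) (v : E3 → ℝ) (x : E3) :
    G.gd (fun y => c * v y) x = c • G.gd v x := by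
  refine ext_inner_right ℝ fun k => ?_
  rw [inner_smul_left, inner_gd, inner_gd]
  have : (fun y => c * v y) ∘ G.a = c • (v ∘ G.a) := rfl
  rw [this, fderiv_const_smul_field]; rfl

lemma DA_add {v w : E3 → ℝ} {x : E3} (hv : G.DA v x) (hw : G.DA w x) :
    G.DA (fun y => v y + w y) x := DifferentiableAt.add hv hw

lemma DA_sub {v w : E3 → ℝ} {x : E3} (hv : G.DA v x) (hw : G.DA w x) :
    G.DA (fun y => v y - w y) x := DifferentiableAt.sub hv hw

lemma DA_mul {v w : E3 → ℝ} {x : E3} (hv : G.DA v x) (hw : G.DA w x) :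
    G.DA (fun y => v y * w y) x := DifferentiableAt.mul hv hw

lemma DA_C1 {v : E3 → ℝ} (hv : ContDiff ℝ 1 v) (x : E3) : G.DA v x :=
  ((hv.differentiable (by simp)) _).comp x (G.diffA x)

lemma C1_comp {v : E3 → ℝ} (hv : ContDiff ℝ 1 v) : ContDiff ℝ 1 (v ∘ G.a) :=
  hv.comp (G.smooth.of_le (by exact_mod_cast le_top))

lemma cont_gd {v : E3 → ℝ} (hv : ContDiff ℝ 1 v) : Continuous (G.gd v) := by
  unfold gd gradient
  exact (LinearIsometryEquiv.continuous _).comp ((C1_comp hv).continuous_fderiv (by simp))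

end Geo
end PartN2

section PartN3
namespace Geo

variable {Srf : SmoothSurface} {G : Geo Srf}

lemma mS : MeasurableSet Srf.S := Srf.compact.isClosed.measurableSet

lemma muS_lt_top (G : Geo Srf) : μH[2] Srf.S < ∞ := by
  obtain ⟨z, hz⟩ := Srf.nonempty
  obtain ⟨R, hR⟩ := Srf.compact.isBounded.subset_closedBall z
  have h1 : Srf.S ⊆ Srf.S ∩ closedBall z (max R 0) := fun x hx =>
    ⟨hx, closedBall_subset_closedBall (le_max_left _ _) (hR hx)⟩
  exact lt_of_le_of_lt ((measure_mono h1).trans (G.ahl z hz _ (le_max_right _ _)))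
    ENNReal.ofReal_lt_top

instance : IsFiniteMeasure G.mu := ⟨by
  rw [mu, Measure.restrict_apply_univ]; exact muS_lt_top G⟩

lemma ae_mem : ∀ᵐ x ∂G.mu, x ∈ Srf.S := ae_restrict_mem mS

lemma ae_of {p : E3 → Prop} (h : ∀ x ∈ Srf.S, p x) : ∀ᵐ x ∂G.mu, p x := by
  filter_upwards [ae_mem] with x hx using h x hx

variable (G) in
/-- Lipschitz, a.e. differentiable functions on the surface -/
def W (v : E3 → ℝ) : Prop :=
  (∃ K : ℝ, 0 ≤ K ∧ ∀ x ∈ Srf.S, ∀ y ∈ Srf.S, |v x - v y| ≤ K * ‖x - y‖) ∧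
    ∀ᵐ x ∂G.mu, G.DA v x

variable (G) in
/-- the bilinear form -/
def form (v w : E3 → ℝ) : ℝ := ∫ x, (⟪G.gd v x, G.gd w x⟫ + v x * w x) ∂G.mu

variable (G) in
/-- energy norm -/
def en (v : E3 → ℝ) : ℝ := Real.sqrt (G.form v v)

variable (G) in
/-- L2 norm -/
def nr {F : Type*} [NormedAddCommGroup F] (v : E3 → F) : ℝ := nrm G.mu v

lemma form_eq (v w : E3 → ℝ) : Srf.aForm v w = G.form v w := by
  unfold SmoothSurface.aForm form mu
  refine setIntegral_congr_fun mS fun x hx => ?_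
  simp only [gd_eq_grad (G := G) _ hx]

lemma gd_le_of_lip {v : E3 → ℝ} {K : ℝ} (hK : 0 ≤ K)
    (h : ∀ x ∈ Srf.S, ∀ y ∈ Srf.S, |v x - v y| ≤ K * ‖x - y‖) {x : E3} (hx : x ∈ Srf.S) :
    ‖G.gd v x‖ ≤ K * G.L := by
  rw [gd, norm_gradient']
  refine norm_fderiv_le_of_lip' ℝ (mul_nonneg hK G.L_pos.le) ?_
  filter_upwards [ev_mem hx] with z hz
  have hax : G.a x ∈ Srf.S := by rwa [G.fix x hx]
  refine (h _ hz _ hax).trans ?_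
  rw [mul_assoc]
  exact mul_le_mul_of_nonneg_left (G.a_lip z x) hK

lemma W.cont {v : E3 → ℝ} (hv : G.W v) : ContinuousOn v Srf.S := by
  obtain ⟨⟨K, hK, h⟩, -⟩ := hv
  have : LipschitzOnWith (Real.toNNReal K) v Srf.S :=
    LipschitzOnWith.of_dist_le_mul fun x hx y hy => by
      rw [Real.coe_toNNReal K hK, Real.dist_eq, dist_eq_norm]; exact h x hx y hy
  exact this.continuousOn

lemma bm_of_cont {F : Type*} [NormedAddCommGroup F] [SecondCountableTopology F]
    {v : E3 → F} (hv : ContinuousOn v Srf.S) : BM G.mu v := by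
  obtain ⟨C, hC⟩ := Srf.compact.exists_bound_of_continuousOn hv
  exact ⟨hv.aestronglyMeasurable mS, C, ae_of hC⟩

lemma meas_gd (v : E3 → ℝ) : Measurable (G.gd v) := by
  unfold gd gradient
  exact (LinearIsometryEquiv.continuous _).measurable.comp (measurable_fderiv ℝ _)

lemma W.bm {v : E3 → ℝ} (hv : G.W v) : BM G.mu v := bm_of_cont hv.cont

lemma W.bmg {v : E3 → ℝ} (hv : G.W v) : BM G.mu (G.gd v) := by
  obtain ⟨⟨K, hK, h⟩, -⟩ := hv
  exact ⟨(meas_gd v).aestronglyMeasurable, K * G.L, ae_of fun x hx => gd_le_of_lip hK h hx⟩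

lemma W.add {v w : E3 → ℝ} (hv : G.W v) (hw : G.W w) : G.W (fun x => v x + w x) := by
  obtain ⟨⟨K, hK, h⟩, h'⟩ := hv
  obtain ⟨⟨K2, hK2, h2⟩, h2'⟩ := hw
  refine ⟨⟨K + K2, by positivity, fun x hx y hy => ?_⟩, ?_⟩
  · have : v x + w x - (v y + w y) = (v x - v y) + (w x - w y) := by ring
    rw [this, add_mul]
    exact (abs_add_le _ _).trans (add_le_add (h x hx y hy) (h2 x hx y hy))
  · filter_upwards [h', h2'] with x h3 h4 using DA_add h3 h4

lemma W.smul (c : ℝ) {v : E3 → ℝ} (hv : G.W v) : G.W (fun x => c * v x) := by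
  obtain ⟨⟨K, hK, h⟩, h'⟩ := hv
  refine ⟨⟨|c| * K, by positivity, fun x hx y hy => ?_⟩, ?_⟩
  · rw [← mul_sub, abs_mul, mul_assoc]
    exact mul_le_mul_of_nonneg_left (h x hx y hy) (abs_nonneg c)
  · filter_upwards [h'] with x h3 using DifferentiableAt.const_mul h3 c

lemma W.sub {v w : E3 → ℝ} (hv : G.W v) (hw : G.W w) : G.W (fun x => v x - w x) := by
  have := hv.add (hw.smul (-1))
  simpa [sub_eq_add_neg] using this

lemma W.mul {v w : E3 → ℝ} (hv : G.W v) (hw : G.W w) : G.W (fun x => v x * w x) := by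
  obtain ⟨C, hC⟩ := Srf.compact.exists_bound_of_continuousOn hv.cont
  obtain ⟨C2, hC2⟩ := Srf.compact.exists_bound_of_continuousOn hw.cont
  have hCn : 0 ≤ C := by
    obtain ⟨z, hz⟩ := Srf.nonempty; exact (norm_nonneg _).trans (hC z hz)
  have hCn2 : 0 ≤ C2 := by
    obtain ⟨z, hz⟩ := Srf.nonempty; exact (norm_nonneg _).trans (hC2 z hz)
  obtain ⟨⟨K, hK, h⟩, h'⟩ := hv
  obtain ⟨⟨K2, hK2, h2⟩, h2'⟩ := hw
  refine ⟨⟨C * K2 + C2 * K, by positivity, fun x hx y hy => ?_⟩, ?_⟩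
  · have : v x * w x - v y * w y = v x * (w x - w y) + w y * (v x - v y) := by ring
    rw [this, add_mul]
    refine (abs_add_le _ _).trans (add_le_add ?_ ?_)
    · rw [abs_mul, mul_assoc]
      exact mul_le_mul (hC x hx) (h2 x hx y hy) (abs_nonneg _) hCn
    · rw [abs_mul, mul_assoc]
      exact mul_le_mul (hC2 y hy) (h x hx y hy) (abs_nonneg _) hCn2
  · filter_upwards [h', h2'] with x h3 h4 using DA_mul h3 h4

lemma W.congr {v w : E3 → ℝ} (hv : G.W v) (h : EqOn v w Srf.S) : G.W w := by
  obtain ⟨⟨K, hK, h1⟩, h'⟩ := hv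
  refine ⟨⟨K, hK, fun x hx y hy => by rw [← h hx, ← h hy]; exact h1 x hx y hy⟩, ?_⟩
  filter_upwards [h', ae_mem] with x h3 hx using (DA_congr h hx).1 h3

lemma C1W {v : E3 → ℝ} (hv : ContDiff ℝ 1 v) : G.W v := by
  refine ⟨?_, Eventually.of_forall fun x => DA_C1 hv x⟩
  obtain ⟨R, hR⟩ := Srf.compact.isBounded.subset_closedBall 0
  obtain ⟨K, hK⟩ := hv.contDiffOn.exists_lipschitzOnWith (s := closedBall (0 : E3) R)
    (by simp) (convex_closedBall _ _) (isCompact_closedBall _ _)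
  refine ⟨K, K.2, fun x hx y hy => ?_⟩
  have := hK.dist_le_mul x (hR hx) y (hR hy)
  rwa [Real.dist_eq, dist_eq_norm] at this

lemma form_integrable {v w : E3 → ℝ} (hv : G.W v) (hw : G.W w) :
    Integrable (fun x => ⟪G.gd v x, G.gd w x⟫ + v x * w x) G.mu :=
  ((hv.bmg.inner hw.bmg).add (hv.bm.mul hw.bm)).integrable

lemma form_symm (v w : E3 → ℝ) : G.form v w = G.form w v := by
  unfold form
  congr 1; ext x; rw [real_inner_comm, mul_comm]

lemma form_add_left {u v w : E3 → ℝ} (hu : G.W u) (hv : G.W v) (hw : G.W w) :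
    G.form (fun x => u x + v x) w = G.form u w + G.form v w := by
  unfold form
  rw [← integral_add (form_integrable hu hw) (form_integrable hv hw)]
  refine integral_congr_ae ?_
  filter_upwards [hu.2, hv.2] with x h1 h2
  rw [gd_add h1 h2, inner_add_left]; ring

lemma form_smul_left (c : ℝ) (v w : E3 → ℝ) :
    G.form (fun x => c * v x) w = c * G.form v w := by
  unfold form
  rw [← integral_const_mul]
  congr 1; ext x
  rw [gd_smul, inner_smul_left]; simp; ring

lemma form_add_right {u v w : E3 → ℝ} (hu : G.W u) (hv : G.W v) (hw : G.W w) :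
    G.form w (fun x => u x + v x) = G.form w u + G.form w v := by
  rw [form_symm, form_add_left hu hv hw, form_symm u, form_symm v]

lemma form_smul_right (c : ℝ) (v w : E3 → ℝ) :
    G.form v (fun x => c * w x) = c * G.form v w := by
  rw [form_symm, form_smul_left, form_symm]

lemma form_sub_left {u v w : E3 → ℝ} (hu : G.W u) (hv : G.W v) (hw : G.W w) :
    G.form (fun x => u x - v x) w = G.form u w - G.form v w := by
  have := form_add_left hu (hv.smul (-1)) hw
  rw [form_smul_left] at this
  simp only [neg_one_mul] at this
  simpa only [sub_eq_add_neg] using this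

lemma form_sub_right {u v w : E3 → ℝ} (hu : G.W u) (hv : G.W v) (hw : G.W w) :
    G.form w (fun x => u x - v x) = G.form w u - G.form w v := by
  rw [form_symm, form_sub_left hu hv hw, form_symm u, form_symm v]

lemma form_self_nonneg (v : E3 → ℝ) : 0 ≤ G.form v v :=
  integral_nonneg fun x => add_nonneg real_inner_self_nonneg (mul_self_nonneg _)

lemma en_nonneg (v : E3 → ℝ) : 0 ≤ G.en v := Real.sqrt_nonneg _

lemma en_sq (v : E3 → ℝ) : G.en v ^ 2 = G.form v v := Real.sq_sqrt (form_self_nonneg v)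

lemma nr_nonneg {F : Type*} [NormedAddCommGroup F] (v : E3 → F) : 0 ≤ G.nr v := nrm_nonneg _

lemma form_self {v : E3 → ℝ} (hv : G.W v) : G.form v v = G.nr (G.gd v) ^ 2 + G.nr v ^ 2 := by
  unfold nr form
  rw [nrm_sq, nrm_sq, ← integral_add hv.bmg.sq_int hv.bm.sq_int]
  congr 1; ext x
  rw [real_inner_self_eq_norm_sq, Real.norm_eq_abs, sq_abs]; ring

lemma en_sq' {v : E3 → ℝ} (hv : G.W v) : G.en v ^ 2 = G.nr (G.gd v) ^ 2 + G.nr v ^ 2 := by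
  rw [en_sq, form_self hv]

lemma nr_le_en {v : E3 → ℝ} (hv : G.W v) : G.nr v ≤ G.en v := by
  refine (le_abs_self _).trans (abs_le_of_sq_le_sq ?_ (en_nonneg v))
  rw [en_sq' hv]; nlinarith [sq_nonneg (G.nr (G.gd v))]

lemma nrg_le_en {v : E3 → ℝ} (hv : G.W v) : G.nr (G.gd v) ≤ G.en v := by
  refine (le_abs_self _).trans (abs_le_of_sq_le_sq ?_ (en_nonneg v))
  rw [en_sq' hv]; nlinarith [sq_nonneg (G.nr v)]

lemma en_le_add {v : E3 → ℝ} (hv : G.W v) : G.en v ≤ G.nr (G.gd v) + G.nr v := by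
  have h1 := nr_nonneg (G := G) (G.gd v)
  have h2 := nr_nonneg (G := G) v
  refine (le_abs_self _).trans (abs_le_of_sq_le_sq ?_ (by positivity))
  rw [en_sq' hv]; nlinarith

lemma form_quad {v w : E3 → ℝ} (hv : G.W v) (hw : G.W w) (t : ℝ) :
    G.form (fun x => v x + t * w x) (fun x => v x + t * w x) =
      G.form v v + 2 * t * G.form v w + t ^ 2 * G.form w w := by
  have h1 := hw.smul t
  rw [form_add_left hv h1 (hv.add h1), form_add_right hv h1 hv, form_add_right hv h1 h1,
    form_smul_left, form_smul_left, form_smul_right, form_smul_right, form_symm w v]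
  ring

lemma form_cs {v w : E3 → ℝ} (hv : G.W v) (hw : G.W w) : |G.form v w| ≤ G.en v * G.en w := by
  have key : ∀ t : ℝ, 0 ≤ G.form w w * (t * t) + (2 * G.form v w) * t + G.form v v := by
    intro t
    have := form_self_nonneg (G := G) (fun x => v x + t * w x)
    rw [form_quad hv hw t] at this
    linarith
  have := discrim_le_zero key
  rw [discrim] at this
  refine abs_le_of_sq_le_sq ?_ (mul_nonneg (en_nonneg _) (en_nonneg _))
  rw [mul_pow, en_sq, en_sq]
  nlinarith

lemma en_add_le {v w : E3 → ℝ} (hv : G.W v) (hw : G.W w) :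
    G.en (fun x => v x + w x) ≤ G.en v + G.en w := by
  have h1 := en_nonneg (G := G) v
  have h2 := en_nonneg (G := G) w
  refine (le_abs_self _).trans (abs_le_of_sq_le_sq ?_ (by positivity))
  have := form_quad hv hw 1
  simp only [one_mul] at this
  rw [en_sq, this, add_sq, en_sq, en_sq]
  have := (abs_le.1 (form_cs hv hw)).2
  nlinarith

lemma en_smul (c : ℝ) (v : E3 → ℝ) : G.en (fun x => c * v x) = |c| * G.en v := by
  unfold en
  rw [form_smul_left, form_smul_right, ← mul_assoc, Real.sqrt_mul (mul_self_nonneg c),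
    Real.sqrt_mul_self_eq_abs]

lemma en_sub_le {v w : E3 → ℝ} (hv : G.W v) (hw : G.W w) :
    G.en (fun x => v x - w x) ≤ G.en v + G.en w := by
  have := en_add_le hv (hw.smul (-1))
  rw [en_smul] at this
  simpa [sub_eq_add_neg] using this

lemma form_congr {v v' w w' : E3 → ℝ} (h : EqOn v v' Srf.S) (h' : EqOn w w' Srf.S) :
    G.form v w = G.form v' w' := by
  refine integral_congr_ae ?_
  filter_upwards [ae_mem] with x hx
  rw [gd_congr h hx, gd_congr h' hx, h hx, h' hx]

lemma en_congr {v v' : E3 → ℝ} (h : EqOn v v' Srf.S) : G.en v = G.en v' := by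
  unfold en; rw [form_congr h h]

/-- near minimizers solve the variational problem approximately -/
lemma near_min (P : (E3 → ℝ) → Prop) (hP : ∀ v, P v → G.W v) (h0 : ∃ v, P v)
    (hadd : ∀ v w, P v → P w → ∀ t : ℝ, P (fun x => v x + t * w x))
    {φ : E3 → ℝ} (hφ : BM G.mu φ) {δ : ℝ} (hδ : 0 < δ) :
    ∃ w, P w ∧ ∀ v, P v → |G.form w v - ∫ x, φ x * v x ∂G.mu| ≤ δ * G.en v := by
  set J : (E3 → ℝ) → ℝ := fun v => G.form v v / 2 - ∫ x, φ x * v x ∂G.mu with hJ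
  have hφv : ∀ v, P v → |∫ x, φ x * v x ∂G.mu| ≤ G.nr φ * G.en v := fun v hv =>
    (cs_nrm_mul hφ (hP v hv).bm).trans
      (mul_le_mul_of_nonneg_left (nr_le_en (hP v hv)) (nrm_nonneg _))
  have hbd : BddBelow (J '' {v | P v}) := by
    refine ⟨- G.nr φ ^ 2 / 2, ?_⟩
    rintro _ ⟨v, hv, rfl⟩
    have h1 := (abs_le.1 (hφv v hv)).2
    simp only [hJ, ← en_sq]
    nlinarith [sq_nonneg (G.en v - G.nr φ)]
  have hne : (J '' {v | P v}).Nonempty := by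
    obtain ⟨v, hv⟩ := h0; exact ⟨_, v, hv, rfl⟩
  obtain ⟨_, ⟨w, hw, rfl⟩, hlt⟩ := exists_lt_of_csInf_lt hne
    (lt_add_of_pos_right (sInf (J '' {v | P v})) (by positivity : 0 < δ ^ 2 / 2))
  refine ⟨w, hw, fun v hv => ?_⟩
  have hWw := hP w hw
  have hWv := hP v hv
  have key : ∀ t : ℝ, 0 ≤ (G.form v v / 2) * (t * t) +
      (G.form w v - ∫ x, φ x * v x ∂G.mu) * t + δ ^ 2 / 2 := by
    intro t
    have h1 := csInf_le hbd ⟨_, hadd w v hw hv t, rfl⟩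
    have h2 : ∫ x, φ x * (w x + t * v x) ∂G.mu =
        ∫ x, φ x * w x ∂G.mu + t * ∫ x, φ x * v x ∂G.mu := by
      rw [← integral_const_mul, ← integral_add (hφ.mul hWw.bm).integrable
        ((hφ.mul hWv.bm).integrable.const_mul t)]
      congr 1; ext x; ring
    simp only [hJ] at h1 hlt
    rw [form_quad hWw hWv, h2] at h1
    linarith
  have := discrim_le_zero key
  rw [discrim] at this
  refine abs_le_of_sq_le_sq ?_ (mul_nonneg hδ.le (en_nonneg _))
  rw [mul_pow, en_sq]
  linarith

end Geo
end PartN3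

section PartN4
section moll

/-- a family of mollifiers -/
lemma exists_moll : ∃ A : ℝ, 0 ≤ A ∧ ∀ ε : ℝ, 0 < ε → ∃ ψ : E3 → ℝ, ContDiff ℝ (⊤ : ℕ∞) ψ ∧
    HasCompactSupport ψ ∧ (∀ t, 0 ≤ ψ t) ∧ (∀ t, ε < ‖t‖ → ψ t = 0) ∧ ∫ t, ψ t = 1 ∧
    ∀ s t, |ψ s - ψ t| ≤ A * ε⁻¹ ^ 4 * ‖s - t‖ := by
  let f : ContDiffBump (0 : E3) := ⟨1 / 2, 1, by norm_num, by norm_num⟩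
  set φ : E3 → ℝ := f.normed volume with hφ
  have hφc : ContDiff ℝ (⊤ : ℕ∞) φ := f.contDiff_normed
  have hφs : HasCompactSupport φ := f.hasCompactSupport_normed
  obtain ⟨A, hA⟩ := (hφc.lipschitzWith_of_hasCompactSupport hφs (by simp))
  refine ⟨A, A.2, fun ε hε => ?_⟩
  refine ⟨fun t => ε⁻¹ ^ 3 * φ (ε⁻¹ • t), ?_, ?_, ?_, ?_, ?_, ?_⟩
  · exact contDiff_const.mul (hφc.comp (contDiff_const_smul ε⁻¹))
  · have : HasCompactSupport (fun t => φ (ε⁻¹ • t)) :=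
      hφs.comp_smul (inv_ne_zero hε.ne')
    exact this.mul_left
  · intro t; have := f.nonneg_normed (μ := volume) (ε⁻¹ • t); positivity
  · intro t ht
    have : φ (ε⁻¹ • t) = 0 := by
      refine image_eq_zero_of_notMem_tsupport ?_
      rw [hφ, f.tsupport_normed_eq]
      simp only [mem_closedBall, dist_zero_right, norm_smul, norm_inv, Real.norm_eq_abs,
        abs_of_pos hε, not_le]
      show 1 < _
      rw [inv_mul_eq_div, lt_div_iff₀ hε]; linarith
    simp [this]
  · rw [integral_const_mul, Measure.integral_comp_smul]
    simp only [finrank_euclideanSpace, Fintype.card_fin]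
    rw [hφ, f.integral_normed]
    rw [abs_of_pos (by positivity)]
    simp; field_simp
  · intro s t
    rw [← mul_sub, abs_mul, abs_of_pos (by positivity : 0 < ε⁻¹ ^ 3)]
    have := hA.dist_le_mul (ε⁻¹ • s) (ε⁻¹ • t)
    rw [Real.dist_eq, dist_eq_norm, ← smul_sub, norm_smul, Real.norm_eq_abs,
      abs_of_pos (by positivity : 0 < ε⁻¹)] at this
    calc ε⁻¹ ^ 3 * |φ (ε⁻¹ • s) - φ (ε⁻¹ • t)| ≤ ε⁻¹ ^ 3 * (A * (ε⁻¹ * ‖s - t‖)) := by gcongr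
      _ = _ := by ring

lemma vol_ball3 {r : ℝ} (hr : 0 ≤ r) (x : E3) :
    volume.real (closedBall x r) = r ^ 3 * volume.real (closedBall (0 : E3) 1) := by
  rw [Measure.real, Measure.addHaar_closedBall _ _ hr, ENNReal.toReal_mul,
    ENNReal.toReal_ofReal (by positivity)]
  simp only [finrank_euclideanSpace, Fintype.card_fin]
  rw [Measure.real, Measure.addHaar_closedBall_eq_addHaar_ball]

variable {ε A Kc : ℝ} {ψ V : E3 → ℝ}

lemma moll_int (hc : Continuous ψ) (hs : HasCompactSupport ψ) {H : E3 → ℝ} (hH : Continuous H) :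
    Integrable (fun t => ψ t * H t) :=
  (hc.mul hH).integrable_of_hasCompactSupport hs.mul_right

lemma moll_diff (hc : Continuous ψ) (hs : HasCompactSupport ψ) (hn : ∀ t, 0 ≤ ψ t)
    (h1 : ∫ t, ψ t = 1) {H H' : E3 → ℝ} (hH : Continuous H) (hH' : Continuous H') {B : ℝ}
    (hsup : ∀ t, ψ t ≠ 0 → |H t - H' t| ≤ B) :
    |(∫ t, ψ t * H t) - ∫ t, ψ t * H' t| ≤ B := by
  rw [← integral_sub (moll_int hc hs hH) (moll_int hc hs hH')]
  have hψ : Integrable ψ := hc.integrable_of_hasCompactSupport hs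
  have : ‖∫ t, (ψ t * H t - ψ t * H' t)‖ ≤ ∫ t, ψ t * B := by
    refine norm_integral_le_of_norm_le (hψ.mul_const B) (Eventually.of_forall fun t => ?_)
    rw [← mul_sub, norm_mul, Real.norm_of_nonneg (hn t)]
    by_cases h : ψ t = 0
    · simp [h]
    · exact mul_le_mul_of_nonneg_left (hsup t h) (hn t)
  rwa [integral_mul_const, h1, one_mul] at this

lemma moll_contDiff (hψ : ContDiff ℝ (⊤ : ℕ∞) ψ) (hs : HasCompactSupport ψ) (hV : Continuous V) :
    ContDiff ℝ (⊤ : ℕ∞) (fun x => ∫ t, ψ t * V (x - t)) := by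
  have := hs.contDiff_convolution_left (ContinuousLinearMap.lsmul ℝ ℝ) hψ
    (hV.locallyIntegrable (μ := (volume : Measure E3)))
  exact this

lemma moll_fderiv (hε : 0 < ε) (hA : 0 ≤ A) (hψ : ContDiff ℝ (⊤ : ℕ∞) ψ) (hs : HasCompactSupport ψ)
    (hsup : ∀ t, ε < ‖t‖ → ψ t = 0) (h1 : ∫ t, ψ t = 1)
    (hlip : ∀ s t, |ψ s - ψ t| ≤ A * ε⁻¹ ^ 4 * ‖s - t‖) (hV : Continuous V) {x : E3}
    {D : E3 →L[ℝ] ℝ} {η : ℝ} (hη : 0 ≤ η)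
    (hR : ∀ z, ‖z - x‖ ≤ 2 * ε → |V z - V x - D (z - x)| ≤ η * ‖z - x‖) :
    ‖fderiv ℝ (fun x => ∫ t, ψ t * V (x - t)) x - D‖ ≤
      16 * A * volume.real (closedBall (0 : E3) 1) * η := by
  set F : E3 → ℝ := fun x => ∫ t, ψ t * V (x - t) with hF
  have hFd : DifferentiableAt ℝ F x := (moll_contDiff hψ hs hV).differentiable (by simp) x
  have hd : HasFDerivAt (fun z => F z - D z) (fderiv ℝ F x - D) x :=
    hFd.hasFDerivAt.sub D.hasFDerivAt
  rw [← hd.fderiv]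
  refine norm_fderiv_le_of_lip' ℝ (by positivity) ?_
  filter_upwards [closedBall_mem_nhds x hε] with y hy
  rw [mem_closedBall, dist_eq_norm] at hy
  set R : E3 → ℝ := fun z => V z - V x - D (z - x) with hRd
  have hRc : Continuous R := by fun_prop
  have e1 : ∀ z, F z - D z = (∫ s, ψ (z - s) * R s) + (V x - ∫ t, ψ t * D t) - D x := by
    intro z
    have e2 : (∫ s, ψ (z - s) * R s) = ∫ t, ψ t * R (z - t) := by
      rw [← integral_sub_left_eq_self (fun t => ψ t * R (z - t)) volume z]
      simp
    have e3 : ∀ t, ψ t * R (z - t) = ψ t * V (z - t) - ψ t * (V x + D z - D x) + ψ t * D t := by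
      intro t; simp only [hRd, map_sub]; ring
    have hc := hψ.continuous
    simp only [e2, e3]
    rw [integral_add, integral_sub, integral_mul_const, h1]
    · simp only [hF]; ring
    · exact moll_int hc hs (by fun_prop)
    · exact moll_int hc hs (by fun_prop)
    · exact (moll_int hc hs (by fun_prop)).sub (moll_int hc hs (by fun_prop))
    · exact moll_int hc hs (by fun_prop)
  have h_intg : ∀ z, Integrable (fun s => ψ (z - s) * R s) := by
    intro z
    refine ((hψ.continuous.comp (by fun_prop)).mul hRc).integrable_of_hasCompactSupport ?_
    refine HasCompactSupport.mul_right ?_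
    exact hs.comp_homeomorph (Homeomorph.subLeft z)
  rw [e1 y, e1 x]
  have e4 : (∫ s, ψ (y - s) * R s) + (V x - ∫ t, ψ t * D t) - D x -
      ((∫ s, ψ (x - s) * R s) + (V x - ∫ t, ψ t * D t) - D x) =
      ∫ s, (ψ (y - s) * R s - ψ (x - s) * R s) := by
    rw [integral_sub (h_intg y) (h_intg x)]; ring
  rw [e4]
  have e5 : (∫ s, (ψ (y - s) * R s - ψ (x - s) * R s)) =
      ∫ s in closedBall x (2 * ε), (ψ (y - s) * R s - ψ (x - s) * R s) := by
    refine (setIntegral_eq_integral_of_forall_compl_eq_zero fun s hs' => ?_).symm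
    rw [mem_closedBall, dist_eq_norm, not_le] at hs'
    have a1 : ψ (x - s) = 0 := hsup _ (by rw [norm_sub_rev]; linarith)
    have a2 : ψ (y - s) = 0 := hsup _ (by
      have : ‖s - x‖ ≤ ‖y - s‖ + ‖y - x‖ := by
        rw [norm_sub_rev y s]; have := norm_add_le (s - y) (y - x); simpa using this
      linarith)
    simp [a1, a2]
  rw [e5]
  refine (norm_setIntegral_le_of_norm_le_const (C := A * ε⁻¹ ^ 4 * ‖y - x‖ * (η * (2 * ε)))
    measure_closedBall_lt_top fun s hs' => ?_).trans ?_
  · rw [mem_closedBall, dist_eq_norm] at hs'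
    rw [← sub_mul, norm_mul]
    have b1 := hlip (y - s) (x - s)
    simp only [sub_sub_sub_cancel_right] at b1
    have b2 := hR s hs'
    refine mul_le_mul b1 (b2.trans (by gcongr)) (norm_nonneg _) (by positivity)
  · rw [vol_ball3 (by positivity)]
    apply le_of_eq
    field_simp
    ring

end moll

namespace Geo

variable {Srf : SmoothSurface} {G : Geo Srf}

lemma density {v : E3 → ℝ} (hv : G.W v) {η : ℝ} (hη : 0 < η) :
    ∃ w : E3 → ℝ, ContDiff ℝ (⊤ : ℕ∞) w ∧ G.en (fun x => v x - w x) ≤ η := by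
  obtain ⟨⟨K, hK, hlip⟩, hDA⟩ := id hv
  have hl : LipschitzOnWith (Real.toNNReal K) v Srf.S :=
    LipschitzOnWith.of_dist_le_mul fun x hx y hy => by
      rw [Real.coe_toNNReal K hK, Real.dist_eq, dist_eq_norm]; exact hlip x hx y hy
  obtain ⟨v', hv'l, hv'e⟩ := hl.extend_real
  set V : E3 → ℝ := v' ∘ G.a with hVdef
  set Q : ℝ := K * G.L with hQ
  have hQ0 : 0 ≤ Q := mul_nonneg hK G.L_pos.le
  have hVlip : ∀ x y, |V x - V y| ≤ Q * ‖x - y‖ := by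
    intro x y
    have := hv'l.dist_le_mul (G.a x) (G.a y)
    rw [Real.coe_toNNReal K hK, Real.dist_eq, dist_eq_norm] at this
    refine this.trans ?_
    rw [hQ, mul_assoc]
    exact mul_le_mul_of_nonneg_left (G.a_lip x y) hK
  have hVc : Continuous V := hv'l.continuous.comp G.contA
  obtain ⟨A, hA, hmoll⟩ := exists_moll
  let e : ℕ → ℝ := fun n => 1 / ((n : ℝ) + 1)
  have he : ∀ n, 0 < e n := fun n => Nat.one_div_pos_of_nat
  choose ψ h1 h2 h3 h4 h5 h6 using fun n => hmoll (e n) (he n)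
  let w : ℕ → E3 → ℝ := fun n x => ∫ t, ψ n t * V (x - t)
  have hw : ∀ n, ContDiff ℝ (⊤ : ℕ∞) (w n) := fun n => moll_contDiff (h1 n) (h2 n) hVc
  have hw1 : ∀ n, ContDiff ℝ 1 (w n) := fun n => (hw n).of_le (by exact_mod_cast le_top)
  have hwlip : ∀ n x y, |w n x - w n y| ≤ Q * ‖x - y‖ := by
    intro n x y
    refine moll_diff (h1 n).continuous (h2 n) (h3 n) (h5 n) (H := fun t => V (x - t))
      (H' := fun t => V (y - t)) (by fun_prop) (by fun_prop) fun t _ => ?_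
    simpa using hVlip (x - t) (y - t)
  have hwc : ∀ n x, |w n x - V x| ≤ Q * e n := by
    intro n x
    have : V x = ∫ t, ψ n t * V x := by rw [integral_mul_const, h5 n, one_mul]
    rw [this]
    refine moll_diff (h1 n).continuous (h2 n) (h3 n) (h5 n) (H := fun t => V (x - t))
      (H' := fun t => V x) (by fun_prop) (by fun_prop) fun t ht => ?_
    refine (hVlip _ _).trans ?_
    have : ‖t‖ ≤ e n := by by_contra hc; exact ht (h4 n t (not_le.1 hc))
    simpa using mul_le_mul_of_nonneg_left this hQ0
  have he0 : Tendsto e atTop (𝓝 0) := tendsto_one_div_add_atTop_nhds_zero_nat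
  -- derivatives converge at points of differentiability
  have hder : ∀ x, DifferentiableAt ℝ V x →
      Tendsto (fun n => ‖fderiv ℝ (w n) x - fderiv ℝ V x‖) atTop (𝓝 0) := by
    intro x hx
    set C0 : ℝ := 16 * A * volume.real (closedBall (0 : E3) 1) with hC0
    have hC0n : 0 ≤ C0 := by positivity
    rw [Metric.tendsto_atTop]
    intro θ hθ
    have hlit := hx.hasFDerivAt.isLittleO
    have hη' : 0 < θ / (2 * (C0 + 1)) := by positivity
    have hb := hlit.def hη'
    obtain ⟨r, hr, hrb⟩ := Metric.eventually_nhds_iff.1 hb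
    obtain ⟨N, hN⟩ := (Metric.tendsto_atTop.1 he0) (r / 3) (by positivity)
    refine ⟨N, fun n hn => ?_⟩
    have hen := hN n hn
    rw [Real.dist_eq, sub_zero, abs_of_pos (he n)] at hen
    have := moll_fderiv (he n) hA (h1 n) (h2 n) (h4 n) (h5 n) (h6 n) hVc (x := x)
      (D := fderiv ℝ V x) hη'.le (fun z hz => by
        have := hrb (y := z) (by rw [dist_eq_norm]; linarith)
        simpa [abs_sub_comm] using this)
    rw [Real.dist_eq, sub_zero, abs_of_nonneg (norm_nonneg _)]
    refine lt_of_le_of_lt this ?_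
    rw [← hC0, mul_div_assoc', div_lt_iff₀ (by positivity)]
    nlinarith
  -- dominated convergence
  have hVv : ∀ x ∈ Srf.S, V x = v x := fun x hx => by
    simp only [hVdef, Function.comp, G.fix x hx]; exact (hv'e hx).symm
  have hgd : ∀ n, ∀ x ∈ Srf.S, G.DA v x →
      ‖G.gd (fun x => v x - w n x) x‖ ≤ ‖fderiv ℝ (w n) x - fderiv ℝ V x‖ * G.L := by
    intro n x hx hd
    rw [gd_sub hd (DA_C1 (hw1 n) x), gd_congr (hv'e) hx]
    have hd' : DifferentiableAt ℝ V x := (DA_congr hv'e hx).1 hd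
    rw [← (InnerProductSpace.toDual ℝ E3).norm_map]
    refine ContinuousLinearMap.opNorm_le_bound _ (by have := G.L_pos; positivity) fun k => ?_
    rw [InnerProductSpace.toDual_apply_apply, inner_sub_left, inner_gd, inner_gd]
    have e1 : fderiv ℝ (w n ∘ G.a) x k = fderiv ℝ (w n) x (G.D x k) := by
      rw [fderiv_comp x (((hw1 n).differentiable (by simp)) _) (G.diffA x), G.fix x hx]; rfl
    have e2 : fderiv ℝ (v' ∘ G.a) x k = fderiv ℝ V x (G.D x k) := by
      rw [fderiv_off (x := x) hx (by simpa using G.ρ_pos)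
        (by rw [G.fix x hx]; exact hd'), G.fix x hx, inner_gd]
    rw [e1, e2, norm_sub_rev, ← ContinuousLinearMap.sub_apply, mul_assoc]
    exact (ContinuousLinearMap.le_opNorm _ _).trans
      (mul_le_mul_of_nonneg_left (G.D_le x k) (norm_nonneg _))
  have hlim : Tendsto (fun n => G.form (fun x => v x - w n x) (fun x => v x - w n x)) atTop (𝓝 0) := by
    have hz : (0 : ℝ) = ∫ x, (0 : ℝ) ∂G.mu := by simp
    rw [hz]
    refine tendsto_integral_of_dominated_convergence
      (fun _ => (2 * Q * G.L) ^ 2 + (Q * 1) ^ 2) ?_ (integrable_const _) ?_ ?_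
    · intro n
      exact (form_integrable (hv.sub (C1W (hw1 n))) (hv.sub (C1W (hw1 n)))).1
    · intro n
      filter_upwards [hDA, ae_mem] with x hd hx
      rw [real_inner_self_eq_norm_sq, Real.norm_of_nonneg (by nlinarith [sq_nonneg ‖G.gd (fun x => v x - w n x) x‖, mul_self_nonneg (v x - w n x)])]
      have b1 := hgd n x hx hd
      have b2 : ‖fderiv ℝ (w n) x - fderiv ℝ V x‖ ≤ 2 * Q := by
        refine (norm_sub_le _ _).trans ?_
        have c1 : ‖fderiv ℝ (w n) x‖ ≤ Q := norm_fderiv_le_of_lip' ℝ hQ0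
          (Eventually.of_forall fun y => hwlip n y x)
        have c2 : ‖fderiv ℝ V x‖ ≤ Q := norm_fderiv_le_of_lip' ℝ hQ0
          (Eventually.of_forall fun y => hVlip y x)
        linarith
      have b3 : |v x - w n x| ≤ Q * 1 := by
        rw [← hVv x hx, abs_sub_comm]
        refine (hwc n x).trans (mul_le_mul_of_nonneg_left ?_ hQ0)
        have : (0 : ℝ) ≤ n := Nat.cast_nonneg n
        exact div_le_one_of_le₀ (by linarith) (by linarith)
      have b4 : ‖G.gd (fun x => v x - w n x) x‖ ≤ 2 * Q * G.L :=
        b1.trans (mul_le_mul_of_nonneg_right b2 G.L_pos.le)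
      rw [← sq, ← sq_abs (v x - w n x)]
      gcongr
    · filter_upwards [hDA, ae_mem] with x hd hx
      have hd' : DifferentiableAt ℝ V x := (DA_congr hv'e hx).1 hd
      have t1 : Tendsto (fun n => G.gd (fun x => v x - w n x) x) atTop (𝓝 0) := by
        refine squeeze_zero_norm (fun n => hgd n x hx hd) ?_
        simpa using (hder x hd').mul_const G.L
      have t2 : Tendsto (fun n => v x - w n x) atTop (𝓝 0) := by
        refine squeeze_zero_norm (a := fun n => Q * e n) (fun n => ?_) ?_
        · rw [← hVv x hx, norm_sub_rev]; exact hwc n x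
        · simpa using he0.const_mul Q
      simpa using (t1.inner t1).add (t2.mul t2)
  have hlim2 : Tendsto (fun n => G.en (fun x => v x - w n x)) atTop (𝓝 0) := by
    have := (Real.continuous_sqrt.tendsto 0).comp hlim
    rw [Real.sqrt_zero] at this
    exact this
  obtain ⟨n, hn⟩ := (hlim2.eventually (gt_mem_nhds hη)).exists
  exact ⟨w n, hw n, hn.le⟩

/-- approximate solutions which are smooth -/
lemma near_sol {φ : E3 → ℝ} (hφ : BM G.mu φ) {δ : ℝ} (hδ : 0 < δ) :
    ∃ w : E3 → ℝ, ContDiff ℝ 1 w ∧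
      ∀ v, G.W v → |G.form w v - ∫ x, φ x * v x ∂G.mu| ≤ δ * G.en v := by
  obtain ⟨w, hw, h⟩ := near_min (G := G) (fun v => ContDiff ℝ 1 v) (fun v => C1W)
    ⟨fun _ => 0, contDiff_const⟩ (fun v w hv hw t => hv.add (contDiff_const.mul hw)) hφ hδ
  refine ⟨w, hw, fun v hv => le_of_forall_pos_le_add fun θ hθ => ?_⟩
  set C := δ + G.en w + G.nr φ with hC
  have hCpos : 0 < C := by
    have := en_nonneg (G := G) w; have := nr_nonneg (G := G) φ; positivity
  obtain ⟨v', hv', he⟩ := density hv (div_pos hθ hCpos)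
  have hv'1 : ContDiff ℝ 1 v' := hv'.of_le (by exact_mod_cast le_top)
  have hW' := C1W (G := G) hv'1
  have hWw := C1W (G := G) hw
  have k1 := h v' hv'1
  have k2 := form_cs hWw (hv.sub hW')
  rw [form_sub_right hv hW' hWw] at k2
  have k3 := cs_nrm_mul hφ (hv.sub hW').bm
  have k4 : ∫ x, φ x * (v x - v' x) ∂G.mu = ∫ x, φ x * v x ∂G.mu - ∫ x, φ x * v' x ∂G.mu := by
    rw [← integral_sub (hφ.mul hv.bm).integrable (hφ.mul hW'.bm).integrable]
    congr 1; ext x; ring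
  rw [k4] at k3
  have k5 := nr_le_en (hv.sub hW')
  have k6 : G.en v' ≤ G.en v + G.en (fun x => v x - v' x) := by
    have := en_sub_le hv (hv.sub hW')
    simpa using this
  have k7 : G.nr φ * G.nr (fun x => v x - v' x) ≤ G.nr φ * G.en (fun x => v x - v' x) :=
    mul_le_mul_of_nonneg_left k5 (nr_nonneg _)
  have k8 : C * G.en (fun x => v x - v' x) ≤ θ := by
    rw [mul_comm]; exact (le_div_iff₀ hCpos).1 he
  have k9 : δ * G.en v' ≤ δ * (G.en v + G.en (fun x => v x - v' x)) :=
    mul_le_mul_of_nonneg_left k6 hδ.le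
  have k3' : |∫ x, φ x * v x ∂G.mu - ∫ x, φ x * v' x ∂G.mu| ≤
    G.nr φ * G.nr (fun x => v x - v' x) := k3
  rw [abs_le] at *
  rw [hC] at k8
  constructor <;> nlinarith

end Geo
end PartN4

section PartN5
namespace Geo
variable {Srf : SmoothSurface} (G : Geo Srf)

/-- admissible size of translations -/
def r1 : ℝ := G.ρ / (64 * G.L ^ 4)

lemma r1_pos : 0 < G.r1 := by have := G.L_pos; have := G.ρ_pos; unfold r1; positivity

lemma r1_mul : 64 * G.L ^ 4 * G.r1 = G.ρ := by
  have := G.L_pos; unfold r1; field_simp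

variable {G} in
lemma r1_bd {y : E3} (hy : ‖y‖ ≤ G.r1) :
    ‖y‖ ≤ G.ρ / 64 ∧ G.L * ‖y‖ ≤ G.ρ / 64 ∧ G.L ^ 2 * ‖y‖ ≤ G.ρ / 64 ∧ G.L ^ 3 * ‖y‖ ≤ G.ρ / 64 ∧
      G.L ^ 4 * ‖y‖ ≤ G.ρ / 64 := by
  have h1 := G.L_one
  have h0 := norm_nonneg y
  have h4 : G.L ^ 4 * ‖y‖ ≤ G.ρ / 64 := by
    have := G.r1_mul
    have : G.L ^ 4 * ‖y‖ ≤ G.L ^ 4 * G.r1 := by gcongr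
    linarith
  have a1 : G.L ^ 3 * ‖y‖ ≤ G.L ^ 4 * ‖y‖ := by gcongr <;> linarith
  have a2 : G.L ^ 2 * ‖y‖ ≤ G.L ^ 3 * ‖y‖ := by gcongr <;> linarith
  have a3 : G.L * ‖y‖ ≤ G.L ^ 2 * ‖y‖ := by
    have : G.L ≤ G.L ^ 2 := by nlinarith
    gcongr
  have a4 : ‖y‖ ≤ G.L * ‖y‖ := by nlinarith
  exact ⟨by linarith, by linarith, by linarith, by linarith, h4⟩

/-- projected translation -/
def Phi (y : E3) (x : E3) : E3 := G.a (x + y)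

variable {G}

lemma Phi_smooth (y : E3) : ContDiff ℝ (⊤ : ℕ∞) (G.Phi y) :=
  G.smooth.comp (contDiff_id.add contDiff_const)

lemma Phi_mem {y : E3} (hy : ‖y‖ ≤ G.r1) {x : E3} (hx : x ∈ Srf.S) : G.Phi y x ∈ Srf.S := by
  refine G.near x hx _ ?_
  have := (r1_bd hy).1
  have := G.ρ_pos
  simpa using by linarith

lemma Phi_dist (y : E3) {x : E3} (hx : x ∈ Srf.S) : ‖G.Phi y x - x‖ ≤ G.L * ‖y‖ := by
  have := G.a_lip (x + y) x
  rw [G.fix x hx] at this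
  simpa [Phi] using this

lemma Phi_sub (y : E3) {x x' : E3} (hx : x ∈ Srf.S) (hx' : x' ∈ Srf.S) :
    ‖(G.Phi y x - G.Phi y x') - (x - x')‖ ≤ G.L * ‖y‖ * ‖x - x'‖ := by
  have := G.a_shift x x' y
  rw [G.fix x hx, G.fix x' hx'] at this
  refine le_trans (le_of_eq ?_) this
  simp only [Phi]; congr 1; abel

lemma exists_inv {y : E3} (hy : ‖y‖ ≤ G.r1) : ∃ g : E3 → E3, ContDiff ℝ (⊤ : ℕ∞) g ∧
    ∀ x ∈ Srf.S, g x ∈ Srf.S ∧ G.Phi y (g x) = x ∧ g (G.Phi y x) = x := by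
  obtain ⟨b0, b1, b2, b3, b4⟩ := r1_bd hy
  have hρ := G.ρ_pos
  have hρ1 := G.ρ_le
  have hL := G.L_one
  set f : E3 → E3 := fun q => q + (G.a (q + y) - G.a q) with hf
  have hfc : ContDiff ℝ (⊤ : ℕ∞) f :=
    contDiff_id.add ((Phi_smooth y).sub G.smooth)
  have hc0 : 0 ≤ G.L * ‖y‖ := by positivity
  have happ : ApproximatesLinearOn f ((ContinuousLinearEquiv.refl ℝ E3 : E3 ≃L[ℝ] E3) : E3 →L[ℝ] E3)
      univ (G.L * ‖y‖).toNNReal := by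
    intro q _ q' _
    rw [Real.coe_toNNReal _ hc0]
    have := G.a_shift q q' y
    refine le_trans (le_of_eq ?_) this
    simp only [hf]
    congr 1
    simp
    abel
  have hlt : (G.L * ‖y‖).toNNReal <
      ‖((ContinuousLinearEquiv.refl ℝ E3).symm : E3 →L[ℝ] E3)‖₊⁻¹ := by
    have e : ‖((ContinuousLinearEquiv.refl ℝ E3).symm : E3 →L[ℝ] E3)‖₊ = 1 := by
      have : ((ContinuousLinearEquiv.refl ℝ E3).symm : E3 →L[ℝ] E3) = ContinuousLinearMap.id ℝ E3 := rfl
      rw [this]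
      exact ContinuousLinearMap.nnnorm_id
    rw [e, inv_one, ← NNReal.coe_lt_coe, Real.coe_toNNReal _ hc0, NNReal.coe_one]
    linarith
  let hom := ApproximatesLinearOn.toHomeomorph f happ (Or.inr hlt)
  have hcoe : ∀ x, hom x = f x := fun x => rfl
  set g := hom.symm with hg
  have hgf : ∀ x, g (f x) = x := fun x => hom.symm_apply_apply x
  have hfg : ∀ x, f (g x) = x := fun x => hom.apply_symm_apply x
  have hder : ∀ q, ∃ B : E3 ≃L[ℝ] E3, HasFDerivAt f (B : E3 →L[ℝ] E3) q := by
    intro q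
    have h1 : HasFDerivAt (fun q => G.a (q + y) - G.a q) (G.D (q + y) - G.D q) q :=
      ((hasFDerivAt_comp_add_right y).2 (G.hasD (q + y))).sub (G.hasD q)
    have h2 : ‖-(G.D (q + y) - G.D q)‖ < 1 := by
      rw [norm_neg]
      have := G.lip (q + y) q
      simp only [add_sub_cancel_left] at this
      exact lt_of_le_of_lt this (by linarith)
    refine ⟨ContinuousLinearEquiv.unitsEquiv ℝ E3 (Units.oneSub _ h2), ?_⟩
    have h3 := (hasFDerivAt_id q).add h1
    refine HasFDerivAt.congr_fderiv h3 ?_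
    have e : ((ContinuousLinearEquiv.unitsEquiv ℝ E3 (Units.oneSub _ h2) : E3 ≃L[ℝ] E3) : E3 →L[ℝ] E3) =
      (1 - -(G.D (q + y) - G.D q)) := rfl
    rw [e, sub_neg_eq_add]; rfl
  choose B hB using hder
  have hgc : ContDiff ℝ (⊤ : ℕ∞) g := hom.contDiff_symm (f₀' := B) hB hfc
  have hfS : ∀ x ∈ Srf.S, f x = G.Phi y x := fun x hx => by
    simp only [hf, G.fix x hx, Phi]; abel
  have hgS : ∀ x ∈ Srf.S, g x ∈ Srf.S := by
    intro s hs
    set q := g s with hq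
    have e1 : q + (G.a (q + y) - G.a q) = s := hfg s
    have n1 : ‖q - s‖ ≤ G.L * ‖y‖ := by
      have h := G.a_lip (q + y) q
      rw [add_sub_cancel_left] at h
      rw [norm_sub_rev, ← e1]; simpa using h
    have hp : G.a q ∈ Srf.S := G.near s hs q (by linarith)
    have n2 : ‖q + y - s‖ ≤ 2 * (G.L * ‖y‖) := by
      have : q + y - s = (q - s) + y := by abel
      rw [this]; refine (norm_add_le _ _).trans ?_
      nlinarith [norm_nonneg y]
    have hp2 : G.a (q + y) ∈ Srf.S := G.near s hs _ (by linarith)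
    set p := G.a q with hpdef
    have e2 : q - p = s - G.a (q + y) := by rw [← e1]; abel
    have n3 : ‖q - p‖ ≤ G.L * (2 * (G.L * ‖y‖)) := by
      rw [e2]
      have h := G.a_lip s (q + y)
      rw [G.fix s hs, norm_sub_rev s (q + y)] at h
      have hLp := G.L_pos
      exact h.trans (by gcongr)
    have t1 := G.a_taylor p q
    rw [G.fix p hp, ← hpdef, sub_self, zero_sub, norm_neg] at t1
    have t2 := chord' (G := G) (p := p) hp2 hs
    rw [← e2] at t2
    have n4 : ‖G.a (q + y) - p‖ ≤ G.L * ‖y‖ := by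
      have h := G.a_lip (q + y) q
      rwa [add_sub_cancel_left] at h
    have n5 : ‖q - p‖ ≤ ‖(q - p) - G.D p (q - p)‖ + ‖G.D p (q - p)‖ := by
      have := norm_add_le ((q - p) - G.D p (q - p)) (G.D p (q - p)); simpa using this
    have n6 : ‖q - p‖ ≤ (G.L * (2 * ‖q - p‖ + G.L * ‖y‖)) * ‖q - p‖ := by
      have : G.L * (‖q - p‖ + ‖G.a (q + y) - p‖) * ‖q - p‖ ≤
          G.L * (‖q - p‖ + G.L * ‖y‖) * ‖q - p‖ := by
        have := G.L_pos; gcongr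
      nlinarith
    have n7 : G.L * (2 * ‖q - p‖ + G.L * ‖y‖) ≤ 1 / 2 := by
      have : G.L * ‖q - p‖ ≤ G.L * (G.L * (2 * (G.L * ‖y‖))) := by
        have := G.L_pos; gcongr
      nlinarith
    have n8 : ‖q - p‖ = 0 := by
      have := norm_nonneg (q - p); nlinarith
    have : q = p := sub_eq_zero.1 (norm_eq_zero.1 n8)
    rw [this]; exact hp
  refine ⟨g, hgc, fun x hx => ⟨hgS x hx, ?_, ?_⟩⟩
  · rw [← hfS _ (hgS x hx), hfg]
  · rw [← hfS x hx, hgf]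

/-! comparison of measures -/

lemma Phi_up {y : E3} {x x' : E3} (hx : x ∈ Srf.S) (hx' : x' ∈ Srf.S) :
    dist (G.Phi y x) (G.Phi y x') ≤ (1 + 2 * (G.L * ‖y‖)) * dist x x' := by
  rw [dist_eq_norm, dist_eq_norm]
  have h := Phi_sub (G := G) y hx hx'
  have h2 := norm_add_le ((G.Phi y x - G.Phi y x') - (x - x')) (x - x')
  rw [sub_add_cancel] at h2
  have : 0 ≤ G.L * ‖y‖ * ‖x - x'‖ := by have := G.L_pos; positivity
  nlinarith

lemma Phi_low {y : E3} (hy : ‖y‖ ≤ G.r1) {x x' : E3} (hx : x ∈ Srf.S) (hx' : x' ∈ Srf.S) :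
    dist x x' ≤ (1 + 2 * (G.L * ‖y‖)) * dist (G.Phi y x) (G.Phi y x') := by
  obtain ⟨b0, b1, b2, b3, b4⟩ := r1_bd hy
  rw [dist_eq_norm, dist_eq_norm]
  have h := Phi_sub (G := G) y hx hx'
  have h2 := norm_sub_le (G.Phi y x - G.Phi y x') ((G.Phi y x - G.Phi y x') - (x - x'))
  rw [sub_sub_cancel] at h2
  have h0 : 0 ≤ G.L * ‖y‖ := by have := G.L_pos; positivity
  have := G.ρ_le
  set A := ‖x - x'‖
  set B := ‖G.Phi y x - G.Phi y x'‖
  have hA : 0 ≤ A := norm_nonneg _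
  set e := G.L * ‖y‖
  have h3 : A * (1 - e) ≤ B := by linarith
  have h4 : A * (1 - e) * (1 + 2 * e) ≤ B * (1 + 2 * e) := by gcongr
  have h5 : A ≤ A * (1 - e) * (1 + 2 * e) := by
    have : 0 ≤ A * (e * (1 - 2 * e)) := by
      have : e ≤ 1 / 2 := by linarith
      have : 0 ≤ 1 - 2 * e := by linarith
      positivity
    nlinarith
  linarith

lemma Phi_meas (y : E3) : Measurable (G.Phi y) := (Phi_smooth y).continuous.measurable

lemma Phi_map {y : E3} (hy : ‖y‖ ≤ G.r1) :
    G.mu.map (G.Phi y) ≤ ENNReal.ofReal (1 + 8 * (G.L * ‖y‖)) • G.mu ∧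
    G.mu ≤ ENNReal.ofReal (1 + 8 * (G.L * ‖y‖)) • G.mu.map (G.Phi y) := by
  obtain ⟨b0, b1, b2, b3, b4⟩ := r1_bd hy
  have := G.ρ_le
  have h0 : 0 ≤ G.L * ‖y‖ := by have := G.L_pos; positivity
  have hk : ENNReal.ofReal ((1 + 2 * (G.L * ‖y‖)) ^ 2) ≤ ENNReal.ofReal (1 + 8 * (G.L * ‖y‖)) :=
    ENNReal.ofReal_le_ofReal (by nlinarith)
  obtain ⟨g, hg, hgS⟩ := exists_inv hy
  constructor
  · refine (map_haus_le (Phi_meas y) mS (K := 1 + 2 * (G.L * ‖y‖)) (by positivity)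
      (fun x hx x' hx' => Phi_low hy hx hx') (B := Srf.S) (fun x hx => Phi_mem hy hx)).trans ?_
    exact Measure.le_iff.2 fun s _ => by
      simp only [Measure.smul_apply, smul_eq_mul]; exact mul_le_mul' hk le_rfl
  · refine (le_map_haus (Phi_meas y) mS (K := 1 + 2 * (G.L * ‖y‖)) (by positivity)
      (fun x hx x' hx' => Phi_up hx hx') (B := Srf.S)
      (fun x hx => ⟨g x, (hgS x hx).1, (hgS x hx).2.1⟩)).trans ?_
    exact Measure.le_iff.2 fun s _ => by
      simp only [Measure.smul_apply, smul_eq_mul]; exact mul_le_mul' hk le_rfl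

lemma int_Phi {y : E3} (hy : ‖y‖ ≤ G.r1) {H : E3 → ℝ} (hH : ContinuousOn H Srf.S) :
    |∫ x, H (G.Phi y x) ∂G.mu - ∫ x, H x ∂G.mu| ≤ 16 * (G.L * ‖y‖) * ∫ x, |H x| ∂G.mu := by
  obtain ⟨b0, b1, b2, b3, b4⟩ := r1_bd hy
  have := G.ρ_le
  have h0 : 0 ≤ G.L * ‖y‖ := by have := G.L_pos; positivity
  have hb : BM G.mu H := bm_of_cont hH
  obtain ⟨h1, h2⟩ := Phi_map (G := G) hy
  obtain ⟨c1, c2⟩ := integral_compare (by positivity) (by linarith) h1 h2 hb.integrable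
  rw [integral_map (Phi_meas y).aemeasurable c1.1] at c2
  linarith

lemma int_Phi_le {y : E3} (hy : ‖y‖ ≤ G.r1) {H : E3 → ℝ} (hH : ContinuousOn H Srf.S)
    (hp : ∀ x ∈ Srf.S, 0 ≤ H x) :
    ∫ x, H (G.Phi y x) ∂G.mu ≤ 2 * ∫ x, H x ∂G.mu ∧
    ∫ x, H x ∂G.mu ≤ 2 * ∫ x, H (G.Phi y x) ∂G.mu := by
  obtain ⟨b0, b1, b2, b3, b4⟩ := r1_bd hy
  have hρ := G.ρ_le
  have h0 : 0 ≤ G.L * ‖y‖ := by have := G.L_pos; positivity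
  have h := int_Phi hy hH
  have e : ∫ x, |H x| ∂G.mu = ∫ x, H x ∂G.mu :=
    integral_congr_ae (ae_of fun x hx => abs_of_nonneg (hp x hx))
  rw [e] at h
  have h1 : 0 ≤ ∫ x, H x ∂G.mu := integral_nonneg_of_ae (ae_of hp)
  rw [abs_le] at h
  have : 16 * (G.L * ‖y‖) * ∫ x, H x ∂G.mu ≤ 1 / 2 * ∫ x, H x ∂G.mu := by
    gcongr; linarith
  constructor <;> linarith

lemma nr_Phi_le {F : Type*} [NormedAddCommGroup F] {y : E3} (hy : ‖y‖ ≤ G.r1) {H : E3 → F}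
    (hH : ContinuousOn H Srf.S) :
    G.nr (fun x => H (G.Phi y x)) ≤ 2 * G.nr H ∧ G.nr H ≤ 2 * G.nr (fun x => H (G.Phi y x)) := by
  have h := int_Phi_le (H := fun x => ‖H x‖ ^ 2) hy (hH.norm.pow 2) (fun x _ => by positivity)
  have e1 := nrm_sq (μ := G.mu) H
  have e2 := nrm_sq (μ := G.mu) (fun x => H (G.Phi y x))
  rw [← e1, ← e2] at h
  have p1 := nrm_nonneg (μ := G.mu) H
  have p2 := nrm_nonneg (μ := G.mu) (fun x => H (G.Phi y x))
  constructor
  · exact abs_le_of_sq_le_sq' (by unfold nr; nlinarith) (by unfold nr; positivity) |>.2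
  · exact abs_le_of_sq_le_sq' (by unfold nr; nlinarith) (by unfold nr; positivity) |>.2

end Geo
end PartN5

section PartN6
/-- L2 norm of averages -/
lemma nrm_avg {X Y : Type*} [MeasurableSpace X] [MeasurableSpace Y] {μ : Measure X} {ν : Measure Y}
    [IsFiniteMeasure μ] [IsFiniteMeasure ν] {F : Y → X → ℝ} (hF : BM (ν.prod μ) (fun p => F p.1 p.2))
    {K : ℝ} (hK : 0 ≤ K) (h : ∀ᵐ y ∂ν, nrm μ (F y) ≤ K) :
    nrm μ (fun x => ∫ y, F y x ∂ν) ≤ ν.real univ * K := by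
  have h_intg : Integrable (fun p : Y × X => F p.1 p.2 ^ 2) (ν.prod μ) := (hF.pow 2).integrable
  have hsw : Integrable (fun p : X × Y => F p.2 p.1 ^ 2) (μ.prod ν) := h_intg.swap
  have h1 : ∀ᵐ x ∂μ, (∫ y, F y x ∂ν) ^ 2 ≤ ν.real univ * ∫ y, F y x ^ 2 ∂ν := by
    obtain ⟨hm, C, hC⟩ := hF
    have hm' : AEStronglyMeasurable (fun p : X × Y => F p.2 p.1) (μ.prod ν) := hm.prod_swap
    have hC' : ∀ᵐ p ∂(μ.prod ν), ‖F p.2 p.1‖ ≤ C :=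
      (Measure.measurePreserving_swap (μ := μ) (ν := ν)).quasiMeasurePreserving.ae hC
    filter_upwards [hm'.prodMk_left, Measure.ae_ae_of_ae_prod hC'] with x hx hCx
    have hb : BM ν (fun y => F y x) := ⟨hx, C, hCx⟩
    have h2 := cs_nrm_mul hb (BM.const (μ := ν) (1 : ℝ))
    simp only [mul_one] at h2
    have h3 : nrm ν (fun _ => (1 : ℝ)) ^ 2 = ν.real univ := by rw [nrm_sq]; simp
    have h4 := nrm_sq (μ := ν) (fun y => F y x)
    simp only [Real.norm_eq_abs, sq_abs] at h4
    rw [← h4, ← h3, ← mul_pow, ← sq_abs, mul_comm]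
    gcongr
  have h2 : ∫ x, (∫ y, F y x ∂ν) ^ 2 ∂μ ≤ ∫ x, ν.real univ * ∫ y, F y x ^ 2 ∂ν ∂μ := by
    refine integral_mono_of_nonneg (Eventually.of_forall fun x => sq_nonneg _) ?_ h1
    exact (hsw.integral_prod_left).const_mul _
  rw [integral_const_mul, integral_integral_swap hsw] at h2
  have h3 : ∫ y, ∫ x, F y x ^ 2 ∂μ ∂ν ≤ ∫ y, K ^ 2 ∂ν := by
    refine integral_mono_ae h_intg.integral_prod_left (integrable_const _) ?_
    filter_upwards [h] with y hy
    have := nrm_sq (μ := μ) (F y)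
    simp only [Real.norm_eq_abs, sq_abs] at this
    rw [← this]
    have := nrm_nonneg (μ := μ) (F y)
    gcongr
  rw [integral_const, smul_eq_mul] at h3
  have h4 := nrm_sq (μ := μ) (fun x => ∫ y, F y x ∂ν)
  simp only [Real.norm_eq_abs, sq_abs] at h4
  have h5 : 0 ≤ ν.real univ := by positivity
  refine (abs_le_of_sq_le_sq' ?_ (by positivity)).2
  rw [h4]
  nlinarith

lemma bm_prod_compact {X Y : Type*} [TopologicalSpace X] [TopologicalSpace Y]
    [MeasurableSpace X] [MeasurableSpace Y] [OpensMeasurableSpace X] [OpensMeasurableSpace Y]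
    [SecondCountableTopology X] [SecondCountableTopology Y]
    {μ : Measure X} {ν : Measure Y} [SFinite μ] [SFinite ν] {A : Set X} {B : Set Y}
    (hA : IsCompact A) (hB : IsCompact B) (mA : MeasurableSet A) (mB : MeasurableSet B)
    {F : Y → X → ℝ} (hF : Continuous (fun p : Y × X => F p.1 p.2)) :
    BM ((ν.restrict B).prod (μ.restrict A)) (fun p => F p.1 p.2) := by
  obtain ⟨C, hC⟩ := (hB.prod hA).exists_bound_of_continuousOn hF.continuousOn
  refine ⟨hF.aestronglyMeasurable, C, ?_⟩
  rw [Measure.prod_restrict]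
  filter_upwards [ae_restrict_mem (mB.prod mA)] with p hp using hC p hp

namespace Geo
variable {Srf : SmoothSurface} {G : Geo Srf}

lemma C1_Phi {w : E3 → ℝ} (hw : ContDiff ℝ 1 w) (y : E3) : ContDiff ℝ 1 (fun x => w (G.Phi y x)) :=
  hw.comp ((Phi_smooth y).of_le (by exact_mod_cast le_top))

lemma gd_Phi {y : E3} (hy : ‖y‖ ≤ G.r1) {w : E3 → ℝ} (hw : ContDiff ℝ 1 w) {x : E3} (hx : x ∈ Srf.S) :
    ‖G.gd (fun x => w (G.Phi y x)) x - G.gd w (G.Phi y x)‖ ≤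
      2 * G.L ^ 2 * ‖y‖ * ‖G.gd w (G.Phi y x)‖ := by
  have hL := G.L_one
  have hLp := G.L_pos
  have hS := Phi_mem hy hx
  rw [← (InnerProductSpace.toDual ℝ E3).norm_map]
  refine ContinuousLinearMap.opNorm_le_bound _ (by positivity) fun k => ?_
  rw [InnerProductSpace.toDual_apply_apply, inner_sub_left, inner_gd]
  have hq : HasFDerivAt (fun z => G.a (G.a z + y)) ((G.D (x + y)).comp (G.D x)) x := by
    have h1 : HasFDerivAt (fun z => G.a z + y) (G.D x) x := (G.hasD x).add_const y
    have h2 : HasFDerivAt G.a (G.D (x + y)) (G.a x + y) := by rw [G.fix x hx]; exact G.hasD _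
    exact h2.comp x h1
  have hm : ∀ᶠ z in 𝓝 x, G.a (G.a z + y) ∈ Srf.S := by
    filter_upwards [ev_mem hx] with z hz using Phi_mem hy hz
  have e := inner_gd_comp (G := G) (w := w) hq hm (DA_C1 hw _) k
  have e0 : G.a (G.a x + y) = G.Phi y x := by rw [G.fix x hx]; rfl
  rw [e0] at e
  have e1 : (fun x => w (G.Phi y x)) ∘ G.a = w ∘ (fun z => G.a (G.a z + y)) := rfl
  rw [e1, e]
  have e2 : ⟪G.gd w (G.Phi y x), k⟫ = ⟪G.gd w (G.Phi y x), G.D (G.Phi y x) k⟫ := by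
    rw [← D_symm hS, gd_tan w hS]
  rw [e2, ← inner_sub_right]
  refine (norm_inner_le_norm _ _).trans ?_
  have e3 : (G.D (x + y)).comp (G.D x) k - G.D (G.Phi y x) k =
      (G.D (x + y) (G.D x k) - G.D x (G.D x k)) + (G.D x k - G.D (G.Phi y x) k) := by
    rw [D_idem hx]; simp
  have e4 : ‖(G.D (x + y)).comp (G.D x) k - G.D (G.Phi y x) k‖ ≤ 2 * G.L ^ 2 * ‖y‖ * ‖k‖ := by
    rw [e3]
    refine (norm_add_le _ _).trans ?_
    have a1 := G.D_sub (x + y) x (G.D x k)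
    rw [add_sub_cancel_left] at a1
    have a2 := G.D_sub x (G.Phi y x) k
    have a3 : G.L * ‖y‖ * ‖G.D x k‖ ≤ G.L * ‖y‖ * ‖k‖ := by
      have := D_norm_le hx k (G := G); gcongr
    have a4 : G.L * ‖x - G.Phi y x‖ * ‖k‖ ≤ G.L * (G.L * ‖y‖) * ‖k‖ := by
      have := Phi_dist (G := G) y hx; rw [norm_sub_rev] at this; gcongr
    have a5 : G.L * ‖y‖ * ‖k‖ ≤ G.L ^ 2 * ‖y‖ * ‖k‖ := by
      have : G.L ≤ G.L ^ 2 := by nlinarith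
      gcongr
    nlinarith
  calc _ ≤ ‖G.gd w (G.Phi y x)‖ * (2 * G.L ^ 2 * ‖y‖ * ‖k‖) := by gcongr
    _ = _ := by ring

lemma form_Phi {y : E3} (hy : ‖y‖ ≤ G.r1) {w χ : E3 → ℝ} (hw : ContDiff ℝ 1 w)
    (hχ : ContDiff ℝ 1 χ) :
    |G.form (fun x => w (G.Phi y x)) (fun x => χ (G.Phi y x)) - G.form w χ| ≤
      28 * G.L ^ 2 * ‖y‖ * ∫ x, (‖G.gd w x‖ * ‖G.gd χ x‖ + |w x| * |χ x|) ∂G.mu := by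
  obtain ⟨b0, b1, b2, b3, b4⟩ := r1_bd hy
  have hρ := G.ρ_le
  have hL := G.L_one
  have hLp := G.L_pos
  have cw := cont_gd (G := G) hw
  have cχ := cont_gd (G := G) hχ
  have cw0 := hw.continuous
  have cχ0 := hχ.continuous
  set H : E3 → ℝ := fun x => ⟪G.gd w x, G.gd χ x⟫ + w x * χ x with hH
  set K : E3 → ℝ := fun x => ‖G.gd w x‖ * ‖G.gd χ x‖ + |w x| * |χ x| with hKd
  have hHc : Continuous H := by fun_prop
  have hKc : Continuous K := by fun_prop
  have hKn : ∀ x, 0 ≤ K x := fun x => by positivity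
  have hHK : ∀ x, |H x| ≤ K x := fun x => by
    refine (abs_add_le _ _).trans ?_
    rw [abs_mul]
    exact add_le_add_left (abs_real_inner_le_norm _ _) _
  have cPhi := (Phi_smooth (G := G) y).continuous
  have h1 := int_Phi hy hHc.continuousOn
  have h2 : ∫ x, |H x| ∂G.mu ≤ ∫ x, K x ∂G.mu :=
    integral_mono (bm_of_cont hHc.continuousOn).abs.integrable
      (bm_of_cont hKc.continuousOn).integrable hHK
  have h3 := (int_Phi_le hy hKc.continuousOn fun x _ => hKn x).1
  have hW1 := C1W (G := G) (C1_Phi (G := G) hw y)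
  have hW2 := C1W (G := G) (C1_Phi (G := G) hχ y)
  have h4 : |G.form (fun x => w (G.Phi y x)) (fun x => χ (G.Phi y x)) - ∫ x, H (G.Phi y x) ∂G.mu| ≤
      6 * G.L ^ 2 * ‖y‖ * ∫ x, K (G.Phi y x) ∂G.mu := by
    have i1 := form_integrable hW1 hW2
    have i2 : Integrable (fun x => H (G.Phi y x)) G.mu :=
      (bm_of_cont (hHc.comp cPhi).continuousOn).integrable
    have i3 : Integrable (fun x => K (G.Phi y x)) G.mu :=
      (bm_of_cont (hKc.comp cPhi).continuousOn).integrable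
    unfold form
    rw [← integral_sub i1 i2, ← integral_const_mul]
    rw [← Real.norm_eq_abs]
    refine norm_integral_le_of_norm_le (i3.const_mul _) (ae_of fun x hx => ?_)
    simp only [hH, hKd]
    rw [add_sub_add_right_eq_sub]
    have d1 := gd_Phi hy hw hx
    have d2 := gd_Phi hy hχ hx
    set A := G.gd (fun x => w (G.Phi y x)) x
    set B := G.gd (fun x => χ (G.Phi y x)) x
    set A' := G.gd w (G.Phi y x)
    set B' := G.gd χ (G.Phi y x)
    have e : ⟪A, B⟫ - ⟪A', B'⟫ = ⟪A - A', B - B'⟫ + ⟪A - A', B'⟫ + ⟪A', B - B'⟫ := by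
      simp only [inner_sub_left, inner_sub_right]; ring
    rw [e, Real.norm_eq_abs]
    set ε := 2 * G.L ^ 2 * ‖y‖ with hε
    have hε0 : 0 ≤ ε := by positivity
    have hε1 : ε ≤ 1 := by linarith
    have c1 : |⟪A - A', B - B'⟫| ≤ ε * (‖A'‖ * ‖B'‖) := by
      refine (abs_real_inner_le_norm _ _).trans ?_
      calc ‖A - A'‖ * ‖B - B'‖ ≤ (ε * ‖A'‖) * (1 * ‖B'‖) := by
            refine mul_le_mul d1 (d2.trans ?_) (norm_nonneg _) (by positivity)
            gcongr
        _ = _ := by ring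
    have c2 : |⟪A - A', B'⟫| ≤ ε * (‖A'‖ * ‖B'‖) := by
      refine (abs_real_inner_le_norm _ _).trans ?_
      rw [← mul_assoc]; gcongr
    have c3 : |⟪A', B - B'⟫| ≤ ε * (‖A'‖ * ‖B'‖) := by
      refine (abs_real_inner_le_norm _ _).trans ?_
      rw [mul_left_comm]; gcongr
    have c4 := abs_add_three ⟪A - A', B - B'⟫ ⟪A - A', B'⟫ ⟪A', B - B'⟫
    have c5 : 0 ≤ 6 * G.L ^ 2 * ‖y‖ * (|w (G.Phi y x)| * |χ (G.Phi y x)|) := by positivity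
    nlinarith
  have hf : G.form w χ = ∫ x, H x ∂G.mu := rfl
  have hK0 : 0 ≤ ∫ x, K x ∂G.mu := integral_nonneg hKn
  have s1 : 16 * (G.L * ‖y‖) * ∫ x, |H x| ∂G.mu ≤ 16 * (G.L ^ 2 * ‖y‖) * ∫ x, K x ∂G.mu := by
    have : G.L ≤ G.L ^ 2 := by nlinarith
    gcongr
  have s2 : 6 * G.L ^ 2 * ‖y‖ * ∫ x, K (G.Phi y x) ∂G.mu ≤
      6 * G.L ^ 2 * ‖y‖ * (2 * ∫ x, K x ∂G.mu) := by gcongr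
  rw [hf]
  have s3 := abs_sub_le (G.form (fun x => w (G.Phi y x)) (fun x => χ (G.Phi y x)))
    (∫ x, H (G.Phi y x) ∂G.mu) (∫ x, H x ∂G.mu)
  nlinarith

lemma int_K_le {w χ : E3 → ℝ} (hw : G.W w) (hχ : G.W χ) :
    ∫ x, (‖G.gd w x‖ * ‖G.gd χ x‖ + |w x| * |χ x|) ∂G.mu ≤ 2 * (G.en w * G.en χ) := by
  rw [integral_add (hw.bmg.norm.mul hχ.bmg.norm).integrable (hw.bm.abs.mul hχ.bm.abs).integrable]
  have h1 := cs_nrm hw.bmg hχ.bmg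
  have h2 := cs_nrm hw.bm hχ.bm
  simp only [Real.norm_eq_abs] at h2
  have h3 : nrm G.mu (G.gd w) * nrm G.mu (G.gd χ) ≤ G.en w * G.en χ :=
    mul_le_mul (nrg_le_en hw) (nrg_le_en hχ) (nrm_nonneg _) (en_nonneg _)
  have h4 : nrm G.mu w * nrm G.mu χ ≤ G.en w * G.en χ :=
    mul_le_mul (nr_le_en hw) (nr_le_en hχ) (nrm_nonneg _) (en_nonneg _)
  linarith

lemma en_Phi {y : E3} (hy : ‖y‖ ≤ G.r1) {w : E3 → ℝ} (hw : ContDiff ℝ 1 w) :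
    G.en (fun x => w (G.Phi y x)) ≤ 2 * G.en w ∧ G.en w ≤ 2 * G.en (fun x => w (G.Phi y x)) := by
  obtain ⟨b0, b1, b2, b3, b4⟩ := r1_bd hy
  have hρ := G.ρ_le
  have h := form_Phi hy hw hw
  have hW := C1W (G := G) hw
  have e : ∫ x, (‖G.gd w x‖ * ‖G.gd w x‖ + |w x| * |w x|) ∂G.mu = G.form w w := by
    unfold form; congr 1; ext x
    rw [real_inner_self_eq_norm_sq, ← abs_mul, abs_mul_self]; ring
  rw [e, ← en_sq, ← en_sq] at h
  have p1 := en_nonneg (G := G) w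
  have p2 := en_nonneg (G := G) (fun x => w (G.Phi y x))
  have : 28 * G.L ^ 2 * ‖y‖ * G.en w ^ 2 ≤ 1 / 2 * G.en w ^ 2 := by gcongr; linarith
  rw [abs_le] at h
  constructor
  · exact (abs_le_of_sq_le_sq' (by nlinarith) (by positivity)).2
  · exact (abs_le_of_sq_le_sq' (by nlinarith) (by positivity)).2

lemma nr_trans {y : E3} (hy : ‖y‖ ≤ G.r1) {w : E3 → ℝ} (hw : ContDiff ℝ 1 w) :
    G.nr (fun x => w (G.Phi y x) - w x) ≤ 2 * G.L * ‖y‖ * G.nr (G.gd w) := by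
  have hLp := G.L_pos
  have cw := cont_gd (G := G) hw
  have cD := G.contD
  have cA := G.contA
  have hsy : ∀ s ∈ Icc (0 : ℝ) 1, ‖s • y‖ ≤ G.r1 := fun s hs => by
    rw [norm_smul, Real.norm_of_nonneg hs.1]
    nlinarith [norm_nonneg y, hs.2]
  have hpt : ∀ x ∈ Srf.S, |w (G.Phi y x) - w x| ≤
      ∫ s in Icc (0 : ℝ) 1, G.L * ‖y‖ * ‖G.gd w (G.Phi (s • y) x)‖ := by
    intro x hx
    have hd : ∀ s ∈ uIcc (0 : ℝ) 1, HasDerivAt (fun s : ℝ => w (G.a (x + s • y)))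
        ⟪G.gd w (G.a (x + s • y)), G.D (x + s • y) y⟫ s := by
      intro s hs
      rw [uIcc_of_le zero_le_one] at hs
      have hb := (r1_bd (hsy s hs)).1
      have hlt : ‖x + s • y - x‖ < G.ρ := by
        rw [add_sub_cancel_left]; have := G.ρ_pos; linarith
      have h1 := DA_off (w := w) hx hlt (DA_C1 hw _)
      have h2 : HasDerivAt (fun s : ℝ => x + s • y) y s := by
        simpa using ((hasDerivAt_id s).smul_const y).const_add x
      have h3 := h1.comp_hasDerivAt s h2
      rw [inner_gd]; exact h3
    have hc : Continuous fun s : ℝ => ⟪G.gd w (G.a (x + s • y)), G.D (x + s • y) y⟫ := by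
      refine Continuous.inner (by fun_prop) ?_
      exact (cD.comp (by fun_prop : Continuous fun s : ℝ => x + s • y)).clm_apply continuous_const
    have e := intervalIntegral.integral_eq_sub_of_hasDerivAt hd (hc.intervalIntegrable _ _)
    simp only [one_smul, zero_smul, add_zero, G.fix x hx] at e
    show |w (G.a (x + y)) - w x| ≤ _
    rw [← e, intervalIntegral.integral_of_le zero_le_one, ← integral_Icc_eq_integral_Ioc]
    rw [← Real.norm_eq_abs]
    refine norm_integral_le_of_norm_le ?_ (Eventually.of_forall fun s => ?_)
    · apply Continuous.integrableOn_Icc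
      unfold Phi
      fun_prop
    · refine (norm_inner_le_norm _ _).trans ?_
      have := G.D_le (x + s • y) y
      show _ ≤ G.L * ‖y‖ * ‖G.gd w (G.a (x + s • y))‖
      rw [mul_comm]; gcongr
  have hcont : Continuous fun p : ℝ × E3 => G.L * ‖y‖ * ‖G.gd w (G.Phi (p.1 • y) p.2)‖ := by
    unfold Phi; fun_prop
  have hBM : BM ((volume.restrict (Icc (0 : ℝ) 1)).prod G.mu)
      (fun p : ℝ × E3 => G.L * ‖y‖ * ‖G.gd w (G.Phi (p.1 • y) p.2)‖) := by
    obtain ⟨C, hC⟩ := (isCompact_Icc (a := (0:ℝ)) (b := 1)).prod Srf.compact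
      |>.exists_bound_of_continuousOn hcont.continuousOn
    refine ⟨hcont.aestronglyMeasurable, C, ?_⟩
    have : ∀ᵐ p ∂((volume.restrict (Icc (0 : ℝ) 1)).prod G.mu), p.1 ∈ Icc (0 : ℝ) 1 :=
      Measure.quasiMeasurePreserving_fst.ae (ae_restrict_mem measurableSet_Icc)
    have h2 : ∀ᵐ p ∂((volume.restrict (Icc (0 : ℝ) 1)).prod G.mu), p.2 ∈ Srf.S :=
      Measure.quasiMeasurePreserving_snd.ae ae_mem
    filter_upwards [this, h2] with p h1 h2 using hC p ⟨h1, h2⟩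
  have h := nrm_avg (μ := G.mu) (ν := volume.restrict (Icc (0 : ℝ) 1))
    (F := fun s x => G.L * ‖y‖ * ‖G.gd w (G.Phi (s • y) x)‖) hBM
    (K := 2 * G.L * ‖y‖ * G.nr (G.gd w)) (by have := nr_nonneg (G := G) (G.gd w); positivity) ?_
  · have e : (volume.restrict (Icc (0 : ℝ) 1)).real univ = 1 := by simp [Measure.real]
    rw [e, one_mul] at h
    refine le_trans ?_ h
    obtain ⟨C, hC⟩ := Srf.compact.exists_bound_of_continuousOn
      (f := fun x => ∫ s in Icc (0 : ℝ) 1, G.L * ‖y‖ * ‖G.gd w (G.Phi (s • y) x)‖)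
      (continuous_parametric_integral_of_continuous (μ := volume) (f := fun x s => G.L * ‖y‖ * ‖G.gd w (G.Phi (s • y) x)‖)
        (by unfold Phi; fun_prop) isCompact_Icc).continuousOn
    refine nrm_mono (bm_of_cont (continuous_parametric_integral_of_continuous (μ := volume) (f := fun x s => G.L * ‖y‖ * ‖G.gd w (G.Phi (s • y) x)‖)
        (by unfold Phi; fun_prop) isCompact_Icc).continuousOn) (ae_of fun x hx => ?_)
    refine (hpt x hx).trans (le_abs_self _)
  · filter_upwards [ae_restrict_mem measurableSet_Icc] with s hs
    rw [nrm_const_mul, abs_of_nonneg (by positivity), nrm_norm]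
    have := (nr_Phi_le (hsy s hs) (cont_gd (G := G) hw).continuousOn).1
    unfold nr at this ⊢
    calc _ ≤ G.L * ‖y‖ * (2 * nrm G.mu (G.gd w)) := by gcongr
      _ = _ := by ring

lemma nr_gd_shift {y : E3} (hy : ‖y‖ ≤ G.r1) {w : E3 → ℝ} (hw : ContDiff ℝ 1 w) {x : E3}
    (hx : x ∈ Srf.S) : ‖G.gd w (G.Phi y x) - G.gd w x‖ ≤
      ‖G.gd (fun x => w (G.Phi y x) - w x) x‖ + 2 * G.L ^ 2 * ‖y‖ * ‖G.gd w (G.Phi y x)‖ := by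
  rw [gd_sub (DA_C1 (C1_Phi hw y) x) (DA_C1 hw x)]
  have h := gd_Phi hy hw hx
  rw [norm_sub_rev] at h
  refine le_trans ?_ (add_le_add_right h _)
  refine le_trans (le_of_eq ?_) (norm_add_le _ _)
  congr 1; abel

end Geo
end PartN6

section PartN7
namespace Geo
variable {Srf : SmoothSurface} {G : Geo Srf}

variable (G) in
/-- admissible weights -/
def Wgt (B : ℝ) (σ : E3 → ℝ) : Prop :=
  1 ≤ B ∧ ContDiff ℝ 1 (fun x => σ x ^ 2) ∧ Continuous σ ∧
    ∀ x ∈ Srf.S, 0 < σ x ∧ σ x ≤ B ∧ ‖G.gd (fun x => σ x ^ 2) x‖ ≤ 2 * σ x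

variable (G) in
/-- weighted energy (squared) -/
def N2 (σ v : E3 → ℝ) : ℝ := G.nr (fun x => σ x • G.gd v x) ^ 2 + G.nr (fun x => σ x * v x) ^ 2

lemma wgt_one : G.Wgt 1 (fun _ => 1) := by
  refine ⟨le_rfl, contDiff_const, continuous_const, fun x _ => ⟨one_pos, le_rfl, ?_⟩⟩
  have h1 : ((fun _ => (1 : ℝ) ^ 2) ∘ G.a : E3 → ℝ) = fun _ => (1 : ℝ) ^ 2 := rfl
  have h2 : ‖G.gd (fun _ => (1 : ℝ) ^ 2) x‖ = 0 := by
    unfold gd; rw [norm_gradient', h1]; simp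
  rw [h2]; norm_num

lemma Wgt.bm {B : ℝ} {σ : E3 → ℝ} (h : G.Wgt B σ) : BM G.mu σ := bm_of_cont h.2.2.1.continuousOn

lemma wid {B : ℝ} {σ : E3 → ℝ} (h : G.Wgt B σ) {v : E3 → ℝ} (hv : G.W v) :
    G.N2 σ v ≤ 2 * G.form v (fun x => σ x ^ 2 * v x) + 4 * G.nr v ^ 2 := by
  obtain ⟨hB, hs, hc, hσ⟩ := h
  have hσb : BM G.mu σ := bm_of_cont hc.continuousOn
  have b1 : BM G.mu (fun x => σ x • G.gd v x) := hσb.smul hv.bmg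
  have b2 : BM G.mu (fun x => σ x * v x) := hσb.mul hv.bm
  have hWs := C1W (G := G) hs
  have key : G.N2 σ v - 2 * (nrm G.mu v * nrm G.mu (fun x => σ x • G.gd v x)) ≤
      G.form v (fun x => σ x ^ 2 * v x) := by
    unfold N2 nr form
    rw [nrm_sq, nrm_sq, ← integral_add b1.sq_int b2.sq_int]
    have c := cs_nrm hv.bm b1
    have i := (hv.bm.norm.mul b1.norm).integrable
    have : ∫ x, ((‖σ x • G.gd v x‖ ^ 2 + ‖σ x * v x‖ ^ 2) - 2 * (‖v x‖ * ‖σ x • G.gd v x‖)) ∂G.mu ≤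
        ∫ x, ⟪G.gd v x, G.gd (fun x => σ x ^ 2 * v x) x⟫ + v x * (σ x ^ 2 * v x) ∂G.mu := by
      refine integral_mono_ae ((b1.sq_int.add b2.sq_int).sub (i.const_mul 2))
        (form_integrable hv (hWs.mul hv)) ?_
      filter_upwards [hv.2, ae_mem] with x hd hx
      obtain ⟨p1, p2, p3⟩ := hσ x hx
      rw [gd_mul hx (DA_C1 hs x) hd]
      simp only [inner_add_right, inner_smul_right, norm_smul, norm_mul, Real.norm_eq_abs,
        abs_of_pos p1, real_inner_self_eq_norm_sq]
      have q : |⟪G.gd v x, G.gd (fun x => σ x ^ 2) x⟫| ≤ ‖G.gd v x‖ * (2 * σ x) :=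
        (abs_real_inner_le_norm _ _).trans (by gcongr)
      have q2 : -(|v x| * (‖G.gd v x‖ * (2 * σ x))) ≤ v x * ⟪G.gd v x, G.gd (fun x => σ x ^ 2) x⟫ := by
        have := neg_abs_le (v x * ⟪G.gd v x, G.gd (fun x => σ x ^ 2) x⟫)
        rw [abs_mul] at this
        have : |v x| * |⟪G.gd v x, G.gd (fun x => σ x ^ 2) x⟫| ≤ |v x| * (‖G.gd v x‖ * (2 * σ x)) := by
          gcongr
        linarith
      have : (σ x * |v x|) ^ 2 = v x * (σ x ^ 2 * v x) := by rw [mul_pow, sq_abs]; ring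
      rw [this]
      nlinarith
    have i12 : Integrable (fun x => ‖σ x • G.gd v x‖ ^ 2 + ‖σ x * v x‖ ^ 2) G.mu :=
      b1.sq_int.add b2.sq_int
    rw [integral_sub i12 (i.const_mul 2), integral_const_mul] at this
    linarith
  have q := sq_nonneg (nrm G.mu (fun x => σ x • G.gd v x) - 2 * nrm G.mu v)
  have q' := sq_nonneg (nrm G.mu (fun x => σ x * v x))
  unfold N2 nr at *
  nlinarith

lemma en_wgt {B : ℝ} {σ : E3 → ℝ} (h : G.Wgt B σ) {v : E3 → ℝ} (hv : G.W v) :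
    G.en (fun x => σ x ^ 2 * v x) ≤ 2 * B * (G.nr (fun x => σ x • G.gd v x) +
      G.nr (fun x => σ x * v x) + G.nr v) := by
  have hσb := h.bm
  obtain ⟨hB, hs, hc, hσ⟩ := h
  have b1 : BM G.mu (fun x => σ x • G.gd v x) := hσb.smul hv.bmg
  have b2 : BM G.mu (fun x => σ x * v x) := hσb.mul hv.bm
  have hWs := C1W (G := G) hs
  refine (en_le_add (hWs.mul hv)).trans ?_
  have n1 : G.nr (G.gd (fun x => σ x ^ 2 * v x)) ≤
      B * G.nr (fun x => σ x • G.gd v x) + 2 * B * G.nr v := by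
    have : G.nr (G.gd (fun x => σ x ^ 2 * v x)) ≤
        nrm G.mu (fun x => B * ‖σ x • G.gd v x‖ + (2 * B) * ‖v x‖) := by
      refine nrm_mono (((BM.const B).mul b1.norm).add ((BM.const (2 * B)).mul hv.bm.norm)) ?_
      filter_upwards [hv.2, ae_mem] with x hd hx
      obtain ⟨p1, p2, p3⟩ := hσ x hx
      rw [gd_mul hx (DA_C1 hs x) hd]
      refine (norm_add_le _ _).trans (le_trans ?_ (le_abs_self _))
      rw [norm_smul, norm_smul, norm_smul, norm_pow, Real.norm_eq_abs, abs_of_pos p1]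
      have : ‖v x‖ * ‖G.gd (fun x => σ x ^ 2) x‖ ≤ ‖v x‖ * (2 * B) := by gcongr; linarith
      have : σ x ^ 2 * ‖G.gd v x‖ ≤ B * (σ x * ‖G.gd v x‖) := by
        rw [sq, mul_assoc]; gcongr
      linarith
    refine this.trans ((nrm_add_le ((BM.const B).mul b1.norm) ((BM.const (2 * B)).mul hv.bm.norm)).trans ?_)
    rw [nrm_const_mul, nrm_const_mul, nrm_norm, nrm_norm, abs_of_nonneg (by linarith),
      abs_of_nonneg (by linarith)]
    rfl
  have n2 : G.nr (fun x => σ x ^ 2 * v x) ≤ B * G.nr (fun x => σ x * v x) := by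
    have : G.nr (fun x => σ x ^ 2 * v x) ≤ nrm G.mu (fun x => B * (σ x * v x)) := by
      refine nrm_mono ((BM.const B).mul b2) (ae_of fun x hx => ?_)
      obtain ⟨p1, p2, p3⟩ := hσ x hx
      rw [sq, mul_assoc, norm_mul, norm_mul B, Real.norm_eq_abs, Real.norm_eq_abs B, abs_of_pos p1,
        abs_of_nonneg (by linarith : 0 ≤ B)]
      gcongr
    rwa [nrm_const_mul, abs_of_nonneg (by linarith)] at this
  have := nr_nonneg (G := G) (fun x => σ x • G.gd v x)
  have := nr_nonneg (G := G) (fun x => σ x * v x)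
  have := nr_nonneg (G := G) v
  nlinarith

/-- basic weighted estimate for differences of near-solutions -/
lemma lemU {B : ℝ} {σ : E3 → ℝ} (h : G.Wgt B σ) {y : E3} (hy : ‖y‖ ≤ G.r1) {w φ : E3 → ℝ}
    (hw : ContDiff ℝ 1 w) (hφ : BM G.mu φ) {δ : ℝ} (hδ : 0 ≤ δ)
    (hsol : ∀ v, G.W v → |G.form w v - ∫ x, φ x * v x ∂G.mu| ≤ δ * G.en v)
    {g : E3 → E3} (hg : ContDiff ℝ (⊤ : ℕ∞) g)
    (hgS : ∀ x ∈ Srf.S, g x ∈ Srf.S ∧ G.Phi y (g x) = x ∧ g (G.Phi y x) = x) {ψ : E3 → ℝ}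
    (hψ : ψ = fun x => w (G.Phi y x) - w x) :
    G.N2 σ ψ ≤ 3 * (2 * B * (224 * G.L ^ 2 * ‖y‖ * G.en w + 6 * δ)) ^ 2 + 9 * G.nr ψ ^ 2 +
      4 * |∫ x, φ x * (σ (g x) ^ 2 * ψ (g x) - σ x ^ 2 * ψ x) ∂G.mu| := by
  have hLp := G.L_pos
  have hψ1 : ContDiff ℝ 1 ψ := by rw [hψ]; exact (C1_Phi hw y).sub hw
  have hψW := C1W (G := G) hψ1
  have hwW := C1W (G := G) hw
  have e1 := wid h hψW
  have e2 := en_wgt h hψW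
  obtain ⟨hB, hs, hc, hσ⟩ := h
  set χ : E3 → ℝ := fun x => σ x ^ 2 * ψ x with hχ
  set χ' : E3 → ℝ := fun x => χ (g x) with hχ'
  have hχ1 : ContDiff ℝ 1 χ := hs.mul hψ1
  have hχ'1 : ContDiff ℝ 1 χ' := hχ1.comp (hg.of_le (by exact_mod_cast le_top))
  have hχW := C1W (G := G) hχ1
  have hχ'W := C1W (G := G) hχ'1
  have hcomp : EqOn (fun x => χ' (G.Phi y x)) χ Srf.S := fun x hx => by
    simp only [hχ', (hgS x hx).2.2]
  have f1 : G.form ψ χ = G.form (fun x => w (G.Phi y x)) χ - G.form w χ := by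
    rw [hψ]; exact form_sub_left (C1W (C1_Phi hw y)) hwW hχW
  have f2 : G.form (fun x => w (G.Phi y x)) χ =
      G.form (fun x => w (G.Phi y x)) (fun x => χ' (G.Phi y x)) :=
    form_congr (fun _ _ => rfl) (fun x hx => (hcomp hx).symm)
  have f3 := form_Phi hy hw hχ'1
  have f4 := int_K_le hwW hχ'W
  have f5 : G.en χ' ≤ 2 * G.en χ := by
    have := (en_Phi hy hχ'1).2
    rwa [en_congr hcomp] at this
  have f6 := hsol χ hχW
  have f7 := hsol χ' hχ'W
  have f8 : ∫ x, φ x * (χ' x - χ x) ∂G.mu = ∫ x, φ x * χ' x ∂G.mu - ∫ x, φ x * χ x ∂G.mu := by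
    rw [← integral_sub (hφ.mul hχ'W.bm).integrable (hφ.mul hχW.bm).integrable]
    congr 1; ext x; ring
  have f9 : 28 * G.L ^ 2 * ‖y‖ * ∫ x, (‖G.gd w x‖ * ‖G.gd χ' x‖ + |w x| * |χ' x|) ∂G.mu ≤
      112 * G.L ^ 2 * ‖y‖ * G.en w * G.en χ := by
    have : G.en w * G.en χ' ≤ G.en w * (2 * G.en χ) :=
      mul_le_mul_of_nonneg_left f5 (en_nonneg _)
    calc _ ≤ 28 * G.L ^ 2 * ‖y‖ * (2 * (G.en w * (2 * G.en χ))) := by gcongr; linarith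
      _ = _ := by ring
  have f10 : δ * G.en χ' ≤ 2 * δ * G.en χ := by nlinarith
  have g1 : G.form ψ χ ≤ (112 * G.L ^ 2 * ‖y‖ * G.en w + 3 * δ) * G.en χ +
      |∫ x, φ x * (χ' x - χ x) ∂G.mu| := by
    rw [f1, f2]
    have := le_abs_self (∫ x, φ x * (χ' x - χ x) ∂G.mu)
    rw [f8] at *
    rw [abs_le] at f3 f6 f7
    nlinarith
  set n1 := G.nr (fun x => σ x • G.gd ψ x)
  set n2 := G.nr (fun x => σ x * ψ x)
  set n3 := G.nr ψ
  have hp : 0 ≤ 112 * G.L ^ 2 * ‖y‖ * G.en w + 3 * δ := by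
    have := en_nonneg (G := G) w; positivity
  have g2 : (112 * G.L ^ 2 * ‖y‖ * G.en w + 3 * δ) * G.en χ ≤
      (112 * G.L ^ 2 * ‖y‖ * G.en w + 3 * δ) * (2 * B * (n1 + n2 + n3)) := by gcongr
  have hN : G.N2 σ ψ = n1 ^ 2 + n2 ^ 2 := rfl
  set a := 2 * B * (224 * G.L ^ 2 * ‖y‖ * G.en w + 6 * δ) with ha
  have g3 : 2 * ((112 * G.L ^ 2 * ‖y‖ * G.en w + 3 * δ) * (2 * B * (n1 + n2 + n3))) =
      a * (n1 + n2 + n3) := by rw [ha]; ring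
  have g4 : a * (n1 + n2 + n3) ≤ 3 / 2 * a ^ 2 + 1 / 2 * (n1 ^ 2 + n2 ^ 2 + n3 ^ 2) := by
    nlinarith [sq_nonneg (a - n1), sq_nonneg (a - n2), sq_nonneg (a - n3)]
  have g5 : (∫ x, φ x * (χ' x - χ x) ∂G.mu) =
    ∫ x, φ x * (σ (g x) ^ 2 * ψ (g x) - σ x ^ 2 * ψ x) ∂G.mu := rfl
  rw [← g5, hN]
  rw [hN] at e1
  linarith

lemma en_sol_le {w φ : E3 → ℝ} (hw : G.W w) (hφ : BM G.mu φ) {δ : ℝ} (hδ : 0 ≤ δ)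
    (hsol : ∀ v, G.W v → |G.form w v - ∫ x, φ x * v x ∂G.mu| ≤ δ * G.en v) :
    G.en w ≤ G.nr φ + δ := by
  have h := hsol w hw
  rw [← en_sq] at h
  have h2 := cs_nrm_mul hφ hw.bm
  have h3 : nrm G.mu φ * nrm G.mu w ≤ G.nr φ * G.en w :=
    mul_le_mul_of_nonneg_left (nr_le_en hw) (nrm_nonneg _)
  rw [abs_le] at h h2
  rcases (en_nonneg (G := G) w).eq_or_lt with h0 | h0
  · rw [← h0]; exact add_nonneg (nr_nonneg _) hδ
  · have : G.en w * G.en w ≤ (G.nr φ + δ) * G.en w := by nlinarith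
    exact le_of_mul_le_mul_right this h0

lemma N2_one {v : E3 → ℝ} (hv : G.W v) : G.N2 (fun _ => 1) v = G.en v ^ 2 := by
  unfold N2; simp only [one_smul, one_mul]; exact (en_sq' hv).symm

set_option maxHeartbeats 1000000 in
variable (G) in
/-- H² regularity through translations -/
lemma regR : ∃ C : ℝ, 0 ≤ C ∧ ∀ y : E3, ‖y‖ ≤ G.r1 → ∀ w φ : E3 → ℝ, ContDiff ℝ 1 w → BM G.mu φ →
    ∀ δ : ℝ, 0 ≤ δ → (∀ v, G.W v → |G.form w v - ∫ x, φ x * v x ∂G.mu| ≤ δ * G.en v) →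
    G.en (fun x => w (G.Phi y x) - w x) ≤ C * (‖y‖ * G.nr φ + δ) := by
  have hLp := G.L_pos
  refine ⟨10000 * G.L ^ 2, by positivity, fun y hy w φ hw hφ δ hδ hsol => ?_⟩
  obtain ⟨g, hg, hgS⟩ := exists_inv hy
  have hU := lemU (wgt_one (G := G)) hy hw hφ hδ hsol hg hgS rfl
  set ψ : E3 → ℝ := fun x => w (G.Phi y x) - w x with hψ
  have hψ1 : ContDiff ℝ 1 ψ := (C1_Phi hw y).sub hw
  have hψW := C1W (G := G) hψ1
  rw [N2_one hψW] at hU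
  simp only [one_pow, one_mul, mul_one] at hU
  have hψg : ContDiff ℝ 1 (fun x => ψ (g x)) := hψ1.comp (hg.of_le (by exact_mod_cast le_top))
  have hcomp : EqOn (fun x => ψ (g (G.Phi y x))) ψ Srf.S := fun x hx => by
    simp only [(hgS x hx).2.2]
  have a1 : G.en (fun x => ψ (g x)) ≤ 2 * G.en ψ := by
    have := (en_Phi hy hψg).2
    rwa [en_congr hcomp] at this
  have a2 : G.nr (fun x => ψ (g x) - ψ x) ≤ 4 * G.L * ‖y‖ * G.en ψ := by
    have t := nr_trans hy hψg
    have t2 := nrg_le_en (C1W (G := G) hψg)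
    have t3 : G.nr (fun x => ψ (g x) - ψ x) = G.nr (fun x => ψ (g (G.Phi y x)) - ψ (g x)) := by
      unfold nr nrm; congr 1
      refine integral_congr_ae (ae_of fun x hx => ?_)
      simp only [(hgS x hx).2.2, norm_sub_rev]
    rw [t3]
    calc _ ≤ 2 * G.L * ‖y‖ * (2 * G.en ψ) := t.trans (by gcongr; linarith)
      _ = _ := by ring
  have a3 : |∫ x, φ x * (ψ (g x) - ψ x) ∂G.mu| ≤ G.nr φ * (4 * G.L * ‖y‖ * G.en ψ) :=
    (cs_nrm_mul hφ ((C1W hψg).sub hψW).bm).trans (mul_le_mul_of_nonneg_left a2 (nr_nonneg _))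
  have a4 : G.nr ψ ≤ 2 * G.L * ‖y‖ * G.en w :=
    (nr_trans hy hw).trans (mul_le_mul_of_nonneg_left (nrg_le_en (C1W hw)) (by positivity))
  have a5 := en_sol_le (C1W hw) hφ hδ hsol
  obtain ⟨b0, b1, b2, b3, b4⟩ := r1_bd hy
  have hρ := G.ρ_le
  have hL := G.L_one
  set X := G.en ψ
  set P := ‖y‖ * G.nr φ + δ with hP
  have hP0 : 0 ≤ P := by have := nr_nonneg (G := G) φ; positivity
  have hX0 : 0 ≤ X := en_nonneg _
  have hyw : ‖y‖ * G.en w ≤ P := by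
    have : ‖y‖ * G.en w ≤ ‖y‖ * (G.nr φ + δ) := by gcongr
    have : ‖y‖ * δ ≤ 1 * δ := by gcongr; linarith
    rw [hP]; nlinarith
  have hyφ : ‖y‖ * G.nr φ ≤ P := by rw [hP]; linarith
  have hδP : δ ≤ P := by
    have : 0 ≤ ‖y‖ * G.nr φ := mul_nonneg (norm_nonneg _) (nr_nonneg _)
    rw [hP]; linarith
  have k1 : 2 * (224 * G.L ^ 2 * ‖y‖ * G.en w + 6 * δ) ≤ 460 * G.L ^ 2 * P := by
    have : G.L ^ 2 * (‖y‖ * G.en w) ≤ G.L ^ 2 * P := by gcongr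
    have : 1 * δ ≤ G.L ^ 2 * P := by
      refine mul_le_mul (by nlinarith) hδP hδ (by positivity)
    nlinarith
  have k2 : G.nr ψ ≤ 2 * G.L ^ 2 * P := by
    have : 2 * G.L * ‖y‖ * G.en w ≤ 2 * G.L ^ 2 * P := by
      have : G.L * (‖y‖ * G.en w) ≤ G.L ^ 2 * P := by
        refine mul_le_mul (by nlinarith) hyw (mul_nonneg (norm_nonneg _) (en_nonneg _)) (by positivity)
      linarith
    linarith
  have k3 : |∫ x, φ x * (ψ (g x) - ψ x) ∂G.mu| ≤ 4 * (G.L ^ 2 * P) * X := by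
    refine a3.trans ?_
    have : G.L * (‖y‖ * G.nr φ) ≤ G.L ^ 2 * P :=
      mul_le_mul (by nlinarith) hyφ (mul_nonneg (norm_nonneg _) (nr_nonneg _)) (by positivity)
    have := mul_le_mul_of_nonneg_right this hX0
    linarith
  set Z := G.L ^ 2 * P with hZ
  have hZ0 : 0 ≤ Z := by positivity
  have k4 : (2 * (224 * G.L ^ 2 * ‖y‖ * G.en w + 6 * δ)) ^ 2 ≤ (460 * Z) ^ 2 := by
    have := en_nonneg (G := G) w
    refine pow_le_pow_left₀ (by positivity) (by rw [hZ]; linarith) 2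
  have k5 : G.nr ψ ^ 2 ≤ (2 * Z) ^ 2 :=
    pow_le_pow_left₀ (nr_nonneg _) (by rw [hZ]; linarith) 2
  have k6 : X ^ 2 ≤ 3 * (460 * Z) ^ 2 + 9 * (2 * Z) ^ 2 + 16 * (Z * X) := by
    linarith
  have : X ≤ 10000 * Z := by
    by_contra hcon
    rw [not_le] at hcon
    have j1 := mul_le_mul_of_nonneg_left hcon.le hZ0
    have j2 := mul_lt_mul_of_pos_left hcon (lt_of_le_of_lt (by positivity) hcon : 0 < X)
    have j3 := mul_nonneg hZ0 hZ0
    linarith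
  rw [hZ] at this; linarith

end Geo
end PartN7

section PartN8
namespace Geo
variable {Srf : SmoothSurface} {G : Geo Srf}

/-- the regularized distance weight -/
def sg (z : E3) (h : ℝ) (x : E3) : ℝ := Real.sqrt (‖x - z‖ ^ 2 + h ^ 2)

lemma sg_sq (z : E3) (h : ℝ) (x : E3) : sg z h x ^ 2 = ‖x - z‖ ^ 2 + h ^ 2 :=
  Real.sq_sqrt (by positivity)

lemma sg_nonneg (z : E3) (h : ℝ) (x : E3) : 0 ≤ sg z h x := Real.sqrt_nonneg _

lemma sg_ge_r (z : E3) (h : ℝ) (x : E3) : ‖x - z‖ ≤ sg z h x :=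
  Real.le_sqrt_of_sq_le (by nlinarith [sq_nonneg h])

lemma sg_ge_h (z : E3) {h : ℝ} (x : E3) : h ≤ sg z h x :=
  Real.le_sqrt_of_sq_le (by nlinarith [sq_nonneg ‖x - z‖])

lemma sg_le (z : E3) {h : ℝ} (hh : 0 ≤ h) (x : E3) : sg z h x ≤ ‖x - z‖ + h := by
  refine Real.sqrt_le_iff.2 ⟨by positivity, ?_⟩
  nlinarith [mul_nonneg (norm_nonneg (x - z)) hh]

lemma sg_cont (z : E3) (h : ℝ) : Continuous (sg z h) := by
  unfold sg; fun_prop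

lemma inner_gd_C1 {v : E3 → ℝ} (hv : ContDiff ℝ 1 v) {x : E3} (hx : x ∈ Srf.S) (k : E3) :
    ⟪G.gd v x, k⟫ = fderiv ℝ v x (G.D x k) := by
  rw [inner_gd]
  have h1 : HasFDerivAt v (fderiv ℝ v (G.a x)) (G.a x) :=
    (hv.differentiable (by norm_num) (G.a x)).hasFDerivAt
  have := h1.comp x (G.hasD x)
  rw [this.fderiv, G.fix x hx]; rfl

variable (G) in
lemma wgt_sg : ∃ B : ℝ, 1 ≤ B ∧ ∀ z ∈ Srf.S, ∀ h : ℝ, 0 < h → h ≤ 1 → G.Wgt B (sg z h) := by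
  obtain ⟨R, hR⟩ := Srf.compact.isBounded.exists_norm_le
  refine ⟨2 * |R| + 1, by have := abs_nonneg R; linarith, fun z hz h h0 h1 => ?_⟩
  have hC : ContDiff ℝ 1 (fun x : E3 => ‖x - z‖ ^ 2 + h ^ 2) :=
    ((contDiff_id.sub contDiff_const).norm_sq ℝ).add contDiff_const
  have he : (fun x => sg z h x ^ 2) = fun x : E3 => ‖x - z‖ ^ 2 + h ^ 2 := funext (sg_sq z h)
  refine ⟨by have := abs_nonneg R; linarith, by rw [he]; exact hC, sg_cont z h, fun x hx => ⟨?_, ?_, ?_⟩⟩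
  · exact lt_of_lt_of_le h0 (sg_ge_h z x)
  · have := sg_le z h0.le x
    have := norm_sub_le x z
    have := hR x hx
    have := hR z hz
    have := le_abs_self R
    linarith
  · rw [he]
    set g := G.gd (fun x : E3 => ‖x - z‖ ^ 2 + h ^ 2) x
    have h2 : ⟪g, g⟫ = 2 * ⟪x - z, g⟫ := by
      rw [inner_gd_C1 hC hx, gd_tan _ hx]
      have : HasFDerivAt (fun x : E3 => ‖x - z‖ ^ 2 + h ^ 2) (2 • (innerSL ℝ (x - z)).comp (ContinuousLinearMap.id ℝ E3)) x :=
        (((hasFDerivAt_id x).sub_const z).norm_sq).add_const _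
      rw [this.fderiv]
      simp [two_mul, inner_sub_left, g]
    have h3 := real_inner_le_norm (x - z) g
    rw [real_inner_self_eq_norm_sq] at h2
    have h4 := sg_ge_r z h x
    by_contra hc
    rw [not_le] at hc
    have : 0 < ‖g‖ := lt_of_le_of_lt (mul_nonneg zero_le_two (sg_nonneg z h x)) hc
    nlinarith

lemma mu_ball {z : E3} (hz : z ∈ Srf.S) {r : ℝ} (hr : 0 ≤ r) :
    G.mu.real (closedBall z r) ≤ G.L * r ^ 2 := by
  have := G.ahl z hz r hr
  unfold Measure.real mu
  rw [Measure.restrict_apply measurableSet_closedBall, inter_comm]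
  exact ENNReal.toReal_le_of_le_ofReal (by have := G.L_pos; positivity) this

variable (G) in
/-- data concentrated near `z` at scale `h` -/
def Loc (K : ℝ) (z : E3) (h : ℝ) (φ : E3 → ℝ) : Prop :=
  BM G.mu φ ∧ ∀ x ∈ Srf.S, |φ x| ≤ (h ^ 2)⁻¹ ∧ (φ x ≠ 0 → ‖x - z‖ ≤ K * h)

lemma Loc.pow_int {K h : ℝ} (hK : 0 ≤ K) (hh : 0 < h) {z : E3} (hz : z ∈ Srf.S) {φ : E3 → ℝ}
    (hφ : G.Loc K z h φ) (n : ℕ) (hn : n ≠ 0) :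
    ∫ x, |φ x| ^ n ∂G.mu ≤ (h ^ 2)⁻¹ ^ n * (G.L * (K * h) ^ 2) := by
  have hi : Integrable (fun x => (closedBall z (K * h)).indicator (fun _ => (h ^ 2)⁻¹ ^ n) x) G.mu :=
    (integrable_const _).indicator measurableSet_closedBall
  have h1 : ∫ x, |φ x| ^ n ∂G.mu ≤
      ∫ x, (closedBall z (K * h)).indicator (fun _ => (h ^ 2)⁻¹ ^ n) x ∂G.mu := by
    refine integral_mono_ae (hφ.1.abs.pow n).integrable hi (ae_of fun x hx => ?_)
    obtain ⟨p, q⟩ := hφ.2 x hx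
    by_cases h0 : φ x = 0
    · simp only [h0, abs_zero, zero_pow hn]
      exact indicator_nonneg (fun _ _ => by positivity) _
    · rw [indicator_of_mem (by rw [mem_closedBall, dist_eq_norm]; exact q h0)]
      exact pow_le_pow_left₀ (abs_nonneg _) p n
  rw [integral_indicator_const _ measurableSet_closedBall, smul_eq_mul, mul_comm] at h1
  refine h1.trans ?_
  gcongr
  exact mu_ball hz (by positivity)

lemma Loc.int_abs {K h : ℝ} (hK : 0 ≤ K) (hh : 0 < h) {z : E3} (hz : z ∈ Srf.S) {φ : E3 → ℝ}
    (hφ : G.Loc K z h φ) : ∫ x, |φ x| ∂G.mu ≤ G.L * K ^ 2 := by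
  have := hφ.pow_int hK hh hz 1 one_ne_zero
  simp only [pow_one] at this
  refine this.trans (le_of_eq ?_)
  field_simp

lemma Loc.nr_le {K h : ℝ} (hK : 0 ≤ K) (hh : 0 < h) {z : E3} (hz : z ∈ Srf.S) {φ : E3 → ℝ}
    (hφ : G.Loc K z h φ) : G.nr φ ≤ G.L * K / h := by
  have := hφ.pow_int hK hh hz 2 two_ne_zero
  have h1 : G.nr φ ^ 2 = ∫ x, |φ x| ^ 2 ∂G.mu := by
    unfold nr; rw [nrm_sq]; rfl
  have hL := G.L_one
  refine le_of_sq_le_sq ?_ (by positivity)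
  rw [h1]
  refine this.trans ?_
  have : (h ^ 2)⁻¹ ^ 2 * (G.L * (K * h) ^ 2) = G.L * (K / h) ^ 2 := by field_simp
  rw [this]
  have : (G.L * K / h) ^ 2 = G.L ^ 2 * (K / h) ^ 2 := by ring
  rw [this]
  gcongr
  nlinarith

variable (G) in
/-- weighted regularity estimate -/
lemma regW (K : ℝ) (hK : 0 ≤ K) : ∃ C : ℝ, 0 ≤ C ∧ ∀ z ∈ Srf.S, ∀ h : ℝ, 0 < h → h ≤ 1 →
    ∀ y : E3, ‖y‖ ≤ G.r1 → ‖y‖ ≤ K * h → ∀ w φ : E3 → ℝ, ContDiff ℝ 1 w → G.Loc K z h φ →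
    ∀ δ : ℝ, 0 ≤ δ → (∀ v, G.W v → |G.form w v - ∫ x, φ x * v x ∂G.mu| ≤ δ * G.en v) →
    G.N2 (sg z h) (fun x => w (G.Phi y x) - w x) ≤ C * (h ^ 2 * (G.en w + 1) ^ 2 + δ ^ 2) := by
  have hL := G.L_one
  have hLp := G.L_pos
  obtain ⟨B, hB, hBW⟩ := G.wgt_sg
  set K' := K + G.L * K + 1 with hK'
  refine ⟨3 * (2 * B) ^ 2 * (2 * (224 * G.L ^ 2 * K) ^ 2 + 72) + 9 * (2 * G.L * K) ^ 2 +
    4 * (K' ^ 2 * (G.L * K) * 3 * (2 * G.L * K)), by positivity, ?_⟩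
  intro z hz h h0 h1 y hy hyK w φ hw hφ δ hδ hsol
  obtain ⟨g, hg, hgS⟩ := exists_inv hy
  have hU := lemU (hBW z hz h h0 h1) hy hw hφ.1 hδ hsol hg hgS rfl
  set ψ : E3 → ℝ := fun x => w (G.Phi y x) - w x with hψ
  change G.N2 (sg z h) ψ ≤ _ + 4 * |∫ x, φ x * (sg z h (g x) ^ 2 * ψ (g x) - sg z h x ^ 2 * ψ x) ∂G.mu| at hU
  have hψ1 : ContDiff ℝ 1 ψ := (C1_Phi hw y).sub hw
  have hψW := C1W (G := G) hψ1
  have hψg : ContDiff ℝ 1 (fun x => ψ (g x)) := hψ1.comp (hg.of_le (by exact_mod_cast le_top))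
  set e := G.en w with he
  have he0 : 0 ≤ e := en_nonneg _
  have a4 : G.nr ψ ≤ 2 * G.L * K * (h * e) := by
    have := (nr_trans hy hw).trans (mul_le_mul_of_nonneg_left (nrg_le_en (C1W hw)) (by positivity))
    refine this.trans ?_
    have : ‖y‖ * e ≤ K * h * e := by gcongr
    calc 2 * G.L * ‖y‖ * e = 2 * G.L * (‖y‖ * e) := by ring
      _ ≤ 2 * G.L * (K * h * e) := by gcongr
      _ = _ := by ring
  have a5 : G.nr (fun x => ψ (g x)) ≤ 2 * G.nr ψ := by
    have := (nr_Phi_le hy (H := fun x => ψ (g x)) hψg.continuous.continuousOn).2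
    have h3 : G.nr (fun x => ψ (g (G.Phi y x))) = G.nr ψ := by
      unfold nr nrm; congr 1
      refine integral_congr_ae (ae_of fun x hx => ?_)
      simp only [(hgS x hx).2.2]
    rwa [h3] at this
  have a6 : |∫ x, φ x * (sg z h (g x) ^ 2 * ψ (g x) - sg z h x ^ 2 * ψ x) ∂G.mu| ≤
      K' ^ 2 * h ^ 2 * (G.nr φ * (3 * G.nr ψ)) := by
    have b1 : BM G.mu (fun x => |ψ (g x)| + |ψ x|) := (C1W hψg).bm.abs.add hψW.bm.abs
    have b2 : BM G.mu (fun x => K' ^ 2 * h ^ 2 * (|φ x| * (|ψ (g x)| + |ψ x|))) :=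
      (BM.const _).mul (hφ.1.abs.mul b1)
    rw [← Real.norm_eq_abs]
    refine (norm_integral_le_of_norm_le b2.integrable (ae_of fun x hx => ?_)).trans ?_
    · by_cases h0' : φ x = 0
      · simp [h0']
      have hxz := (hφ.2 x hx).2 h0'
      have hgx : ‖g x - z‖ ≤ (K + G.L * K) * h := by
        have t1 := Phi_dist (G := G) y (hgS x hx).1
        rw [(hgS x hx).2.1] at t1
        have t2 : ‖g x - z‖ ≤ ‖x - z‖ + ‖x - g x‖ := by
          have : g x - z = (x - z) - (x - g x) := by abel
          rw [this]; exact norm_sub_le _ _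
        have t3 : G.L * ‖y‖ ≤ G.L * (K * h) := by gcongr
        linarith
      have s1 : sg z h (g x) ≤ K' * h := by
        have := sg_le z h0.le (g x); rw [hK']; linarith
      have s2 : sg z h x ≤ K' * h := by
        have := sg_le z h0.le x; rw [hK']
        have : 0 ≤ G.L * K * h := by positivity
        linarith
      have s1' : sg z h (g x) ^ 2 ≤ K' ^ 2 * h ^ 2 := by
        rw [← mul_pow]; exact pow_le_pow_left₀ (sg_nonneg _ _ _) s1 2
      have s2' : sg z h x ^ 2 ≤ K' ^ 2 * h ^ 2 := by
        rw [← mul_pow]; exact pow_le_pow_left₀ (sg_nonneg _ _ _) s2 2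
      rw [norm_mul, Real.norm_eq_abs, Real.norm_eq_abs]
      have : |sg z h (g x) ^ 2 * ψ (g x) - sg z h x ^ 2 * ψ x| ≤ K' ^ 2 * h ^ 2 * (|ψ (g x)| + |ψ x|) := by
        refine (abs_sub _ _).trans ?_
        rw [abs_mul, abs_mul, abs_of_nonneg (sq_nonneg (sg z h (g x))),
          abs_of_nonneg (sq_nonneg (sg z h x)), mul_add]
        gcongr
      calc _ ≤ |φ x| * (K' ^ 2 * h ^ 2 * (|ψ (g x)| + |ψ x|)) := by gcongr
        _ = _ := by ring
    · rw [integral_const_mul]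
      gcongr
      have c := cs_nrm hφ.1 b1
      have c2 := nrm_add_le (C1W (G := G) hψg).bm.abs hψW.bm.abs
      have c3 : ∫ x, |φ x| * (|ψ (g x)| + |ψ x|) ∂G.mu = ∫ x, ‖φ x‖ * ‖|ψ (g x)| + |ψ x|‖ ∂G.mu := by
        congr 1; ext x; rw [Real.norm_eq_abs, Real.norm_eq_abs, abs_of_nonneg (by positivity : 0 ≤ |ψ (g x)| + |ψ x|)]
      rw [c3]
      refine c.trans (mul_le_mul_of_nonneg_left ?_ (nrm_nonneg _))
      refine c2.trans ?_
      have d1 : nrm G.mu (fun x => |ψ (g x)|) = G.nr (fun x => ψ (g x)) := nrm_norm (fun x => ψ (g x))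
      have d2 : nrm G.mu (fun x => |ψ x|) = G.nr ψ := nrm_norm ψ
      rw [d1, d2]; linarith
  have a7 := hφ.nr_le hK h0 hz
  have a8 : K' ^ 2 * h ^ 2 * (G.nr φ * (3 * G.nr ψ)) ≤ K' ^ 2 * (G.L * K) * 3 * (2 * G.L * K) * (h ^ 2 * (e + 1) ^ 2) := by
    have := nr_nonneg (G := G) ψ
    calc _ ≤ K' ^ 2 * h ^ 2 * (G.L * K / h * (3 * (2 * G.L * K * (h * e)))) := by gcongr
      _ = K' ^ 2 * (G.L * K) * 3 * (2 * G.L * K) * (h ^ 2 * e) := by field_simp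
      _ ≤ _ := by gcongr; nlinarith
  have a9 : G.nr ψ ^ 2 ≤ (2 * G.L * K) ^ 2 * (h ^ 2 * (e + 1) ^ 2) := by
    have := pow_le_pow_left₀ (nr_nonneg _) a4 2
    refine this.trans ?_
    rw [mul_pow, mul_pow h e 2]; gcongr; linarith
  have a10 : (2 * B * (224 * G.L ^ 2 * ‖y‖ * e + 6 * δ)) ^ 2 ≤
      (2 * B) ^ 2 * (2 * (224 * G.L ^ 2 * K) ^ 2 * (h ^ 2 * (e + 1) ^ 2) + 72 * δ ^ 2) := by
    rw [mul_pow]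
    gcongr
    have : 224 * G.L ^ 2 * ‖y‖ * e ≤ 224 * G.L ^ 2 * K * (h * (e + 1)) := by
      have : ‖y‖ * e ≤ K * h * (e + 1) := by gcongr; linarith
      calc _ = 224 * G.L ^ 2 * (‖y‖ * e) := by ring
        _ ≤ 224 * G.L ^ 2 * (K * h * (e + 1)) := by gcongr
        _ = _ := by ring
    have q : (224 * G.L ^ 2 * ‖y‖ * e + 6 * δ) ^ 2 ≤ (224 * G.L ^ 2 * K * (h * (e + 1)) + 6 * δ) ^ 2 :=
      pow_le_pow_left₀ (by positivity) (by linarith) 2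
    refine q.trans ?_
    have := sq_nonneg (224 * G.L ^ 2 * K * (h * (e + 1)) - 6 * δ)
    nlinarith
  set Q := h ^ 2 * (e + 1) ^ 2
  have hQ : 0 ≤ Q := by positivity
  have hδ2 := sq_nonneg δ
  have z1 : 0 ≤ (2 * B) ^ 2 * (72 * Q + 2 * (224 * G.L ^ 2 * K) ^ 2 * δ ^ 2) := by positivity
  have z2 : 0 ≤ (9 * (2 * G.L * K) ^ 2 +
    4 * (K' ^ 2 * (G.L * K) * 3 * (2 * G.L * K))) * δ ^ 2 := by positivity
  linarith

end Geo
end PartN8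

section PartN9
namespace Geo
variable {Srf : SmoothSurface} {G : Geo Srf}

lemma sg_inv_bm {z : E3} {h : ℝ} (h0 : 0 < h) : BM G.mu (fun x => (sg z h x)⁻¹) := by
  refine bm_of_cont (Continuous.continuousOn ?_)
  exact (sg_cont z h).inv₀ (fun x => (lt_of_lt_of_le h0 (sg_ge_h z x)).ne')

variable (G) in
lemma int_sg : ∃ C : ℝ, 0 ≤ C ∧ ∀ z ∈ Srf.S, ∀ h : ℝ, 0 < h → h ≤ 1 → 1 ≤ - Real.log h →
    G.nr (fun x => (sg z h x)⁻¹) ^ 2 ≤ C * (- Real.log h) := by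
  have hL := G.L_pos
  set M := G.mu.real univ with hM
  have hM0 : 0 ≤ M := measureReal_nonneg
  refine ⟨M + 2 * G.L, by positivity, fun z hz h h0 h1 hl => ?_⟩
  have hb := sg_inv_bm (G := G) (z := z) h0
  have hpos : ∀ x, 0 < sg z h x := fun x => lt_of_lt_of_le h0 (sg_ge_h z x)
  unfold nr
  rw [nrm_sq]
  set T := (h ^ 2)⁻¹ with hT
  have hT1 : 1 ≤ T := by rw [hT]; exact (one_le_inv₀ (by positivity)).2 (by nlinarith)
  rw [Integrable.integral_eq_integral_meas_lt hb.sq_int (Eventually.of_forall fun x => by positivity)]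
  set g : ℝ → ℝ := fun t => (Ioc (0 : ℝ) 1).indicator (fun _ => M) t +
    (Ioc 1 T).indicator (fun t => G.L * t⁻¹) t with hg
  have i1 : Integrable ((Ioc (0 : ℝ) 1).indicator (fun _ => M)) (volume : Measure ℝ) :=
    (integrable_indicator_iff measurableSet_Ioc).2 (by simp [integrableOn_const_iff])
  have i2 : Integrable ((Ioc 1 T).indicator (fun t => G.L * t⁻¹)) (volume : Measure ℝ) := by
    rw [integrable_indicator_iff measurableSet_Ioc]
    have : IntervalIntegrable (fun t : ℝ => G.L * t⁻¹) volume 1 T := by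
      apply ContinuousOn.intervalIntegrable
      rw [uIcc_of_le hT1]
      exact continuousOn_const.mul (continuousOn_inv₀.mono fun t ht => by
        have := ht.1; simp; linarith)
    rwa [intervalIntegrable_iff_integrableOn_Ioc_of_le hT1] at this
  have hle : ∫ t in Ioi (0 : ℝ), G.mu.real {x | t < ‖(sg z h x)⁻¹‖ ^ 2} ≤ ∫ t in Ioi (0 : ℝ), g t := by
    refine integral_mono_of_nonneg (Eventually.of_forall fun t => measureReal_nonneg)
      (i1.add i2).integrableOn ?_
    filter_upwards [ae_restrict_mem measurableSet_Ioi] with t ht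
    have ht0 : (0 : ℝ) < t := ht
    have hmem : ∀ x, t < ‖(sg z h x)⁻¹‖ ^ 2 ↔ sg z h x ^ 2 < t⁻¹ := fun x => by
      rw [norm_inv, inv_pow, Real.norm_eq_abs, sq_abs]
      exact lt_inv_comm₀ ht0 (pow_pos (hpos x) 2)
    simp only [hmem, hg]
    by_cases c1 : t ≤ 1
    · rw [indicator_of_mem (show t ∈ Ioc (0 : ℝ) 1 from ⟨ht0, c1⟩), indicator_of_notMem (by simp [c1]), add_zero]
      exact measureReal_mono (subset_univ _)
    · rw [not_le] at c1
      by_cases c2 : t ≤ T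
      · rw [indicator_of_mem (show t ∈ Ioc 1 T from ⟨c1, c2⟩), indicator_of_notMem (by simp [c1]), zero_add]
        have : {x | sg z h x ^ 2 < t⁻¹} ⊆ closedBall z (Real.sqrt t⁻¹) := fun x hx => by
          rw [mem_closedBall, dist_eq_norm]
          refine Real.le_sqrt_of_sq_le ?_
          have := sg_sq z h x
          have hx' : sg z h x ^ 2 < t⁻¹ := hx
          nlinarith [sq_nonneg h]
        refine (measureReal_mono this).trans ((mu_ball hz (Real.sqrt_nonneg _)).trans ?_)
        rw [Real.sq_sqrt (by positivity)]
      · rw [not_le] at c2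
        have : {x | sg z h x ^ 2 < t⁻¹} = ∅ := by
          ext x; simp only [mem_setOf_eq, mem_empty_iff_false, iff_false, not_lt]
          have : t⁻¹ ≤ h ^ 2 := by
            rw [inv_le_comm₀ ht0 (by positivity)]; exact c2.le
          exact this.trans (pow_le_pow_left₀ h0.le (sg_ge_h z x) 2)
        rw [this, measureReal_empty]
        refine add_nonneg (indicator_nonneg (fun _ _ => hM0) _) (indicator_nonneg (fun s hs => ?_) _)
        have := hs.1
        positivity
  refine hle.trans ?_
  have e1 : ∫ t in Ioi (0 : ℝ), g t ≤ ∫ t, g t := by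
    refine setIntegral_le_integral (i1.add i2) (Eventually.of_forall fun t => ?_)
    refine add_nonneg (indicator_nonneg (fun _ _ => hM0) _) (indicator_nonneg (fun s hs => ?_) _)
    have := hs.1
    positivity
  refine e1.trans ?_
  rw [hg, integral_add i1 i2, integral_indicator_const _ measurableSet_Ioc,
    integral_indicator measurableSet_Ioc, ← intervalIntegral.integral_of_le hT1,
    intervalIntegral.integral_const_mul, integral_inv_of_pos one_pos (by linarith)]
  rw [div_one, hT, Real.log_inv, Real.log_pow]
  simp
  nlinarith

end Geo
end PartN9

section PartN10
namespace Geo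
variable {Srf : SmoothSurface} {G : Geo Srf}

variable (G) in
/-- radius for radial maps -/
def r2 : ℝ := G.ρ / (8 * G.L)

lemma r2_pos : 0 < G.r2 := div_pos G.ρ_pos (by have := G.L_pos; linarith)

lemma r2_mul : 8 * (G.L * G.r2) = G.ρ := by
  unfold r2; have := G.L_pos; field_simp

lemma r2_lt : G.r2 < G.ρ := by
  have h1 := r2_mul (G := G)
  have h2 := r2_pos (G := G)
  have h3 := G.L_one
  nlinarith

lemma a_near {z p q : E3} {r : ℝ} (hp : ‖p - z‖ ≤ r) (hq : ‖q - z‖ ≤ r) :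
    ‖G.a p - G.a q - G.D z (p - q)‖ ≤ G.L * r * ‖p - q‖ := by
  refine Convex.norm_image_sub_le_of_norm_hasFDerivWithin_le' (f := G.a) (f' := G.D) (s := closedBall z r)
    (fun x _ => (G.hasD x).hasFDerivWithinAt) (fun x hx => ?_) (convex_closedBall z r) ?_ ?_
  · refine (G.lip x z).trans ?_
    rw [mem_closedBall, dist_eq_norm] at hx
    have := G.L_pos
    gcongr
  · rwa [mem_closedBall, dist_eq_norm]
  · rwa [mem_closedBall, dist_eq_norm]

variable (G) in
/-- radial expansion map on the surface -/
def Ex (z : E3) (l : ℝ) (x : E3) : E3 := G.a (z + l • (x - z))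

lemma Ex_meas (z : E3) (l : ℝ) : Measurable (G.Ex z l) := by
  have : Continuous (G.Ex z l) := by
    unfold Ex; exact G.contA.comp (by fun_prop)
  exact this.measurable

lemma Ex_mem {z : E3} (hz : z ∈ Srf.S) {l : ℝ} (hl : 0 ≤ l) {x : E3} (h : l * ‖x - z‖ ≤ G.r2) :
    G.Ex z l x ∈ Srf.S := by
  refine G.near z hz _ ?_
  rw [add_sub_cancel_left, norm_smul, Real.norm_eq_abs, abs_of_nonneg hl]
  exact lt_of_le_of_lt h r2_lt

lemma Ex_dist {z : E3} (hz : z ∈ Srf.S) {l : ℝ} (hl : 0 ≤ l) (x : E3) :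
    ‖G.Ex z l x - z‖ ≤ G.L * (l * ‖x - z‖) := by
  have := G.a_lip (z + l • (x - z)) z
  rwa [G.fix z hz, add_sub_cancel_left, norm_smul, Real.norm_eq_abs, abs_of_nonneg hl] at this

lemma Ex_anti {z : E3} {l : ℝ} (hl : 1 ≤ l) {x x' : E3} (hx : x ∈ Srf.S)
    (hx' : x' ∈ Srf.S) (h : l * ‖x - z‖ ≤ G.r2) (h' : l * ‖x' - z‖ ≤ G.r2) :
    dist x x' ≤ 2 / l * dist (G.Ex z l x) (G.Ex z l x') := by
  have hl0 : 0 < l := by linarith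
  have hL := G.L_pos
  have n1 : ∀ x : E3, l * ‖x - z‖ ≤ G.r2 → ‖(z + l • (x - z)) - z‖ ≤ G.r2 := fun x hx => by
    rwa [add_sub_cancel_left, norm_smul, Real.norm_eq_abs, abs_of_nonneg hl0.le]
  have e1 := a_near (G := G) (n1 x h) (n1 x' h')
  have hd : z + l • (x - z) - (z + l • (x' - z)) = l • (x - x') := by
    rw [smul_sub, smul_sub, smul_sub]; abel
  rw [hd, norm_smul, Real.norm_eq_abs, abs_of_pos hl0] at e1
  have e2 := chord' (G := G) (p := z) hx' hx
  have b1 : ‖x - z‖ ≤ G.r2 := by nlinarith [norm_nonneg (x - z)]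
  have b2 : ‖x' - z‖ ≤ G.r2 := by nlinarith [norm_nonneg (x' - z)]
  have b3 : ‖x - x'‖ ≤ 2 * G.r2 := by
    have : x - x' = (x - z) - (x' - z) := by abel
    rw [this]; exact (norm_sub_le _ _).trans (by linarith)
  have e3 : ‖x - x' - G.D z (x - x')‖ ≤ G.L * (3 * G.r2) * ‖x - x'‖ := by
    refine e2.trans ?_; gcongr; linarith
  have e4 : ‖l • (x - x')‖ ≤ ‖G.Ex z l x - G.Ex z l x'‖ + ‖G.Ex z l x - G.Ex z l x' - G.D z (l • (x - x'))‖
      + ‖l • (x - x' - G.D z (x - x'))‖ := by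
    have : l • (x - x') = (G.Ex z l x - G.Ex z l x') - (G.Ex z l x - G.Ex z l x' - G.D z (l • (x - x')))
      + l • (x - x' - G.D z (x - x')) := by
      rw [map_smul, smul_sub l (x - x')]; abel
    conv_lhs => rw [this]
    exact (norm_add_le _ _).trans (by gcongr; exact norm_sub_le _ _)
  rw [norm_smul, norm_smul, Real.norm_eq_abs, abs_of_pos hl0] at e4
  have e5 : ‖G.Ex z l x - G.Ex z l x' - G.D z (l • (x - x'))‖ ≤ G.L * G.r2 * (l * ‖x - x'‖) := e1
  have e6 := mul_le_mul_of_nonneg_left e3 hl0.le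
  have hr := r2_mul (G := G)
  have hρ := G.ρ_le
  have hq : 0 ≤ l * ‖x - x'‖ := by positivity
  rw [dist_eq_norm, dist_eq_norm, div_mul_eq_mul_div, le_div_iff₀ hl0]
  have : G.L * G.r2 * (l * ‖x - x'‖) + l * (G.L * (3 * G.r2) * ‖x - x'‖) =
    (4 * (G.L * G.r2)) * (l * ‖x - x'‖) := by ring
  nlinarith

lemma Ex_path {z : E3} (hz : z ∈ Srf.S) {v : E3 → ℝ} (hv : ContDiff ℝ 1 v) {Λ : ℝ} (hΛ : 1 ≤ Λ)
    {x : E3} (hx : x ∈ Srf.S) {R : ℝ} (hR : ‖x - z‖ ≤ R) (hΛR : Λ * R ≤ G.r2) :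
    ‖v x‖ₑ ≤ ‖v (G.Ex z Λ x)‖ₑ + ∫⁻ l in Ioc 1 Λ, ENNReal.ofReal (G.L * R) * ‖G.gd v (G.Ex z l x)‖ₑ := by
  have hL := G.L_pos
  have hR0 : 0 ≤ R := (norm_nonneg _).trans hR
  set f : ℝ → ℝ := fun l => (v ∘ G.a) (z + l • (x - z)) with hf
  have hc1 := C1_comp (G := G) hv
  have hd : ∀ l, HasDerivAt f (fderiv ℝ (v ∘ G.a) (z + l • (x - z)) (x - z)) l := fun l => by
    have h1 : HasDerivAt (fun l : ℝ => z + l • (x - z)) (x - z) l := by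
      simpa using ((hasDerivAt_id l).smul_const (x - z)).const_add z
    exact ((hc1.differentiable (by norm_num) _).hasFDerivAt).comp_hasDerivAt l h1
  have hcont : Continuous (fun l : ℝ => fderiv ℝ (v ∘ G.a) (z + l • (x - z)) (x - z)) :=
    ((hc1.continuous_fderiv (by norm_num)).comp (by fun_prop)).clm_apply continuous_const
  have h2 := intervalIntegral.integral_eq_sub_of_hasDerivAt (fun l _ => hd l)
    (hcont.intervalIntegrable 1 Λ)
  have f1 : f 1 = v x := by simp [hf, G.fix x hx]
  have f2 : f Λ = v (G.Ex z Λ x) := rfl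
  have h3 : v x = v (G.Ex z Λ x) - ∫ l in (1:ℝ)..Λ, fderiv ℝ (v ∘ G.a) (z + l • (x - z)) (x - z) := by
    rw [h2, f1, f2]; ring
  rw [h3]
  refine (enorm_sub_le).trans ?_
  gcongr
  rw [intervalIntegral.integral_of_le hΛ]
  refine (enorm_integral_le_lintegral_enorm _).trans ?_
  refine setLIntegral_mono' measurableSet_Ioc fun l hl => ?_
  have hl0 : 0 ≤ l := by linarith [hl.1]
  have n1 : ‖(z + l • (x - z)) - z‖ < G.ρ := by
    rw [add_sub_cancel_left, norm_smul, Real.norm_eq_abs, abs_of_nonneg hl0]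
    refine lt_of_le_of_lt (le_trans ?_ hΛR) r2_lt
    gcongr; exact hl.2
  rw [fderiv_off hz n1 (DA_C1 hv _), ← ofReal_norm_eq_enorm, ← ofReal_norm_eq_enorm,
    ← ENNReal.ofReal_mul (by positivity)]
  refine ENNReal.ofReal_le_ofReal ?_
  refine (norm_inner_le_norm _ _).trans ?_
  rw [mul_comm]
  refine mul_le_mul_of_nonneg_right ?_ (norm_nonneg _)
  exact (G.D_le _ _).trans (by gcongr)

lemma Ex_int {z : E3} (hz : z ∈ Srf.S) {l R : ℝ} (hl : 1 ≤ l) (hR : l * R ≤ G.r2)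
    {H : E3 → ℝ≥0∞} (hH : Measurable H) :
    ∫⁻ x in closedBall z R, H (G.Ex z l x) ∂G.mu ≤
      ENNReal.ofReal (4 / l ^ 2) * ∫⁻ x in closedBall z (G.L * (l * R)), H x ∂G.mu := by
  have hl0 : 0 < l := by linarith
  have hA : MeasurableSet (closedBall z R ∩ Srf.S) := measurableSet_closedBall.inter mS
  have hb : ∀ x ∈ closedBall z R ∩ Srf.S, l * ‖x - z‖ ≤ G.r2 := fun x hx => by
    have := hx.1; rw [mem_closedBall, dist_eq_norm] at this
    exact le_trans (by gcongr) hR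
  have key := map_haus_le (Ex_meas (G := G) z l) hA (K := 2 / l) (by positivity)
    (fun x hx y hy => Ex_anti hl hx.2 hy.2 (hb x hx) (hb y hy))
    (B := closedBall z (G.L * (l * R)) ∩ Srf.S) (fun x hx => ⟨by
      rw [mem_closedBall, dist_eq_norm]
      refine (Ex_dist hz hl0.le x).trans ?_
      have := hx.1; rw [mem_closedBall, dist_eq_norm] at this
      have := G.L_pos
      gcongr, Ex_mem hz hl0.le (hb x hx)⟩)
  unfold mu
  rw [Measure.restrict_restrict measurableSet_closedBall, Measure.restrict_restrict measurableSet_closedBall,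
    ← lintegral_map hH (Ex_meas z l)]
  refine (lintegral_mono' key le_rfl).trans ?_
  rw [lintegral_smul_measure, smul_eq_mul, div_pow]
  norm_num

end Geo
end PartN10

section PartN11
lemma lint_sq {m : ℝ} (hm : 0 < m) : ∫⁻ l in Ioi m, ENNReal.ofReal (l ^ (-2 : ℝ)) = ENNReal.ofReal (1 / m) := by
  rw [← ofReal_integral_eq_lintegral_ofReal (integrableOn_Ioi_rpow_of_lt (by norm_num) hm),
    integral_Ioi_rpow_of_lt (by norm_num) hm]
  · congr 1
    norm_num [Real.rpow_neg hm.le]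
  · filter_upwards [self_mem_ae_restrict measurableSet_Ioi] with l hl
    exact Real.rpow_nonneg (hm.trans hl).le _

namespace Geo
variable {Srf : SmoothSurface} {G : Geo Srf}

lemma logSob_aux {z : E3} (hz : z ∈ Srf.S) {v : E3 → ℝ} (hv : ContDiff ℝ 1 v) {R h : ℝ}
    (h0 : 0 < h) (hhR : h ≤ R) (hR2 : R ≤ G.r2) :
    ∫⁻ x in closedBall z R, ‖v x‖ₑ ∂G.mu ≤ ENNReal.ofReal (4 * R ^ 2 / G.r2 ^ 2) * ∫⁻ x, ‖v x‖ₑ ∂G.mu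
      + ∫⁻ x, ENNReal.ofReal (16 * (G.L * R) ^ 2 * (sg z h x)⁻¹) * ‖G.gd v x‖ₑ ∂G.mu := by
  have hR : 0 < R := by linarith
  have hL := G.L_pos
  have hL1 := G.L_one
  set Λ := G.r2 / R with hΛ
  have hΛ1 : 1 ≤ Λ := by rw [hΛ, le_div_iff₀ hR]; linarith
  have hΛR : Λ * R = G.r2 := by rw [hΛ]; field_simp
  have hgm := meas_gd (G := G) v
  have hvm : Measurable v := hv.continuous.measurable
  have s1 : ∫⁻ x in closedBall z R, ‖v x‖ₑ ∂G.mu ≤ ∫⁻ x in closedBall z R, (‖v (G.Ex z Λ x)‖ₑ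
      + ∫⁻ l in Ioc 1 Λ, ENNReal.ofReal (G.L * R) * ‖G.gd v (G.Ex z l x)‖ₑ) ∂G.mu := by
    refine lintegral_mono_ae ?_
    have := ae_restrict_of_ae (s := closedBall z R) (ae_mem (G := G))
    filter_upwards [this, self_mem_ae_restrict measurableSet_closedBall] with x hx hxb
    rw [mem_closedBall, dist_eq_norm] at hxb
    exact Ex_path hz hv hΛ1 hx hxb hΛR.le
  have hExj : Measurable (fun p : E3 × ℝ => G.Ex z p.2 p.1) := by
    unfold Ex
    exact (G.contA.comp (by fun_prop)).measurable
  have m1 : Measurable (fun x => ‖v (G.Ex z Λ x)‖ₑ) := (hvm.comp (Ex_meas z Λ)).enorm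
  rw [lintegral_add_left m1] at s1
  have s2 := Ex_int (G := G) hz hΛ1 hΛR.le (H := fun x => ‖v x‖ₑ) hvm.enorm
  have s3 : ∫⁻ x in closedBall z R, (∫⁻ l in Ioc 1 Λ, ENNReal.ofReal (G.L * R) * ‖G.gd v (G.Ex z l x)‖ₑ) ∂G.mu
      = ∫⁻ l in Ioc 1 Λ, (∫⁻ x in closedBall z R, ENNReal.ofReal (G.L * R) * ‖G.gd v (G.Ex z l x)‖ₑ ∂G.mu) := by
    refine lintegral_lintegral_swap ?_
    exact ((hgm.comp hExj).enorm.const_mul _).aemeasurable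
  have s4 : ∫⁻ l in Ioc 1 Λ, (∫⁻ x in closedBall z R, ENNReal.ofReal (G.L * R) * ‖G.gd v (G.Ex z l x)‖ₑ ∂G.mu)
      ≤ ∫⁻ l in Ioc 1 Λ, ∫⁻ x, (ENNReal.ofReal (G.L * R * 4 * l ^ (-2 : ℝ)) *
        {p : ℝ × E3 | ‖p.2 - z‖ ≤ G.L * (p.1 * R)}.indicator (fun _ => 1) (l, x)) * ‖G.gd v x‖ₑ ∂G.mu := by
    refine setLIntegral_mono' measurableSet_Ioc fun l hl => ?_
    rw [lintegral_const_mul' _ _ ENNReal.ofReal_ne_top]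
    have hl0 : 0 < l := by linarith [hl.1]
    have := Ex_int (G := G) hz hl.1.le (R := R) (by rw [← hΛR]; gcongr; exact hl.2)
      (H := fun x => ‖G.gd v x‖ₑ) hgm.enorm
    refine (mul_le_mul_right this _).trans ?_
    rw [← lintegral_indicator measurableSet_closedBall, ← mul_assoc, ← ENNReal.ofReal_mul (by positivity),
      ← lintegral_const_mul' _ _ ENNReal.ofReal_ne_top]
    refine lintegral_mono fun x => ?_
    by_cases hx : ‖x - z‖ ≤ G.L * (l * R)
    · have hx' : x ∈ closedBall z (G.L * (l * R)) := by rwa [mem_closedBall, dist_eq_norm]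
      have hx2 : (l, x) ∈ {p : ℝ × E3 | ‖p.2 - z‖ ≤ G.L * (p.1 * R)} := hx
      rw [indicator_of_mem hx', indicator_of_mem hx2, mul_one]
      have e : G.L * R * (4 / l ^ 2) = G.L * R * 4 * l ^ (-2 : ℝ) := by
        rw [Real.rpow_neg hl0.le, Real.rpow_two]; ring
      rw [e]
    · have hx' : x ∉ closedBall z (G.L * (l * R)) := by rwa [mem_closedBall, dist_eq_norm]
      rw [indicator_of_notMem hx']
      simp
  have mset : MeasurableSet {p : ℝ × E3 | ‖p.2 - z‖ ≤ G.L * (p.1 * R)} :=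
    (isClosed_le (by fun_prop) (by fun_prop)).measurableSet
  rw [lintegral_lintegral_swap (μ := volume.restrict (Ioc 1 Λ)) (ν := G.mu) (f := fun l x =>
      (ENNReal.ofReal (G.L * R * 4 * l ^ (-2 : ℝ)) *
        {p : ℝ × E3 | ‖p.2 - z‖ ≤ G.L * (p.1 * R)}.indicator (fun _ => 1) (l, x)) * ‖G.gd v x‖ₑ)] at s4
  rotate_left
  · refine AEMeasurable.mul (AEMeasurable.mul ?_ ?_) ?_
    · refine (ENNReal.measurable_ofReal.comp ?_).aemeasurable
      exact (measurable_fst.pow_const _).const_mul _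
    · exact (measurable_const.indicator mset).aemeasurable
    · exact (hgm.comp measurable_snd).enorm.aemeasurable
  have s5 : ∀ x : E3, ∫⁻ l in Ioc 1 Λ, (ENNReal.ofReal (G.L * R * 4 * l ^ (-2 : ℝ)) *
        {p : ℝ × E3 | ‖p.2 - z‖ ≤ G.L * (p.1 * R)}.indicator (fun _ => 1) (l, x)) * ‖G.gd v x‖ₑ
      ≤ ENNReal.ofReal (16 * (G.L * R) ^ 2 * (sg z h x)⁻¹) * ‖G.gd v x‖ₑ := by
    intro x
    rw [lintegral_mul_const'' _ (by
      refine AEMeasurable.mul ?_ ?_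
      · refine (ENNReal.measurable_ofReal.comp ?_).aemeasurable
        exact (measurable_id.pow_const _).const_mul _
      · exact ((measurable_const.indicator mset).comp measurable_prodMk_right).aemeasurable)]
    gcongr
    set m := (1 + ‖x - z‖ / (G.L * R)) / 4 with hm
    have hm0 : 0 < m := by positivity
    calc _ ≤ ∫⁻ l in Ioc 1 Λ, (Ioi m).indicator (fun l => ENNReal.ofReal (G.L * R * 4) * ENNReal.ofReal (l ^ (-2 : ℝ))) l := by
          refine setLIntegral_mono' measurableSet_Ioc fun l hl => ?_
          by_cases hx : ‖x - z‖ ≤ G.L * (l * R)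
          · have hx2 : (l, x) ∈ {p : ℝ × E3 | ‖p.2 - z‖ ≤ G.L * (p.1 * R)} := hx
            have : l ∈ Ioi m := by
              have : ‖x - z‖ / (G.L * R) ≤ l := by rw [div_le_iff₀ (by positivity)]; linarith
              rw [mem_Ioi, hm]
              linarith [hl.1]
            rw [indicator_of_mem this, indicator_of_mem hx2, mul_one, ENNReal.ofReal_mul (by positivity)]
          · have hx2 : (l, x) ∉ {p : ℝ × E3 | ‖p.2 - z‖ ≤ G.L * (p.1 * R)} := hx
            rw [indicator_of_notMem hx2]; simp
      _ ≤ ∫⁻ l, (Ioi m).indicator (fun l => ENNReal.ofReal (G.L * R * 4) * ENNReal.ofReal (l ^ (-2 : ℝ))) l :=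
          setLIntegral_le_lintegral _ _
      _ = ENNReal.ofReal (G.L * R * 4) * ENNReal.ofReal (1 / m) := by
          rw [lintegral_indicator measurableSet_Ioi, lintegral_const_mul' _ _ ENNReal.ofReal_ne_top, lint_sq hm0]
      _ ≤ _ := by
          rw [← ENNReal.ofReal_mul (by positivity)]
          apply ENNReal.ofReal_le_ofReal
          have hs := sg_le z h0.le x
          have hsp : 0 < sg z h x := lt_of_lt_of_le h0 (sg_ge_h z x)
          have e : G.L * R * 4 * (1 / m) = 16 * (G.L * R) ^ 2 * (G.L * R + ‖x - z‖)⁻¹ := by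
            rw [hm]; field_simp; norm_num
          rw [e]
          gcongr
          nlinarith
  calc _ ≤ _ := s1
    _ ≤ ENNReal.ofReal (4 / Λ ^ 2) * ∫⁻ x, ‖v x‖ₑ ∂G.mu + ∫⁻ x, ENNReal.ofReal (16 * (G.L * R) ^ 2 * (sg z h x)⁻¹) * ‖G.gd v x‖ₑ ∂G.mu := by
        refine add_le_add (s2.trans ?_) (s3.le.trans (s4.trans (lintegral_mono s5)))
        exact mul_le_mul_right (setLIntegral_le_lintegral _ _) _
    _ = _ := by
        congr 3
        rw [hΛ]; field_simp

lemma logSob (K : ℝ) (hK : 1 ≤ K) : ∃ C : ℝ, 0 ≤ C ∧ ∀ z ∈ Srf.S, ∀ h : ℝ, 0 < h → h ≤ 1 → K * h ≤ G.r2 →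
    1 ≤ - Real.log h → ∀ φ v : E3 → ℝ, G.Loc K z h φ → ContDiff ℝ 1 v →
    |∫ x, φ x * v x ∂G.mu| ≤ C * √(- Real.log h) * G.en v := by
  obtain ⟨C0, hC0, H0⟩ := int_sg (G := G)
  refine ⟨4 * K ^ 2 / G.r2 ^ 2 * √(G.mu.real univ) + 16 * (G.L * K) ^ 2 * √C0, by positivity, ?_⟩
  intro z hz h h0 h1 hr hlog φ v hφ hv
  have hvW : G.W v := C1W hv
  have key := logSob_aux (G := G) hz hv h0 (R := K * h) (by nlinarith) hr
  have bmv := hvW.bm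
  have bmg := hvW.bmg
  have bms := sg_inv_bm (G := G) (z := z) h0
  have i1 : Integrable v G.mu := bmv.integrable
  have bmp : BM G.mu (fun x => (16 * (G.L * (K * h)) ^ 2 * (sg z h x)⁻¹) • G.gd v x) :=
    ((BM.const _).mul bms).smul bmg
  have e3 : ∀ x, ENNReal.ofReal (16 * (G.L * (K * h)) ^ 2 * (sg z h x)⁻¹) * ‖G.gd v x‖ₑ
      = ‖(16 * (G.L * (K * h)) ^ 2 * (sg z h x)⁻¹) • G.gd v x‖ₑ := fun x => by
    rw [enorm_smul, Real.enorm_of_nonneg]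
    have := sg_nonneg z h x
    positivity
  simp only [e3] at key
  rw [← ofReal_integral_norm_eq_lintegral_enorm i1, ← ofReal_integral_norm_eq_lintegral_enorm bmp.integrable,
    ← ofReal_integral_norm_eq_lintegral_enorm i1.integrableOn, ← ENNReal.ofReal_mul (by positivity),
    ← ENNReal.ofReal_add (by positivity) (by positivity), ENNReal.ofReal_le_ofReal_iff (by positivity)] at key
  have hl0 : 1 ≤ √(- Real.log h) := by rw [Real.one_le_sqrt]; exact hlog
  have a1 : ∫ x, ‖v x‖ ∂G.mu ≤ G.nr v * √(G.mu.real univ) := by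
    have := cs_nrm bmv (BM.const (μ := G.mu) (1 : ℝ))
    simp only [norm_one, mul_one] at this
    refine this.trans ?_
    have h2 := nrm_le_of_bound (μ := G.mu) (f := fun _ => (1 : ℝ)) zero_le_one (by simp)
    rw [one_mul] at h2
    exact mul_le_mul_of_nonneg_left h2 (nr_nonneg _)
  have a2 : ∫ x, ‖(16 * (G.L * (K * h)) ^ 2 * (sg z h x)⁻¹) • G.gd v x‖ ∂G.mu
      ≤ 16 * (G.L * (K * h)) ^ 2 * (√C0 * √(- Real.log h) * G.nr (G.gd v)) := by
    have := cs_nrm bms bmg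
    have e : ∀ x, ‖(16 * (G.L * (K * h)) ^ 2 * (sg z h x)⁻¹) • G.gd v x‖ =
      16 * (G.L * (K * h)) ^ 2 * (‖(sg z h x)⁻¹‖ * ‖G.gd v x‖) := fun x => by
        rw [norm_smul, norm_mul, Real.norm_of_nonneg (by positivity), mul_assoc]
    simp only [e]
    rw [integral_const_mul]
    refine mul_le_mul_of_nonneg_left (this.trans ?_) (by positivity)
    refine mul_le_mul_of_nonneg_right ?_ (nr_nonneg _)
    rw [← Real.sqrt_mul hC0]
    exact Real.le_sqrt_of_sq_le (H0 z hz h h0 h1 hlog)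
  have a3 : |∫ x, φ x * v x ∂G.mu| ≤ (h ^ 2)⁻¹ * ∫ x in closedBall z (K * h), ‖v x‖ ∂G.mu := by
    rw [← Real.norm_eq_abs, ← integral_const_mul, ← integral_indicator measurableSet_closedBall]
    refine norm_integral_le_of_norm_le ?_ ?_
    · exact (i1.norm.const_mul _).indicator measurableSet_closedBall
    · refine ae_of fun x hx => ?_
      have := hφ.2 x hx
      by_cases hne : φ x = 0
      · rw [hne, zero_mul, norm_zero]
        exact indicator_nonneg (fun _ _ => by positivity) _
      · have hm : x ∈ closedBall z (K * h) := by
          rw [mem_closedBall, dist_eq_norm]; exact this.2 hne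
        rw [indicator_of_mem hm, norm_mul]
        exact mul_le_mul_of_nonneg_right this.1 (norm_nonneg _)
  have n1 := nr_le_en hvW
  have n2 := nrg_le_en hvW
  have n0 := en_nonneg (G := G) v
  calc _ ≤ _ := a3
    _ ≤ (h ^ 2)⁻¹ * (4 * (K * h) ^ 2 / G.r2 ^ 2 * (G.en v * √(G.mu.real univ)) +
        16 * (G.L * (K * h)) ^ 2 * (√C0 * √(- Real.log h) * G.en v)) := by
        refine mul_le_mul_of_nonneg_left (key.trans (add_le_add ?_ (a2.trans ?_))) (by positivity)
        · refine mul_le_mul_of_nonneg_left (a1.trans ?_) (by positivity)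
          gcongr
        · gcongr
    _ = 4 * K ^ 2 / G.r2 ^ 2 * √(G.mu.real univ) * 1 * G.en v + 16 * (G.L * K) ^ 2 * √C0 * √(- Real.log h) * G.en v := by
        field_simp
    _ ≤ _ := by
        rw [add_mul, add_mul]
        gcongr

end Geo
end PartN11

section PartN12
lemma verts_sub_tri (t : E3 × E3 × E3) : vertsOf t ⊆ triOf t := subset_convexHull ℝ _

lemma verts_finite (t : E3 × E3 × E3) : (vertsOf t).Finite := by
  unfold vertsOf; exact Set.toFinite _

lemma tri_compact (t : E3 × E3 × E3) : IsCompact (triOf t) := by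
  exact (verts_finite t).isCompact_convexHull (𝕜 := ℝ)

lemma tri_convex (t : E3 × E3 × E3) : Convex ℝ (triOf t) := convex_convexHull ℝ _

lemma tri_meas (t : E3 × E3 × E3) : MeasurableSet (triOf t) := (tri_compact t).isClosed.measurableSet

lemma tri_sub_plane (t : E3 × E3 × E3) : triOf t ⊆ planeOf t := convexHull_subset_affineSpan _

lemma tri_sub_dir {t : E3 × E3 × E3} {x y : E3} (hx : x ∈ triOf t) (hy : y ∈ triOf t) :
    x - y ∈ dirOf t := AffineSubspace.vsub_mem_direction (tri_sub_plane t hx) (tri_sub_plane t hy)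

lemma conv_bound {F : Type*} [NormedAddCommGroup F] [NormedSpace ℝ F] {t : E3 × E3 × E3}
    (l : E3 →ₗ[ℝ] F) (c : F) {β : ℝ} (h : ∀ p ∈ vertsOf t, ‖l p + c‖ ≤ β) {x : E3} (hx : x ∈ triOf t) :
    ‖l x + c‖ ≤ β := by
  have hc : Convex ℝ {x : E3 | ‖l x + c‖ ≤ β} := by
    intro x hx y hy a b ha hb hab
    simp only [mem_ofPred_eq] at *
    have : l (a • x + b • y) + c = a • (l x + c) + b • (l y + c) := by
      rw [map_add, map_smul, map_smul, smul_add, smul_add]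
      have : c = a • c + b • c := by rw [← add_smul, hab, one_smul]
      nth_rewrite 1 [this]; abel
    rw [this]
    calc _ ≤ ‖a • (l x + c)‖ + ‖b • (l y + c)‖ := norm_add_le _ _
      _ = a * ‖l x + c‖ + b * ‖l y + c‖ := by
          rw [norm_smul, norm_smul, Real.norm_of_nonneg ha, Real.norm_of_nonneg hb]
      _ ≤ a * β + b * β := by gcongr
      _ = β := by rw [← add_mul, hab, one_mul]
  exact convexHull_min (s := vertsOf t) (fun p hp => h p hp) hc hx

/-- A good triangle. -/
structure TriOK {Srf : SmoothSurface} (G : Geo Srf) (γ h : ℝ) (t : E3 × E3 × E3) : Prop where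
  h0 : 0 < h
  γ0 : 0 < γ
  γ1 : γ ≤ 1
  small : 10 ^ 4 * G.L ^ 6 * h ≤ G.ρ * γ ^ 2
  indep : AffineIndependent ℝ ![t.1, t.2.1, t.2.2]
  vS : vertsOf t ⊆ Srf.S
  diam : Metric.diam (triOf t) ≤ h
  disk : ∃ y ∈ triOf t, closedBall y (γ * h) ∩ planeOf t ⊆ triOf t

namespace TriOK
open Geo
variable {Srf : SmoothSurface} {G : Geo Srf} {γ h : ℝ} {t : E3 × E3 × E3}

lemma dist_le (H : TriOK G γ h t) {x y : E3} (hx : x ∈ triOf t) (hy : y ∈ triOf t) : ‖x - y‖ ≤ h := by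
  rw [← dist_eq_norm]
  exact (dist_le_diam_of_mem (tri_compact t).isBounded hx hy).trans H.diam

lemma exists_diff (H : TriOK G γ h t) {k : E3} (hk : k ∈ dirOf t) : ∃ x ∈ triOf t, ∃ y ∈ triOf t, (γ * h) • k = ‖k‖ • (x - y) := by
  obtain ⟨y, hy, hd⟩ := H.disk
  have hγh : 0 < γ * h := mul_pos H.γ0 H.h0
  by_cases h0 : k = 0
  · exact ⟨y, hy, y, hy, by simp [h0]⟩
  have hk0 : 0 < ‖k‖ := norm_pos_iff.2 h0
  refine ⟨y + (γ * h / ‖k‖) • k, hd ⟨?_, ?_⟩, y, hy, ?_⟩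
  · rw [mem_closedBall, dist_eq_norm, add_sub_cancel_left, norm_smul, Real.norm_of_nonneg (by positivity)]
    exact le_of_eq (by field_simp)
  · have := AffineSubspace.vadd_mem_of_mem_direction ((dirOf t).smul_mem (γ * h / ‖k‖) hk) (tri_sub_plane t hy)
    rwa [vadd_eq_add, add_comm] at this
  · rw [add_sub_cancel_left, smul_smul]; congr 1; field_simp

lemma shape (H : TriOK G γ h t) {F : Type*} [NormedAddCommGroup F] [NormedSpace ℝ F] (l : E3 →ₗ[ℝ] F) (c : F) {β : ℝ}
    (hb : ∀ p ∈ vertsOf t, ‖l p + c‖ ≤ β) {k : E3} (hk : k ∈ dirOf t) :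
    ‖l k‖ ≤ 2 * β / (γ * h) * ‖k‖ := by
  have hγh : 0 < γ * h := mul_pos H.γ0 H.h0
  obtain ⟨x, hx, y, hy, e⟩ := H.exists_diff hk
  have e1 : (γ * h) * ‖l k‖ = ‖k‖ * ‖l x - l y‖ := by
    have := congrArg (fun z => ‖l z‖) e
    simpa [norm_smul, abs_of_pos H.γ0, abs_of_pos H.h0, mul_assoc] using this
  have e2 : ‖l x - l y‖ ≤ 2 * β := by
    have : l x - l y = (l x + c) - (l y + c) := by abel
    rw [this]
    refine (norm_sub_le _ _).trans ?_
    linarith [conv_bound l c hb hx, conv_bound l c hb hy]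
  rw [div_mul_eq_mul_div, le_div_iff₀ hγh]
  nlinarith [norm_nonneg k]

lemma finrank_dir (H : TriOK G γ h t) : Module.finrank ℝ (dirOf t) = 2 := by
  have := H.indep.finrank_vectorSpan (n := 2) (by simp)
  rw [← this, dirOf, direction_affineSpan, vertsOf]
  have e : ({t.1, t.2.1, t.2.2} : Set E3) = range ![t.1, t.2.1, t.2.2] := by
    ext x; simp [Matrix.range_cons]; tauto
  rw [e]

lemma h_le (H : TriOK G γ h t) : h ≤ 1 / 10 ^ 4 * G.ρ := by
  have h1 : 1 ≤ G.L ^ 6 := one_le_pow₀ G.L_one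
  have h2 : γ ^ 2 ≤ 1 := pow_le_one₀ H.γ0.le H.γ1
  have := H.small
  have h3 := H.h0
  have h4 := G.ρ_pos
  nlinarith [mul_le_mul_of_nonneg_right h1 h3.le, mul_le_mul_of_nonneg_left h2 h4.le]

lemma near_v (H : TriOK G γ h t) {x : E3} (hx : x ∈ triOf t) : ∃ s ∈ Srf.S, ‖x - s‖ < G.ρ := by
  refine ⟨t.1, H.vS (by simp [vertsOf]), ?_⟩
  have := H.dist_le hx (verts_sub_tri t (show t.1 ∈ vertsOf t by simp [vertsOf]))
  have := H.h_le
  linarith [G.ρ_pos]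

lemma a_mem (H : TriOK G γ h t) {x : E3} (hx : x ∈ triOf t) : G.a x ∈ Srf.S := by
  obtain ⟨s, hs, h⟩ := H.near_v hx
  exact G.near s hs x h

lemma a_dist (H : TriOK G γ h t) {x : E3} (hx : x ∈ triOf t) : ‖x - G.a x‖ ≤ G.L * h ^ 2 := by
  have key : ∀ p ∈ vertsOf t, ‖((LinearMap.id : E3 →ₗ[ℝ] E3) - (G.D x : E3 →ₗ[ℝ] E3)) p + (G.D x x - G.a x)‖ ≤ G.L * h ^ 2 := by
    intro p hp
    have h1 := G.a_taylor x p
    rw [G.fix p (H.vS hp)] at h1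
    have h2 := H.dist_le (verts_sub_tri t hp) hx
    have : ((LinearMap.id : E3 →ₗ[ℝ] E3) - (G.D x : E3 →ₗ[ℝ] E3)) p + (G.D x x - G.a x) = p - G.a x - G.D x (p - x) := by
      simp [map_sub]; abel
    rw [this]
    refine h1.trans ?_
    have := G.L_pos
    gcongr
  have := conv_bound _ _ key hx
  have e : ((LinearMap.id : E3 →ₗ[ℝ] E3) - (G.D x : E3 →ₗ[ℝ] E3)) x + (G.D x x - G.a x) = x - G.a x := by simp
  rwa [e] at this

/-- The distance from the projection of `x` to vertices. -/
lemma v_dist (H : TriOK G γ h t) {x p : E3} (hx : x ∈ triOf t) (hp : p ∈ vertsOf t) : ‖p - G.a x‖ ≤ G.L * h := by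
  have := G.a_lip p x
  rw [G.fix p (H.vS hp)] at this
  refine this.trans ?_
  have := H.dist_le (verts_sub_tri t hp) hx
  have := G.L_pos
  gcongr

lemma D_defect (H : TriOK G γ h t) {x k : E3} (hx : x ∈ triOf t) (hk : k ∈ dirOf t) :
    ‖k - G.D (G.a x) k‖ ≤ 2 * G.L ^ 3 * h / γ * ‖k‖ := by
  have hs := H.a_mem hx
  have key : ∀ p ∈ vertsOf t, ‖((LinearMap.id : E3 →ₗ[ℝ] E3) - (G.D (G.a x) : E3 →ₗ[ℝ] E3)) p + (G.D (G.a x) (G.a x) - G.a x)‖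
      ≤ G.L * (G.L * h) ^ 2 := by
    intro p hp
    have h1 := chord (G := G) hs (H.vS hp)
    have : ((LinearMap.id : E3 →ₗ[ℝ] E3) - (G.D (G.a x) : E3 →ₗ[ℝ] E3)) p + (G.D (G.a x) (G.a x) - G.a x)
      = p - G.a x - G.D (G.a x) (p - G.a x) := by
      simp [map_sub]; abel
    rw [this]
    refine h1.trans ?_
    have := H.v_dist hx hp
    have := G.L_pos
    gcongr
  have h1 := H.shape _ _ key hk
  have e : ((LinearMap.id : E3 →ₗ[ℝ] E3) - (G.D (G.a x) : E3 →ₗ[ℝ] E3)) k = k - G.D (G.a x) k := by simp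
  rw [e] at h1
  refine h1.trans (le_of_eq ?_)
  have := H.γ0; have := H.h0
  field_simp

lemma D_change (H : TriOK G γ h t) {x : E3} (hx : x ∈ triOf t) (k : E3) :
    ‖G.D x k - G.D (G.a x) k‖ ≤ G.L ^ 2 * h ^ 2 * ‖k‖ := by
  refine (G.D_sub x (G.a x) k).trans ?_
  have := H.a_dist hx
  have := G.L_pos
  calc G.L * ‖x - G.a x‖ * ‖k‖ ≤ G.L * (G.L * h ^ 2) * ‖k‖ := by gcongr
    _ = _ := by ring

/-- almost isometry. -/
lemma D_iso (H : TriOK G γ h t) {x k k' : E3} (hx : x ∈ triOf t) (hk : k ∈ dirOf t) (hk' : k' ∈ dirOf t) :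
    |⟪G.D x k, G.D x k'⟫ - ⟪k, k'⟫| ≤ 10 * G.L ^ 6 / γ ^ 2 * h ^ 2 * (‖k‖ * ‖k'‖) := by
  have hs := H.a_mem hx
  have hL := G.L_one
  set s := G.a x
  have e1 : ⟪G.D s k, G.D s k'⟫ - ⟪k, k'⟫ = - ⟪k - G.D s k, k' - G.D s k'⟫ := by
    have a1 := D_symm (G := G) hs k (G.D s k')
    rw [D_idem hs] at a1
    have a2 := D_symm (G := G) hs k k'
    rw [inner_sub_left, inner_sub_right, inner_sub_right]
    linarith
  have e2 : |⟪G.D s k, G.D s k'⟫ - ⟪k, k'⟫| ≤ 4 * G.L ^ 6 / γ ^ 2 * h ^ 2 * (‖k‖ * ‖k'‖) := by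
    rw [e1, abs_neg]
    refine (abs_real_inner_le_norm _ _).trans ?_
    calc _ ≤ (2 * G.L ^ 3 * h / γ * ‖k‖) * (2 * G.L ^ 3 * h / γ * ‖k'‖) :=
          mul_le_mul (H.D_defect hx hk) (H.D_defect hx hk') (norm_nonneg _)
            ((norm_nonneg _).trans (H.D_defect hx hk))
      _ = _ := by have := H.γ0; field_simp; ring
  have e3 : |⟪G.D x k, G.D x k'⟫ - ⟪G.D s k, G.D s k'⟫| ≤ 2 * G.L ^ 3 * h ^ 2 * (‖k‖ * ‖k'‖) := by
    have : ⟪G.D x k, G.D x k'⟫ - ⟪G.D s k, G.D s k'⟫ = ⟪G.D x k - G.D s k, G.D x k'⟫ + ⟪G.D s k, G.D x k' - G.D s k'⟫ := by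
      rw [inner_sub_left, inner_sub_right]; ring
    rw [this]
    refine (abs_add_le _ _).trans ?_
    have b1 : |⟪G.D x k - G.D s k, G.D x k'⟫| ≤ (G.L ^ 2 * h ^ 2 * ‖k‖) * (G.L * ‖k'‖) := by
      refine (abs_real_inner_le_norm _ _).trans ?_
      gcongr
      · exact H.D_change hx k
      · exact G.D_le _ _
    have b2 : |⟪G.D s k, G.D x k' - G.D s k'⟫| ≤ (G.L * ‖k‖) * (G.L ^ 2 * h ^ 2 * ‖k'‖) := by
      refine (abs_real_inner_le_norm _ _).trans ?_
      have := G.L_pos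
      gcongr
      · exact G.D_le _ _
      · exact H.D_change hx k'
    linarith
  have e4 : G.L ^ 3 ≤ G.L ^ 6 / γ ^ 2 := by
    rw [le_div_iff₀ (pow_pos H.γ0 2)]
    have : γ ^ 2 ≤ 1 := pow_le_one₀ H.γ0.le H.γ1
    have : G.L ^ 3 ≤ G.L ^ 6 := pow_le_pow_right₀ hL (by norm_num)
    have : 0 < G.L ^ 3 := by have := G.L_pos; positivity
    nlinarith
  calc _ ≤ |⟪G.D x k, G.D x k'⟫ - ⟪G.D s k, G.D s k'⟫| + |⟪G.D s k, G.D s k'⟫ - ⟪k, k'⟫| := abs_sub_le _ _ _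
    _ ≤ 2 * (G.L ^ 6 / γ ^ 2) * h ^ 2 * (‖k‖ * ‖k'‖) + 4 * G.L ^ 6 / γ ^ 2 * h ^ 2 * (‖k‖ * ‖k'‖) := by
        refine add_le_add (e3.trans ?_) e2
        gcongr
    _ = 6 * (G.L ^ 6 / γ ^ 2 * h ^ 2 * (‖k‖ * ‖k'‖)) := by ring
    _ ≤ 10 * (G.L ^ 6 / γ ^ 2 * h ^ 2 * (‖k‖ * ‖k'‖)) := by
        have := G.L_pos
        have := H.γ0
        gcongr
        norm_num
    _ = _ := by ring

end TriOK
end PartN12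

section PartN13
def Geo.eps {Srf : SmoothSurface} (G : Geo Srf) (γ h : ℝ) : ℝ := 10 * G.L ^ 6 / γ ^ 2 * h ^ 2

namespace TriOK
open Geo
variable {Srf : SmoothSurface} {G : Geo Srf} {γ h : ℝ} {t : E3 × E3 × E3}

lemma eps_nonneg (H : TriOK G γ h t) : 0 ≤ G.eps γ h := by
  unfold Geo.eps
  have := G.L_pos
  positivity

lemma eps_le_h (H : TriOK G γ h t) : G.eps γ h ≤ 1 / 1000 * h := by
  unfold Geo.eps
  have h1 := H.small
  have h0 := H.h0
  have hγ := H.γ0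
  have e : 10 * G.L ^ 6 / γ ^ 2 * h ^ 2 = (10 * G.L ^ 6 * h) / γ ^ 2 * h := by ring
  rw [e]
  refine mul_le_mul_of_nonneg_right ?_ h0.le
  rw [div_le_iff₀ (by positivity)]
  nlinarith [G.ρ_le, pow_pos hγ 2]

lemma eps_le (H : TriOK G γ h t) : G.eps γ h ≤ 1 / 1000 := by
  have := H.eps_le_h
  have := H.h_le
  have := G.ρ_le
  linarith

lemma D_iso' (H : TriOK G γ h t) {x k k' : E3} (hx : x ∈ triOf t) (hk : k ∈ dirOf t) (hk' : k' ∈ dirOf t) :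
    |⟪G.D x k, G.D x k'⟫ - ⟪k, k'⟫| ≤ G.eps γ h * (‖k‖ * ‖k'‖) := H.D_iso hx hk hk'

lemma D_sq (H : TriOK G γ h t) {x k : E3} (hx : x ∈ triOf t) (hk : k ∈ dirOf t) :
    |‖G.D x k‖ ^ 2 - ‖k‖ ^ 2| ≤ G.eps γ h * ‖k‖ ^ 2 := by
  have := H.D_iso' hx hk hk
  rwa [real_inner_self_eq_norm_sq, real_inner_self_eq_norm_sq, ← sq] at this

lemma D_up (H : TriOK G γ h t) {x k : E3} (hx : x ∈ triOf t) (hk : k ∈ dirOf t) : ‖G.D x k‖ ≤ (1 + G.eps γ h) * ‖k‖ := by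
  have h1 := (abs_le.1 (H.D_sq hx hk)).2
  have h2 := H.eps_nonneg
  have h3 := norm_nonneg k
  refine le_of_sq_le_sq ?_ (by positivity)
  nlinarith [mul_nonneg h2 (sq_nonneg ‖k‖), mul_nonneg (mul_nonneg h2 h2) (sq_nonneg ‖k‖)]

lemma D_low (H : TriOK G γ h t) {x k : E3} (hx : x ∈ triOf t) (hk : k ∈ dirOf t) : ‖k‖ ≤ (1 + G.eps γ h) * ‖G.D x k‖ := by
  have h1 := (abs_le.1 (H.D_sq hx hk)).1
  have h2 := H.eps_nonneg
  have h4 := H.eps_le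
  have h3 := norm_nonneg (G.D x k)
  set ε := G.eps γ h
  refine le_of_sq_le_sq ?_ (by positivity)
  have h5 : (1 - ε) * ‖k‖ ^ 2 ≤ ‖G.D x k‖ ^ 2 := by linarith
  have h6 : 1 ≤ (1 + ε) ^ 2 * (1 - ε) := by nlinarith [mul_nonneg h2 h2]
  calc ‖k‖ ^ 2 ≤ ((1 + ε) ^ 2 * (1 - ε)) * ‖k‖ ^ 2 := by nlinarith [sq_nonneg ‖k‖]
    _ = (1 + ε) ^ 2 * ((1 - ε) * ‖k‖ ^ 2) := by ring
    _ ≤ (1 + ε) ^ 2 * ‖G.D x k‖ ^ 2 := by gcongr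
    _ = _ := by ring

lemma D_pair (H : TriOK G γ h t) {x k : E3} (hx : x ∈ triOf t) (hk : k ∈ dirOf t) :
    (1 - G.eps γ h) * ‖k‖ ^ 2 ≤ ⟪G.D x k, k⟫ := by
  have h1 := (abs_le.1 (H.D_sq hx hk)).1
  have hL := G.L_one
  have hγ := H.γ0
  have e : ‖G.D x k - k‖ ^ 2 = ‖G.D x k‖ ^ 2 - 2 * ⟪G.D x k, k⟫ + ‖k‖ ^ 2 := norm_sub_sq_real _ _
  have b : ‖G.D x k - k‖ ≤ 3 * G.L ^ 3 * h / γ * ‖k‖ := by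
    have a1 := H.D_defect hx hk
    have a2 := H.D_change hx k
    have : G.D x k - k = (G.D x k - G.D (G.a x) k) - (k - G.D (G.a x) k) := by abel
    rw [this]
    refine (norm_sub_le _ _).trans ?_
    have c1 : G.L ^ 2 * h ^ 2 ≤ G.L ^ 3 * h / γ := by
      rw [le_div_iff₀ hγ]
      have h1 : h ≤ 1 := by have := H.h_le; have := G.ρ_le; linarith
      have h2 : h * γ ≤ 1 := by nlinarith [H.h0, H.γ1]
      have h3 : G.L ^ 2 ≤ G.L ^ 3 := pow_le_pow_right₀ hL (by norm_num)
      calc G.L ^ 2 * h ^ 2 * γ = G.L ^ 2 * h * (h * γ) := by ring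
        _ ≤ G.L ^ 2 * h * 1 := by have := H.h0; gcongr
        _ ≤ G.L ^ 3 * h := by rw [mul_one]; have := H.h0; gcongr
    calc _ ≤ G.L ^ 3 * h / γ * ‖k‖ + 2 * G.L ^ 3 * h / γ * ‖k‖ := add_le_add (a2.trans (by gcongr)) a1
      _ = _ := by ring
  have b2 : ‖G.D x k - k‖ ^ 2 ≤ G.eps γ h * ‖k‖ ^ 2 := by
    calc ‖G.D x k - k‖ ^ 2 ≤ (3 * G.L ^ 3 * h / γ * ‖k‖) ^ 2 := by gcongr
      _ = 9 * (G.L ^ 6 / γ ^ 2 * h ^ 2 * ‖k‖ ^ 2) := by field_simp; ring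
      _ ≤ 10 * (G.L ^ 6 / γ ^ 2 * h ^ 2 * ‖k‖ ^ 2) := by gcongr; norm_num
      _ = _ := by unfold Geo.eps; ring
  nlinarith

lemma a_up (H : TriOK G γ h t) {x y : E3} (hx : x ∈ triOf t) (hy : y ∈ triOf t) :
    ‖G.a y - G.a x‖ ≤ (1 + G.eps γ h) * ‖y - x‖ := by
  have hk := tri_sub_dir hy hx
  have hd : ∀ s ∈ Icc (0 : ℝ) 1, HasDerivWithinAt (fun s : ℝ => G.a (x + s • (y - x)))
      (G.D (x + s • (y - x)) (y - x)) (Icc 0 1) s := fun s _ => by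
    have h1 : HasDerivAt (fun s : ℝ => x + s • (y - x)) (y - x) s := by
      simpa using ((hasDerivAt_id s).smul_const (y - x)).const_add x
    exact ((G.hasD (x + s • (y - x))).comp_hasDerivAt s h1).hasDerivWithinAt
  have := norm_image_sub_le_of_norm_deriv_le_segment_01' hd (C := (1 + G.eps γ h) * ‖y - x‖) fun s hs =>
    H.D_up ((tri_convex t).add_smul_sub_mem hx hy ⟨hs.1, hs.2.le⟩) hk
  simpa using this

lemma a_low (H : TriOK G γ h t) {x y : E3} (hx : x ∈ triOf t) (hy : y ∈ triOf t) :
    ‖y - x‖ ≤ (1 + 2 * G.eps γ h) * ‖G.a y - G.a x‖ := by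
  have hk := tri_sub_dir hy hx
  have h2 := H.eps_nonneg
  have h4 := H.eps_le
  have hd : ∀ s : ℝ, HasDerivAt (fun s : ℝ => ⟪G.a (x + s • (y - x)), y - x⟫)
      ⟪G.D (x + s • (y - x)) (y - x), y - x⟫ s := fun s => by
    have h1 : HasDerivAt (fun s : ℝ => x + s • (y - x)) (y - x) s := by
      simpa using ((hasDerivAt_id s).smul_const (y - x)).const_add x
    have h2 := (G.hasD (x + s • (y - x))).comp_hasDerivAt s h1
    simpa using h2.inner ℝ (hasDerivAt_const s (y - x))
  obtain ⟨s, hs, e⟩ := exists_hasDerivAt_eq_slope _ _ (zero_lt_one (α := ℝ))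
    (fun s _ => (hd s).continuousAt.continuousWithinAt) (fun s _ => hd s)
  have e1 := H.D_pair ((tri_convex t).add_smul_sub_mem hx hy ⟨hs.1.le, hs.2.le⟩) hk
  simp only [one_smul, zero_smul, add_zero, add_sub_cancel, sub_zero, div_one] at e
  rw [e, ← inner_sub_left] at e1
  have e2 := e1.trans (real_inner_le_norm _ _)
  set ε := G.eps γ h
  rcases eq_or_lt_of_le (norm_nonneg (y - x)) with h0 | h0
  · rw [← h0]; positivity
  have e3 : (1 - ε) * ‖y - x‖ ≤ ‖G.a y - G.a x‖ := by nlinarith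
  have h6 : 1 ≤ (1 + 2 * ε) * (1 - ε) := by nlinarith
  calc ‖y - x‖ ≤ ((1 + 2 * ε) * (1 - ε)) * ‖y - x‖ := by nlinarith
    _ = (1 + 2 * ε) * ((1 - ε) * ‖y - x‖) := by ring
    _ ≤ _ := by gcongr

lemma DaD (H : TriOK G γ h t) {x : E3} (hx : x ∈ triOf t) (k : E3) : G.D (G.a x) (G.D x k) = G.D x k := by
  obtain ⟨s, hs, hn⟩ := H.near_v hx
  have h1 : ∀ᶠ z in 𝓝 x, G.a (G.a z) = G.a z := by
    have : ∀ᶠ z in 𝓝 x, ‖z - s‖ < G.ρ := by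
      have : Continuous fun z : E3 => ‖z - s‖ := by fun_prop
      exact this.continuousAt.eventually_lt continuousAt_const hn
    filter_upwards [this] with z hz
    exact G.fix _ (G.near s hs z hz)
  have h2 : HasFDerivAt (fun z => G.a (G.a z)) ((G.D (G.a x)).comp (G.D x)) x :=
    (G.hasD (G.a x)).comp x (G.hasD x)
  have h3 : HasFDerivAt (fun z => G.a (G.a z)) (G.D x) x := (G.hasD x).congr_of_eventuallyEq h1
  have := h2.unique h3
  exact congrArg (fun A : E3 →L[ℝ] E3 => A k) this

lemma D_surj (H : TriOK G γ h t) {x g : E3} (hx : x ∈ triOf t) (hg : G.D (G.a x) g = g) :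
    ∃ k ∈ dirOf t, G.D x k = g ∧ ‖k‖ ≤ 2 * ‖g‖ := by
  have hs := H.a_mem hx
  set s := G.a x
  have ht : ∀ v : E3, G.D s v = v → v ∈ (ℝ ∙ Srf.n s)ᗮ := fun v hv => by
    rw [Submodule.mem_orthogonal_singleton_iff_inner_right]
    rw [D_apply hs] at hv
    have h1 : ⟪Srf.n s, v⟫ • Srf.n s = 0 := by
      have := sub_eq_self.1 hv; exact this
    rcases smul_eq_zero.1 h1 with h | h
    · exact h
    · have := Srf.n_unit s hs; rw [h, norm_zero] at this; exact absurd this (by norm_num)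
  let f : dirOf t →ₗ[ℝ] (ℝ ∙ Srf.n s)ᗮ := LinearMap.codRestrict _
    ((G.D x : E3 →ₗ[ℝ] E3).comp (dirOf t).subtype) (fun k => ht _ (H.DaD hx k))
  have hinj : Function.Injective f := by
    rw [injective_iff_map_eq_zero]
    intro k hk
    have h1 : G.D x k = 0 := congrArg Subtype.val hk
    have h2 := H.D_low hx k.2
    rw [h1, norm_zero, mul_zero] at h2
    exact Subtype.ext (norm_le_zero_iff.1 h2)
  have hfin : Module.finrank ℝ (dirOf t) = Module.finrank ℝ ((ℝ ∙ Srf.n s)ᗮ : Submodule ℝ E3) := by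
    have : Fact (Module.finrank ℝ E3 = 2 + 1) := ⟨by simp⟩
    rw [H.finrank_dir, Submodule.finrank_orthogonal_span_singleton (n := 2)]
    intro h
    have := Srf.n_unit s hs; rw [h, norm_zero] at this; exact absurd this (by norm_num)
  have hsurj := (LinearMap.injective_iff_surjective_of_finrank_eq_finrank hfin).1 hinj
  obtain ⟨k, hk⟩ := hsurj ⟨g, ht g hg⟩
  have e : G.D x k = g := congrArg Subtype.val hk
  refine ⟨k, k.2, e, ?_⟩
  have h2 := H.D_low hx k.2
  rw [e] at h2
  have := H.eps_le
  exact h2.trans (mul_le_mul_of_nonneg_right (by linarith) (norm_nonneg _))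

/-- Comparison of flat and curved gradients. -/
lemma grad_cmp (H : TriOK G γ h t) {x g g' q q' : E3} (hx : x ∈ triOf t) (hg : G.D (G.a x) g = g) (hg' : G.D (G.a x) g' = g')
    (hq : q ∈ dirOf t) (hq' : q' ∈ dirOf t) (e : ∀ k ∈ dirOf t, ⟪g, G.D x k⟫ = ⟪q, k⟫)
    (e' : ∀ k ∈ dirOf t, ⟪g', G.D x k⟫ = ⟪q', k⟫) :
    |⟪q, q'⟫ - ⟪g, g'⟫| ≤ 20 * G.eps γ h * (‖g‖ * ‖g'‖) := by
  obtain ⟨k, hk, ek, bk⟩ := H.D_surj hx hg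
  obtain ⟨k', hk', ek', bk'⟩ := H.D_surj hx hg'
  have h2 := H.eps_nonneg
  have h4 := H.eps_le
  have aux : ∀ {k g q : E3}, k ∈ dirOf t → G.D x k = g → q ∈ dirOf t → (∀ k ∈ dirOf t, ⟪g, G.D x k⟫ = ⟪q, k⟫) →
      ‖q - k‖ ≤ G.eps γ h * ‖k‖ := by
    intro k g q hk ek hq e
    have hd := (dirOf t).sub_mem hq hk
    have h1 := H.D_iso' hx hk hd
    rw [ek, e _ hd, ← inner_sub_left, real_inner_self_eq_norm_sq, abs_of_nonneg (sq_nonneg _)] at h1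
    rcases eq_or_lt_of_le (norm_nonneg (q - k)) with h0 | h0
    · rw [← h0]; positivity
    · nlinarith
  have b1 := aux hk ek hq e
  have b2 := aux hk' ek' hq' e'
  have h3 := H.D_iso' hx hk hk'
  rw [ek, ek'] at h3
  set ε := G.eps γ h
  have e1 : ⟪q, q'⟫ - ⟪k, k'⟫ = ⟪q - k, q' - k'⟫ + ⟪q - k, k'⟫ + ⟪k, q' - k'⟫ := by
    simp only [inner_sub_left, inner_sub_right]; ring
  have c1 : |⟪q, q'⟫ - ⟪k, k'⟫| ≤ 3 * ε * (‖k‖ * ‖k'‖) := by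
    rw [e1]
    have d1 : |⟪q - k, q' - k'⟫| ≤ (ε * ‖k‖) * (ε * ‖k'‖) :=
      (abs_real_inner_le_norm _ _).trans (by gcongr)
    have d2 : |⟪q - k, k'⟫| ≤ (ε * ‖k‖) * ‖k'‖ := (abs_real_inner_le_norm _ _).trans (by gcongr)
    have d3 : |⟪k, q' - k'⟫| ≤ ‖k‖ * (ε * ‖k'‖) := (abs_real_inner_le_norm _ _).trans (by gcongr)
    have d4 : (ε * ‖k‖) * (ε * ‖k'‖) ≤ ε * (‖k‖ * ‖k'‖) := by
      have : 0 ≤ ε * (‖k‖ * ‖k'‖) := by positivity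
      nlinarith
    have := abs_add_three (⟪q - k, q' - k'⟫) (⟪q - k, k'⟫) (⟪k, q' - k'⟫)
    linarith
  have c2 : ‖k‖ * ‖k'‖ ≤ (2 * ‖g‖) * (2 * ‖g'‖) := by gcongr
  have c3 : |⟪q, q'⟫ - ⟪g, g'⟫| ≤ 4 * ε * (‖k‖ * ‖k'‖) := by
    have := abs_sub_le ⟪q, q'⟫ ⟪k, k'⟫ ⟪g, g'⟫
    rw [abs_sub_comm ⟪k, k'⟫] at this
    linarith
  have c4 := mul_le_mul_of_nonneg_left c2 h2
  have : 0 ≤ ε * (‖g‖ * ‖g'‖) := by positivity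
  linarith

end TriOK
end PartN13

section PartN14
structure FE {Srf : SmoothSurface} (G : Geo Srf) {γ h : ℝ} (Tr : Triangulation Srf γ h) : Prop where
  h0 : 0 < h
  γ0 : 0 < γ
  γ1 : γ ≤ 1
  small : 10 ^ 4 * G.L ^ 6 * h ≤ G.ρ * γ ^ 2
  eqa : EqOn Tr.a G.a Tr.Sh

namespace FE
open Geo
variable {Srf : SmoothSurface} {G : Geo Srf} {γ h : ℝ} {Tr : Triangulation Srf γ h}

lemma tri (F : FE G Tr) {t : E3 × E3 × E3} (ht : t ∈ Tr.T) : TriOK G γ h t :=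
  ⟨F.h0, F.γ0, F.γ1, F.small, Tr.indep t ht, Tr.verts_on t ht, Tr.diam_le t ht, Tr.disk t ht⟩

lemma eps_nonneg (F : FE G Tr) : 0 ≤ G.eps γ h := by
  obtain ⟨t, ht⟩ := Tr.T_nonempty; exact (F.tri ht).eps_nonneg

lemma eps_le (F : FE G Tr) : G.eps γ h ≤ 1 / 1000 := by
  obtain ⟨t, ht⟩ := Tr.T_nonempty; exact (F.tri ht).eps_le

lemma eps_le_h (F : FE G Tr) : G.eps γ h ≤ 1 / 1000 * h := by
  obtain ⟨t, ht⟩ := Tr.T_nonempty; exact (F.tri ht).eps_le_h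

lemma h_le (F : FE G Tr) : h ≤ 1 / 10 ^ 4 * G.ρ := by
  obtain ⟨t, ht⟩ := Tr.T_nonempty; exact (F.tri ht).h_le

lemma h1 (F : FE G Tr) : h ≤ 1 := by have := F.h_le; have := G.ρ_le; linarith

lemma mem_Sh {t : E3 × E3 × E3} (ht : t ∈ Tr.T) {x : E3} (hx : x ∈ triOf t) : x ∈ Tr.Sh :=
  mem_biUnion ht hx

lemma Sh_mem {x : E3} (hx : x ∈ Tr.Sh) : ∃ t ∈ Tr.T, x ∈ triOf t := by
  simpa [Triangulation.Sh] using hx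

lemma Sh_compact : IsCompact Tr.Sh :=
  Tr.T.finite_toSet.isCompact_biUnion fun t _ => tri_compact t

lemma bij (F : FE G Tr) : BijOn G.a Tr.Sh Srf.S := Tr.a_bij.congr F.eqa

lemma b_mem {s : E3} (hs : s ∈ Srf.S) : Function.invFunOn Tr.a Tr.Sh s ∈ Tr.Sh := by
  obtain ⟨x, hx, e⟩ := Tr.a_bij.surjOn hs
  exact Function.invFunOn_mem ⟨x, hx, e⟩

lemma a_b (F : FE G Tr) {s : E3} (hs : s ∈ Srf.S) : G.a (Function.invFunOn Tr.a Tr.Sh s) = s := by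
  rw [← F.eqa (b_mem hs)]
  obtain ⟨x, hx, e⟩ := Tr.a_bij.surjOn hs
  exact Function.invFunOn_eq ⟨x, hx, e⟩

lemma b_a (F : FE G Tr) {x : E3} (hx : x ∈ Tr.Sh) : Function.invFunOn Tr.a Tr.Sh (G.a x) = x := by
  have hs := F.bij.mapsTo hx
  exact F.bij.injOn (b_mem hs) hx (F.a_b hs)

lemma lift_a (F : FE G Tr) {x : E3} (hx : x ∈ Tr.Sh) (v : E3 → ℝ) : Tr.liftS v (G.a x) = v x := by
  unfold Triangulation.liftS; rw [F.b_a hx]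

lemma lift_v (F : FE G Tr) {t : E3 × E3 × E3} (ht : t ∈ Tr.T) {p : E3} (hp : p ∈ vertsOf t) (v : E3 → ℝ) :
    Tr.liftS v p = v p := by
  have := F.lift_a (mem_Sh ht (verts_sub_tri t hp)) v
  rwa [G.fix p (Tr.verts_on t ht hp)] at this

lemma b_cont (F : FE G Tr) : ContinuousOn (Function.invFunOn Tr.a Tr.Sh) Srf.S := by
  rw [continuousOn_iff_isClosed]
  intro C hC
  refine ⟨G.a '' (C ∩ Tr.Sh), ((Sh_compact.inter_left hC).image G.contA).isClosed, ?_⟩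
  ext s
  constructor
  · rintro ⟨h1, h2⟩
    exact ⟨⟨_, ⟨h1, b_mem h2⟩, F.a_b h2⟩, h2⟩
  · rintro ⟨⟨x, ⟨hx, hx'⟩, rfl⟩, h2⟩
    refine ⟨?_, h2⟩
    rw [mem_preimage, F.b_a hx']; exact hx

lemma lift_cont (F : FE G Tr) {v : E3 → ℝ} (hv : Tr.IsVh v) : ContinuousOn (Tr.liftS v) Srf.S :=
  hv.1.comp F.b_cont fun _ hs => b_mem hs

lemma null_inter {t t' : E3 × E3 × E3} (ht : t ∈ Tr.T) (ht' : t' ∈ Tr.T) (hne : t ≠ t') :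
    μH[2] (triOf t ∩ triOf t') = 0 := by
  have hseg : ∀ v w : E3, μH[2] (segment ℝ v w) = 0 := fun v w => by
    rcases Measure.hausdorffMeasure_zero_or_top (d₁ := 1) (d₂ := 2) (by norm_num) (segment ℝ v w) with h | h
    · exact h
    · rw [hausdorffMeasure_segment] at h
      exact absurd h (edist_ne_top _ _)
  rcases Tr.meet t ht t' ht' hne with h | ⟨v, _, h⟩ | ⟨v, w, _, _, _, h⟩
  · rw [h, measure_empty]
  · rw [h, ← segment_same ℝ v]; exact hseg _ _
  · rw [h]; exact hseg _ _

lemma null_inter_a (F : FE G Tr) {t t' : E3 × E3 × E3} (ht : t ∈ Tr.T) (ht' : t' ∈ Tr.T) (hne : t ≠ t') :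
    μH[2] (G.a '' triOf t ∩ G.a '' triOf t') = 0 := by
  have : G.a '' triOf t ∩ G.a '' triOf t' ⊆ G.a '' (triOf t ∩ triOf t') := by
    rintro _ ⟨⟨x, hx, rfl⟩, ⟨y, hy, e⟩⟩
    have := F.bij.injOn (mem_Sh ht' hy) (mem_Sh ht hx) e
    subst this
    exact ⟨y, ⟨hx, hy⟩, rfl⟩
  refine measure_mono_null this ?_
  have := haus_image_le (f := G.a) (A := triOf t ∩ triOf t') G.L_pos.le (fun x _ y _ => by
    rw [dist_eq_norm, dist_eq_norm]; exact G.a_lip x y)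
  rw [null_inter ht ht' hne, mul_zero] at this
  exact le_antisymm this zero_le

lemma S_eq (F : FE G Tr) : Srf.S = ⋃ t : Tr.T, G.a '' triOf (t : E3 × E3 × E3) := by
  rw [← F.bij.image_eq, Triangulation.Sh, image_iUnion₂]
  ext x; simp

lemma Sh_eq : Tr.Sh = ⋃ t : Tr.T, triOf (t : E3 × E3 × E3) := by
  rw [Triangulation.Sh]
  ext x; simp

lemma mu_eq (F : FE G Tr) : G.mu = Measure.sum fun t : Tr.T => μH[2].restrict (G.a '' triOf (t : E3 × E3 × E3)) := by
  unfold Geo.mu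
  rw [F.S_eq]
  refine Measure.restrict_iUnion_ae ?_ fun t => ((tri_compact _).image G.contA).isClosed.measurableSet.nullMeasurableSet
  intro t t' hne
  exact F.null_inter_a t.2 t'.2 (fun h => hne (Subtype.ext h))

lemma Sh_restrict : μH[2].restrict Tr.Sh = Measure.sum fun t : Tr.T => μH[2].restrict (triOf (t : E3 × E3 × E3)) := by
  rw [Sh_eq]
  refine Measure.restrict_iUnion_ae ?_ fun t => (tri_meas _).nullMeasurableSet
  intro t t' hne
  exact null_inter t.2 t'.2 (fun h => hne (Subtype.ext h))

lemma int_mu (F : FE G Tr) {H : E3 → ℝ} (hH : Integrable H G.mu) :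
    ∫ x, H x ∂G.mu = ∑ t ∈ Tr.T, ∫ x in G.a '' triOf t, H x ∂μH[2] := by
  rw [F.mu_eq] at hH ⊢
  rw [integral_sum_measure hH, tsum_fintype]
  exact Finset.sum_coe_sort Tr.T (fun t => ∫ x in G.a '' triOf t, H x ∂μH[2])

lemma map_cmp (F : FE G Tr) {t : E3 × E3 × E3} (ht : t ∈ Tr.T) :
    (μH[2].restrict (triOf t)).map G.a ≤ ENNReal.ofReal (1 + 5 * G.eps γ h) • (μH[2].restrict (G.a '' triOf t)) ∧
    μH[2].restrict (G.a '' triOf t) ≤ ENNReal.ofReal (1 + 5 * G.eps γ h) • ((μH[2].restrict (triOf t)).map G.a) := by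
  have H := F.tri ht
  have e0 := F.eps_nonneg
  have e1 := F.eps_le
  constructor
  · refine (map_haus_le G.contA.measurable (tri_meas t) (K := 1 + 2 * G.eps γ h) (by positivity) ?_
      (fun x hx => mem_image_of_mem _ hx)).trans ?_
    · intro x hx y hy
      rw [dist_eq_norm, dist_eq_norm]; exact H.a_low hy hx
    · refine Measure.le_iff.2 fun s _ => ?_
      simp only [Measure.smul_apply, smul_eq_mul]
      gcongr
      nlinarith
  · refine (le_map_haus G.contA.measurable (tri_meas t) (K := 1 + G.eps γ h) (by positivity) ?_ subset_rfl).trans ?_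
    · intro x hx y hy
      rw [dist_eq_norm, dist_eq_norm]; exact H.a_up hy hx
    · refine Measure.le_iff.2 fun s _ => ?_
      simp only [Measure.smul_apply, smul_eq_mul]
      gcongr
      nlinarith

lemma int_tri (F : FE G Tr) {t : E3 × E3 × E3} (ht : t ∈ Tr.T) {H : E3 → ℝ} (hH : IntegrableOn H (G.a '' triOf t) μH[2]) :
    IntegrableOn (fun x => H (G.a x)) (triOf t) μH[2] ∧
    |∫ x in triOf t, H (G.a x) ∂μH[2] - ∫ x in G.a '' triOf t, H x ∂μH[2]| ≤
      10 * G.eps γ h * ∫ x in G.a '' triOf t, |H x| ∂μH[2] := by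
  obtain ⟨c1, c2⟩ := F.map_cmp ht
  have e0 := F.eps_nonneg
  have e1 := F.eps_le
  obtain ⟨i, b⟩ := integral_compare (ε := 5 * G.eps γ h) (by linarith) (by linarith) c1 c2 hH
  have i2 := i.comp_measurable G.contA.measurable
  rw [integral_map G.contA.measurable.aemeasurable i.1] at b
  refine ⟨i2, b.trans (le_of_eq (by ring))⟩

lemma int_on (F : FE G Tr) {H : E3 → ℝ} (hH : Integrable H G.mu) {t : E3 × E3 × E3} (ht : t ∈ Tr.T) :
    IntegrableOn H (G.a '' triOf t) μH[2] := by
  rw [F.mu_eq] at hH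
  exact hH.mono_measure (Measure.le_sum _ (⟨t, ht⟩ : Tr.T))

/-- Transfer of integrals. -/
lemma int_Sh (F : FE G Tr) {H : E3 → ℝ} (hH : Integrable H G.mu) :
    |∑ t ∈ Tr.T, ∫ x in triOf t, H (G.a x) ∂μH[2] - ∫ x, H x ∂G.mu| ≤ 10 * G.eps γ h * ∫ x, |H x| ∂G.mu := by
  rw [F.int_mu hH, F.int_mu hH.abs, ← Finset.sum_sub_distrib, Finset.mul_sum]
  refine (Finset.abs_sum_le_sum_abs _ _).trans (Finset.sum_le_sum fun t ht => ?_)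
  exact (F.int_tri ht (F.int_on hH ht)).2

end FE
end PartN14

section PartN15
/-- a path that is Lipschitz on each of finitely many closed pieces -/
lemma lip_pieces {ι : Type*} (T : Finset ι) (A : ι → Set ℝ) {K : ℝ} (hK : 0 ≤ K) {w : ℝ → ℝ}
    (hw : ContinuousOn w (Icc 0 1)) (hc : Icc (0:ℝ) 1 ⊆ ⋃ t ∈ T, A t)
    (hl : ∀ t ∈ T, ∀ x ∈ A t ∩ Icc 0 1, ∀ y ∈ A t ∩ Icc 0 1, |w x - w y| ≤ K * |x - y|) :
    |w 1 - w 0| ≤ T.card * K := by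
  have h1 : uIcc (w 0) (w 1) ⊆ ⋃ t ∈ T, w '' (A t ∩ Icc 0 1) := by
    have := intermediate_value_uIcc (a := (0:ℝ)) (b := 1) (f := w) (by rwa [uIcc_of_le zero_le_one])
    rw [uIcc_of_le (zero_le_one : (0:ℝ) ≤ 1)] at this
    intro z hz
    obtain ⟨x, hx, rfl⟩ := this hz
    obtain ⟨t, ht, hxt⟩ := mem_iUnion₂.1 (hc hx)
    exact mem_iUnion₂.2 ⟨t, ht, x, ⟨hxt, hx⟩, rfl⟩
  have h2 : ∀ t ∈ T, volume (w '' (A t ∩ Icc 0 1)) ≤ ENNReal.ofReal K := by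
    intro t ht
    have hL : LipschitzOnWith (Real.toNNReal K) w (A t ∩ Icc 0 1) := by
      refine LipschitzOnWith.of_dist_le_mul fun x hx y hy => ?_
      rw [Real.dist_eq, Real.dist_eq, Real.coe_toNNReal _ hK]
      exact hl t ht x hx y hy
    have := hL.hausdorffMeasure_image_le (d := 1) zero_le_one
    rw [hausdorffMeasure_real] at this
    refine this.trans ?_
    rw [ENNReal.rpow_one]
    calc _ ≤ (Real.toNNReal K : ℝ≥0∞) * volume (Icc (0:ℝ) 1) := by
          gcongr; exact inter_subset_right
      _ = _ := by rw [Real.volume_Icc]; simp [ENNReal.ofReal]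
  have h3 : volume (uIcc (w 0) (w 1)) ≤ T.card * ENNReal.ofReal K := by
    refine (measure_mono h1).trans ((measure_biUnion_finset_le _ _).trans ?_)
    refine (Finset.sum_le_sum h2).trans ?_
    simp
  rw [Real.volume_interval] at h3
  have : (T.card : ℝ≥0∞) * ENNReal.ofReal K = ENNReal.ofReal (T.card * K) := by
    rw [ENNReal.ofReal_mul (by positivity)]; simp
  rw [this] at h3
  exact (ENNReal.ofReal_le_ofReal_iff (by positivity)).1 h3

lemma gradTri_mem (t : E3 × E3 × E3) (v : E3 → ℝ) (x : E3) : gradTri t v x ∈ dirOf t := by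
  simp [gradTri, tGrad]

namespace TriOK
open Geo
variable {Srf : SmoothSurface} {G : Geo Srf} {γ h : ℝ} {t : E3 × E3 × E3}

lemma inner_gradTri (H : TriOK G γ h t) {v : E3 → ℝ} {l : E3 →ₗ[ℝ] ℝ} {c : ℝ} (hv : ∀ x ∈ triOf t, v x = l x + c)
    {x : E3} (hx : x ∈ triOf t) {k : E3} (hk : k ∈ dirOf t) : ⟪gradTri t v x, k⟫ = l k := by
  have h1 : HasFDerivWithinAt v (LinearMap.toContinuousLinearMap l) (triOf t) x := by
    have : HasFDerivWithinAt (fun y => l y + c) (LinearMap.toContinuousLinearMap l) (triOf t) x :=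
      ((LinearMap.toContinuousLinearMap l).hasFDerivAt.add_const c).hasFDerivWithinAt
    exact this.congr (fun y hy => hv y hy) (hv x hx)
  have h2 := h1.differentiableWithinAt.hasFDerivWithinAt
  have h3 : ∀ y ∈ triOf t, fderivWithin ℝ v (triOf t) x (y - x) = l (y - x) := by
    intro y hy
    exact h2.unique_on h1 (mem_tangentConeAt_of_segment_subset ((tri_convex t).segment_subset hx hy))
  have h4 : fderivWithin ℝ v (triOf t) x k = l k := by
    obtain ⟨y, hy, y', hy', e⟩ := H.exists_diff hk
    have e1 : fderivWithin ℝ v (triOf t) x (y - y') = l (y - y') := by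
      have : y - y' = (y - x) - (y' - x) := by abel
      rw [this, map_sub _ (y - x), map_sub l (y - x), h3 y hy, h3 y' hy']
    have e2 := congrArg (fderivWithin ℝ v (triOf t) x) e
    have e3 := congrArg l e
    rw [map_smul, map_smul, e1] at e2
    rw [map_smul, map_smul, ← e2] at e3
    have : γ * h ≠ 0 := (mul_pos H.γ0 H.h0).ne'
    simpa [this, H.γ0.ne', H.h0.ne'] using e3.symm
  rw [← h4, gradTri, tGrad]
  have := Submodule.inner_orthogonalProjectionOnto_eq_of_mem_right (K := dirOf t) ⟨k, hk⟩
    ((InnerProductSpace.toDual ℝ E3).symm (fderivWithin ℝ v (triOf t) x))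
  rw [InnerProductSpace.toDual_symm_apply] at this
  exact this

lemma exists_fun (H : TriOK G γ h t) (l : E3 →ₗ[ℝ] ℝ) {x : E3} (hx : x ∈ triOf t) :
    ∃ D' : E3 →L[ℝ] ℝ, ∀ k ∈ dirOf t, D' (G.D x k) = l k := by
  have hinj : LinearMap.ker (((G.D x : E3 →L[ℝ] E3) : E3 →ₗ[ℝ] E3).comp (dirOf t).subtype) = ⊥ := by
    rw [LinearMap.ker_eq_bot']
    intro k hk
    have := H.D_low hx k.2
    have e : G.D x (k : E3) = 0 := hk
    rw [e, norm_zero, mul_zero] at this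
    exact Subtype.ext (norm_le_zero_iff.1 this)
  obtain ⟨g, hg⟩ := LinearMap.exists_leftInverse_of_injective _ hinj
  refine ⟨LinearMap.toContinuousLinearMap (l.comp ((dirOf t).subtype.comp g)), fun k hk => ?_⟩
  have := LinearMap.congr_fun hg ⟨k, hk⟩
  simp only [LinearMap.comp_apply, LinearMap.id_apply, Submodule.subtype_apply] at this
  simp only [LinearMap.coe_toContinuousLinearMap', LinearMap.comp_apply, Submodule.subtype_apply]
  have e : g (G.D x k) = ⟨k, hk⟩ := this
  rw [e]

end TriOK

namespace FE
open Geo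
variable {Srf : SmoothSurface} {G : Geo Srf} {γ h : ℝ} {Tr : Triangulation Srf γ h} 

/-- `s = a x` lies in the image of exactly one triangle -/
structure Good (G : Geo Srf) (Tr : Triangulation Srf γ h) (s : E3) (t : E3 × E3 × E3) (x : E3) : Prop where
  ht : t ∈ Tr.T
  hx : x ∈ triOf t
  e : G.a x = s
  only : ∀ t' ∈ Tr.T, t' ≠ t → s ∉ G.a '' triOf t'


lemma good_ae (F : FE G Tr) : ∀ᵐ s ∂G.mu, ∃ t x, Good G Tr s t x := by
  have h1 : ∀ᵐ s ∂G.mu, ∀ t ∈ Tr.T, ∀ t' ∈ Tr.T, t' ≠ t → s ∉ G.a '' triOf t ∩ G.a '' triOf t' := by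
    have : ∀ t : Tr.T, ∀ t' : Tr.T, t' ≠ t → ∀ᵐ s ∂G.mu,
        s ∉ G.a '' triOf (t : E3 × E3 × E3) ∩ G.a '' triOf (t' : E3 × E3 × E3) := by
      intro t t' hne
      refine measure_eq_zero_iff_ae_notMem.1 ?_
      refine le_antisymm ((Measure.restrict_apply_le _ _).trans ?_) bot_le
      exact (F.null_inter_a t.2 t'.2 (fun e => hne (Subtype.ext e.symm))).le
    have h2 : ∀ᵐ s ∂G.mu, ∀ t : Tr.T, ∀ t' : Tr.T, t' ≠ t → 
        s ∉ G.a '' triOf (t : E3 × E3 × E3) ∩ G.a '' triOf (t' : E3 × E3 × E3) := by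
      refine ae_all_iff.2 fun t => ae_all_iff.2 fun t' => ?_
      by_cases hne : t' = t
      · exact Eventually.of_forall fun s h => absurd hne h
      · filter_upwards [this t t' hne] with s hs _ using hs
    filter_upwards [h2] with s hs t ht t' ht' hne
    exact hs ⟨t, ht⟩ ⟨t', ht'⟩ (fun e => hne (congrArg Subtype.val e))
  filter_upwards [h1, ae_mem (G := G)] with s hs hS
  obtain ⟨t, ht, hx⟩ := Sh_mem (b_mem hS)
  refine ⟨t, _, ht, hx, F.a_b hS, fun t' ht' hne hc => hs t ht t' ht' hne ⟨⟨_, hx, F.a_b hS⟩, hc⟩⟩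

lemma good_on (F : FE G Tr) {t : E3 × E3 × E3} (ht : t ∈ Tr.T) :
    ∀ᵐ x ∂(μH[2].restrict (triOf t)), Good G Tr (G.a x) t x := by
  have h1 : ∀ᵐ x ∂(μH[2].restrict (triOf t)), ∀ t' : Tr.T, (t' : E3 × E3 × E3) ≠ t → x ∉ triOf (t' : E3 × E3 × E3) := by
    refine ae_all_iff.2 fun t' => ?_
    by_cases hne : (t' : E3 × E3 × E3) = t
    · exact Eventually.of_forall fun s h => absurd hne h
    · have : ∀ᵐ x ∂(μH[2].restrict (triOf t)), x ∉ triOf (t' : E3 × E3 × E3) := by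
        refine measure_eq_zero_iff_ae_notMem.1 ?_
        rw [Measure.restrict_apply (tri_meas _)]
        exact null_inter t'.2 ht hne
      filter_upwards [this] with s hs _ using hs
  filter_upwards [h1, ae_restrict_mem (tri_meas t)] with x hx hxt
  refine ⟨ht, hxt, rfl, ?_⟩
  rintro t' ht' hne ⟨y, hy, e⟩
  have := F.bij.injOn (mem_Sh ht' hy) (mem_Sh ht hxt) e
  exact hx ⟨t', ht'⟩ hne (this ▸ hy)

lemma Good.mem (F : FE G Tr) {s x : E3} {t : E3 × E3 × E3} (g : Good G Tr s t x) : s ∈ Srf.S := 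
  g.e ▸ (F.tri g.ht).a_mem g.hx

lemma Good.nhds (F : FE G Tr) {s x : E3} {t : E3 × E3 × E3} (g : Good G Tr s t x) :
    ∀ᶠ q in 𝓝[Srf.S] s, q ∈ G.a '' triOf t := by
  have hc : IsClosed (⋃ t' ∈ Tr.T.filter (· ≠ t), G.a '' triOf t') :=
    isClosed_biUnion_finset fun t' _ => ((tri_compact _).image G.contA).isClosed
  have hs : s ∉ (⋃ t' ∈ Tr.T.filter (· ≠ t), G.a '' triOf t') := by
    simp only [mem_iUnion, not_exists, Finset.mem_filter]
    intro t' h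
    exact g.only t' h.1 h.2
  filter_upwards [mem_nhdsWithin_of_mem_nhds (hc.isOpen_compl.mem_nhds hs), self_mem_nhdsWithin] with q hq hS
  obtain ⟨t', ht', hx⟩ := Sh_mem (b_mem hS)
  by_cases hne : t' = t
  · subst hne; exact ⟨_, hx, F.a_b hS⟩
  · refine absurd ?_ hq
    simp only [mem_iUnion]
    exact ⟨t', Finset.mem_filter.2 ⟨ht', hne⟩, _, hx, F.a_b hS⟩

/-- differentiability of the lift at a good point -/
lemma Good.der (F : FE G Tr) {s x : E3} {t : E3 × E3 × E3} (g : Good G Tr s t x) {v : E3 → ℝ}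
    {l : E3 →ₗ[ℝ] ℝ} {c : ℝ} (hv : ∀ x ∈ triOf t, v x = l x + c) :
    G.DA (Tr.liftS v) s ∧ ∀ k ∈ dirOf t, ⟪G.gd (Tr.liftS v) s, G.D x k⟫ = l k := by
  have H := F.tri g.ht
  obtain ⟨D', hD⟩ := H.exists_fun l g.hx
  have hw : HasFDerivWithinAt (Tr.liftS v) D' Srf.S s := by
    refine HasFDerivWithinAt.of_isLittleO ?_
    have hb : (fun q : E3 => Tr.liftS v q - Tr.liftS v s - D' (q - s)) =O[𝓝[Srf.S] s] fun q => ‖q - s‖ ^ 2 := by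
      refine Asymptotics.IsBigO.of_bound (‖D'‖ * (G.L * 4)) ?_
      filter_upwards [g.nhds F] with q hq
      obtain ⟨y, hy, rfl⟩ := hq
      obtain ⟨ht, hx, rfl, _⟩ := g
      rw [F.lift_a (mem_Sh ht hy), F.lift_a (mem_Sh ht hx), hv y hy, hv x hx]
      have e1 : l y + c - (l x + c) - D' (G.a y - G.a x) = - D' (G.a y - G.a x - G.D x (y - x)) := by
        rw [map_sub D' _ (G.D x (y - x)), hD _ (tri_sub_dir hy hx), map_sub l]; ring
      rw [e1, norm_neg, norm_pow, norm_norm, mul_assoc]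
      refine (ContinuousLinearMap.le_opNorm _ _).trans (mul_le_mul_of_nonneg_left ?_ (norm_nonneg _))
      refine (G.a_taylor x y).trans ?_
      rw [mul_assoc]
      refine mul_le_mul_of_nonneg_left ?_ G.L_pos.le
      have := H.a_low hx hy
      have e0 := F.eps_nonneg
      have e1 := F.eps_le
      have : ‖y - x‖ ≤ 2 * ‖G.a y - G.a x‖ := this.trans (by
        refine mul_le_mul_of_nonneg_right (by linarith) (norm_nonneg _))
      have h3 := pow_le_pow_left₀ (norm_nonneg _) this 2
      linarith [h3, mul_pow 2 ‖G.a y - G.a x‖ 2]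
    exact (hb.trans_isLittleO ((Asymptotics.isLittleO_pow_sub_sub s (by norm_num : 1 < 2)).mono nhdsWithin_le_nhds))
  have hs := g.mem F
  have h1 := DA_of_within (G := G) hs hw
  refine ⟨h1.differentiableAt, fun k hk => ?_⟩
  rw [inner_gd, h1.fderiv, ContinuousLinearMap.comp_apply, ← hD k hk]
  have := H.DaD g.hx k
  rw [g.e] at this
  rw [this]

lemma lift_bdd (F : FE G Tr) {v : E3 → ℝ} (hv : Tr.IsVh v) : ∃ C, 0 ≤ C ∧ ∀ s ∈ Srf.S, |Tr.liftS v s| ≤ C := by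
  obtain ⟨C, hC⟩ := Srf.compact.exists_bound_of_continuousOn (F.lift_cont hv)
  exact ⟨max C 0, le_max_right _ _, fun s hs => (hC s hs).trans (le_max_left _ _)⟩

lemma lift_lip (F : FE G Tr) {v : E3 → ℝ} (hv : Tr.IsVh v) :
    ∃ K, 0 ≤ K ∧ ∀ x ∈ Srf.S, ∀ y ∈ Srf.S, |Tr.liftS v x - Tr.liftS v y| ≤ K * ‖x - y‖ := by
  obtain ⟨C, hC0, hC⟩ := F.lift_bdd hv
  -- piecewise constant
  have hp : ∃ K, 0 ≤ K ∧ ∀ t ∈ Tr.T, ∀ p ∈ G.a '' triOf t, ∀ q ∈ G.a '' triOf t,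
      |Tr.liftS v p - Tr.liftS v q| ≤ K * ‖p - q‖ := by
    have : ∀ t : Tr.T, ∃ K : ℝ, 0 ≤ K ∧ ∀ p ∈ G.a '' triOf (t : E3 × E3 × E3), ∀ q ∈ G.a '' triOf (t : E3 × E3 × E3),
      |Tr.liftS v p - Tr.liftS v q| ≤ K * ‖p - q‖ := by
      rintro ⟨t, ht⟩
      obtain ⟨l, c, hl⟩ := hv.2 t ht
      refine ⟨‖LinearMap.toContinuousLinearMap l‖ * 2, by positivity, ?_⟩
      rintro _ ⟨y, hy, rfl⟩ _ ⟨x, hx, rfl⟩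
      rw [F.lift_a (mem_Sh ht hy), F.lift_a (mem_Sh ht hx), hl y hy, hl x hx]
      have e1 : l y + c - (l x + c) = LinearMap.toContinuousLinearMap l (y - x) := by simp
      rw [e1, mul_assoc, ← Real.norm_eq_abs]
      refine (ContinuousLinearMap.le_opNorm _ _).trans (mul_le_mul_of_nonneg_left ?_ (norm_nonneg _))
      refine ((F.tri ht).a_low hx hy).trans (mul_le_mul_of_nonneg_right ?_ (norm_nonneg _))
      have := F.eps_le
      linarith
    choose K hK0 hK using this
    refine ⟨∑ t, K t, Finset.sum_nonneg fun t _ => hK0 t, fun t ht p hp q hq => ?_⟩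
    refine (hK ⟨t, ht⟩ p hp q hq).trans (mul_le_mul_of_nonneg_right ?_ (norm_nonneg _))
    exact Finset.single_le_sum (f := K) (fun t _ => hK0 t) (Finset.mem_univ _)
  obtain ⟨K, hK0, hK⟩ := hp
  have hL := G.L_pos
  have hρ := G.ρ_pos
  refine ⟨Tr.T.card * (K * G.L) + 2 * C / G.ρ, by positivity, fun x hx y hy => ?_⟩
  by_cases hd : ‖y - x‖ < G.ρ
  · set p : ℝ → E3 := fun τ => G.a (x + τ • (y - x)) with hpdef
    have hpS : ∀ τ ∈ Icc (0:ℝ) 1, p τ ∈ Srf.S := by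
      intro τ hτ
      refine G.near x hx _ ?_
      rw [add_sub_cancel_left, norm_smul, Real.norm_eq_abs, abs_of_nonneg hτ.1]
      exact lt_of_le_of_lt (mul_le_of_le_one_left (norm_nonneg _) hτ.2) hd
    have := lip_pieces Tr.T (fun t => {τ | p τ ∈ G.a '' triOf t}) (K := K * G.L * ‖y - x‖) (by positivity)
      (w := fun τ => Tr.liftS v (p τ)) ?_ ?_ ?_
    · have e1 : p 1 = y := by simp [hpdef, G.fix y hy]
      have e0 : p 0 = x := by simp [hpdef, G.fix x hx]
      simp only [e1, e0] at this
      rw [abs_sub_comm, norm_sub_rev x y]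
      refine this.trans ?_
      have : 0 ≤ 2 * C / G.ρ * ‖y - x‖ := by positivity
      nlinarith
    · refine (F.lift_cont hv).comp ?_ hpS
      exact (G.contA.comp (by fun_prop)).continuousOn
    · intro τ hτ
      have h1 := hpS τ hτ
      rw [F.S_eq] at h1
      obtain ⟨t, ht⟩ := mem_iUnion.1 h1
      exact mem_iUnion₂.2 ⟨t, t.2, ht⟩
    · intro t ht τ hτ τ' hτ'
      refine (hK t ht _ hτ.1 _ hτ'.1).trans ?_
      rw [mul_assoc, mul_assoc]
      refine mul_le_mul_of_nonneg_left ?_ hK0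
      refine (G.a_lip _ _).trans ?_
      refine mul_le_mul_of_nonneg_left ?_ hL.le
      rw [add_sub_add_left_eq_sub, ← sub_smul, norm_smul, Real.norm_eq_abs, mul_comm]
  · push Not at hd
    have h1 : |Tr.liftS v x - Tr.liftS v y| ≤ 2 * C := by
      have a1 := abs_le.1 (hC x hx)
      have a2 := abs_le.1 (hC y hy)
      exact abs_le.2 ⟨by linarith, by linarith⟩
    rw [norm_sub_rev x y]
    have h2 : 2 * C ≤ 2 * C / G.ρ * ‖y - x‖ := by
      rw [div_mul_eq_mul_div, le_div_iff₀ hρ]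
      exact mul_le_mul_of_nonneg_left hd (by positivity)
    have h3 : 0 ≤ Tr.T.card * (K * G.L) * ‖y - x‖ := by positivity
    nlinarith

lemma lift_W (F : FE G Tr) {v : E3 → ℝ} (hv : Tr.IsVh v) : G.W (Tr.liftS v) := by
  refine ⟨?_, ?_⟩
  · obtain ⟨K, h0, hK⟩ := F.lift_lip hv
    exact ⟨K, h0, hK⟩
  · filter_upwards [F.good_ae] with s ⟨t, x, g⟩
    obtain ⟨l, c, hl⟩ := hv.2 t g.ht
    exact (g.der F hl).1

/-- gradients at good points -/
lemma Good.inner (F : FE G Tr) {s x : E3} {t : E3 × E3 × E3} (g : Good G Tr s t x) {v : E3 → ℝ} (hv : Tr.IsVh v) :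
    ∀ k ∈ dirOf t, ⟪G.gd (Tr.liftS v) s, G.D x k⟫ = ⟪gradTri t v x, k⟫ := by
  obtain ⟨l, c, hl⟩ := hv.2 t g.ht
  intro k hk
  rw [(g.der F hl).2 k hk, (F.tri g.ht).inner_gradTri hl g.hx hk]

end FE
end PartN15

section PartN16
namespace FE
open Geo
variable {Srf : SmoothSurface} {G : Geo Srf} {γ h : ℝ} {Tr : Triangulation Srf γ h} 

lemma Vh_add_smul {v w : E3 → ℝ} (hv : Tr.IsVh v) (hw : Tr.IsVh w) (r : ℝ) : Tr.IsVh (fun x => v x + r * w x) := by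
  refine ⟨hv.1.add (continuousOn_const.mul hw.1), fun t ht => ?_⟩
  obtain ⟨l, c, hl⟩ := hv.2 t ht
  obtain ⟨l', c', hl'⟩ := hw.2 t ht
  refine ⟨l + r • l', c + r * c', fun x hx => ?_⟩
  simp only [hl x hx, hl' x hx]
  simp only [LinearMap.add_apply, LinearMap.smul_apply, smul_eq_mul]; ring

lemma Vh_sub {v w : E3 → ℝ} (hv : Tr.IsVh v) (hw : Tr.IsVh w) : Tr.IsVh (fun x => v x - w x) := by
  have := Vh_add_smul hv hw (-1)
  simpa [sub_eq_add_neg] using this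

lemma Vh_zero : Tr.IsVh (fun _ => 0) := ⟨continuousOn_const, fun _ _ => ⟨0, 0, fun x _ => by simp⟩⟩

lemma exists_aff {t : E3 × E3 × E3} (hi : AffineIndependent ℝ ![t.1, t.2.1, t.2.2]) (Fn : E3 → ℝ) :
    ∃ (l : E3 →ₗ[ℝ] ℝ) (c : ℝ), ∀ p ∈ vertsOf t, l p + c = Fn p := by
  have h1 := (affineIndependent_iff_linearIndependent_vsub ℝ _ (0 : Fin 3)).1 hi
  obtain ⟨g, hg⟩ := LinearMap.exists_leftInverse_of_injective _ (linearIndependent_iff_ker.1 h1)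
  set l : E3 →ₗ[ℝ] ℝ := (Finsupp.linearCombination ℝ
    (fun i : {x : Fin 3 // x ≠ 0} => Fn (![t.1, t.2.1, t.2.2] i) - Fn t.1)).comp g with hl
  have h2 : ∀ i : Fin 3, l (![t.1, t.2.1, t.2.2] i - t.1) = Fn (![t.1, t.2.1, t.2.2] i) - Fn t.1 := by
    intro i
    by_cases hi0 : i = 0
    · subst hi0; simp
    · have := LinearMap.congr_fun hg (Finsupp.single ⟨i, hi0⟩ 1)
      simp only [LinearMap.comp_apply, Finsupp.linearCombination_single, one_smul, LinearMap.id_apply, vsub_eq_sub,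
        Matrix.cons_val_zero] at this
      rw [hl, LinearMap.comp_apply, this, Finsupp.linearCombination_single, one_smul]
  refine ⟨l, Fn t.1 - l t.1, fun p hp => ?_⟩
  have h3 : ∃ i : Fin 3, ![t.1, t.2.1, t.2.2] i = p := by
    rcases hp with rfl | rfl | rfl
    · exact ⟨0, rfl⟩
    · exact ⟨1, rfl⟩
    · exact ⟨2, rfl⟩
  obtain ⟨i, rfl⟩ := h3
  have := h2 i
  rw [map_sub] at this
  linarith

/-- nodal interpolation -/
lemma exists_interp (Tr : Triangulation Srf γ h) (Fn : E3 → ℝ) :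
    ∃ v, Tr.IsVh v ∧ ∀ t ∈ Tr.T, ∀ p ∈ vertsOf t, v p = Fn p := by
  classical
  have : ∀ t : E3 × E3 × E3, ∃ (l : E3 →ₗ[ℝ] ℝ) (c : ℝ), t ∈ Tr.T → ∀ p ∈ vertsOf t, l p + c = Fn p := by
    intro t
    by_cases ht : t ∈ Tr.T
    · obtain ⟨l, c, hl⟩ := exists_aff (Tr.indep t ht) Fn
      exact ⟨l, c, fun _ => hl⟩
    · exact ⟨0, 0, fun h => absurd h ht⟩
  choose l c hl using this
  have cons : ∀ t ∈ Tr.T, ∀ t' ∈ Tr.T, ∀ x ∈ triOf t ∩ triOf t', l t x + c t = l t' x + c t' := by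
    intro t ht t' ht' x hx
    by_cases hne : t = t'
    · rw [hne]
    rcases Tr.meet t ht t' ht' hne with h0 | ⟨p, hp, h1⟩ | ⟨p, q, _, hp, hq, h2⟩
    · rw [h0] at hx; exact absurd hx (notMem_empty _)
    · rw [h1] at hx
      rw [mem_singleton_iff.1 hx, hl t ht p hp.1, hl t' ht' p hp.2]
    · rw [h2] at hx
      obtain ⟨α, β, _, _, hs, rfl⟩ := hx
      have e1 := hl t ht p hp.1
      have e2 := hl t' ht' p hp.2
      have e3 := hl t ht q hq.1
      have e4 := hl t' ht' q hq.2
      simp only [map_add, map_smul, smul_eq_mul]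
      have hb : β = 1 - α := by linarith
      subst hb
      linear_combination α * e1 - α * e2 + (1 - α) * e3 - (1 - α) * e4
  set v : E3 → ℝ := fun x => if hx : ∃ t ∈ Tr.T, x ∈ triOf t then l hx.choose x + c hx.choose else 0 with hv
  have hvt : ∀ t ∈ Tr.T, ∀ x ∈ triOf t, v x = l t x + c t := by
    intro t ht x hx
    have hex : ∃ t ∈ Tr.T, x ∈ triOf t := ⟨t, ht, hx⟩
    simp only [hv, dif_pos hex]
    exact cons _ hex.choose_spec.1 t ht x ⟨hex.choose_spec.2, hx⟩
  refine ⟨v, ⟨?_, fun t ht => ⟨l t, c t, hvt t ht⟩⟩, fun t ht p hp => ?_⟩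
  · rw [Sh_eq]
    refine LocallyFinite.continuousOn_iUnion (locallyFinite_of_finite _) (fun t => (tri_compact _).isClosed) ?_
    intro t
    have : ContinuousOn (fun x => l t x + c t) (triOf (t : E3 × E3 × E3)) :=
      ((LinearMap.continuous_of_finiteDimensional (l t)).add continuous_const).continuousOn
    exact this.congr fun x hx => hvt t t.2 x hx
  · rw [hvt t ht p (verts_sub_tri t hp), hl t ht p hp]

lemma Vh_max {v : E3 → ℝ} (hv : Tr.IsVh v) :
    ∃ t ∈ Tr.T, ∃ p ∈ vertsOf t, ∀ x ∈ Tr.Sh, |v x| ≤ |v p| := by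
  have hfin : (⋃ t ∈ Tr.T, vertsOf t).Finite := Tr.T.finite_toSet.biUnion fun t _ => verts_finite t
  have hne : (⋃ t ∈ Tr.T, vertsOf t).Nonempty := by
    obtain ⟨t, ht⟩ := Tr.T_nonempty
    exact ⟨t.1, mem_iUnion₂.2 ⟨t, ht, by simp [vertsOf]⟩⟩
  obtain ⟨p, hp, hmax⟩ := Set.exists_max_image _ (fun x => |v x|) hfin hne
  obtain ⟨t, ht, hpt⟩ := mem_iUnion₂.1 hp
  refine ⟨t, ht, p, hpt, fun x hx => ?_⟩
  obtain ⟨t', ht', hx'⟩ := Sh_mem hx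
  obtain ⟨l, c, hl⟩ := hv.2 t' ht'
  rw [hl x hx', ← Real.norm_eq_abs]
  refine conv_bound l c (fun q hq => ?_) hx'
  rw [← hl q (verts_sub_tri t' hq), Real.norm_eq_abs]
  exact hmax q (mem_iUnion₂.2 ⟨t', ht', hq⟩)


lemma gradTri_const (F : FE G Tr) {t : E3 × E3 × E3} (ht : t ∈ Tr.T) {v : E3 → ℝ} (hv : Tr.IsVh v) :
    ∃ q, ∀ x ∈ triOf t, gradTri t v x = q := by
  obtain ⟨l, c, hl⟩ := hv.2 t ht
  refine ⟨gradTri t v t.1, fun x hx => ?_⟩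
  have h0 : t.1 ∈ triOf t := verts_sub_tri t (by simp [vertsOf])
  have hd : gradTri t v x - gradTri t v t.1 ∈ dirOf t := Submodule.sub_mem _ (gradTri_mem _ _ _) (gradTri_mem _ _ _)
  have h1 := (F.tri ht).inner_gradTri hl hx hd
  have h2 := (F.tri ht).inner_gradTri hl h0 hd
  rw [← h2, ← sub_eq_zero, ← inner_sub_left] at h1
  exact sub_eq_zero.1 (inner_self_eq_zero.1 h1)

/-- consistency of the bilinear forms -/
lemma form_cmp (F : FE G Tr) {v w : E3 → ℝ} (hv : Tr.IsVh v) (hw : Tr.IsVh w) :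
    |Tr.ahForm v w - G.form (Tr.liftS v) (Tr.liftS w)| ≤
      60 * G.eps γ h * (G.en (Tr.liftS v) * G.en (Tr.liftS w)) := by
  set V := Tr.liftS v
  set W := Tr.liftS w
  have hV : G.W V := F.lift_W hv
  have hW : G.W W := F.lift_W hw
  have e0 := F.eps_nonneg
  have e1 := F.eps_le
  set ε := G.eps γ h with hε
  have hH := form_integrable hV hW
  set H : E3 → ℝ := fun x => ⟪G.gd V x, G.gd W x⟫ + V x * W x with hHd
  set K : E3 → ℝ := fun x => ‖G.gd V x‖ * ‖G.gd W x‖ with hKd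
  have hK : Integrable K G.mu := (hV.bmg.norm.mul hW.bmg.norm).integrable
  have h1 : ∀ t ∈ Tr.T, |∫ x in triOf t, (⟪gradTri t v x, gradTri t w x⟫ + v x * w x) ∂μH[2] -
      ∫ x in triOf t, H (G.a x) ∂μH[2]| ≤ 20 * ε * ∫ x in triOf t, K (G.a x) ∂μH[2] := by
    intro t ht
    have i1 := (F.int_tri ht (F.int_on hH ht)).1
    have i2 := (F.int_tri ht (F.int_on hK ht)).1
    have hb : ∀ᵐ x ∂(μH[2].restrict (triOf t)), 
        |(⟪gradTri t v x, gradTri t w x⟫ + v x * w x) - H (G.a x)| ≤ 20 * ε * K (G.a x) := by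
      filter_upwards [F.good_on ht] with x g
      have s1 : V (G.a x) = v x := F.lift_a (mem_Sh ht g.hx) v
      have s2 : W (G.a x) = w x := F.lift_a (mem_Sh ht g.hx) w
      have hS := g.mem F
      have := (F.tri ht).grad_cmp g.hx (gd_tan V hS) (gd_tan W hS) (gradTri_mem t v x) (gradTri_mem t w x)
        (g.inner F hv) (g.inner F hw)
      simp only [hHd, hKd, s1, s2]
      rw [add_sub_add_right_eq_sub]; exact this
    have hm : AEStronglyMeasurable (fun x => ⟪gradTri t v x, gradTri t w x⟫ + v x * w x) (μH[2].restrict (triOf t)) := by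
      obtain ⟨q, hq⟩ := F.gradTri_const ht hv
      obtain ⟨q', hq'⟩ := F.gradTri_const ht hw
      have hc : ContinuousOn (fun x => ⟪q, q'⟫ + v x * w x) (triOf t) :=
        continuousOn_const.add ((hv.1.mono fun x hx => mem_Sh ht hx).mul (hw.1.mono fun x hx => mem_Sh ht hx))
      refine (hc.aestronglyMeasurable (tri_meas t)).congr ?_
      filter_upwards [ae_restrict_mem (tri_meas t)] with x hx
      rw [hq x hx, hq' x hx]
    have hd : Integrable (fun x => (⟪gradTri t v x, gradTri t w x⟫ + v x * w x) - H (G.a x)) (μH[2].restrict (triOf t)) := by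
      refine (i2.const_mul (20 * ε)).mono' (hm.sub i1.aestronglyMeasurable) ?_
      exact hb
    have i3 : Integrable (fun x => ⟪gradTri t v x, gradTri t w x⟫ + v x * w x) (μH[2].restrict (triOf t)) := by
      have := hd.add i1
      refine this.congr (Eventually.of_forall fun x => ?_)
      simp
    rw [← integral_sub i3 i1, ← integral_const_mul, ← Real.norm_eq_abs]
    exact norm_integral_le_of_norm_le (i2.const_mul _) hb
  have h2 := F.int_Sh hH
  have h3 := F.int_Sh hK
  rw [← hε] at h2 h3
  have hK0 : ∀ x, 0 ≤ K x := fun x => by positivity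
  have h4 : ∫ x, |K x| ∂G.mu = ∫ x, K x ∂G.mu := integral_congr_ae (Eventually.of_forall fun x => abs_of_nonneg (hK0 x))
  rw [h4] at h3
  have hE := mul_nonneg (en_nonneg (G := G) V) (en_nonneg (G := G) W)
  have h5 : ∫ x, K x ∂G.mu ≤ G.en V * G.en W := by
    have := cs_nrm_mul hV.bmg.norm hW.bmg.norm
    rw [nrm_norm (G.gd V), nrm_norm (G.gd W)] at this
    refine (le_abs_self _).trans (this.trans ?_)
    exact mul_le_mul (nrg_le_en hV) (nrg_le_en hW) (nr_nonneg _) (en_nonneg _)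
  have hVW : Integrable (fun x => |V x| * |W x|) G.mu := (hV.bm.abs.mul hW.bm.abs).integrable
  have h6 : ∫ x, |H x| ∂G.mu ≤ 2 * (G.en V * G.en W) := by
    have a1 : ∫ x, |V x| * |W x| ∂G.mu ≤ G.en V * G.en W := by
      have := cs_nrm_mul hV.bm.norm hW.bm.norm
      rw [nrm_norm V, nrm_norm W] at this
      refine (le_abs_self _).trans (this.trans ?_)
      exact mul_le_mul (nr_le_en hV) (nr_le_en hW) (nr_nonneg _) (en_nonneg _)
    have a2 : ∫ x, |H x| ∂G.mu ≤ ∫ x, (K x + |V x| * |W x|) ∂G.mu := by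
      refine integral_mono hH.abs (hK.add hVW) fun x => ?_
      refine (abs_add_le _ _).trans ?_
      rw [abs_mul]
      exact add_le_add (abs_real_inner_le_norm _ _) le_rfl
    rw [integral_add hK hVW] at a2
    linarith
  have h7 : |Tr.ahForm v w - ∑ t ∈ Tr.T, ∫ x in triOf t, H (G.a x) ∂μH[2]| ≤
      20 * ε * ∑ t ∈ Tr.T, ∫ x in triOf t, K (G.a x) ∂μH[2] := by
    rw [Triangulation.ahForm, ← Finset.sum_sub_distrib, Finset.mul_sum]
    exact (Finset.abs_sum_le_sum_abs _ _).trans (Finset.sum_le_sum h1)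
  have h8 : ∑ t ∈ Tr.T, ∫ x in triOf t, K (G.a x) ∂μH[2] ≤ 2 * (G.en V * G.en W) := by
    have := (abs_le.1 h3).2
    have i0 : 0 ≤ ∫ x, K x ∂G.mu := integral_nonneg hK0
    nlinarith
  have h9 : G.form V W = ∫ x, H x ∂G.mu := rfl
  rw [h9]
  have h10 : 20 * ε * ∑ t ∈ Tr.T, ∫ x in triOf t, K (G.a x) ∂μH[2] ≤ 20 * ε * (2 * (G.en V * G.en W)) :=
    mul_le_mul_of_nonneg_left h8 (by positivity)
  have h11 : 10 * ε * ∫ x, |H x| ∂G.mu ≤ 10 * ε * (2 * (G.en V * G.en W)) :=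
    mul_le_mul_of_nonneg_left h6 (by positivity)
  have := abs_sub_le (Tr.ahForm v w) (∑ t ∈ Tr.T, ∫ x in triOf t, H (G.a x) ∂μH[2]) (∫ x, H x ∂G.mu)
  linarith

/-- consistency of the right-hand side -/
lemma rhs_cmp (F : FE G Tr) {f v : E3 → ℝ} (hf : BM G.mu f) (hv : Tr.IsVh v) :
    |∫ x in Tr.Sh, f (Tr.a x) * v x ∂μH[2] - ∫ x, f x * Tr.liftS v x ∂G.mu| ≤
      10 * G.eps γ h * (G.nr f * G.nr (Tr.liftS v)) := by
  have hV := F.lift_W hv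
  set V := Tr.liftS v
  have hH : Integrable (fun x => f x * V x) G.mu := (hf.mul hV.bm).integrable
  have h1 := F.int_Sh hH
  have h2 : ∫ x in Tr.Sh, f (Tr.a x) * v x ∂μH[2] = ∑ t ∈ Tr.T, ∫ x in triOf t, f (G.a x) * V (G.a x) ∂μH[2] := by
    have hc : ∫ x in Tr.Sh, f (Tr.a x) * v x ∂μH[2] = ∫ x in Tr.Sh, f (G.a x) * V (G.a x) ∂μH[2] := by
      refine setIntegral_congr_fun Sh_compact.isClosed.measurableSet fun x hx => ?_
      simp only [V]
      rw [F.lift_a hx, F.eqa hx]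
    rw [hc, Sh_restrict]
    have hi : Integrable (fun x => f (G.a x) * V (G.a x)) (Measure.sum fun t : Tr.T => μH[2].restrict (triOf (t : E3 × E3 × E3))) := by
      refine integrable_sum_measure (fun t => (F.int_tri t.2 (F.int_on hH t.2)).1) ?_
      exact (hasSum_fintype _).summable
    rw [integral_sum_measure hi, tsum_fintype]
    exact Finset.sum_coe_sort Tr.T (fun t => ∫ x in triOf t, f (G.a x) * V (G.a x) ∂μH[2])
  rw [h2]
  refine h1.trans (mul_le_mul_of_nonneg_left ?_ (by have := F.eps_nonneg; positivity))
  have := cs_nrm_mul hf.norm hV.bm.norm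
  rw [nrm_norm f, nrm_norm V] at this
  refine le_trans (le_of_eq ?_) ((le_abs_self _).trans this)
  refine integral_congr_ae (Eventually.of_forall fun x => ?_)
  simp [abs_mul]

end FE
end PartN16

section PartN17
namespace FE
open Geo
variable {Srf : SmoothSurface} {G : Geo Srf} {γ h : ℝ} {Tr : Triangulation Srf γ h} 

/-- Taylor lemma at a good point -/
lemma Good.taylor (F : FE G Tr) {s x : E3} {t : E3 × E3 × E3} (gd : Good G Tr s t x) {v : E3 → ℝ} (hv : Tr.IsVh v)
    {g : E3} (hg : G.D s g = g) {r β : ℝ}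
    (hb : ∀ p ∈ vertsOf t, |v p - r - ⟪g, G.D x (p - x)⟫| ≤ β) :
    |Tr.liftS v s - r| ≤ β ∧ ‖G.gd (Tr.liftS v) s - g‖ ≤ 4 * β / (γ * h) := by
  have H := F.tri gd.ht
  obtain ⟨l, c, hl⟩ := hv.2 t gd.ht
  set l' : E3 →ₗ[ℝ] ℝ := l - (innerSL ℝ g : E3 →L[ℝ] ℝ).toLinearMap.comp (G.D x : E3 →L[ℝ] E3).toLinearMap with hl'
  have e' : ∀ k, l' k = l k - ⟪g, G.D x k⟫ := fun k => by simp [hl']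
  have hb' : ∀ p ∈ vertsOf t, ‖l' p + (c - r + ⟪g, G.D x x⟫)‖ ≤ β := by
    intro p hp
    refine le_trans (le_of_eq ?_) (hb p hp)
    rw [e', hl p (verts_sub_tri t hp), map_sub, inner_sub_right, Real.norm_eq_abs]
    congr 1; ring
  have hβ : 0 ≤ β := (abs_nonneg _).trans (hb t.1 (by simp [vertsOf]))
  constructor
  · have := conv_bound l' _ hb' gd.hx
    refine le_trans (le_of_eq ?_) this
    rw [← gd.e, F.lift_a (mem_Sh gd.ht gd.hx), hl x gd.hx, e', Real.norm_eq_abs]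
    congr 1; ring
  · have hs := gd.mem F
    set d := G.gd (Tr.liftS v) s - g with hd
    have hdt : G.D s d = d := by rw [hd, map_sub, gd_tan _ hs, hg]
    obtain ⟨k, hk, hkd, hkn⟩ := H.D_surj (x := x) (g := d) gd.hx (by rw [gd.e]; exact hdt)
    have h1 := H.shape l' _ hb' hk
    have h2 : l' k = ‖d‖ ^ 2 := by
      rw [e', ← (gd.der F hl).2 k hk, hkd, ← inner_sub_left, ← hd, real_inner_self_eq_norm_sq]
    rw [h2, Real.norm_eq_abs, abs_of_nonneg (by positivity)] at h1
    have hγh : 0 < γ * h := mul_pos F.γ0 F.h0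
    have h3 : 2 * β / (γ * h) * ‖k‖ ≤ 2 * β / (γ * h) * (2 * ‖d‖) := mul_le_mul_of_nonneg_left hkn (by positivity)
    have e3 : 4 * β / (γ * h) = 2 * (2 * β / (γ * h)) := by ring
    rw [e3]
    by_contra hc
    push Not at hc
    have hp : 0 < ‖d‖ := lt_of_le_of_lt (by positivity) hc
    nlinarith [mul_lt_mul_of_pos_right hc hp]

/-- basic displacement facts -/
lemma Good.disp (F : FE G Tr) {s x p : E3} {t : E3 × E3 × E3} (g : Good G Tr s t x) (hp : p ∈ vertsOf t) :
    p ∈ Srf.S ∧ ‖p - s‖ ≤ G.L * h ∧ ‖(p - s) - G.D x (p - x)‖ ≤ G.L * h ^ 2 ∧ ‖G.D x (p - x)‖ ≤ 2 * h := by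
  have H := F.tri g.ht
  have hpS := H.vS hp
  have hxp := verts_sub_tri t hp
  have hd : ‖p - x‖ ≤ h := by
    have := H.dist_le hxp g.hx
    exact this
  have hh := F.h0
  refine ⟨hpS, ?_, ?_, ?_⟩
  · have := H.v_dist g.hx hp
    rwa [g.e] at this
  · have := G.a_taylor x p
    rw [G.fix p hpS, g.e] at this
    refine this.trans (mul_le_mul_of_nonneg_left ?_ G.L_pos.le)
    exact pow_le_pow_left₀ (norm_nonneg _) hd 2
  · have h1 := H.D_up g.hx (tri_sub_dir hxp g.hx)
    have := F.eps_le
    have h2 : (1 + G.eps γ h) * ‖p - x‖ ≤ 2 * ‖p - x‖ := mul_le_mul_of_nonneg_right (by linarith) (norm_nonneg _)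
    linarith

/-- Taylor lemma with chords on the surface -/
lemma Good.taylor' (F : FE G Tr) {s x : E3} {t : E3 × E3 × E3} (gd : Good G Tr s t x) {v : E3 → ℝ} (hv : Tr.IsVh v)
    {g : E3} (hg : G.D s g = g) {r β : ℝ}
    (hb : ∀ p ∈ vertsOf t, |v p - r - ⟪g, p - s⟫| ≤ β) :
    |Tr.liftS v s - r| ≤ β + G.L * h ^ 2 * ‖g‖ ∧
      ‖G.gd (Tr.liftS v) s - g‖ ≤ 4 * (β + G.L * h ^ 2 * ‖g‖) / (γ * h) := by
  refine gd.taylor F hv hg fun p hp => ?_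
  have h1 := hb p hp
  obtain ⟨_, _, h3, _⟩ := gd.disp F hp
  have h4 : |⟪g, (p - s) - G.D x (p - x)⟫| ≤ G.L * h ^ 2 * ‖g‖ := by
    refine (abs_real_inner_le_norm _ _).trans ?_
    rw [mul_comm]
    exact mul_le_mul_of_nonneg_right h3 (norm_nonneg _)
  have e : v p - r - ⟪g, G.D x (p - x)⟫ = (v p - r - ⟪g, p - s⟫) + ⟪g, (p - s) - G.D x (p - x)⟫ := by
    rw [inner_sub_right g (p - s) (G.D x (p - x))]; ring
  rw [e]
  exact (abs_add_le _ _).trans (add_le_add h1 h4)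

/-- superapproximation at good points -/
lemma superapprox (G : Geo Srf) : ∃ C : ℝ, 0 ≤ C ∧ ∀ {γ h : ℝ} {Tr : Triangulation Srf γ h} (_ : FE G Tr) (z : E3) (_ : z ∈ Srf.S)
    (ζ v : E3 → ℝ) (_ : Tr.IsVh ζ) (_ : Tr.IsVh v)
    (_ : ∀ t ∈ Tr.T, ∀ p ∈ vertsOf t, v p = sg z h p ^ 2 * ζ p),
    ∀ᵐ s ∂G.mu, |Tr.liftS v s - sg z h s ^ 2 * Tr.liftS ζ s| ≤ C * h ^ 2 * (|Tr.liftS ζ s| + sg z h s * ‖G.gd (Tr.liftS ζ) s‖) ∧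
      ‖G.gd (Tr.liftS v) s - G.gd (fun x => sg z h x ^ 2 * Tr.liftS ζ x) s‖ ≤
        4 * C / γ * h * (|Tr.liftS ζ s| + sg z h s * ‖G.gd (Tr.liftS ζ) s‖) := by
  set R := Metric.diam Srf.S
  have hR : 0 ≤ R := Metric.diam_nonneg
  have hL := G.L_pos
  refine ⟨8 + 3 * (2 * R * G.L + G.L ^ 2), by positivity, fun {γ h Tr} F z hz ζ v hζ hv hn => ?_⟩
  filter_upwards [F.good_ae] with s ⟨t, x, g⟩
  have hs := g.mem F
  have hh := F.h0
  have hh1 := F.h1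
  set σ := sg z h s with hσ
  have hσh : h ≤ σ := sg_ge_h z s
  have hC : ContDiff ℝ 1 (fun x : E3 => ‖x - z‖ ^ 2 + h ^ 2) :=
    ((contDiff_id.sub contDiff_const).norm_sq ℝ).add contDiff_const
  have he : (fun x => sg z h x ^ 2) = fun x : E3 => ‖x - z‖ ^ 2 + h ^ 2 := funext (sg_sq z h)
  have hC' : ContDiff ℝ 1 (fun x => sg z h x ^ 2) := by rw [he]; exact hC
  obtain ⟨l, c, hl⟩ := hζ.2 t g.ht
  have hder := g.der F hl
  set Z := Tr.liftS ζ with hZ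
  have hgd := gd_mul hs (DA_C1 (G := G) hC' s) hder.1
  have hgs : ∀ k, ⟪G.gd (fun x => sg z h x ^ 2) s, k⟫ = 2 * ⟪s - z, G.D s k⟫ := by
    intro k
    rw [inner_gd_C1 hC' hs, he]
    have : HasFDerivAt (fun x : E3 => ‖x - z‖ ^ 2 + h ^ 2) (2 • (innerSL ℝ (s - z)).comp (ContinuousLinearMap.id ℝ E3)) s :=
      (((hasFDerivAt_id s).sub_const z).norm_sq).add_const _
    rw [this.fderiv]
    simp [inner_sub_left]
  set β := (8 + 3 * (2 * R * G.L + G.L ^ 2)) * h ^ 2 * (|Z s| + σ * ‖G.gd Z s‖) with hβ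
  have key := g.taylor F hv (g := G.gd (fun x => sg z h x ^ 2 * Z x) s) (gd_tan _ hs) (r := σ ^ 2 * Z s) (β := β) ?_
  · refine ⟨key.1, key.2.trans (le_of_eq ?_)⟩
    rw [hβ]
    have := F.γ0
    field_simp
  intro p hp
  obtain ⟨hpS, hp1, hp2, hp3⟩ := g.disp F hp
  set k := G.D x (p - x) with hk
  have hDk : G.D s k = k := by
    have := (F.tri g.ht).DaD g.hx (p - x)
    rwa [g.e] at this
  have hpx := tri_sub_dir (verts_sub_tri t hp) g.hx
  set A := ⟪G.gd Z s, k⟫ with hA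
  have hζp : ζ p = Z s + A := by
    have h1 : Z s = l x + c := by rw [hZ, ← g.e, F.lift_a (mem_Sh g.ht g.hx), hl x g.hx]
    rw [hA, hder.2 _ hpx, hl p (verts_sub_tri t hp), h1, map_sub]; ring
  set B := 2 * ⟪s - z, k⟫ with hB
  set ρ₁ := 2 * ⟪s - z, (p - s) - k⟫ + ‖p - s‖ ^ 2 with hρ
  have hσp : sg z h p ^ 2 = σ ^ 2 + B + ρ₁ := by
    rw [hσ, sg_sq, sg_sq, hB, hρ, inner_sub_right (s - z) (p - s) k]
    have : p - z = (s - z) + (p - s) := by abel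
    rw [this, norm_add_sq_real]; ring
  have hin : ⟪G.gd (fun x => sg z h x ^ 2 * Z x) s, k⟫ = σ ^ 2 * A + Z s * B := by
    rw [hgd, inner_add_left, real_inner_smul_left, real_inner_smul_left, hgs, hDk]
  rw [hn t g.ht p hp, hζp, hσp, hin]
  have e : (σ ^ 2 + B + ρ₁) * (Z s + A) - σ ^ 2 * Z s - (σ ^ 2 * A + Z s * B) = B * A + ρ₁ * (Z s + A) := by ring
  rw [e]
  have bA : |A| ≤ 2 * h * ‖G.gd Z s‖ := by
    refine (abs_real_inner_le_norm _ _).trans ?_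
    rw [mul_comm]; exact mul_le_mul_of_nonneg_right hp3 (norm_nonneg _)
  have bB : |B| ≤ 4 * h * σ := by
    rw [hB, abs_mul, abs_two]
    have := (abs_real_inner_le_norm (s - z) k).trans (mul_le_mul (sg_ge_r z h s) hp3 (norm_nonneg _) (sg_nonneg _ _ _))
    rw [← hσ] at this
    linarith
  have hsz : ‖s - z‖ ≤ R := by
    rw [← dist_eq_norm]; exact Metric.dist_le_diam_of_mem Srf.compact.isBounded hs hz
  have bρ : |ρ₁| ≤ (2 * R * G.L + G.L ^ 2) * h ^ 2 := by
    have h1 := (abs_real_inner_le_norm (s - z) ((p - s) - k)).trans (mul_le_mul hsz hp2 (norm_nonneg _) hR)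
    have h2 := pow_le_pow_left₀ (norm_nonneg _) hp1 2
    rw [hρ]
    refine (abs_add_le _ _).trans ?_
    rw [abs_mul, abs_two, abs_of_nonneg (sq_nonneg ‖p - s‖)]
    linarith [h1, h2, mul_pow G.L h 2]
  set q := ‖G.gd Z s‖ with hq
  have q0 : 0 ≤ q := norm_nonneg _
  have hqσ : h * q ≤ σ * q := mul_le_mul_of_nonneg_right hσh q0
  have b1 : |B * A| ≤ 8 * h ^ 2 * (σ * q) := by
    rw [abs_mul]
    refine (mul_le_mul bB bA (abs_nonneg _) (by have := hh.le.trans hσh; positivity)).trans (le_of_eq (by ring))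
  have b2 : |Z s + A| ≤ 3 * (|Z s| + σ * q) := by
    refine (abs_add_le _ _).trans ?_
    have := abs_nonneg (Z s)
    have : 0 ≤ σ * q := by have := hh.le.trans hσh; positivity
    linarith
  have b3 : |ρ₁ * (Z s + A)| ≤ ((2 * R * G.L + G.L ^ 2) * h ^ 2) * (3 * (|Z s| + σ * q)) := by
    rw [abs_mul]
    exact mul_le_mul bρ b2 (abs_nonneg _) (by positivity)
  refine (abs_add_le _ _).trans ?_
  rw [hβ]
  have := mul_nonneg (by positivity : 0 ≤ 8 * h ^ 2) (abs_nonneg (Z s))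
  nlinarith

end FE
end PartN17

section PartN18
namespace Geo
variable {Srf : SmoothSurface} {G : Geo Srf}

lemma gd_comp_C1 {u : E3 → ℝ} (hu : ContDiff ℝ (⊤ : ℕ∞) u) (i : Fin 3) : ContDiff ℝ 1 (fun y => G.gd u y i) := by
  have h1 : ContDiff ℝ (⊤ : ℕ∞) (u ∘ G.a) := hu.comp G.smooth
  have h2 : ContDiff ℝ 1 (fderiv ℝ (u ∘ G.a)) := h1.fderiv_right (WithTop.coe_le_coe.2 (le_top : (1 + 1 : ℕ∞) ≤ ⊤))
  have e : (fun y => G.gd u y i) = fun y => fderiv ℝ (u ∘ G.a) y (EuclideanSpace.single i 1) := by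
    funext y
    rw [← inner_gd, real_inner_comm]
    simp [EuclideanSpace.inner_single_left]
  rw [e]
  exact h2.clm_apply contDiff_const

lemma norm_le_sum3 (w : E3) : ‖w‖ ≤ |w 0| + |w 1| + |w 2| := by
  rw [EuclideanSpace.norm_eq, Fin.sum_univ_three]
  apply Real.sqrt_le_iff.2 ⟨by positivity, ?_⟩
  simp only [Real.norm_eq_abs]
  have := mul_nonneg (abs_nonneg (w 0)) (abs_nonneg (w 1))
  have := mul_nonneg (abs_nonneg (w 0)) (abs_nonneg (w 2))
  have := mul_nonneg (abs_nonneg (w 1)) (abs_nonneg (w 2))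
  nlinarith

/-- mean value along projected segments -/
lemma mvt_path {v : E3 → ℝ} (hv : ContDiff ℝ 1 v) {s k : E3} (hs : s ∈ Srf.S) (hk : ‖k‖ < G.ρ) :
    ∃ ξ : ℝ, 0 ≤ ξ ∧ ξ ≤ 1 ∧ G.a (s + ξ • k) ∈ Srf.S ∧
      v (G.a (s + k)) - v s = ⟪G.gd v (G.a (s + ξ • k)), G.D (s + ξ • k) k⟫ := by
  have hd : ∀ τ : ℝ, HasDerivAt (fun τ : ℝ => (v ∘ G.a) (s + τ • k)) (fderiv ℝ (v ∘ G.a) (s + τ • k) k) τ := by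
    intro τ
    have h1 : HasFDerivAt (v ∘ G.a) (fderiv ℝ (v ∘ G.a) (s + τ • k)) (s + τ • k) :=
      (((C1_comp (G := G) hv).differentiable (by simp)) _).hasFDerivAt
    have h2 : HasDerivAt (fun τ : ℝ => s + τ • k) k τ := by
      simpa using ((hasDerivAt_id τ).smul_const k).const_add s
    exact HasFDerivAt.comp_hasDerivAt (l := v ∘ G.a) (f := fun τ : ℝ => s + τ • k) τ h1 h2
  obtain ⟨ξ, hξ, e⟩ := exists_hasDerivAt_eq_slope (fun τ : ℝ => (v ∘ G.a) (s + τ • k))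
    (fun τ => fderiv ℝ (v ∘ G.a) (s + τ • k) k) one_pos
    (fun τ _ => (hd τ).continuousAt.continuousWithinAt) (fun τ _ => hd τ)
  have hn : ‖s + ξ • k - s‖ < G.ρ := by
    rw [add_sub_cancel_left, norm_smul, Real.norm_eq_abs, abs_of_pos hξ.1]
    have := norm_nonneg k
    nlinarith [hξ.2]
  refine ⟨ξ, hξ.1.le, hξ.2.le, G.near s hs _ hn, ?_⟩
  rw [← fderiv_off hs hn (DA_C1 hv _), e]
  simp [G.fix s hs]

lemma lip_path {v : E3 → ℝ} (hv : ContDiff ℝ 1 v) {s k : E3} (hs : s ∈ Srf.S) (hk : ‖k‖ < G.ρ) {M : ℝ}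
    (hM : ∀ x ∈ Srf.S, ‖G.gd v x‖ ≤ M) : |v (G.a (s + k)) - v s| ≤ M * (G.L * ‖k‖) := by
  obtain ⟨ξ, _, _, hm, e⟩ := mvt_path hv hs hk
  rw [e]
  have hM0 : 0 ≤ M := (norm_nonneg _).trans (hM _ hm)
  exact (abs_real_inner_le_norm _ _).trans (mul_le_mul (hM _ hm) (G.D_le _ _) (norm_nonneg _) hM0)

lemma taylor2 {u : E3 → ℝ} (hu : ContDiff ℝ (⊤ : ℕ∞) u) {M : ℝ} (h1 : ∀ x ∈ Srf.S, ‖G.gd u x‖ ≤ M)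
    (h2 : ∀ i : Fin 3, ∀ x ∈ Srf.S, ‖G.gd (fun y => G.gd u y i) x‖ ≤ M) {s p : E3} (hs : s ∈ Srf.S) (hp : p ∈ Srf.S)
    (hd : ‖p - s‖ < G.ρ) : |u p - u s - ⟪G.gd u s, p - s⟫| ≤ 5 * G.L ^ 2 * M * ‖p - s‖ ^ 2 := by
  have hM0 : 0 ≤ M := (norm_nonneg _).trans (h1 _ hs)
  have hL := G.L_one
  have hu1 : ContDiff ℝ 1 u := hu.of_le (by exact_mod_cast le_top)
  obtain ⟨ξ, h0, h1', hm, e⟩ := mvt_path hu1 hs hd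
  rw [add_sub_cancel, G.fix p hp] at e
  set k := p - s with hk
  set q := s + ξ • k with hq
  have hqs : ‖q - s‖ ≤ ‖k‖ := by
    rw [hq, add_sub_cancel_left, norm_smul, Real.norm_eq_abs, abs_of_nonneg h0]
    have := norm_nonneg k
    nlinarith
  have b1 : ‖G.gd u (G.a q) - G.gd u s‖ ≤ 3 * (M * (G.L * ‖k‖)) := by
    have hc : ∀ i : Fin 3, |(G.gd u (G.a q) - G.gd u s) i| ≤ M * (G.L * ‖k‖) := by
      intro i
      have := lip_path (G := G) (gd_comp_C1 hu i) hs (k := ξ • k) (by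
        have : ‖ξ • k‖ = ‖q - s‖ := by rw [hq, add_sub_cancel_left]
        rw [this]; linarith) (h2 i)
      refine this.trans ?_
      have e2 : ‖ξ • k‖ = ‖q - s‖ := by rw [hq, add_sub_cancel_left]
      rw [e2]
      have := G.L_pos
      gcongr
    have := norm_le_sum3 (G.gd u (G.a q) - G.gd u s)
    linarith [hc 0, hc 1, hc 2]
  have b2 : ‖G.D q k - k‖ ≤ 2 * G.L * ‖k‖ ^ 2 := by
    have i1 := G.D_sub q s k
    have i2 := chord (G := G) hs hp
    rw [← hk] at i2
    have i3 : ‖G.D q k - k‖ ≤ ‖G.D q k - G.D s k‖ + ‖k - G.D s k‖ := by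
      have : G.D q k - k = (G.D q k - G.D s k) - (k - G.D s k) := by abel
      rw [this]; exact norm_sub_le _ _
    have i4 : G.L * ‖q - s‖ * ‖k‖ ≤ G.L * ‖k‖ * ‖k‖ :=
      mul_le_mul_of_nonneg_right (mul_le_mul_of_nonneg_left hqs G.L_pos.le) (norm_nonneg _)
    linarith [sq ‖k‖, mul_assoc G.L ‖k‖ ‖k‖]
  have e3 : u p - u s - ⟪G.gd u s, k⟫ = ⟪G.gd u (G.a q) - G.gd u s, G.D q k⟫ + ⟪G.gd u s, G.D q k - k⟫ := by
    rw [e, inner_sub_left (G.gd u (G.a q)), inner_sub_right (G.gd u s) (G.D q k) k]; ring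
  rw [e3]
  refine (abs_add_le _ _).trans ?_
  have j1 := (abs_real_inner_le_norm (G.gd u (G.a q) - G.gd u s) (G.D q k)).trans
    (mul_le_mul b1 (G.D_le q k) (norm_nonneg _) (by have := G.L_pos; positivity))
  have j2 := (abs_real_inner_le_norm (G.gd u s) (G.D q k - k)).trans
    (mul_le_mul (h1 s hs) b2 (norm_nonneg _) hM0)
  have j3 : M * (2 * G.L * ‖k‖ ^ 2) ≤ 2 * G.L ^ 2 * M * ‖k‖ ^ 2 := by
    have : G.L ≤ G.L ^ 2 := by nlinarith
    have : 0 ≤ M * ‖k‖ ^ 2 := by positivity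
    nlinarith
  nlinarith

end Geo

namespace FE
open Geo
variable {Srf : SmoothSurface} {G : Geo Srf} {γ h : ℝ} {Tr : Triangulation Srf γ h}

/-- interpolation estimate for smooth functions -/
lemma interp_u (F : FE G Tr) {u : E3 → ℝ} (hu : ContDiff ℝ (⊤ : ℕ∞) u) {M : ℝ} (h1 : ∀ x ∈ Srf.S, ‖G.gd u x‖ ≤ M)
    (h2 : ∀ i : Fin 3, ∀ x ∈ Srf.S, ‖G.gd (fun y => G.gd u y i) x‖ ≤ M) {v : E3 → ℝ} (hv : Tr.IsVh v)
    (hn : ∀ t ∈ Tr.T, ∀ p ∈ vertsOf t, v p = u p) :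
    ∀ᵐ s ∂G.mu, |Tr.liftS v s - u s| ≤ 6 * G.L ^ 4 * M * h ^ 2 ∧
      ‖G.gd (Tr.liftS v) s - G.gd u s‖ ≤ 24 * G.L ^ 4 / γ * M * h := by
  filter_upwards [F.good_ae] with s ⟨t, x, g⟩
  have hs := g.mem F
  have hM0 : 0 ≤ M := (norm_nonneg _).trans (h1 _ hs)
  have hL := G.L_one
  have hL0 := G.L_pos
  have hh := F.h0
  have hγ := F.γ0
  have key := g.taylor' F hv (g := G.gd u s) (gd_tan _ hs) (r := u s) (β := 5 * G.L ^ 4 * M * h ^ 2) ?_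
  · have e : 5 * G.L ^ 4 * M * h ^ 2 + G.L * h ^ 2 * ‖G.gd u s‖ ≤ 6 * G.L ^ 4 * M * h ^ 2 := by
      have i1 : G.L ≤ G.L ^ 4 := le_self_pow₀ hL (by norm_num)
      have i2 := mul_le_mul (mul_le_mul_of_nonneg_right i1 (sq_nonneg h)) (h1 s hs) (norm_nonneg _) (by positivity)
      linarith
    refine ⟨key.1.trans e, key.2.trans ?_⟩
    rw [div_le_iff₀ (by positivity)]
    have : 24 * G.L ^ 4 / γ * M * h * (γ * h) = 4 * (6 * G.L ^ 4 * M * h ^ 2) := by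
      field_simp; ring
    rw [this]
    linarith
  intro p hp
  obtain ⟨hpS, hp1, -, -⟩ := g.disp F hp
  rw [hn t g.ht p hp]
  have hlt : ‖p - s‖ < G.ρ := by
    have h1 := (F.tri g.ht).small
    have h2 : G.L ≤ G.L ^ 6 := le_self_pow₀ hL (by norm_num)
    have h3 : γ ^ 2 ≤ 1 := pow_le_one₀ hγ.le F.γ1
    have h4 := mul_le_mul_of_nonneg_right h2 hh.le
    have h5 := mul_le_mul_of_nonneg_left h3 G.ρ_pos.le
    have : 0 < G.L ^ 6 * h := by positivity
    linarith [G.ρ_pos]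
  refine (taylor2 hu h1 h2 hs hpS hlt).trans ?_
  have := pow_le_pow_left₀ (norm_nonneg _) hp1 2
  calc 5 * G.L ^ 2 * M * ‖p - s‖ ^ 2 ≤ 5 * G.L ^ 2 * M * (G.L * h) ^ 2 := mul_le_mul_of_nonneg_left this (by positivity)
    _ = _ := by ring

end FE
end PartN18

section PartN19
namespace Geo
variable {Srf : SmoothSurface} {G : Geo Srf}

/-- derivative oscillation of the extension -/
def osc (G : Geo Srf) (g : E3 → ℝ) (k s : E3) : ℝ := ‖fderiv ℝ (g ∘ G.a) (s + k) - fderiv ℝ (g ∘ G.a) s‖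

lemma osc_nonneg (g : E3 → ℝ) (k s : E3) : 0 ≤ G.osc g k s := norm_nonneg _

lemma osc_cont {g : E3 → ℝ} (hg : ContDiff ℝ 1 g) : Continuous (fun z : E3 × E3 => G.osc g z.1 z.2) := by
  have h1 : Continuous (fderiv ℝ (g ∘ G.a)) := (C1_comp (G := G) hg).continuous_fderiv (by simp)
  unfold osc
  exact ((h1.comp (continuous_snd.add continuous_fst)).sub (h1.comp continuous_snd)).norm

lemma osc_cont' {X : Type*} [TopologicalSpace X] {g : E3 → ℝ} (hg : ContDiff ℝ 1 g) {f f' : X → E3} (hf : Continuous f)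
    (hf' : Continuous f') : Continuous (fun x => G.osc g (f x) (f' x)) :=
  Continuous.comp (g := fun z : E3 × E3 => G.osc g z.1 z.2) (f := fun x => (f x, f' x)) (osc_cont hg) (hf.prodMk hf')

lemma osc_path {g : E3 → ℝ} (hg : ContDiff ℝ 1 g) (s k : E3) :
    |(g ∘ G.a) (s + k) - (g ∘ G.a) s - fderiv ℝ (g ∘ G.a) s k| ≤ ‖k‖ * ∫ τ in Icc (0:ℝ) 1, G.osc g (τ • k) s := by
  set w := g ∘ G.a with hw
  have hc : ContDiff ℝ 1 w := C1_comp hg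
  have h1 : Continuous (fderiv ℝ w) := hc.continuous_fderiv (by simp)
  have hd : ∀ τ : ℝ, HasDerivAt (fun τ : ℝ => w (s + τ • k) - τ * fderiv ℝ w s k)
      ((fderiv ℝ w (s + τ • k) - fderiv ℝ w s) k) τ := by
    intro τ
    have h2 : HasDerivAt (fun τ : ℝ => s + τ • k) k τ := by
      simpa using ((hasDerivAt_id τ).smul_const k).const_add s
    have h3 := HasFDerivAt.comp_hasDerivAt (l := w) (f := fun τ : ℝ => s + τ • k) τ
      ((hc.differentiable (by simp)) _).hasFDerivAt h2
    have h4 : HasDerivAt (fun τ : ℝ => τ * fderiv ℝ w s k) (fderiv ℝ w s k) τ := by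
      simpa using (hasDerivAt_id τ).mul_const (fderiv ℝ w s k)
    exact h3.sub h4
  have hcont : Continuous fun τ : ℝ => (fderiv ℝ w (s + τ • k) - fderiv ℝ w s) k :=
    ((h1.comp (continuous_const.add (continuous_id.smul continuous_const))).sub continuous_const).clm_apply continuous_const
  have hI := intervalIntegral.integral_eq_sub_of_hasDerivAt (a := 0) (b := 1) (fun τ _ => hd τ) (hcont.intervalIntegrable 0 1)
  have e : w (s + k) - w s - fderiv ℝ w s k = ∫ τ in (0:ℝ)..1, (fderiv ℝ w (s + τ • k) - fderiv ℝ w s) k := by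
    rw [hI]; simp; ring
  rw [e, intervalIntegral.integral_of_le zero_le_one, ← integral_Icc_eq_integral_Ioc, ← Real.norm_eq_abs,
    ← integral_const_mul]
  refine norm_integral_le_of_norm_le ?_ (Eventually.of_forall fun τ => ?_)
  · have : Continuous fun τ : ℝ => ‖k‖ * G.osc g (τ • k) s :=
      continuous_const.mul (osc_cont' hg (f := fun τ : ℝ => τ • k) (f' := fun _ => s) (by fun_prop) (by fun_prop))
    exact this.continuousOn.integrableOn_Icc
  · rw [mul_comm]
    exact ContinuousLinearMap.le_opNorm _ _

lemma int_lin_ball (A : E3 →L[ℝ] ℝ) : ∫ y in closedBall (0:E3) 1, A y = 0 := by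
  have h1 : ∫ y in closedBall (0:E3) 1, A y = ∫ y in closedBall (0:E3) 1, A (-y) := by
    rw [← integral_indicator measurableSet_closedBall, ← integral_indicator measurableSet_closedBall,
      ← integral_neg_eq_self]
    congr 1
    funext y
    simp [indicator]
  have h2 : ∫ y in closedBall (0:E3) 1, A (-y) = - ∫ y in closedBall (0:E3) 1, A y := by
    rw [← integral_neg]; simp
  linarith

/-- averaged value -/
def av (G : Geo Srf) (h : ℝ) (g : E3 → ℝ) (p : E3) : ℝ :=
  (volume.real (closedBall (0:E3) 1))⁻¹ * ∫ y in closedBall (0:E3) 1, g (G.a (p + h • y))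

/-- averaged oscillation -/
def avo (G : Geo Srf) (h : ℝ) (g : E3 → ℝ) (s : E3) : ℝ :=
  ∫ z in closedBall (0:E3) (G.L + 1) ×ˢ Icc (0:ℝ) 1, G.osc g ((z.2 * h) • z.1) s

lemma osc_cont2 {g : E3 → ℝ} (hg : ContDiff ℝ 1 g) (h : ℝ) :
    Continuous (fun w : (E3 × ℝ) × E3 => G.osc g ((w.1.2 * h) • w.1.1) w.2) := by
  exact osc_cont' hg (f := fun w : (E3 × ℝ) × E3 => (w.1.2 * h) • w.1.1) (f' := fun w => w.2) (by fun_prop) (by fun_prop)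

lemma cpt_avo : IsCompact (closedBall (0:E3) (G.L + 1) ×ˢ Icc (0:ℝ) 1) :=
  (isCompact_closedBall _ _).prod isCompact_Icc

lemma avo_cont {g : E3 → ℝ} (hg : ContDiff ℝ 1 g) (h : ℝ) : Continuous (G.avo h g) := by
  unfold avo
  refine continuous_parametric_integral_of_continuous (f := fun s (z : E3 × ℝ) => G.osc g ((z.2 * h) • z.1) s) ?_ cpt_avo
  exact osc_cont' hg (f := fun w : E3 × (E3 × ℝ) => (w.2.2 * h) • w.2.1) (f' := fun w => w.1) (by fun_prop) (by fun_prop)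

lemma cvol_pos : 0 < volume.real (closedBall (0:E3) 1) := by
  rw [measureReal_def]
  exact ENNReal.toReal_pos (measure_closedBall_pos _ _ one_pos).ne' measure_closedBall_lt_top.ne

lemma av_pt {g : E3 → ℝ} (hg : ContDiff ℝ 1 g) {s p : E3} (hs : s ∈ Srf.S) {h : ℝ} (hh : 0 < h)
    (hp : ‖p - s‖ ≤ G.L * h) :
    |G.av h g p - g s - ⟪G.gd g s, p - s⟫| ≤
      (volume.real (closedBall (0:E3) 1))⁻¹ * ((G.L + 1) * h) * G.avo h g s := by
  set c := volume.real (closedBall (0:E3) 1) with hc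
  have hc0 : 0 < c := cvol_pos
  set w := g ∘ G.a with hw
  have hws : g s = w s := by simp [hw, G.fix s hs]
  set A := fderiv ℝ w s with hA
  have hwc : Continuous w := (C1_comp (G := G) hg).continuous
  set k : E3 → E3 := fun y => (p - s) + h • y with hk
  have hkc : Continuous k := by fun_prop
  have hsk : ∀ y, p + h • y = s + k y := by intro y; simp only [hk]; abel
  have int1 : ∀ {f : E3 → ℝ}, Continuous f → IntegrableOn f (closedBall (0:E3) 1) := fun hf =>
    hf.continuousOn.integrableOn_compact (isCompact_closedBall _ _)
  have e1 : G.av h g p - g s - ⟪G.gd g s, p - s⟫ =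
      c⁻¹ * ∫ y in closedBall (0:E3) 1, (w (s + k y) - w s - A (k y)) := by
    have i1 : ∫ y in closedBall (0:E3) 1, (w (s + k y) - w s - A (k y)) =
        (∫ y in closedBall (0:E3) 1, w (s + k y)) - c * w s - c * A (p - s) := by
      rw [integral_sub, integral_sub]
      · have : ∫ y in closedBall (0:E3) 1, A (k y) = c * A (p - s) := by
          simp only [hk, map_add, map_smul, smul_eq_mul]
          rw [integral_add, integral_const_mul, int_lin_ball]
          · simp [hc]
          · exact int1 continuous_const
          · exact int1 (continuous_const.mul A.continuous)
        rw [this]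
        simp [hc]
      · exact int1 (hwc.comp (continuous_const.add hkc))
      · exact int1 continuous_const
      · exact (int1 (hwc.comp (continuous_const.add hkc))).sub (int1 continuous_const)
      · exact int1 (A.continuous.comp hkc)
    have i2 : G.av h g p = c⁻¹ * ∫ y in closedBall (0:E3) 1, w (s + k y) := by
      unfold av
      simp only [hsk]
      rfl
    rw [i1, i2, hws, inner_gd]
    field_simp
    rfl
  set J : E3 → ℝ := fun q => ∫ τ in Icc (0:ℝ) 1, G.osc g ((τ * h) • q) s with hJ
  have hJ0 : ∀ q, 0 ≤ J q := fun q => integral_nonneg fun τ => osc_nonneg _ _ _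
  have hJc : Continuous J := by
    refine continuous_parametric_integral_of_continuous (f := fun q (τ : ℝ) => G.osc g ((τ * h) • q) s) ?_ isCompact_Icc
    have := osc_cont' (G := G) hg (f := fun z : E3 × ℝ => (z.2 * h) • z.1) (f' := fun _ => s) (by fun_prop) (by fun_prop)
    exact this
  set b := h⁻¹ • (p - s) with hb
  have hhb : h • b = p - s := by rw [hb, smul_inv_smul₀ hh.ne']
  have hbn : ‖b‖ ≤ G.L := by
    rw [hb, norm_smul, norm_inv, Real.norm_eq_abs, abs_of_pos hh, inv_mul_le_iff₀ hh]; linarith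
  have hkb : ∀ y, k y = h • (y + b) := by intro y; simp only [hk]; rw [smul_add, hhb]; abel
  have hL := G.L_pos
  have e2 : |∫ y in closedBall (0:E3) 1, (w (s + k y) - w s - A (k y))| ≤
      ∫ y in closedBall (0:E3) 1, (G.L + 1) * h * J (y + b) := by
    rw [← Real.norm_eq_abs]
    refine norm_integral_le_of_norm_le (int1 (by fun_prop)) ?_
    filter_upwards [ae_restrict_mem measurableSet_closedBall] with y hy
    have h1 := osc_path (G := G) hg s (k y)
    rw [Real.norm_eq_abs]
    refine h1.trans ?_
    have h2 : (∫ τ in Icc (0:ℝ) 1, G.osc g (τ • k y) s) = J (y + b) := by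
      simp only [hJ, hkb, smul_smul]
    rw [h2]
    refine mul_le_mul_of_nonneg_right ?_ (hJ0 _)
    rw [hkb, norm_smul, Real.norm_eq_abs, abs_of_pos hh, mul_comm]
    refine mul_le_mul_of_nonneg_right ?_ hh.le
    have := norm_add_le y b
    rw [mem_closedBall_zero_iff] at hy
    linarith
  have e3 : ∫ y in closedBall (0:E3) 1, J (y + b) ≤ ∫ q in closedBall (0:E3) (G.L + 1), J q := by
    have i1 : ∫ y in closedBall (0:E3) 1, J (y + b) = ∫ q in closedBall b 1, J q := by
      rw [← integral_indicator measurableSet_closedBall, ← integral_indicator measurableSet_closedBall,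
        ← integral_add_right_eq_self ((closedBall b 1).indicator J) b]
      congr 1
      funext y
      simp [indicator, dist_eq_norm]
    rw [i1]
    refine setIntegral_mono_set (hJc.continuousOn.integrableOn_compact (isCompact_closedBall _ _))
      (Eventually.of_forall fun q => hJ0 q) (LE.le.eventuallyLE fun q hq => ?_)
    rw [mem_closedBall, dist_eq_norm] at hq
    rw [mem_closedBall_zero_iff]
    have := norm_add_le (q - b) b
    rw [sub_add_cancel] at this
    linarith
  have e4 : ∫ q in closedBall (0:E3) (G.L + 1), J q = G.avo h g s := by
    unfold avo
    rw [Measure.volume_eq_prod, setIntegral_prod]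
    have := osc_cont' (G := G) hg (f := fun z : E3 × ℝ => (z.2 * h) • z.1) (f' := fun _ => s) (by fun_prop) (by fun_prop)
    exact this.continuousOn.integrableOn_compact cpt_avo
  rw [e1, abs_mul, abs_of_pos (inv_pos.2 hc0), mul_assoc]
  refine mul_le_mul_of_nonneg_left (e2.trans ?_) (inv_pos.2 hc0).le
  rw [integral_const_mul, ← e4]
  exact mul_le_mul_of_nonneg_left e3 (by positivity)

/-- pointwise bound of the oscillation -/
lemma osc_le {g : E3 → ℝ} (hg : ContDiff ℝ 1 g) {k s : E3} (hs : s ∈ Srf.S) (hk : ‖k‖ ≤ G.r1) :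
    G.osc g k s ≤ G.L * ‖G.gd (fun x => g (G.Phi k x) - g x) s‖ +
      (2 * G.L ^ 3 * ‖k‖) * ‖G.gd g (G.Phi k s)‖ + (G.L * ‖k‖) * ‖G.gd g s‖ := by
  have hL := G.L_pos
  have h1 := nr_gd_shift hk hg hs
  have hkρ : ‖s + k - s‖ < G.ρ := by
    rw [add_sub_cancel_left]; have := (r1_bd hk).1; linarith [G.ρ_pos]
  unfold osc
  refine ContinuousLinearMap.opNorm_le_bound _ (by positivity) fun v => ?_
  have e : (fderiv ℝ (g ∘ G.a) (s + k) - fderiv ℝ (g ∘ G.a) s) v =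
      ⟪G.gd g (G.Phi k s) - G.gd g s, G.D (s + k) v⟫ + ⟪G.gd g s, G.D (s + k) v - G.D s v⟫ := by
    rw [sub_apply, fderiv_off hs hkρ (DA_C1 hg _),
      fderiv_off hs (by simpa using G.ρ_pos) (DA_C1 hg _), G.fix s hs,
      inner_sub_left (G.gd g (G.Phi k s)), inner_sub_right (G.gd g s) (G.D (s + k) v)]
    simp [Phi]
  rw [e]
  have j1 := (abs_real_inner_le_norm (G.gd g (G.Phi k s) - G.gd g s) (G.D (s + k) v)).trans
    (mul_le_mul h1 (G.D_le _ _) (norm_nonneg _) (by positivity))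
  have j2 := (abs_real_inner_le_norm (G.gd g s) (G.D (s + k) v - G.D s v)).trans
    (mul_le_mul_of_nonneg_left (G.D_sub _ _ _) (norm_nonneg _))
  rw [add_sub_cancel_left] at j2
  rw [Real.norm_eq_abs]
  refine (abs_add_le _ _).trans ((add_le_add j1 j2).trans (le_of_eq ?_))
  ring

lemma avo_nr {g ω : E3 → ℝ} (hg : ContDiff ℝ 1 g) (hω : Continuous ω) {B : ℝ} (hB : ∀ x ∈ Srf.S, |ω x| ≤ B) {h K : ℝ}
    (hh : 0 < h) (hr : (G.L + 1) * h ≤ G.r1)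
    (hK : ∀ k : E3, ‖k‖ ≤ (G.L + 1) * h → G.nr (fun s => ω s • G.gd (fun x => g (G.Phi k x) - g x) s) ≤ K) :
    G.nr (fun s => ω s * G.avo h g s) ≤ ((volume : Measure (E3 × ℝ)).restrict (closedBall (0:E3) (G.L + 1) ×ˢ Icc (0:ℝ) 1)).real univ *
      (G.L * K + 5 * G.L ^ 3 * ((G.L + 1) * h) * (B * G.en g)) := by
  have hL := G.L_pos
  have hL1 := G.L_one
  obtain ⟨s0, hs0⟩ := Srf.nonempty
  have hB0 : 0 ≤ B := (abs_nonneg _).trans (hB s0 hs0)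
  have hW := C1W (G := G) hg
  have hK0 : 0 ≤ K := (nr_nonneg _).trans (hK 0 (by simp; positivity))
  have key : ∀ k : E3, ‖k‖ ≤ (G.L + 1) * h → G.nr (fun s => ω s * G.osc g k s) ≤
      G.L * K + 5 * G.L ^ 3 * ((G.L + 1) * h) * (B * G.en g) := by
    intro k hk
    have hkr := hk.trans hr
    have hC : ContDiff ℝ 1 (fun x => g (G.Phi k x) - g x) := (C1_Phi hg k).sub hg
    have c1 : Continuous (fun s => G.gd (fun x => g (G.Phi k x) - g x) s) := cont_gd hC
    have c2 : Continuous (fun s => G.gd g (G.Phi k s)) := (cont_gd hg).comp (Phi_smooth k).continuous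
    have c3 : Continuous (G.gd g) := cont_gd hg
    have bm1 : BM G.mu (fun s => ‖ω s • G.gd (fun x => g (G.Phi k x) - g x) s‖) := bm_of_cont (by fun_prop)
    have bm2 : BM G.mu (fun s => ‖G.gd g (G.Phi k s)‖) := bm_of_cont c2.norm.continuousOn
    have bm3 : BM G.mu (fun s => ‖G.gd g s‖) := bm_of_cont (by fun_prop)
    have n1 : nrm G.mu (fun s => G.L * ‖ω s • G.gd (fun x => g (G.Phi k x) - g x) s‖) ≤ G.L * K := by
      rw [nrm_const_mul, abs_of_pos hL, nrm_norm]
      exact mul_le_mul_of_nonneg_left (hK k hk) hL.le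
    have n2 : nrm G.mu (fun s => (2 * G.L ^ 3 * ‖k‖ * B) * ‖G.gd g (G.Phi k s)‖) ≤ 2 * G.L ^ 3 * ‖k‖ * B * (2 * G.en g) := by
      rw [nrm_const_mul, abs_of_nonneg (by positivity), nrm_norm]
      refine mul_le_mul_of_nonneg_left ?_ (by positivity)
      have := (nr_Phi_le (G := G) hkr c3.continuousOn).1
      have h2 := nrg_le_en hW
      exact this.trans (by linarith)
    have n3 : nrm G.mu (fun s => (G.L * ‖k‖ * B) * ‖G.gd g s‖) ≤ G.L * ‖k‖ * B * G.en g := by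
      rw [nrm_const_mul, abs_of_nonneg (by positivity), nrm_norm]
      exact mul_le_mul_of_nonneg_left (nrg_le_en hW) (by positivity)
    have b1 := (BM.const G.L).mul bm1
    have b2 := (BM.const (2 * G.L ^ 3 * ‖k‖ * B)).mul bm2
    have b3 := (BM.const (G.L * ‖k‖ * B)).mul bm3
    have m1 : G.nr (fun s => ω s * G.osc g k s) ≤ nrm G.mu (fun s => (G.L * ‖ω s • G.gd (fun x => g (G.Phi k x) - g x) s‖ +
        (2 * G.L ^ 3 * ‖k‖ * B) * ‖G.gd g (G.Phi k s)‖) + (G.L * ‖k‖ * B) * ‖G.gd g s‖) := by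
      refine nrm_mono ((b1.add b2).add b3) (ae_of fun s hs => ?_)
      have o := osc_le hg hs hkr
      have o0 := osc_nonneg (G := G) g k s
      have hb := hB s hs
      simp only [norm_mul, norm_smul, Real.norm_eq_abs, abs_of_nonneg o0]
      refine le_trans ?_ (le_abs_self _)
      have p1 := mul_le_mul_of_nonneg_left o (abs_nonneg (ω s))
      have p2 : |ω s| * ((2 * G.L ^ 3 * ‖k‖) * ‖G.gd g (G.Phi k s)‖) ≤ B * ((2 * G.L ^ 3 * ‖k‖) * ‖G.gd g (G.Phi k s)‖) :=
        mul_le_mul_of_nonneg_right hb (by positivity)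
      have p3 : |ω s| * ((G.L * ‖k‖) * ‖G.gd g s‖) ≤ B * ((G.L * ‖k‖) * ‖G.gd g s‖) :=
        mul_le_mul_of_nonneg_right hb (by positivity)
      linarith
    refine m1.trans ((nrm_add_le (b1.add b2) b3).trans ?_)
    have m2 := nrm_add_le b1 b2
    have hBe : 0 ≤ B * G.en g := mul_nonneg hB0 (en_nonneg _)
    have m3 : G.L * ‖k‖ * B * G.en g ≤ G.L ^ 3 * ((G.L + 1) * h) * (B * G.en g) := by
      have : G.L * ‖k‖ ≤ G.L ^ 3 * ((G.L + 1) * h) :=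
        mul_le_mul (le_self_pow₀ hL1 (by norm_num)) hk (norm_nonneg _) (by positivity)
      have := mul_le_mul_of_nonneg_right this hBe
      linarith
    have m4 : 2 * G.L ^ 3 * ‖k‖ * B * (2 * G.en g) ≤ 4 * G.L ^ 3 * ((G.L + 1) * h) * (B * G.en g) := by
      have : 4 * G.L ^ 3 * ‖k‖ ≤ 4 * G.L ^ 3 * ((G.L + 1) * h) := mul_le_mul_of_nonneg_left hk (by positivity)
      have := mul_le_mul_of_nonneg_right this hBe
      linarith
    linarith
  set Q := closedBall (0:E3) (G.L + 1) ×ˢ Icc (0:ℝ) 1 with hQ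
  have hfin : IsFiniteMeasure ((volume : Measure (E3 × ℝ)).restrict Q) := ⟨by
    rw [Measure.restrict_apply_univ]; exact (cpt_avo (G := G)).measure_lt_top⟩
  have e : (fun s => ω s * G.avo h g s) = fun s => ∫ z in Q, ω s * G.osc g ((z.2 * h) • z.1) s := by
    funext s
    rw [integral_const_mul]; rfl
  have hKK : 0 ≤ G.L * K + 5 * G.L ^ 3 * ((G.L + 1) * h) * (B * G.en g) := by
    have := en_nonneg (G := G) g
    positivity
  rw [e]
  refine nrm_avg (F := fun (z : E3 × ℝ) s => ω s * G.osc g ((z.2 * h) • z.1) s) ?_ hKK ?_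
  · have hm : G.mu = G.mu.restrict Srf.S := by rw [mu, Measure.restrict_restrict mS, inter_self]
    rw [hm]
    refine bm_prod_compact (F := fun (z : E3 × ℝ) s => ω s * G.osc g ((z.2 * h) • z.1) s) Srf.compact cpt_avo mS (cpt_avo (G := G)).isClosed.measurableSet ?_
    exact (hω.comp continuous_snd).mul (osc_cont2 hg h)
  · filter_upwards [ae_restrict_mem (cpt_avo (G := G)).isClosed.measurableSet] with z hz
    refine key _ ?_
    rw [norm_smul, Real.norm_eq_abs, abs_of_nonneg (mul_nonneg hz.2.1 hh.le)]
    have h1 := mem_closedBall_zero_iff.1 hz.1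
    have h2 : z.2 * h ≤ h := by nlinarith [hz.2.2]
    have := mul_le_mul h2 h1 (norm_nonneg _) hh.le
    linarith

end Geo
end PartN19

section PartN20
namespace FE
open Geo
variable {Srf : SmoothSurface}

/-- Clement type interpolation -/
lemma clement (G : Geo Srf) {γ : ℝ} (hγ : 0 < γ) : ∃ C : ℝ, 0 ≤ C ∧ ∀ {h : ℝ} {Tr : Triangulation Srf γ h} (_ : FE G Tr)
    (g ω : E3 → ℝ) (_ : ContDiff ℝ 1 g) (_ : Continuous ω) (B : ℝ) (_ : ∀ x ∈ Srf.S, |ω x| ≤ B) (K : ℝ)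
    (_ : ∀ k : E3, ‖k‖ ≤ (G.L + 1) * h → G.nr (fun s => ω s • G.gd (fun x => g (G.Phi k x) - g x) s) ≤ K),
    ∃ v, Tr.IsVh v ∧ G.nr (fun s => ω s * (g s - Tr.liftS v s)) ≤ C * h * (K + h * (B * G.en g)) ∧
      G.nr (fun s => ω s • G.gd (fun x => g x - Tr.liftS v x) s) ≤ C * (K + h * (B * G.en g)) := by
  set c := volume.real (closedBall (0:E3) 1) with hc
  have hc0 : 0 < c := cvol_pos
  set q := ((volume : Measure (E3 × ℝ)).restrict (closedBall (0:E3) (G.L + 1) ×ˢ Icc (0:ℝ) 1)).real univ with hq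
  have hq0 : 0 ≤ q := measureReal_nonneg
  have hL := G.L_pos
  have hL1 := G.L_one
  set C₁ := c⁻¹ * (G.L + 1) * q * (5 * G.L ^ 3 * (G.L + 1)) + G.L with hC₁
  have hC0 : 0 ≤ C₁ := by positivity
  refine ⟨C₁ * (1 + 4 / γ), by positivity, fun {h Tr} F g ω hg hω B hB K hK => ?_⟩
  have hh := F.h0
  have hh1 := F.h1
  obtain ⟨s0, hs0⟩ := Srf.nonempty
  have hB0 : 0 ≤ B := (abs_nonneg _).trans (hB s0 hs0)
  have hK0 : 0 ≤ K := (nr_nonneg _).trans (hK 0 (by simp; positivity))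
  have he0 := en_nonneg (G := G) g
  have hr : (G.L + 1) * h ≤ G.r1 := by
    have h1 := F.small
    have h2 := G.r1_mul
    have h3 : γ ^ 2 ≤ 1 := pow_le_one₀ hγ.le F.γ1
    have h4 : G.ρ * γ ^ 2 ≤ G.ρ := by nlinarith [G.ρ_pos]
    have h5 : G.L ^ 6 = G.L ^ 4 * G.L ^ 2 := by ring
    have h6 : 64 * G.L ^ 4 * ((G.L + 1) * h) ≤ 64 * G.L ^ 4 * G.r1 := by
      rw [h2]
      refine le_trans ?_ (h1.trans h4)
      rw [h5]
      have : G.L + 1 ≤ 2 * G.L ^ 2 := by nlinarith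
      have := mul_le_mul_of_nonneg_left (mul_le_mul_of_nonneg_right this hh.le) (by positivity : 0 ≤ 64 * G.L ^ 4)
      have : 0 ≤ G.L ^ 4 * G.L ^ 2 * h := by positivity
      linarith
    exact le_of_mul_le_mul_left h6 (by positivity)
  have hA := avo_nr hg hω hB hh hr hK
  obtain ⟨v, hv, hn⟩ := exists_interp Tr (G.av h g)
  set b : E3 → ℝ := fun s => c⁻¹ * ((G.L + 1) * h) * G.avo h g s + G.L * h ^ 2 * ‖G.gd g s‖ with hb
  have havo : ∀ s, 0 ≤ G.avo h g s := fun s => integral_nonneg fun z => osc_nonneg _ _ _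
  have hb0 : ∀ s, 0 ≤ b s := fun s => by have := havo s; positivity
  have hpt : ∀ᵐ s ∂G.mu, |g s - Tr.liftS v s| ≤ b s ∧ ‖G.gd (fun x => g x - Tr.liftS v x) s‖ ≤ 4 / (γ * h) * b s := by
    filter_upwards [F.good_ae, (F.lift_W hv).2] with s ⟨t, x, gd⟩ hDA
    have hs := gd.mem F
    have key := gd.taylor' F hv (g := G.gd g s) (gd_tan _ hs) (r := g s)
      (β := c⁻¹ * ((G.L + 1) * h) * G.avo h g s) fun p hp => by
        rw [hn t gd.ht p hp]
        exact av_pt hg hs hh (gd.disp F hp).2.1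
    rw [gd_sub (DA_C1 hg s) hDA, abs_sub_comm, norm_sub_rev]
    refine ⟨key.1, key.2.trans (le_of_eq ?_)⟩
    rw [hb]; ring
  have ca : Continuous (G.avo h g) := avo_cont hg h
  have cg : Continuous (G.gd g) := cont_gd hg
  have bm1 : BM G.mu (fun s => ω s * G.avo h g s) := bm_of_cont (by fun_prop)
  have bmg : BM G.mu (fun s => ‖G.gd g s‖) := bm_of_cont (by fun_prop)
  have bmb : BM G.mu (fun s => ω s * b s) := bm_of_cont (by fun_prop)
  have hcb : nrm G.mu (fun s => ω s * b s) ≤ C₁ * h * (K + h * (B * G.en g)) := by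
    have n1 : nrm G.mu (fun s => ω s * b s) ≤ nrm G.mu (fun s => (c⁻¹ * ((G.L + 1) * h)) * |ω s * G.avo h g s| + (G.L * h ^ 2 * B) * ‖G.gd g s‖) := by
      refine nrm_mono (((BM.const _).mul bm1.abs).add ((BM.const _).mul bmg)) (ae_of fun s hs => ?_)
      have := hb0 s
      have := havo s
      rw [norm_mul, Real.norm_eq_abs, Real.norm_eq_abs, Real.norm_eq_abs, abs_of_nonneg (hb0 s), abs_mul, abs_of_nonneg (havo s)]
      refine le_trans ?_ (le_abs_self _)
      rw [hb]
      have h1 := mul_le_mul_of_nonneg_right (hB s hs) (by positivity : 0 ≤ G.L * h ^ 2 * ‖G.gd g s‖)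
      linarith
    refine n1.trans ((nrm_add_le ((BM.const _).mul bm1.abs) ((BM.const _).mul bmg)).trans ?_)
    rw [nrm_const_mul, nrm_const_mul, nrm_norm, abs_of_nonneg (by positivity), abs_of_nonneg (by positivity)]
    have e1 : nrm G.mu (fun x => |ω x * G.avo h g x|) = G.nr (fun s => ω s * G.avo h g s) :=
      nrm_norm (fun s => ω s * G.avo h g s)
    rw [e1]
    have i1 := mul_le_mul_of_nonneg_left hA (by positivity : 0 ≤ c⁻¹ * ((G.L + 1) * h))
    have i2 := mul_le_mul_of_nonneg_left (nrg_le_en (C1W (G := G) hg)) (by positivity : 0 ≤ G.L * h ^ 2 * B)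
    refine (add_le_add i1 i2).trans ?_
    have hLL : G.L ≤ 5 * G.L ^ 3 * (G.L + 1) := by
      have := le_self_pow₀ hL1 (by norm_num : 3 ≠ 0)
      nlinarith
    have i3 : G.L * K + 5 * G.L ^ 3 * ((G.L + 1) * h) * (B * G.en g) ≤ (5 * G.L ^ 3 * (G.L + 1)) * (K + h * (B * G.en g)) := by
      have := mul_le_mul_of_nonneg_right hLL hK0
      linarith
    have i4 := mul_le_mul_of_nonneg_left i3 (by positivity : 0 ≤ c⁻¹ * ((G.L + 1) * h) * q)
    have i5 : 0 ≤ G.L * h * K := by positivity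
    rw [hC₁]
    linarith
  have hBe : 0 ≤ B * G.en g := by positivity
  have hX : 0 ≤ K + h * (B * G.en g) := by positivity
  refine ⟨v, hv, ?_, ?_⟩
  · refine (nrm_mono bmb ?_).trans (hcb.trans ?_)
    · filter_upwards [hpt] with s hs
      rw [norm_mul, norm_mul, Real.norm_eq_abs (b s), abs_of_nonneg (hb0 s)]
      exact mul_le_mul_of_nonneg_left hs.1 (norm_nonneg _)
    · have : 0 ≤ C₁ * (4 / γ) * (h * (K + h * (B * G.en g))) := by positivity
      linarith
  · have m : G.nr (fun s => ω s • G.gd (fun x => g x - Tr.liftS v x) s) ≤ nrm G.mu (fun s => 4 / (γ * h) * (ω s * b s)) := by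
      refine nrm_mono ((BM.const _).mul bmb) ?_
      filter_upwards [hpt] with s hs
      rw [norm_smul, norm_mul, norm_mul, Real.norm_eq_abs (b s), abs_of_nonneg (hb0 s), Real.norm_eq_abs (4 / (γ * h)), abs_of_pos (by positivity)]
      have := mul_le_mul_of_nonneg_left hs.2 (norm_nonneg (ω s))
      linarith
    refine m.trans ?_
    rw [nrm_const_mul, abs_of_pos (by positivity)]
    refine (mul_le_mul_of_nonneg_left hcb (by positivity)).trans ?_
    have e : 4 / (γ * h) * (C₁ * h * (K + h * (B * G.en g))) = C₁ * (4 / γ) * (K + h * (B * G.en g)) := by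
      field_simp
    rw [e]
    have : 0 ≤ C₁ * (K + h * (B * G.en g)) := by positivity
    linarith

lemma r1_small {G : Geo Srf} {γ h : ℝ} {Tr : Triangulation Srf γ h} (F : FE G Tr) : (G.L + 1) * h ≤ G.r1 := by
  have hL := G.L_pos
  have hL1 := G.L_one
  have hh := F.h0
  have h1 := F.small
  have h2 := G.r1_mul
  have h3 : γ ^ 2 ≤ 1 := pow_le_one₀ F.γ0.le F.γ1
  have h4 : G.ρ * γ ^ 2 ≤ G.ρ := by nlinarith [G.ρ_pos]
  have h5 : G.L ^ 6 = G.L ^ 4 * G.L ^ 2 := by ring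
  have h6 : 64 * G.L ^ 4 * ((G.L + 1) * h) ≤ 64 * G.L ^ 4 * G.r1 := by
    rw [h2]
    refine le_trans ?_ (h1.trans h4)
    rw [h5]
    have : G.L + 1 ≤ 2 * G.L ^ 2 := by nlinarith
    have := mul_le_mul_of_nonneg_left (mul_le_mul_of_nonneg_right this hh.le) (by positivity : 0 ≤ 64 * G.L ^ 4)
    have : 0 ≤ G.L ^ 4 * G.L ^ 2 * h := by positivity
    linarith
  exact le_of_mul_le_mul_left h6 (by positivity)

/-- approximation of near solutions with square integrable data -/
lemma clemR (G : Geo Srf) {γ : ℝ} (hγ : 0 < γ) : ∃ C : ℝ, 0 ≤ C ∧ ∀ {h : ℝ} {Tr : Triangulation Srf γ h} (_ : FE G Tr)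
    (w φ : E3 → ℝ) (_ : ContDiff ℝ 1 w) (_ : BM G.mu φ) (δ : ℝ) (_ : 0 ≤ δ)
    (_ : ∀ v, G.W v → |G.form w v - ∫ x, φ x * v x ∂G.mu| ≤ δ * G.en v),
    ∃ v, Tr.IsVh v ∧ G.en (fun x => w x - Tr.liftS v x) ≤ C * (h * G.nr φ + δ) := by
  obtain ⟨C₁, hC₁, h₁⟩ := clement G hγ
  obtain ⟨C₂, hC₂, h₂⟩ := regR (G := G)
  have hL := G.L_pos
  refine ⟨2 * C₁ * (C₂ * (G.L + 2) + 1), by positivity, fun {h Tr} F w φ hw hφ δ hδ hsol => ?_⟩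
  have hh := F.h0
  have hh1 := F.h1
  have hn0 := nr_nonneg (G := G) φ
  have hB : ∀ x ∈ Srf.S, |(fun _ : E3 => (1:ℝ)) x| ≤ 1 := fun x _ => by simp
  obtain ⟨v, hv, k1, k2⟩ := h₁ F w (fun _ => 1) hw continuous_const 1 hB (C₂ * ((G.L + 1) * h * G.nr φ + δ)) (by
    intro k hk
    have hC : ContDiff ℝ 1 (fun x => w (G.Phi k x) - w x) := (C1_Phi hw k).sub hw
    have := h₂ k (hk.trans (r1_small F)) w φ hw hφ δ hδ hsol
    simp only [one_smul]
    refine (nrg_le_en (C1W hC)).trans (this.trans ?_)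
    have := mul_le_mul_of_nonneg_right hk hn0
    exact mul_le_mul_of_nonneg_left (by linarith) hC₂)
  refine ⟨v, hv, ?_⟩
  simp only [one_smul, one_mul] at k1 k2
  have hW : G.W (fun x => w x - Tr.liftS v x) := (C1W hw).sub (F.lift_W hv)
  refine (en_le_add hW).trans ?_
  have hes := en_sol_le (C1W hw) hφ hδ hsol
  set X := C₂ * ((G.L + 1) * h * G.nr φ + δ) + h * G.en w with hX
  have hX0 : 0 ≤ X := by have := en_nonneg (G := G) w; positivity
  have i1 : C₁ * h * X ≤ C₁ * X := by
    have := mul_le_mul_of_nonneg_left hh1 (mul_nonneg hC₁ hX0)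
    linarith
  have i2 : X ≤ (C₂ * (G.L + 2) + 1) * (h * G.nr φ + δ) := by
    have j1 : h * G.en w ≤ h * G.nr φ + δ := by
      have a1 := mul_le_mul_of_nonneg_left hes hh.le
      have a2 : h * δ ≤ 1 * δ := mul_le_mul_of_nonneg_right hh1 hδ
      linarith
    have j2 : 0 ≤ C₂ * (h * G.nr φ) := by positivity
    have j3 : 0 ≤ C₂ * (G.L + 1) * δ := by positivity
    rw [hX]
    linarith
  have i3 := mul_le_mul_of_nonneg_left i2 hC₁
  linarith

/-- weighted approximation of near solutions with localized data -/
lemma clemW (G : Geo Srf) {γ : ℝ} (hγ : 0 < γ) {K : ℝ} (hK : G.L + 1 ≤ K) : ∃ C : ℝ, 0 ≤ C ∧ ∀ {h : ℝ} {Tr : Triangulation Srf γ h} (_ : FE G Tr)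
    (z : E3) (_ : z ∈ Srf.S) (w φ : E3 → ℝ) (_ : ContDiff ℝ 1 w) (_ : G.Loc K z h φ) (δ : ℝ) (_ : 0 ≤ δ)
    (_ : ∀ v, G.W v → |G.form w v - ∫ x, φ x * v x ∂G.mu| ≤ δ * G.en v),
    ∃ v, Tr.IsVh v ∧ G.nr (fun s => sg z h s * (w s - Tr.liftS v s)) ≤ C * h * (h * (G.en w + 1) + δ) ∧
      G.nr (fun s => sg z h s • G.gd (fun x => w x - Tr.liftS v x) s) ≤ C * (h * (G.en w + 1) + δ) := by
  obtain ⟨C₁, hC₁, h₁⟩ := clement G hγ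
  have hL := G.L_pos
  obtain ⟨C₂, hC₂, h₂⟩ := regW (G := G) K (by linarith)
  set R := Metric.diam Srf.S
  have hR : 0 ≤ R := Metric.diam_nonneg
  refine ⟨C₁ * (√C₂ + (R + 1)), by positivity, fun {h Tr} F z hz w φ hw hφ δ hδ hsol => ?_⟩
  have hh := F.h0
  have hh1 := F.h1
  have he := en_nonneg (G := G) w
  have hB : ∀ x ∈ Srf.S, |sg z h x| ≤ R + 1 := fun x hx => by
    rw [abs_of_nonneg (sg_nonneg _ _ _)]
    have h1 := sg_le z hh.le x
    have h2 : ‖x - z‖ ≤ R := by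
      rw [← dist_eq_norm]; exact Metric.dist_le_diam_of_mem Srf.compact.isBounded hx hz
    linarith
  set Y := h * (G.en w + 1) + δ with hY
  have hY0 : 0 ≤ Y := by positivity
  obtain ⟨v, hv, k1, k2⟩ := h₁ F w (sg z h) hw (sg_cont z h) (R + 1) hB (√C₂ * Y) (by
    intro k hk
    have := h₂ z hz h hh hh1 k (hk.trans (r1_small F)) (hk.trans (mul_le_mul_of_nonneg_right hK hh.le)) w φ hw hφ δ hδ hsol
    unfold N2 at this
    have h3 : h ^ 2 * (G.en w + 1) ^ 2 + δ ^ 2 ≤ Y ^ 2 := by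
      have : 0 ≤ h * (G.en w + 1) * δ := by positivity
      rw [hY]; nlinarith
    have h4 : C₂ * (h ^ 2 * (G.en w + 1) ^ 2 + δ ^ 2) ≤ (√C₂ * Y) ^ 2 := by
      rw [mul_pow, Real.sq_sqrt hC₂]
      exact mul_le_mul_of_nonneg_left h3 hC₂
    refine le_of_sq_le_sq ?_ (by positivity)
    refine le_trans ?_ (this.trans h4)
    linarith [sq_nonneg (G.nr fun x => sg z h x * (w (G.Phi k x) - w x))])
  have hX : √C₂ * Y + h * ((R + 1) * G.en w) ≤ (√C₂ + (R + 1)) * Y := by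
    have : h * G.en w ≤ Y := by rw [hY]; linarith
    have := mul_le_mul_of_nonneg_left this (by positivity : 0 ≤ R + 1)
    linarith
  refine ⟨v, hv, k1.trans ?_, k2.trans ?_⟩
  · have := mul_le_mul_of_nonneg_left hX (by positivity : 0 ≤ C₁ * h)
    linarith
  · have := mul_le_mul_of_nonneg_left hX hC₁
    linarith

end FE
end PartN20

section PartN21
namespace FE
open Geo
variable {Srf : SmoothSurface}

/-- discrete/continuous Green pair -/
structure GP (G : Geo Srf) {γ h : ℝ} (Tr : Triangulation Srf γ h) (φ g gh : E3 → ℝ) : Prop where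
  C1 : ContDiff ℝ 1 g
  vh : Tr.IsVh gh
  sol : ∀ v, G.W v → |G.form g v - ∫ x, φ x * v x ∂G.mu| ≤ h ^ 2 * G.en v
  dsol : ∀ v, Tr.IsVh v → |G.form (Tr.liftS gh) (Tr.liftS v) - ∫ x, φ x * Tr.liftS v x ∂G.mu| ≤ h ^ 2 * G.en (Tr.liftS v)

/-- error of the Green pair -/
def ER {γ h : ℝ} (Tr : Triangulation Srf γ h) (g gh : E3 → ℝ) : E3 → ℝ := fun x => g x - Tr.liftS gh x

variable {G : Geo Srf} {γ h : ℝ} {Tr : Triangulation Srf γ h}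

lemma exists_GP (F : FE G Tr) {φ : E3 → ℝ} (hφ : BM G.mu φ) : ∃ g gh, GP G Tr φ g gh := by
  have hδ : 0 < h ^ 2 := pow_pos F.h0 2
  obtain ⟨g, hg, hs⟩ := near_sol hφ hδ
  obtain ⟨w, ⟨gh, hgh, rfl⟩, hd⟩ := near_min (G := G) (fun v => ∃ w, Tr.IsVh w ∧ v = Tr.liftS w)
    (by rintro v ⟨w, hw, rfl⟩; exact F.lift_W hw) ⟨_, _, Vh_zero, rfl⟩
    (by
      rintro v w ⟨v', hv, rfl⟩ ⟨w', hw, rfl⟩ t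
      exact ⟨_, Vh_add_smul hv hw t, rfl⟩) hφ hδ
  exact ⟨g, gh, hg, hgh, hs, fun v hv => hd _ ⟨v, hv, rfl⟩⟩

variable {φ g gh : E3 → ℝ}

lemma GP.W (F : FE G Tr) (P : GP G Tr φ g gh) : G.W (ER Tr g gh) := (C1W P.C1).sub (F.lift_W P.vh)

lemma GP.orth (F : FE G Tr) (P : GP G Tr φ g gh) {v : E3 → ℝ} (hv : Tr.IsVh v) :
    |G.form (ER Tr g gh) (Tr.liftS v)| ≤ 2 * h ^ 2 * G.en (Tr.liftS v) := by
  have e : G.form (ER Tr g gh) (Tr.liftS v) = G.form g (Tr.liftS v) - G.form (Tr.liftS gh) (Tr.liftS v) :=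
    form_sub_left (C1W P.C1) (F.lift_W P.vh) (F.lift_W hv)
  have h1 := P.sol _ (F.lift_W hv)
  have h2 := P.dsol v hv
  rw [e]
  rw [abs_le] at *
  constructor <;> linarith [h1.1, h1.2, h2.1, h2.2]

lemma GP.en_gh (F : FE G Tr) (P : GP G Tr φ g gh) : G.en (Tr.liftS gh) ≤ G.en g + 2 * h ^ 2 := by
  have hW := F.lift_W P.vh
  have e : G.form (ER Tr g gh) (Tr.liftS gh) = G.form g (Tr.liftS gh) - G.form (Tr.liftS gh) (Tr.liftS gh) :=
    form_sub_left (C1W P.C1) hW hW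
  have h1 := P.orth F P.vh
  have h2 := form_cs (C1W (G := G) P.C1) hW
  rw [e, ← en_sq] at h1
  have h3 := (abs_le.1 h1).1
  have h4 := (abs_le.1 h2).2
  rcases (en_nonneg (G := G) (Tr.liftS gh)).eq_or_lt with h0 | h0
  · rw [← h0]; have := en_nonneg (G := G) g; positivity
  · refine le_of_mul_le_mul_right ?_ h0
    nlinarith

lemma GP.en_E (F : FE G Tr) (P : GP G Tr φ g gh) : G.en (ER Tr g gh) ≤ 2 * (G.en g + 1) := by
  have h1 := en_sub_le (C1W (G := G) P.C1) (F.lift_W P.vh)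
  have h2 := P.en_gh F
  have h3 : h ^ 2 ≤ 1 := pow_le_one₀ F.h0.le F.h1
  refine h1.trans ?_
  linarith

lemma GP.L2 (G : Geo Srf) {γ : ℝ} (hγ : 0 < γ) : ∃ C : ℝ, 0 ≤ C ∧ ∀ {h : ℝ} {Tr : Triangulation Srf γ h} (_ : FE G Tr)
    {φ g gh : E3 → ℝ} (_ : GP G Tr φ g gh), G.nr (ER Tr g gh) ≤ C * (h * (G.en g + 1)) := by
  obtain ⟨C, hC, hcl⟩ := clemR G hγ
  refine ⟨2 * (2 * C + 1) + 4 * (C + 1), by positivity, fun {h Tr} F φ g gh P => ?_⟩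
  have hh := F.h0
  have hh1 := F.h1
  have he := en_nonneg (G := G) g
  have hW := P.W F
  set E := ER Tr g gh with hE
  set X := h * (G.en g + 1) with hX
  have hX0 : 0 ≤ X := by positivity
  rcases (nr_nonneg (G := G) E).eq_or_lt with h0 | h0
  · rw [← h0]; positivity
  obtain ⟨w, hw, hs⟩ := near_sol (G := G) hW.bm (mul_pos hh h0)
  obtain ⟨v, hv, hvv⟩ := hcl F w E hw hW.bm _ (mul_pos hh h0).le hs
  have hVW := F.lift_W hv
  have hwW := C1W (G := G) hw
  have e1 : ∫ x, E x * E x ∂G.mu = G.nr E ^ 2 := by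
    rw [Geo.nr, nrm_sq]; congr 1; funext x; rw [Real.norm_eq_abs, sq_abs, sq]
  have h1 := hs E hW
  rw [e1] at h1
  have hsum : G.form (fun x => w x - Tr.liftS v x) E = G.form w E - G.form (Tr.liftS v) E := form_sub_left hwW hVW hW
  have h2 := form_cs (hwW.sub hVW) hW
  rw [hsum] at h2
  have h3 := P.orth F hv
  rw [form_symm] at h3
  have hen := P.en_E F
  have hnE := h0.le
  -- energy of w and v
  have hew := en_sol_le hwW hW.bm (mul_pos hh h0).le hs
  have hev : G.en (Tr.liftS v) ≤ G.en w + G.en (fun x => w x - Tr.liftS v x) := by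
    have := en_sub_le hwW (hwW.sub hVW)
    simpa using this
  set n := G.nr E
  have hev2 : G.en (Tr.liftS v) ≤ 2 * (C + 1) * n := by
    have a1 : h * n ≤ n := by nlinarith
    have a2 : C * (h * n + h * n) ≤ C * (n + n) := mul_le_mul_of_nonneg_left (by linarith) hC
    linarith
  have hh2 : h ^ 2 ≤ X := by rw [hX]; nlinarith
  have b1 : (G.en fun x => w x - Tr.liftS v x) * G.en E ≤ 2 * C * (h * n) * (2 * (G.en g + 1)) :=
    mul_le_mul (by linarith) hen (en_nonneg _) (by positivity)
  have b2 : 2 * h ^ 2 * G.en (Tr.liftS v) ≤ 2 * X * (2 * (C + 1) * n) :=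
    mul_le_mul (by linarith) hev2 (en_nonneg _) (by positivity)
  have b3 : h * n * G.en E ≤ h * n * (2 * (G.en g + 1)) := mul_le_mul_of_nonneg_left hen (by positivity)
  have c1 := (abs_le.1 h1).1
  have c2 := (abs_le.1 h2).2
  have c3 := (abs_le.1 h3).2
  have fin : n * n ≤ n * ((2 * (2 * C + 1) + 4 * (C + 1)) * X) := by
    have d1 : 2 * C * (h * n) * (2 * (G.en g + 1)) = n * (4 * C * X) := by rw [hX]; ring
    have d2 : h * n * (2 * (G.en g + 1)) = n * (2 * X) := by rw [hX]; ring
    rw [d1] at b1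
    rw [d2] at b3
    linarith [sq n]
  exact le_of_mul_le_mul_left fin h0

end FE
end PartN21

section PartN22
namespace Geo
variable {Srf : SmoothSurface} {G : Geo Srf}

lemma form_wgt {B : ℝ} {σ : E3 → ℝ} (h : G.Wgt B σ) {e k : E3 → ℝ} (he : G.W e) (hk : G.W k) :
    |G.form e (fun x => σ x ^ 2 * k x)| ≤ G.nr (fun x => σ x • G.gd e x) *
      (G.nr (fun x => σ x • G.gd k x) + 2 * G.nr k) +
      G.nr (fun x => σ x * e x) * G.nr (fun x => σ x * k x) := by
  have hσb := h.bm
  obtain ⟨hB, hs, hc, hσ⟩ := h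
  have b1 : BM G.mu (fun x => σ x • G.gd e x) := hσb.smul he.bmg
  have b2 : BM G.mu (fun x => σ x * e x) := hσb.mul he.bm
  have b3 : BM G.mu (fun x => σ x • G.gd k x) := hσb.smul hk.bmg
  have b4 : BM G.mu (fun x => σ x * k x) := hσb.mul hk.bm
  have b5 : BM G.mu (fun x => 2 * ‖k x‖) := (BM.const 2).mul hk.bm.norm
  have b6 : BM G.mu (fun x => ‖σ x • G.gd k x‖ + 2 * ‖k x‖) := b3.norm.add b5
  have i1 : Integrable (fun x => ‖σ x • G.gd e x‖ * ‖‖σ x • G.gd k x‖ + 2 * ‖k x‖‖) G.mu :=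
    (b1.norm.mul b6.norm).integrable
  have i2 : Integrable (fun x => ‖σ x * e x‖ * ‖σ x * k x‖) G.mu := (b2.norm.mul b4.norm).integrable
  have key : |G.form e (fun x => σ x ^ 2 * k x)| ≤
      ∫ x, (‖σ x • G.gd e x‖ * ‖‖σ x • G.gd k x‖ + 2 * ‖k x‖‖ + ‖σ x * e x‖ * ‖σ x * k x‖) ∂G.mu := by
    rw [← Real.norm_eq_abs]
    refine norm_integral_le_of_norm_le (i1.add i2) ?_
    filter_upwards [hk.2, ae_mem] with x hd hx
    obtain ⟨p1, p2, p3⟩ := hσ x hx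
    rw [gd_mul hx (DA_C1 hs x) hd]
    refine (norm_add_le _ _).trans (add_le_add ?_ ?_)
    · refine (norm_inner_le_norm _ _).trans ?_
      have : ‖σ x ^ 2 • G.gd k x + k x • G.gd (fun x => σ x ^ 2) x‖ ≤
          σ x * (‖σ x • G.gd k x‖ + 2 * ‖k x‖) := by
        refine (norm_add_le _ _).trans ?_
        rw [norm_smul, norm_smul, norm_smul, norm_pow, Real.norm_eq_abs, abs_of_pos p1]
        have : ‖k x‖ * ‖G.gd (fun x => σ x ^ 2) x‖ ≤ ‖k x‖ * (2 * σ x) := by gcongr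
        linarith
      refine (mul_le_mul_of_nonneg_left this (norm_nonneg _)).trans ?_
      rw [norm_smul (σ x) (G.gd e x), Real.norm_eq_abs (σ x), abs_of_pos p1, Real.norm_eq_abs (_ + _),
        abs_of_nonneg (by positivity)]
      exact le_of_eq (by ring)
    · rw [← norm_mul]
      exact le_of_eq (by congr 1; ring)
  refine key.trans ?_
  rw [integral_add i1 i2]
  refine add_le_add ((cs_nrm b1 b6).trans (mul_le_mul_of_nonneg_left ?_ (nrm_nonneg _))) (cs_nrm b2 b4)
  refine (nrm_add_le b3.norm b5).trans ?_
  rw [nrm_const_mul, nrm_norm, nrm_norm, abs_of_nonneg (by norm_num)]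
  rfl

end Geo
namespace FE
open Geo
variable {Srf : SmoothSurface}

/-- superapproximation in the energy norm -/
lemma super_en (G : Geo Srf) {γ : ℝ} (hγ : 0 < γ) : ∃ C : ℝ, 0 ≤ C ∧ ∀ {h : ℝ} {Tr : Triangulation Srf γ h}
    (_ : FE G Tr) (z : E3) (_ : z ∈ Srf.S) (ζ : E3 → ℝ) (_ : Tr.IsVh ζ), ∃ v, Tr.IsVh v ∧
      G.en (fun x => sg z h x ^ 2 * Tr.liftS ζ x - Tr.liftS v x) ≤
        C * h * (G.nr (Tr.liftS ζ) + G.nr (fun x => sg z h x • G.gd (Tr.liftS ζ) x)) := by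
  obtain ⟨C, hC, hs⟩ := superapprox G
  obtain ⟨B, hB, hw⟩ := wgt_sg (G := G)
  refine ⟨4 * C / γ + C, by positivity, fun {h Tr} F z hz ζ hζ => ?_⟩
  obtain ⟨v, hv, hn⟩ := exists_interp Tr (fun p => sg z h p ^ 2 * ζ p)
  refine ⟨v, hv, ?_⟩
  have hwg := hw z hz h F.h0 F.h1
  have hσb := hwg.bm
  have hZ := F.lift_W hζ
  have hV := F.lift_W hv
  have hWs := C1W (G := G) hwg.2.1
  have hP : G.W (fun x => sg z h x ^ 2 * Tr.liftS ζ x) := hWs.mul hZ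
  have b3 : BM G.mu (fun x => sg z h x • G.gd (Tr.liftS ζ) x) := hσb.smul hZ.bmg
  have bM : BM G.mu (fun x => ‖Tr.liftS ζ x‖ + ‖sg z h x • G.gd (Tr.liftS ζ) x‖) := hZ.bm.norm.add b3.norm
  have hs' := hs F z hz ζ v hζ hv hn
  have nM : nrm G.mu (fun x => ‖Tr.liftS ζ x‖ + ‖sg z h x • G.gd (Tr.liftS ζ) x‖) ≤
      G.nr (Tr.liftS ζ) + G.nr (fun x => sg z h x • G.gd (Tr.liftS ζ) x) := by
    refine (nrm_add_le hZ.bm.norm b3.norm).trans ?_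
    rw [nrm_norm, nrm_norm]; rfl
  have h0 := F.h0
  have h1 := F.h1
  have n1 : G.nr (G.gd (fun x => sg z h x ^ 2 * Tr.liftS ζ x - Tr.liftS v x)) ≤
      nrm G.mu (fun x => (4 * C / γ * h) * (‖Tr.liftS ζ x‖ + ‖sg z h x • G.gd (Tr.liftS ζ) x‖)) := by
    refine nrm_mono ((BM.const _).mul bM) ?_
    filter_upwards [hs', hP.2, hV.2] with x hx d1 d2
    rw [gd_sub d1 d2, norm_sub_rev]
    refine hx.2.trans (le_trans (le_of_eq ?_) (le_abs_self _))
    rw [norm_smul, Real.norm_eq_abs, Real.norm_eq_abs, abs_of_nonneg (sg_nonneg z h x)]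
  have n2 : G.nr (fun x => sg z h x ^ 2 * Tr.liftS ζ x - Tr.liftS v x) ≤
      nrm G.mu (fun x => (C * h) * (‖Tr.liftS ζ x‖ + ‖sg z h x • G.gd (Tr.liftS ζ) x‖)) := by
    refine nrm_mono ((BM.const _).mul bM) ?_
    filter_upwards [hs'] with x hx
    rw [norm_sub_rev]
    refine hx.1.trans (le_trans ?_ (le_abs_self _))
    rw [norm_smul, Real.norm_eq_abs, Real.norm_eq_abs, abs_of_nonneg (sg_nonneg z h x)]
    have := sg_nonneg z h x
    refine mul_le_mul_of_nonneg_right ?_ (by positivity)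
    nlinarith [mul_nonneg hC h0.le]
  rw [nrm_const_mul, abs_of_nonneg (by positivity)] at n1 n2
  refine (en_le_add (hP.sub hV)).trans ?_
  have k1 := mul_le_mul_of_nonneg_left nM (show 0 ≤ 4 * C / γ * h by positivity)
  have k2 := mul_le_mul_of_nonneg_left nM (show 0 ≤ C * h by positivity)
  linarith

lemma quad_aux {s X K : ℝ} (hX : 0 ≤ X) (hK : 0 ≤ K) (h : s ^ 2 ≤ K * X * (s + X)) : s ≤ (K + 1) * X := by
  by_contra hc
  push Not at hc
  have hs : 0 < s := lt_of_le_of_lt (by positivity) hc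
  have e1 : (K + 1) * X * s ≤ s * s := mul_le_mul_of_nonneg_right hc.le hs.le
  have e2 : X * ((K + 1) * X) ≤ X * s := mul_le_mul_of_nonneg_left hc.le hX
  have : X * X ≤ 0 := by nlinarith
  have hX0 : X = 0 := by nlinarith
  subst hX0
  nlinarith

set_option maxHeartbeats 1000000 in
lemma GP.wE (G : Geo Srf) {γ : ℝ} (hγ : 0 < γ) {K : ℝ} (hK : G.L + 1 ≤ K) :
    ∃ C : ℝ, 0 ≤ C ∧ ∀ {h : ℝ} {Tr : Triangulation Srf γ h}
    (_ : FE G Tr) {φ g gh : E3 → ℝ} (_ : GP G Tr φ g gh) (z : E3) (_ : z ∈ Srf.S) (_ : G.Loc K z h φ),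
    G.nr (fun x => sg z h x • G.gd (ER Tr g gh) x) ≤ C * (h * (G.en g + 1)) ∧
    G.nr (fun x => sg z h x * ER Tr g gh x) ≤ C * (h * (G.en g + 1)) := by
  obtain ⟨C1, hC1, cl⟩ := clemW G hγ hK
  obtain ⟨C3, hC3, l2⟩ := GP.L2 G hγ
  obtain ⟨C5, hC5, su⟩ := super_en G hγ
  obtain ⟨B, hB, hw⟩ := wgt_sg (G := G)
  obtain ⟨K', hK'⟩ : ∃ K', K' = 2 * (2 * (6 * C1 + 4 * C5 * (1 + C3 + 4 * C1) + 4 * B * (1 + C3 + 6 * C1)) + 4 * C3 ^ 2) := ⟨_, rfl⟩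
  have hK0 : 0 ≤ K' := by rw [hK']; positivity
  refine ⟨K' + 1, by positivity, fun {h Tr} F φ g gh P z hz hL => ?_⟩
  have h0 := F.h0
  have h1 := F.h1
  have hE := P.W F
  obtain ⟨X, hX⟩ : ∃ X, X = h * (G.en g + 1) := ⟨_, rfl⟩
  have eg := en_nonneg (G := G) g
  have hXh : h ≤ X := by rw [hX]; nlinarith
  have hX0 : 0 ≤ X := h0.le.trans hXh
  have hhX : h ^ 2 ≤ X := by nlinarith
  have hwg := hw z hz h h0 h1
  have hσb := hwg.bm
  have hWs := C1W (G := G) hwg.2.1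
  obtain ⟨w, hwv, k0, k1⟩ := cl F z hz g φ P.C1 hL (h ^ 2) (by positivity) P.sol
  rw [← hX] at k0 k1 ⊢
  have hWw := F.lift_W hwv
  have hκ : G.W (fun x => g x - Tr.liftS w x) := (C1W P.C1).sub hWw
  have hζh := Vh_sub hwv P.vh
  have hζ := F.lift_W hζh
  obtain ⟨v, hv, hsu⟩ := su F z hz _ hζh
  have hV := F.lift_W hv
  have hP : G.W (fun x => sg z h x ^ 2 * Tr.liftS (fun x => w x - gh x) x) := hWs.mul hζ
  have hPk : G.W (fun x => sg z h x ^ 2 * (g x - Tr.liftS w x)) := hWs.mul hκ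
  have l2' := l2 F P
  rw [← hX] at l2'
  have enE := P.en_E F
  -- abbreviations
  set a := G.nr (fun x => sg z h x • G.gd (ER Tr g gh) x) with ha
  set b := G.nr (fun x => sg z h x * ER Tr g gh x) with hb
  have a0 : 0 ≤ a := nr_nonneg _
  have b0 : 0 ≤ b := nr_nonneg _
  have hEd : ER Tr g gh = fun x => (g x - Tr.liftS w x) + Tr.liftS (fun x => w x - gh x) x := by
    funext x; simp only [ER, Triangulation.liftS]; ring
  have hζe : Tr.liftS (fun x => w x - gh x) = fun x => ER Tr g gh x - (g x - Tr.liftS w x) := by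
    funext x; simp only [ER, Triangulation.liftS]; ring
  -- kappa in L2
  have nκ : G.nr (fun x => g x - Tr.liftS w x) ≤ 2 * C1 * X := by
    have : nrm G.mu (fun x => h * (g x - Tr.liftS w x)) ≤ G.nr (fun s => sg z h s * (g s - Tr.liftS w s)) := by
      refine nrm_mono (hσb.mul hκ.bm) (ae_of fun x hx => ?_)
      rw [norm_mul, norm_mul]
      refine mul_le_mul_of_nonneg_right ?_ (norm_nonneg _)
      rw [Real.norm_eq_abs, Real.norm_eq_abs, abs_of_pos h0, abs_of_nonneg (sg_nonneg _ _ _)]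
      exact sg_ge_h z x
    rw [nrm_const_mul, abs_of_pos h0] at this
    have e : C1 * h * (X + h ^ 2) ≤ h * (2 * C1 * X) := by nlinarith [mul_nonneg hC1 h0.le]
    exact le_of_mul_le_mul_left ((this.trans k0).trans e) h0
  have k0' : G.nr (fun s => sg z h s * (g s - Tr.liftS w s)) ≤ 2 * C1 * X := by
    refine k0.trans ?_
    have : C1 * h * (X + h ^ 2) ≤ C1 * 1 * (X + X) := by gcongr
    linarith
  have k1' : G.nr (fun s => sg z h s • G.gd (fun x => g x - Tr.liftS w x) s) ≤ 2 * C1 * X := by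
    refine k1.trans ?_
    have : C1 * (X + h ^ 2) ≤ C1 * (X + X) := by gcongr
    linarith
  have nζ : G.nr (Tr.liftS (fun x => w x - gh x)) ≤ (C3 + 2 * C1) * X := by
    rw [hζe]
    have := nrm_sub_le hE.bm hκ.bm
    have : G.nr (fun x => ER Tr g gh x - (g x - Tr.liftS w x)) ≤ G.nr (ER Tr g gh) + G.nr (fun x => g x - Tr.liftS w x) := this
    linarith
  have nσζ : G.nr (fun x => sg z h x * Tr.liftS (fun x => w x - gh x) x) ≤ b + 2 * C1 * X := by
    have e : (fun x => sg z h x * Tr.liftS (fun x => w x - gh x) x) =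
        fun x => sg z h x * ER Tr g gh x - sg z h x * (g x - Tr.liftS w x) := by
      rw [hζe]; funext x; ring
    rw [e]
    have := nrm_sub_le (hσb.mul hE.bm) (hσb.mul hκ.bm)
    exact this.trans (add_le_add le_rfl k0')
  have ngζ : G.nr (fun x => sg z h x • G.gd (Tr.liftS (fun x => w x - gh x)) x) ≤ a + 2 * C1 * X := by
    have := nrm_sub_le (hσb.smul hE.bmg) (hσb.smul hκ.bmg)
    refine le_trans ?_ (this.trans (add_le_add le_rfl k1'))
    refine nrm_mono ((hσb.smul hE.bmg).sub (hσb.smul hκ.bmg)) ?_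
    filter_upwards [hE.2, hκ.2] with x d1 d2
    rw [hζe, gd_sub d1 d2, smul_sub]
  have eζ := en_wgt hwg hζ
  have T1 := form_wgt hwg hE hκ
  have T2 := form_cs hE (hP.sub hV)
  have T3 := P.orth F hv
  have T4 : G.en (Tr.liftS v) ≤ G.en (fun x => sg z h x ^ 2 * Tr.liftS (fun x => w x - gh x) x) +
      G.en (fun x => sg z h x ^ 2 * Tr.liftS (fun x => w x - gh x) x - Tr.liftS v x) := by
    have := en_sub_le hP (hP.sub hV)
    refine le_trans (le_of_eq (en_congr fun x _ => ?_)) this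
    ring
  have split : G.form (ER Tr g gh) (fun x => sg z h x ^ 2 * ER Tr g gh x) =
      G.form (ER Tr g gh) (fun x => sg z h x ^ 2 * (g x - Tr.liftS w x)) +
      (G.form (ER Tr g gh) (fun x => sg z h x ^ 2 * Tr.liftS (fun x => w x - gh x) x - Tr.liftS v x) +
        G.form (ER Tr g gh) (Tr.liftS v)) := by
    rw [← form_add_right (hP.sub hV) hV hE, ← form_add_right hPk ((hP.sub hV).add hV) hE]
    refine form_congr (fun _ _ => rfl) fun x _ => ?_
    have := congrFun hEd x
    rw [this]; ring
  have wd := wid hwg hE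
  have N2e : G.N2 (sg z h) (ER Tr g gh) = a ^ 2 + b ^ 2 := rfl
  rw [N2e, split] at wd
  -- numeric part
  obtain ⟨Y, hY⟩ : ∃ Y, Y = a + b + X := ⟨_, rfl⟩
  have hYX : X ≤ Y := by rw [hY]; linarith
  have hY0 : 0 ≤ Y := hX0.trans hYX
  have ab : a + b ≤ Y := by rw [hY]; linarith
  set D := G.en (fun x => sg z h x ^ 2 * Tr.liftS (fun x => w x - gh x) x - Tr.liftS v x) with hD
  have D0 : 0 ≤ D := en_nonneg _
  have m (c : ℝ) (hc : 0 ≤ c) : c * X ≤ c * Y := mul_le_mul_of_nonneg_left hYX hc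
  have mm (c : ℝ) (hc : 0 ≤ c) : 0 ≤ c * Y := mul_nonneg hc hY0
  have D1 : D ≤ C5 * h * ((1 + C3 + 4 * C1) * Y) := by
    refine hsu.trans (mul_le_mul_of_nonneg_left ?_ (by positivity))
    linarith [m (C3 + 4 * C1) (by positivity)]
  have U1 : |G.form (ER Tr g gh) (fun x => sg z h x ^ 2 * (g x - Tr.liftS w x))| ≤ 6 * C1 * X * Y := by
    have e1 : a * (G.nr (fun x => sg z h x • G.gd (fun x => g x - Tr.liftS w x) x) +
        2 * G.nr (fun x => g x - Tr.liftS w x)) ≤ a * (6 * C1 * X) :=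
      mul_le_mul_of_nonneg_left (by linarith) a0
    have e2 := mul_le_mul_of_nonneg_left k0' b0
    have e3 : 6 * C1 * X * (a + b) ≤ 6 * C1 * X * Y := mul_le_mul_of_nonneg_left ab (by positivity)
    have e4 : 0 ≤ b * (C1 * X) := by positivity
    linarith
  have U2 : |G.form (ER Tr g gh) (fun x => sg z h x ^ 2 * Tr.liftS (fun x => w x - gh x) x - Tr.liftS v x)| ≤
      2 * C5 * (1 + C3 + 4 * C1) * X * Y := by
    refine T2.trans ((mul_le_mul enE D1 D0 (by positivity)).trans (le_of_eq ?_))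
    rw [hX]; ring
  have U3 : |G.form (ER Tr g gh) (Tr.liftS v)| ≤
      (2 * C5 * (1 + C3 + 4 * C1) + 4 * B * (1 + C3 + 6 * C1)) * X * Y := by
    have e1 : D ≤ C5 * (1 + C3 + 4 * C1) * Y := by
      refine D1.trans ?_
      have := mul_le_mul_of_nonneg_right h1 (mm (C5 * (1 + C3 + 4 * C1)) (by positivity))
      linarith
    have e2 : G.en (fun x => sg z h x ^ 2 * Tr.liftS (fun x => w x - gh x) x) ≤ 2 * B * ((1 + C3 + 6 * C1) * Y) := by
      refine eζ.trans (mul_le_mul_of_nonneg_left ?_ (by linarith))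
      linarith [m (C3 + 6 * C1) (by positivity)]
    have e3 : G.en (Tr.liftS v) ≤ (C5 * (1 + C3 + 4 * C1) + 2 * B * (1 + C3 + 6 * C1)) * Y := by linarith
    refine T3.trans ((mul_le_mul (mul_le_mul_of_nonneg_left hhX (by norm_num)) e3 (en_nonneg _) (by positivity)).trans
      (le_of_eq (by ring)))
  have U4 : G.nr (ER Tr g gh) ^ 2 ≤ C3 ^ 2 * X * Y := by
    have e1 : G.nr (ER Tr g gh) ^ 2 ≤ (C3 * X) ^ 2 := pow_le_pow_left₀ (nr_nonneg _) l2' 2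
    have e2 : C3 ^ 2 * X * X ≤ C3 ^ 2 * X * Y := mul_le_mul_of_nonneg_left hYX (by positivity)
    linarith
  have fin : a ^ 2 + b ^ 2 ≤ K' / 2 * X * Y := by
    rw [hK']
    have := (abs_le.1 U1).2
    have := (abs_le.1 U2).2
    have := (abs_le.1 U3).2
    linarith
  have fin2 : a + b ≤ (K' + 1) * X := by
    refine quad_aux hX0 hK0 ?_
    have : (a + b) ^ 2 ≤ 2 * (a ^ 2 + b ^ 2) := by nlinarith [sq_nonneg (a - b)]
    rw [hY] at fin
    linarith
  exact ⟨by linarith, by linarith⟩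

end FE
end PartN22

section PartN23
namespace FE
open Geo
variable {Srf : SmoothSurface}

lemma green (G : Geo Srf) {γ : ℝ} (hγ : 0 < γ) {K : ℝ} (hK : G.L + 1 ≤ K) :
    ∃ C : ℝ, 0 ≤ C ∧ ∀ {h : ℝ} {Tr : Triangulation Srf γ h}
    (_ : FE G Tr) {φ g gh : E3 → ℝ} (_ : GP G Tr φ g gh) (z : E3) (_ : z ∈ Srf.S) (_ : G.Loc K z h φ)
    (_ : K * h ≤ G.r2) (_ : 1 ≤ - Real.log h),
    G.en g ≤ C * √(- Real.log h) ∧ G.en (Tr.liftS gh) ≤ C * √(- Real.log h) ∧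
    ∫ x, ‖G.gd (ER Tr g gh) x‖ ∂G.mu ≤ C * (h * (- Real.log h)) ∧
    ∫ x, ‖ER Tr g gh x‖ ∂G.mu ≤ C * (h * (- Real.log h)) := by
  obtain ⟨C1, hC1, ls⟩ := logSob (G := G) K (by have := G.L_one; linarith)
  obtain ⟨C2, hC2, we⟩ := GP.wE G hγ hK
  obtain ⟨C3, hC3, is⟩ := int_sg (G := G)
  obtain ⟨C, hC⟩ : ∃ C, C = (C1 + 3) + √C3 * (C2 * (C1 + 2)) := ⟨_, rfl⟩
  have hA : C1 + 3 ≤ C := by rw [hC]; have : 0 ≤ √C3 * (C2 * (C1 + 2)) := by positivity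
                             linarith
  have hB : √C3 * (C2 * (C1 + 2)) ≤ C := by rw [hC]; linarith
  refine ⟨C, by linarith, fun {h Tr} F φ g gh P z hz hL hr hl => ?_⟩
  have h0 := F.h0
  have h1 := F.h1
  obtain ⟨l, hl'⟩ : ∃ l, l = - Real.log h := ⟨_, rfl⟩
  have ls' := ls z hz h h0 h1 hr hl φ g hL P.C1
  have is' := is z hz h h0 h1 hl
  obtain ⟨w1, w2⟩ := we F P z hz hL
  rw [← hl'] at ls' is' hl ⊢
  have sl : 1 ≤ √l := by rw [Real.one_le_sqrt]; exact hl
  have eg : G.en g ≤ (C1 + 1) * √l := by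
    have s := P.sol g (C1W P.C1)
    rw [← en_sq] at s
    have s1 := (abs_le.1 s).2
    have s2 := (abs_le.1 ls').2
    rcases (en_nonneg (G := G) g).eq_or_lt with e0 | e0
    · rw [← e0]; positivity
    · refine le_of_mul_le_mul_right (a := G.en g) ?_ e0
      have : h ^ 2 * G.en g ≤ √l * G.en g := mul_le_mul_of_nonneg_right (by nlinarith) e0.le
      nlinarith
  have egh : G.en (Tr.liftS gh) ≤ (C1 + 3) * √l := by
    have := P.en_gh F
    nlinarith
  have hX : C2 * (h * (G.en g + 1)) ≤ C2 * (C1 + 2) * (h * √l) := by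
    have : h * (G.en g + 1) ≤ h * ((C1 + 2) * √l) := mul_le_mul_of_nonneg_left (by linarith) h0.le
    have := mul_le_mul_of_nonneg_left this hC2
    linarith
  have hi : G.nr (fun x => (sg z h x)⁻¹) ≤ √C3 * √l := by
    rw [← Real.sqrt_mul hC3]; exact Real.le_sqrt_of_sq_le is'
  have key (p : ℝ) (hp : 0 ≤ p) (hp' : p ≤ C2 * (h * (G.en g + 1))) :
      G.nr (fun x => (sg z h x)⁻¹) * p ≤ C * (h * l) := by
    have e1 := mul_le_mul hi (hp'.trans hX) hp (by positivity)
    have e2 : √l * √l = l := Real.mul_self_sqrt (by linarith)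
    have e3 : √C3 * √l * (C2 * (C1 + 2) * (h * √l)) = √C3 * (C2 * (C1 + 2)) * (h * l) := by
      linear_combination (√C3 * (C2 * (C1 + 2)) * h) * e2
    rw [e3] at e1
    exact e1.trans (mul_le_mul_of_nonneg_right hB (by nlinarith))
  have hE := P.W F
  obtain ⟨B, hB1, hw⟩ := wgt_sg (G := G)
  have hσb := (hw z hz h h0 h1).bm
  have hib := sg_inv_bm (G := G) (z := z) h0
  have pos (x : E3) : sg z h x ≠ 0 := (h0.trans_le (sg_ge_h z x)).ne'
  refine ⟨eg.trans (mul_le_mul_of_nonneg_right (by linarith) (by positivity)),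
    egh.trans (mul_le_mul_of_nonneg_right hA (by positivity)), ?_, ?_⟩
  · have := cs_nrm hib (hσb.smul hE.bmg)
    refine le_trans (le_of_eq ?_) (this.trans (key _ (nrm_nonneg _) w1))
    refine integral_congr_ae (Eventually.of_forall fun x => ?_)
    simp only [norm_smul, norm_inv]
    rw [inv_mul_cancel_left₀ (by simpa using pos x)]
  · have := cs_nrm hib (hσb.mul hE.bm)
    refine le_trans (le_of_eq ?_) (this.trans (key _ (nrm_nonneg _) w2))
    refine integral_congr_ae (Eventually.of_forall fun x => ?_)
    simp only [norm_mul, norm_inv]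
    rw [inv_mul_cancel_left₀ (by simpa using pos x)]

end FE
end PartN23

section PartN24
namespace Geo
variable {Srf : SmoothSurface} {G : Geo Srf}

/-- a bound for the integral of a derivative -/
lemma int_gd_le {v : E3 → ℝ} (hv : ContDiff ℝ 1 v) {k : E3} (hk : ‖k‖ ≤ 1) :
    |∫ x, ⟪G.gd v x, k⟫ ∂G.mu| ≤ 16 * G.L * ∫ x, |v x| ∂G.mu := by
  obtain ⟨M, hM⟩ := (Srf.compact.bddAbove_image (f := fun x => ‖G.gd v x‖) (cont_gd hv).norm.continuousOn)
  have hM' : ∀ x ∈ Srf.S, ‖G.gd v x‖ ≤ M := fun x hx => hM (mem_image_of_mem _ hx)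
  have hL := G.L_pos
  have lim : Tendsto (fun τ : ℝ => ∫ x, τ⁻¹ * (v (G.a (x + τ • k)) - v x) ∂G.mu) (𝓝[>] 0)
      (𝓝 (∫ x, ⟪G.gd v x, k⟫ ∂G.mu)) := by
    refine tendsto_integral_filter_of_dominated_convergence (fun _ => M * G.L) ?_ ?_ (integrable_const _) ?_
    · refine Eventually.of_forall fun τ => Continuous.aestronglyMeasurable ?_
      have h1 := hv.continuous
      have h2 := G.contA
      exact continuous_const.mul ((h1.comp (h2.comp (continuous_id.add continuous_const))).sub h1)
    · have : ∀ᶠ τ : ℝ in 𝓝[>] 0, τ < G.ρ := nhdsWithin_le_nhds (Iio_mem_nhds G.ρ_pos)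
      filter_upwards [this, self_mem_nhdsWithin] with τ h1 h2
      have h2 : 0 < τ := h2
      refine ae_of fun x hx => ?_
      have hn : ‖τ • k‖ ≤ τ := by
        rw [norm_smul, Real.norm_eq_abs, abs_of_pos h2]; nlinarith
      have := lip_path hv hx (k := τ • k) (by linarith) hM'
      have hM0 : 0 ≤ M := (norm_nonneg _).trans (hM' x hx)
      have h3 : M * (G.L * ‖τ • k‖) ≤ M * (G.L * τ) := by gcongr
      rw [norm_mul, norm_inv, Real.norm_eq_abs, abs_of_pos h2, inv_mul_le_iff₀ h2, Real.norm_eq_abs]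
      linarith
    · refine ae_of fun x hx => ?_
      rw [inner_gd]
      have hd : HasFDerivAt (v ∘ G.a) (fderiv ℝ (v ∘ G.a) x) x := (DA_C1 hv x : DifferentiableAt ℝ (v ∘ G.a) x).hasFDerivAt
      have hl : HasDerivAt (fun τ : ℝ => (v ∘ G.a) (x + τ • k)) (fderiv ℝ (v ∘ G.a) x k) 0 := by
        have h1 : HasDerivAt (fun τ : ℝ => x + τ • k) k 0 := by
          simpa using ((hasDerivAt_id (0:ℝ)).smul_const k).const_add x
        refine HasFDerivAt.comp_hasDerivAt (l := v ∘ G.a) (f := fun τ : ℝ => x + τ • k) 0 ?_ h1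
        simpa using hd
      have := hl.tendsto_slope.mono_left (nhdsWithin_mono 0 (fun τ (h : τ ∈ Ioi 0) => (ne_of_gt h : τ ≠ 0)))
      refine this.congr fun τ => ?_
      simp [slope, G.fix x hx]
  refine le_of_tendsto (lim.abs) ?_
  have : ∀ᶠ τ : ℝ in 𝓝[>] 0, τ < G.r1 := nhdsWithin_le_nhds (Iio_mem_nhds G.r1_pos)
  filter_upwards [this, self_mem_nhdsWithin] with τ h1 h2
  have h2 : 0 < τ := h2
  have hn : ‖τ • k‖ ≤ τ := by
    rw [norm_smul, Real.norm_eq_abs, abs_of_pos h2]; nlinarith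
  have hy : ‖τ • k‖ ≤ G.r1 := by linarith
  have := int_Phi (G := G) hy hv.continuous.continuousOn
  have c1 : BM G.mu (fun x => v (G.Phi (τ • k) x)) :=
    bm_of_cont (hv.continuous.comp (Phi_smooth (G := G) (τ • k)).continuous).continuousOn
  have c2 : BM G.mu v := bm_of_cont hv.continuous.continuousOn
  have e : ∫ x, τ⁻¹ * (v (G.a (x + τ • k)) - v x) ∂G.mu =
      τ⁻¹ * (∫ x, v (G.Phi (τ • k) x) ∂G.mu - ∫ x, v x ∂G.mu) := by
    rw [integral_const_mul, ← integral_sub c1.integrable c2.integrable]; rfl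
  rw [e, abs_mul, abs_inv, abs_of_pos h2, inv_mul_le_iff₀ h2]
  refine this.trans ?_
  have i0 : 0 ≤ ∫ x, |v x| ∂G.mu := integral_nonneg fun _ => abs_nonneg _
  have : 16 * (G.L * ‖τ • k‖) * ∫ x, |v x| ∂G.mu ≤ 16 * (G.L * τ) * ∫ x, |v x| ∂G.mu := by gcongr
  linarith

lemma f_bound (G : Geo Srf) : ∃ C : ℝ, 0 ≤ C ∧ ∀ (u f : E3 → ℝ) (_ : ContDiff ℝ (⊤ : ℕ∞) u) (_ : ContDiff ℝ (⊤ : ℕ∞) f) (M : ℝ)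
    (_ : ∀ x ∈ Srf.S, |u x| ≤ M) (_ : ∀ x ∈ Srf.S, ‖G.gd u x‖ ≤ M)
    (_ : ∀ i : Fin 3, ∀ x ∈ Srf.S, ‖G.gd (fun y => G.gd u y i) x‖ ≤ M)
    (_ : ∀ φ, ContDiff ℝ (⊤ : ℕ∞) φ → G.form u φ = ∫ x, f x * φ x ∂G.mu), G.nr f ≤ C * M := by
  have hL := G.L_pos
  refine ⟨(3 * (16 * G.L + 1) + 1) * √(G.mu.real univ), by positivity, fun u f hu hf M h0 h1 h2 he => ?_⟩
  obtain ⟨x0, hx0⟩ := Srf.nonempty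
  have hM : 0 ≤ M := (abs_nonneg _).trans (h0 _ hx0)
  have hf1 : ContDiff ℝ 1 f := hf.of_le (by exact_mod_cast le_top)
  have hu1 : ContDiff ℝ 1 u := hu.of_le (by exact_mod_cast le_top)
  have fb := bm_of_cont (G := G) hf1.continuous.continuousOn
  have ub := bm_of_cont (G := G) hu1.continuous.continuousOn
  have I0 : 0 ≤ ∫ x, |f x| ∂G.mu := integral_nonneg fun _ => abs_nonneg _
  have iabs := fb.abs.integrable
  have comp (i : Fin 3) : |∫ x, G.gd u x i * G.gd f x i ∂G.mu| ≤ (16 * G.L + 1) * M * ∫ x, |f x| ∂G.mu := by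
    have hui := gd_comp_C1 (G := G) hu i
    have hv : ContDiff ℝ 1 (fun x => G.gd u x i * f x) := hui.mul hf1
    have k1 : ‖(EuclideanSpace.single i (1:ℝ) : E3)‖ ≤ 1 := by simp
    have e1 := int_gd_le (G := G) hv k1
    have bi : BM G.mu (fun x => G.gd (fun y => G.gd u y i) x i) := by
      refine bm_of_cont (Continuous.continuousOn ?_)
      exact (EuclideanSpace.proj (𝕜 := ℝ) i).continuous.comp (cont_gd hui)
    have bv : BM G.mu (fun x => ⟪G.gd (fun x => G.gd u x i * f x) x, (EuclideanSpace.single i (1:ℝ) : E3)⟫) :=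
      bm_of_cont (((cont_gd hv).inner continuous_const).continuousOn)
    have hin (w : E3) : ⟪w, (EuclideanSpace.single i (1:ℝ) : E3)⟫ = w i := by
      simp [EuclideanSpace.inner_single_right]
    have e2 : ∫ x, G.gd u x i * G.gd f x i ∂G.mu =
        ∫ x, ⟪G.gd (fun x => G.gd u x i * f x) x, (EuclideanSpace.single i (1:ℝ) : E3)⟫ ∂G.mu -
        ∫ x, f x * G.gd (fun y => G.gd u y i) x i ∂G.mu := by
      rw [← integral_sub bv.integrable (fb.mul bi).integrable]
      refine integral_congr_ae (ae_of fun x hx => ?_)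
      simp only
      rw [gd_mul hx (DA_C1 hui x) (DA_C1 hf1 x), hin]
      simp
    have co (w : E3) : |w i| ≤ ‖w‖ := by
      have := PiLp.norm_apply_le w i
      simpa using this
    have e3 : |∫ x, f x * G.gd (fun y => G.gd u y i) x i ∂G.mu| ≤ M * ∫ x, |f x| ∂G.mu := by
      rw [← integral_const_mul, ← Real.norm_eq_abs]
      refine norm_integral_le_of_norm_le (iabs.const_mul M) (ae_of fun x hx => ?_)
      rw [norm_mul, mul_comm, Real.norm_eq_abs, Real.norm_eq_abs]
      exact mul_le_mul_of_nonneg_right ((co _).trans (h2 i x hx)) (abs_nonneg _)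
    have e4 : ∫ x, |G.gd u x i * f x| ∂G.mu ≤ M * ∫ x, |f x| ∂G.mu := by
      rw [← integral_const_mul]
      refine integral_mono_ae (bm_of_cont (G := G) hv.continuous.continuousOn).abs.integrable (iabs.const_mul M) (ae_of fun x hx => ?_)
      simp only [abs_mul]
      exact mul_le_mul_of_nonneg_right ((co _).trans (h1 x hx)) (abs_nonneg _)
    rw [e2]
    refine (abs_sub _ _).trans ?_
    have := mul_le_mul_of_nonneg_left e4 (show 0 ≤ 16 * G.L by positivity)
    linarith
  have bci (i : Fin 3) : BM G.mu (fun x => G.gd u x i * G.gd f x i) := by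
    refine BM.mul ?_ ?_
    · exact bm_of_cont ((EuclideanSpace.proj (𝕜 := ℝ) i).continuous.comp (cont_gd hu1)).continuousOn
    · exact bm_of_cont ((EuclideanSpace.proj (𝕜 := ℝ) i).continuous.comp (cont_gd hf1)).continuousOn
  have e := he f hf
  have form_e : G.form u f = ∑ i : Fin 3, ∫ x, G.gd u x i * G.gd f x i ∂G.mu + ∫ x, u x * f x ∂G.mu := by
    rw [← integral_finset_sum _ fun i _ => (bci i).integrable, ← integral_add
      (integrable_finset_sum _ fun i _ => (bci i).integrable) (ub.mul fb).integrable]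
    refine integral_congr_ae (ae_of fun x hx => ?_)
    simp only [PiLp.inner_apply]
    congr 1
    refine Finset.sum_congr rfl fun i _ => ?_
    simp [mul_comm]
  have uf : |∫ x, u x * f x ∂G.mu| ≤ M * ∫ x, |f x| ∂G.mu := by
    rw [← integral_const_mul, ← Real.norm_eq_abs]
    refine norm_integral_le_of_norm_le (iabs.const_mul M) (ae_of fun x hx => ?_)
    rw [norm_mul, Real.norm_eq_abs, Real.norm_eq_abs]
    exact mul_le_mul_of_nonneg_right (h0 x hx) (abs_nonneg _)
  have nf : G.nr f ^ 2 = ∫ x, f x * f x ∂G.mu := by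
    refine (nrm_sq f).trans ?_
    congr 1; funext x; rw [Real.norm_eq_abs, sq_abs, sq]
  have If : ∫ x, |f x| ∂G.mu ≤ G.nr f * √(G.mu.real univ) := by
    have := cs_nrm fb (BM.const (μ := G.mu) (1:ℝ))
    simp only [norm_one, mul_one, Real.norm_eq_abs] at this
    refine this.trans (mul_le_mul_of_nonneg_left ?_ (nrm_nonneg _))
    have := nrm_le_of_bound (μ := G.mu) (f := fun _ => (1:ℝ)) (C := 1) (by norm_num) (by simp)
    linarith
  have tot : G.nr f ^ 2 ≤ (3 * (16 * G.L + 1) + 1) * M * ∫ x, |f x| ∂G.mu := by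
    rw [nf, ← e, form_e, Fin.sum_univ_three]
    have a0 := (abs_le.1 (comp 0)).2
    have a1 := (abs_le.1 (comp 1)).2
    have a2 := (abs_le.1 (comp 2)).2
    have a3 := (abs_le.1 uf).2
    linarith
  rcases (nr_nonneg (G := G) f).eq_or_lt with z | z
  · rw [← z]; positivity
  · refine le_of_mul_le_mul_right ?_ z
    have := mul_le_mul_of_nonneg_left If (show 0 ≤ (3 * (16 * G.L + 1) + 1) * M by positivity)
    nlinarith

lemma weak_ext {u f : E3 → ℝ} (hu : G.W u) (hf : BM G.mu f)
    (he : ∀ φ, ContDiff ℝ (⊤ : ℕ∞) φ → G.form u φ = ∫ x, f x * φ x ∂G.mu) {v : E3 → ℝ} (hv : G.W v) :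
    G.form u v = ∫ x, f x * v x ∂G.mu := by
  rw [← sub_eq_zero, ← abs_nonpos_iff]
  refine le_of_forall_pos_le_add fun ε hε => ?_
  have p : 0 < G.en u + G.nr f + 1 := by
    have := en_nonneg (G := G) u; have := nr_nonneg (G := G) f; linarith
  obtain ⟨w, hw, hd⟩ := density hv (η := ε / (G.en u + G.nr f + 1)) (by positivity)
  have hwW : G.W w := C1W (hw.of_le (by exact_mod_cast le_top))
  have e1 := form_cs hu (hv.sub hwW)
  rw [form_sub_right hv hwW hu, he w hw] at e1
  have e2 := cs_nrm_mul hf (hv.sub hwW).bm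
  have e3 : ∫ x, f x * (v x - w x) ∂G.mu = ∫ x, f x * v x ∂G.mu - ∫ x, f x * w x ∂G.mu := by
    rw [← integral_sub (hf.mul hv.bm).integrable (hf.mul hwW.bm).integrable]
    simp only [mul_sub]
  rw [e3] at e2
  have e4 : nrm G.mu (fun x => v x - w x) ≤ G.en (fun x => v x - w x) := nr_le_en (hv.sub hwW)
  have e5 : nrm G.mu f * nrm G.mu (fun x => v x - w x) ≤ G.nr f * (ε / (G.en u + G.nr f + 1)) :=
    mul_le_mul_of_nonneg_left (e4.trans hd) (nrm_nonneg _)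
  have e6 : G.en u * G.en (fun x => v x - w x) ≤ G.en u * (ε / (G.en u + G.nr f + 1)) :=
    mul_le_mul_of_nonneg_left hd (en_nonneg _)
  have e7 : (G.en u + G.nr f + 1) * (ε / (G.en u + G.nr f + 1)) = ε := by field_simp
  have e8 : 0 ≤ ε / (G.en u + G.nr f + 1) := by positivity
  have e9 := e1.trans e6
  have e10 := e2.trans e5
  rw [abs_le] at e9 e10 ⊢
  constructor <;> nlinarith [e9.1, e9.2, e10.1, e10.2]

end Geo
namespace FE
open Geo
variable {Srf : SmoothSurface} {G : Geo Srf} {γ h : ℝ} {Tr : Triangulation Srf γ h}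

lemma interp_pt (F : FE G Tr) {u : E3 → ℝ} (hu : ContDiff ℝ (⊤ : ℕ∞) u) {M : ℝ} (h1 : ∀ x ∈ Srf.S, ‖G.gd u x‖ ≤ M)
    (h2 : ∀ i : Fin 3, ∀ x ∈ Srf.S, ‖G.gd (fun y => G.gd u y i) x‖ ≤ M) {v : E3 → ℝ} (hv : Tr.IsVh v)
    (hn : ∀ t ∈ Tr.T, ∀ p ∈ vertsOf t, v p = u p) {x : E3} (hx : x ∈ Tr.Sh) :
    |v x - u (G.a x)| ≤ 6 * G.L ^ 4 * M * h ^ 2 := by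
  obtain ⟨t, ht, hxt⟩ := Sh_mem hx
  have H := F.tri ht
  have hs := H.a_mem hxt
  obtain ⟨s, hse⟩ : ∃ s, s = G.a x := ⟨_, rfl⟩
  rw [← hse] at hs ⊢
  have hM0 : 0 ≤ M := (norm_nonneg _).trans (h1 _ hs)
  have hL := G.L_one
  have hL0 := G.L_pos
  have hh := F.h0
  have hγ := F.γ0
  obtain ⟨l, c, hl⟩ := hv.2 t ht
  set g := G.gd u s with hg
  set l' : E3 →ₗ[ℝ] ℝ := l - (innerSL ℝ g : E3 →L[ℝ] ℝ).toLinearMap.comp (G.D x : E3 →L[ℝ] E3).toLinearMap with hl'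
  have e' : ∀ k, l' k = l k - ⟪g, G.D x k⟫ := fun k => by simp [hl']
  have hb' : ∀ p ∈ vertsOf t, ‖l' p + (c - u s + ⟪g, G.D x x⟫)‖ ≤ 6 * G.L ^ 4 * M * h ^ 2 := by
    intro p hp
    have hpS := H.vS hp
    have hxp := verts_sub_tri t hp
    have hd : ‖p - x‖ ≤ h := H.dist_le hxp hxt
    have hp1 : ‖p - s‖ ≤ G.L * h := by rw [hse]; exact H.v_dist hxt hp
    have hp2 : ‖(p - s) - G.D x (p - x)‖ ≤ G.L * h ^ 2 := by
      have := G.a_taylor x p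
      rw [G.fix p hpS, ← hse] at this
      refine this.trans (mul_le_mul_of_nonneg_left ?_ G.L_pos.le)
      exact pow_le_pow_left₀ (norm_nonneg _) hd 2
    have hlt : ‖p - s‖ < G.ρ := by
      have h1 := H.small
      have h2 : G.L ≤ G.L ^ 6 := le_self_pow₀ hL (by norm_num)
      have h3 : γ ^ 2 ≤ 1 := pow_le_one₀ hγ.le F.γ1
      have h4 := mul_le_mul_of_nonneg_right h2 hh.le
      have h5 := mul_le_mul_of_nonneg_left h3 G.ρ_pos.le
      have : 0 < G.L * h := by positivity
      linarith
    have T := taylor2 hu h1 h2 hs hpS hlt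
    have h4 : |⟪g, (p - s) - G.D x (p - x)⟫| ≤ G.L * h ^ 2 * M := by
      refine (abs_real_inner_le_norm _ _).trans ?_
      rw [mul_comm]
      exact mul_le_mul hp2 (h1 s hs) (norm_nonneg _) (by positivity)
    have T2 : 5 * G.L ^ 2 * M * ‖p - s‖ ^ 2 ≤ 5 * G.L ^ 2 * M * (G.L * h) ^ 2 := by gcongr
    have e : l' p + (c - u s + ⟪g, G.D x x⟫) = (u p - u s - ⟪g, p - s⟫) + ⟪g, (p - s) - G.D x (p - x)⟫ := by
      have := hl p hxp
      rw [hn t ht p hp] at this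
      rw [e', inner_sub_right g (p - s) (G.D x (p - x)), map_sub, inner_sub_right g (G.D x p) (G.D x x), this]; ring
    rw [e]
    refine (abs_add_le _ _).trans ((add_le_add T h4).trans ?_)
    have i1 : G.L ≤ G.L ^ 4 := le_self_pow₀ hL (by norm_num)
    have i2 := mul_le_mul_of_nonneg_right i1 (show 0 ≤ h ^ 2 * M by positivity)
    nlinarith
  have := conv_bound l' _ hb' hxt
  refine le_trans (le_of_eq ?_) this
  rw [hl x hxt, e', Real.norm_eq_abs]
  congr 1; ring

end FE
end PartN24

section PartN25
/-- area constant -/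
def c0 : ℝ := (μH[2] (closedBall (0 : EuclideanSpace ℝ (Fin 2)) 1)).toReal

lemma c0_fin : μH[2] (closedBall (0 : EuclideanSpace ℝ (Fin 2)) 1) ≠ ⊤ := by
  have : (μH[2] : Measure (EuclideanSpace ℝ (Fin 2))).IsAddHaarMeasure := by
    have := isAddHaarMeasure_hausdorffMeasure (E := EuclideanSpace ℝ (Fin 2))
    simpa using this
  exact measure_closedBall_lt_top.ne

lemma c0_pos : 0 < c0 := by
  have : (μH[2] : Measure (EuclideanSpace ℝ (Fin 2))).IsAddHaarMeasure := by
    have := isAddHaarMeasure_hausdorffMeasure (E := EuclideanSpace ℝ (Fin 2))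
    simpa using this
  exact ENNReal.toReal_pos (measure_closedBall_pos _ _ one_pos).ne' c0_fin

/-- area of planar balls -/
lemma haus_ball {r : ℝ} (hr : 0 ≤ r) :
    μH[2] (closedBall (0 : EuclideanSpace ℝ (Fin 2)) r) = ENNReal.ofReal (c0 * r ^ 2) := by
  have : (μH[2] : Measure (EuclideanSpace ℝ (Fin 2))).IsAddHaarMeasure := by
    have := isAddHaarMeasure_hausdorffMeasure (E := EuclideanSpace ℝ (Fin 2))
    simpa using this
  rw [Measure.addHaar_closedBall' _ _ hr]
  simp only [finrank_euclideanSpace, Fintype.card_fin]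
  rw [mul_comm c0, ENNReal.ofReal_mul (by positivity), c0, ENNReal.ofReal_toReal c0_fin]

namespace TriOK
open Geo
variable {Srf : SmoothSurface} {G : Geo Srf} {γ h : ℝ} {t : E3 × E3 × E3}

lemma area (H : TriOK G γ h t) : ENNReal.ofReal (c0 * (γ * h) ^ 2) ≤ μH[2] (triOf t) := by
  obtain ⟨y, hy, hd⟩ := H.disk
  have h0 := H.h0
  have g0 := H.γ0
  have hf : Module.finrank ℝ (EuclideanSpace ℝ (Fin 2)) = Module.finrank ℝ (dirOf t) := by
    rw [H.finrank_dir]; simp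
  let e : EuclideanSpace ℝ (Fin 2) ≃ₗᵢ[ℝ] dirOf t :=
    (stdOrthonormalBasis ℝ (EuclideanSpace ℝ (Fin 2))).equiv (stdOrthonormalBasis ℝ (dirOf t))
      (finCongr hf)
  let f : EuclideanSpace ℝ (Fin 2) → E3 := fun x => y + (e x : E3)
  have hiso : Isometry f := by
    refine Isometry.of_dist_eq fun a b => ?_
    simp only [f, dist_eq_norm, add_sub_add_left_eq_sub]
    rw [← Submodule.coe_sub, ← map_sub, ← Submodule.coe_norm, LinearIsometryEquiv.norm_map]
  have hsub : f '' closedBall 0 (γ * h) ⊆ triOf t := by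
    rintro _ ⟨x, hx, rfl⟩
    refine hd ⟨?_, ?_⟩
    · simp only [f, mem_closedBall, dist_eq_norm, add_sub_cancel_left]
      rw [← Submodule.coe_norm, LinearIsometryEquiv.norm_map]
      simpa using hx
    · have h1 : (e x : E3) ∈ (affineSpan ℝ (vertsOf t)).direction := (e x).2
      have h2 : y ∈ affineSpan ℝ (vertsOf t) := tri_sub_plane t hy
      have := AffineSubspace.vadd_mem_of_mem_direction h1 h2
      rw [vadd_eq_add, add_comm] at this
      exact this
  calc ENNReal.ofReal (c0 * (γ * h) ^ 2) = μH[2] (closedBall (0 : EuclideanSpace ℝ (Fin 2)) (γ * h)) :=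
        (haus_ball (by positivity)).symm
    _ = μH[2] (f '' closedBall 0 (γ * h)) := (hiso.hausdorffMeasure_image (Or.inl (by norm_num)) _).symm
    _ ≤ _ := measure_mono hsub

lemma area4 (H : TriOK G γ h t) {p : E3} (hp : p ∈ vertsOf t) :
    AffineMap.homothety p (1 / 4 : ℝ) '' triOf t ⊆ triOf t ∧
    IsCompact (G.a '' (AffineMap.homothety p (1 / 4 : ℝ) '' triOf t)) ∧
    c0 * (γ * h) ^ 2 / 64 ≤
      G.mu.real (G.a '' (AffineMap.homothety p (1 / 4 : ℝ) '' triOf t)) := by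
  set T4 := AffineMap.homothety p (1 / 4 : ℝ) '' triOf t with hT
  have hsub : T4 ⊆ triOf t := by
    rintro _ ⟨x, hx, rfl⟩
    rw [AffineMap.homothety_apply, vsub_eq_sub, vadd_eq_add]
    have := (tri_convex t) (verts_sub_tri t hp) hx (by norm_num : (0:ℝ) ≤ 3 / 4)
      (by norm_num : (0:ℝ) ≤ 1 / 4) (by norm_num)
    convert this using 1
    module
  have hc4 : IsCompact T4 := by
    refine (tri_compact t).image ?_
    exact AffineMap.continuous_of_finiteDimensional _
  have hcA : IsCompact (G.a '' T4) := hc4.image G.contA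
  refine ⟨hsub, hcA, ?_⟩
  have h1 : μH[2] T4 = ((1 / 4 : ℝ≥0) ^ (2:ℝ)) • μH[2] (triOf t) := by
    rw [hT, hausdorffMeasure_homothety_image (by norm_num) p (by norm_num : (1/4:ℝ) ≠ 0)]
    congr 2
    ext; simp
  have h2 : μH[2] T4 ≤ ENNReal.ofReal (2 ^ 2) * μH[2] (G.a '' T4) := by
    refine haus_le_image (by norm_num) fun x hx y hy => ?_
    have := H.a_low (hsub hy) (hsub hx)
    rw [dist_eq_norm, dist_eq_norm]
    refine this.trans ?_
    have := H.eps_le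
    gcongr
    linarith
  have hAS : G.a '' T4 ⊆ Srf.S := by
    rintro _ ⟨x, hx, rfl⟩; exact H.a_mem (hsub hx)
  have h3 : G.mu (G.a '' T4) = μH[2] (G.a '' T4) := by
    rw [Geo.mu, Measure.restrict_apply hcA.measurableSet, inter_eq_left.2 hAS]
  have h4 : ENNReal.ofReal (c0 * (γ * h) ^ 2 / 64) ≤ G.mu (G.a '' T4) := by
    have h5 := H.area
    have h6 : ENNReal.ofReal (1 / 16) * ENNReal.ofReal (c0 * (γ * h) ^ 2) ≤ ENNReal.ofReal 4 * G.mu (G.a '' T4) := by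
      have e1 : ((1 / 4 : ℝ≥0) ^ (2:ℝ)) • μH[2] (triOf t) = ENNReal.ofReal (1/16) * μH[2] (triOf t) := by
        have : ((1 / 4 : ℝ≥0) ^ (2:ℝ)) = Real.toNNReal (1 / 16) := by
          ext; rw [Real.coe_toNNReal _ (by norm_num)]; norm_num
        rw [this]; rfl
      calc _ ≤ ENNReal.ofReal (1/16) * μH[2] (triOf t) := by gcongr
        _ = μH[2] T4 := by rw [h1, e1]
        _ ≤ _ := by rw [h3]; convert h2 using 2; norm_num
    have h7 : ENNReal.ofReal (1/4) * (ENNReal.ofReal (1 / 16) * ENNReal.ofReal (c0 * (γ * h) ^ 2)) ≤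
      ENNReal.ofReal (1/4) * (ENNReal.ofReal 4 * G.mu (G.a '' T4)) := by gcongr
    rw [← mul_assoc, ← mul_assoc, ← ENNReal.ofReal_mul (by norm_num), ← ENNReal.ofReal_mul (by norm_num),
      ← ENNReal.ofReal_mul (by norm_num)] at h7
    norm_num at h7
    rw [← ENNReal.ofReal_mul (by norm_num)] at h7
    convert h7 using 2
    ring
  have := c0_pos
  exact (ENNReal.ofReal_le_iff_le_toReal (measure_ne_top _ _)).1 h4

end TriOK

namespace FE
open Geo
variable {Srf : SmoothSurface} {G : Geo Srf} {γ h : ℝ} {Tr : Triangulation Srf γ h}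

/-- the discrete delta function detecting the maximum of a finite element function -/
lemma exists_phi (F : FE G Tr) {v : E3 → ℝ} (hv : Tr.IsVh v) : ∃ φ : E3 → ℝ, ∃ z ∈ Srf.S,
    G.Loc (G.L + 1) z h φ ∧
    ∀ x ∈ Tr.Sh, c0 * γ ^ 2 / 128 * |v x| ≤ ∫ x, φ x * Tr.liftS v x ∂G.mu := by
  obtain ⟨t, ht, p, hp, hmax⟩ := Vh_max hv
  have H := F.tri ht
  obtain ⟨hsub, hcA, har⟩ := H.area4 hp
  set A := G.a '' (AffineMap.homothety p (1 / 4 : ℝ) '' triOf t) with hA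
  have h0 := F.h0
  have g0 := F.γ0
  set s : ℝ := if 0 ≤ v p then 1 else -1 with hs
  have sabs : |s| = 1 := by rw [hs]; split_ifs <;> simp
  have smul : s * v p = |v p| := by
    rw [hs]; split_ifs with h
    · rw [abs_of_nonneg h, one_mul]
    · rw [abs_of_neg (not_le.1 h)]; ring
  have h_intg : G.W (Tr.liftS v) := F.lift_W hv
  refine ⟨A.indicator fun _ => (h ^ 2)⁻¹ * s, p, H.vS hp, ⟨⟨?_, ?_⟩, ?_⟩, ?_⟩
  · exact (stronglyMeasurable_const.indicator hcA.measurableSet).aestronglyMeasurable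
  · refine ⟨(h ^ 2)⁻¹, Eventually.of_forall fun x => ?_⟩
    refine (norm_indicator_le_norm_self _ _).trans ?_
    rw [norm_mul, Real.norm_eq_abs s, sabs, mul_one, Real.norm_of_nonneg (by positivity)]
  · intro x hx
    constructor
    · rw [← Real.norm_eq_abs]
      refine (norm_indicator_le_norm_self _ _).trans ?_
      rw [norm_mul, Real.norm_eq_abs s, sabs, mul_one, Real.norm_of_nonneg (by positivity)]
    · intro hne
      have hxA : x ∈ A := by
        by_contra hc
        exact hne (indicator_of_notMem hc _)
      obtain ⟨y, hy, rfl⟩ := hxA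
      have := H.v_dist (hsub hy) hp
      rw [norm_sub_rev]
      linarith
  · intro x hx
    have hval : ∀ y ∈ A, |v p| / 2 ≤ s * Tr.liftS v y := by
      rintro _ ⟨w, ⟨y, hy, rfl⟩, rfl⟩
      have hw : AffineMap.homothety p (1 / 4 : ℝ) y ∈ triOf t := hsub ⟨y, hy, rfl⟩
      rw [F.lift_a (mem_Sh ht hw)]
      obtain ⟨l, c, hl⟩ := hv.2 t ht
      have e1 := hl _ hw
      have e2 := hl _ hy
      have e3 := hl _ (verts_sub_tri t hp)
      rw [AffineMap.homothety_apply, vsub_eq_sub, vadd_eq_add] at e1 ⊢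
      rw [map_add, map_smul, map_sub, smul_eq_mul] at e1
      have e4 : v ((1 / 4 : ℝ) • (y - p) + p) = 3 / 4 * v p + 1 / 4 * v y := by
        rw [e1, e2, e3]; ring
      have e5 := hmax y (mem_Sh ht hy)
      have e6 : |s * v y| ≤ |v p| := by rw [abs_mul, sabs, one_mul]; exact e5
      have e7 := (abs_le.1 e6).1
      rw [e4]
      have : s * (3 / 4 * v p + 1 / 4 * v y) = 3 / 4 * (s * v p) + 1 / 4 * (s * v y) := by ring
      rw [this, smul]
      linarith
    have e1 : ∀ x, (A.indicator (fun _ => (h ^ 2)⁻¹ * s) x) * Tr.liftS v x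
        = A.indicator (fun x => (h ^ 2)⁻¹ * (s * Tr.liftS v x)) x := by
      intro x
      by_cases hx : x ∈ A
      · simp only [indicator_of_mem hx]; ring
      · simp only [indicator_of_notMem hx]; ring
    simp only [e1]
    rw [integral_indicator hcA.measurableSet]
    have e2 : ∫ x in A, (h ^ 2)⁻¹ * (|v p| / 2) ∂G.mu ≤
        ∫ x in A, (h ^ 2)⁻¹ * (s * Tr.liftS v x) ∂G.mu := by
      refine setIntegral_mono_on (integrable_const _) ?_ hcA.measurableSet ?_
      · exact ((h_intg.bm.integrable.const_mul s).const_mul _).integrableOn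
      · intro y hy
        have := hval y hy
        gcongr
    refine le_trans ?_ e2
    rw [setIntegral_const, smul_eq_mul]
    have e3 : c0 * (γ * h) ^ 2 / 64 * ((h ^ 2)⁻¹ * (|v p| / 2)) ≤
        G.mu.real A * ((h ^ 2)⁻¹ * (|v p| / 2)) := by gcongr
    refine le_trans ?_ e3
    have e4 : c0 * (γ * h) ^ 2 / 64 * ((h ^ 2)⁻¹ * (|v p| / 2)) = c0 * γ ^ 2 / 128 * |v p| := by
      field_simp; ring
    rw [e4]
    have := hmax x hx
    have := c0_pos
    gcongr

end FE
end PartN25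

section PartN26
namespace FE
open Geo
variable {Srf : SmoothSurface} {G : Geo Srf} {γ h : ℝ} {Tr : Triangulation Srf γ h}

lemma en_bd {v : E3 → ℝ} (hv : G.W v) {A B : ℝ} (hA : 0 ≤ A) (hB : 0 ≤ B)
    (h1 : ∀ᵐ x ∂G.mu, |v x| ≤ A) (h2 : ∀ᵐ x ∂G.mu, ‖G.gd v x‖ ≤ B) :
    G.en v ≤ (A + B) * √(G.mu.real univ) := by
  have e1 := en_le_add hv
  have e2 : G.nr v ≤ A * √(G.mu.real univ) := nrm_le_of_bound hA h1
  have e3 : G.nr (G.gd v) ≤ B * √(G.mu.real univ) := nrm_le_of_bound hB h2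
  linarith

/-- pairing of an `L^1` function with an `L^∞` function -/
lemma form_l1 {v w : E3 → ℝ} (hv : G.W v) (hw : G.W w) {A B : ℝ}
    (h1 : ∀ᵐ x ∂G.mu, |w x| ≤ A) (h2 : ∀ᵐ x ∂G.mu, ‖G.gd w x‖ ≤ B) :
    |G.form v w| ≤ B * (∫ x, ‖G.gd v x‖ ∂G.mu) + A * ∫ x, ‖v x‖ ∂G.mu := by
  have i1 : Integrable (fun x => ‖G.gd v x‖) G.mu := hv.bmg.norm.integrable
  have i2 : Integrable (fun x => ‖v x‖) G.mu := hv.bm.norm.integrable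
  rw [← integral_const_mul, ← integral_const_mul, ← integral_add (i1.const_mul _) (i2.const_mul _),
    Geo.form, ← Real.norm_eq_abs]
  refine norm_integral_le_of_norm_le ((i1.const_mul _).add (i2.const_mul _)) ?_
  filter_upwards [h1, h2] with x hx1 hx2
  refine (norm_add_le _ _).trans (add_le_add ?_ ?_)
  · refine (norm_inner_le_norm _ _).trans ?_
    rw [mul_comm]; gcongr
  · rw [norm_mul, mul_comm, Real.norm_eq_abs (w x)]; gcongr

lemma en_uh (F : FE G Tr) {f uh : E3 → ℝ} (hf : BM G.mu f) (hv : Tr.IsVh uh)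
    (he : Tr.ahForm uh uh = ∫ x in Tr.Sh, f (Tr.a x) * uh x ∂μH[2]) :
    G.en (Tr.liftS uh) ≤ 2 * G.nr f := by
  have hW := F.lift_W hv
  have e1 := F.form_cmp hv hv
  have e2 := F.rhs_cmp hf hv
  have e3 : |∫ x, f x * Tr.liftS uh x ∂G.mu| ≤ G.nr f * G.nr (Tr.liftS uh) := cs_nrm_mul hf hW.bm
  have e4 := nr_le_en hW
  have e5 := F.eps_le
  have e6 := F.eps_nonneg
  have e7 := G.en_nonneg (Tr.liftS uh)
  have e8 : 0 ≤ G.nr f := nr_nonneg f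
  have e9 : 0 ≤ G.nr (Tr.liftS uh) := nr_nonneg _
  rw [← en_sq, he] at e1
  set U := G.en (Tr.liftS uh)
  have f1 : G.nr f * G.nr (Tr.liftS uh) ≤ G.nr f * U := by gcongr
  have f2 : G.eps γ h * (G.nr f * G.nr (Tr.liftS uh)) ≤ 1 / 1000 * (G.nr f * U) := by gcongr
  have f3 : G.eps γ h * (U * U) ≤ 1 / 1000 * (U * U) := by gcongr
  have g1 := (abs_le.1 e1).1
  have g2 := (abs_le.1 e2).2
  have g3 := (abs_le.1 e3).2
  have f4 : U * U ≤ (2 * G.nr f) * U := by nlinarith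
  by_contra hc
  push Not at hc
  have : 0 < U := lt_of_le_of_lt (by positivity) hc
  nlinarith

set_option maxHeartbeats 1000000 in
/-- the maximum norm estimate for the discrete error -/
lemma main_e (G : Geo Srf) {γ : ℝ} (hγ : 0 < γ) : ∃ C : ℝ, 0 ≤ C ∧
    ∀ {h : ℝ} {Tr : Triangulation Srf γ h} (_ : FE G Tr) (_ : (G.L + 1) * h ≤ G.r2)
      (_ : 1 ≤ - Real.log h) (u f uh : E3 → ℝ)
      (_ : ContDiff ℝ (⊤ : ℕ∞) u) (_ : ContDiff ℝ (⊤ : ℕ∞) f) (M : ℝ)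
      (_ : ∀ x ∈ Srf.S, |u x| ≤ M) (_ : ∀ x ∈ Srf.S, ‖G.gd u x‖ ≤ M)
      (_ : ∀ i : Fin 3, ∀ x ∈ Srf.S, ‖G.gd (fun y => G.gd u y i) x‖ ≤ M)
      (_ : ∀ φ, ContDiff ℝ (⊤ : ℕ∞) φ → G.form u φ = ∫ x, f x * φ x ∂G.mu)
      (_ : Tr.IsVh uh) (_ : ∀ v, Tr.IsVh v → Tr.ahForm uh v = ∫ x in Tr.Sh, f (Tr.a x) * v x ∂μH[2]),
      ∀ x ∈ Tr.Sh, |u (G.a x) - uh x| ≤ C * (h ^ 2 * (- Real.log h) * M) := by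
  obtain ⟨Cg, hCg, green⟩ := green G hγ (le_refl (G.L + 1))
  obtain ⟨Cf, hCf, fb⟩ := f_bound G
  have hL := G.L_pos
  have hc0 := c0_pos
  set A := 6 * G.L ^ 4 with hA
  set B := 24 * G.L ^ 4 / γ with hB
  set Q := √(G.mu.real univ) with hQ
  set E0 := 10 * G.L ^ 6 / γ ^ 2 with hE0
  have A0 : 0 ≤ A := by positivity
  have B0 : 0 ≤ B := by positivity
  have Q0 : 0 ≤ Q := by positivity
  have E00 : 0 ≤ E0 := by positivity
  set C1 := A * (G.L * (G.L + 1) ^ 2) + (A + B) * Q + (A + B) * Cg + 130 * E0 * Cf * Cg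
    + ((A + B + 2) * Q + 2 * Cf) with hC1
  have C10 : 0 ≤ C1 := by positivity
  refine ⟨A + C1 / (c0 * γ ^ 2 / 128), by positivity, ?_⟩
  intro h Tr F hr2 hlog u f uh hu hf M hM0 hM1 hM2 hweak huh hdisc x hx
  obtain ⟨s₀, hs₀⟩ := Srf.nonempty
  have M0 : 0 ≤ M := (abs_nonneg _).trans (hM0 s₀ hs₀)
  obtain ⟨I, hI, hIn⟩ := exists_interp Tr u
  have hu1 : ContDiff ℝ 1 u := hu.of_le (by exact_mod_cast le_top)
  have hf1 : ContDiff ℝ 1 f := hf.of_le (by exact_mod_cast le_top)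
  have Wu : G.W u := C1W hu1
  have Wf : G.W f := C1W hf1
  have WI : G.W (Tr.liftS I) := F.lift_W hI
  have WU : G.W (Tr.liftS uh) := F.lift_W huh
  have Wη : G.W (fun x => Tr.liftS I x - u x) := WI.sub Wu
  have h_intg := F.interp_u hu hM1 hM2 hI hIn
  have hpt := F.interp_pt hu hM1 hM2 hI hIn hx
  have h0 := F.h0
  have hh1 := F.h1
  set ℓ := - Real.log h with hℓ
  have ηa : ∀ᵐ x ∂G.mu, |Tr.liftS I x - u x| ≤ A * M * h ^ 2 := by
    filter_upwards [h_intg] with y hy using hy.1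
  have ηb : ∀ᵐ x ∂G.mu, ‖G.gd (fun x => Tr.liftS I x - u x) x‖ ≤ B * M * h := by
    filter_upwards [h_intg, WI.2, Wu.2] with y hy d1 d2
    rw [gd_sub d1 d2]; exact hy.2
  have hsq : h ^ 2 ≤ 1 := by nlinarith
  have enη : G.en (fun x => Tr.liftS I x - u x) ≤ (A + B) * Q * M := by
    have e1 := en_bd Wη (by positivity) (by positivity) ηa ηb
    refine e1.trans ?_
    have e2 : A * M * h ^ 2 + B * M * h ≤ A * M * 1 + B * M * 1 := by gcongr
    calc _ ≤ (A * M * 1 + B * M * 1) * Q := by gcongr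
      _ = _ := by ring
  have enu : G.en u ≤ 2 * Q * M := by
    have e1 := en_bd Wu M0 M0 (ae_of hM0) (ae_of hM1)
    linarith
  have nf := fb u f hu hf M hM0 hM1 hM2 hweak
  have enU : G.en (Tr.liftS uh) ≤ 2 * Cf * M := by
    have := F.en_uh Wf.bm huh (hdisc uh huh); linarith
  have hv : Tr.IsVh (fun x => I x - uh x) := Vh_sub hI huh
  obtain ⟨φ, z, hz, hloc, hφ⟩ := F.exists_phi hv
  obtain ⟨g, gh, P⟩ := exists_GP F hloc.1
  obtain ⟨g1, g2, g3, g4⟩ := green F P z hz hloc hr2 hlog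
  have hlift : Tr.liftS (fun x => I x - uh x) = fun y => Tr.liftS I y - Tr.liftS uh y := rfl
  have Wgh : G.W (Tr.liftS gh) := F.lift_W P.vh
  have Wg : G.W g := C1W P.C1
  have WE := P.W F
  have d1 := P.dsol _ hv
  have m1 := hφ x hx
  rw [hlift] at d1 m1
  have enE : G.en (fun y => Tr.liftS I y - Tr.liftS uh y) ≤ ((A + B + 2) * Q + 2 * Cf) * M := by
    have e1 := en_sub_le WI WU
    have e2 := en_add_le Wη Wu
    have e3 : (fun x => Tr.liftS I x - u x + u x) = Tr.liftS I := by funext y; ring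
    rw [e3] at e2
    linarith
  have e1 := form_sub_right WI WU Wgh
  have e2 := form_sub_right WI Wu Wgh
  have e3 : G.form (ER Tr g gh) (fun x => Tr.liftS I x - u x) = _ := form_sub_left Wg Wgh Wη
  have e4 := P.sol _ Wη
  have e5 : |∫ x, φ x * (Tr.liftS I x - u x) ∂G.mu| ≤ A * M * h ^ 2 * (G.L * (G.L + 1) ^ 2) := by
    have i1 : Integrable (fun x => |φ x|) G.mu := hloc.1.abs.integrable
    have j1 : |∫ x, φ x * (Tr.liftS I x - u x) ∂G.mu| ≤ ∫ x, (A * M * h ^ 2) * |φ x| ∂G.mu := by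
      rw [← Real.norm_eq_abs]
      refine norm_integral_le_of_norm_le (i1.const_mul _) ?_
      filter_upwards [ηa] with y hy
      rw [norm_mul, mul_comm, Real.norm_eq_abs, Real.norm_eq_abs]
      gcongr
    rw [integral_const_mul] at j1
    have j2 := Loc.int_abs (by positivity) h0 hz hloc
    refine j1.trans ?_
    gcongr
  have e6 := form_l1 WE Wη ηa ηb
  have e7 : G.form u (Tr.liftS gh) = _ := weak_ext Wu Wf.bm hweak Wgh
  have e8 := F.rhs_cmp Wf.bm P.vh
  have e9 := F.form_cmp huh P.vh
  rw [hdisc gh P.vh] at e9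
  have s1 : 1 ≤ √ℓ := Real.one_le_sqrt.2 hlog
  have s2 : √ℓ ≤ ℓ := by
    have := Real.mul_self_sqrt (by linarith : 0 ≤ ℓ)
    nlinarith
  have ee : G.eps γ h = E0 * h ^ 2 := rfl
  have nGh : G.nr (Tr.liftS gh) ≤ Cg * ℓ := (nr_le_en Wgh).trans (g2.trans (by gcongr))
  have eGh : G.en (Tr.liftS gh) ≤ Cg * ℓ := g2.trans (by gcongr)
  have ℓ0 : 0 ≤ ℓ := by linarith
  have k1 : 10 * G.eps γ h * (G.nr f * G.nr (Tr.liftS gh)) ≤ 10 * (E0 * h ^ 2) * (Cf * M * (Cg * ℓ)) := by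
    rw [ee]
    have := nr_nonneg (G := G) f
    have := nr_nonneg (G := G) (Tr.liftS gh)
    gcongr
  have k2 : 60 * G.eps γ h * (G.en (Tr.liftS uh) * G.en (Tr.liftS gh)) ≤
      60 * (E0 * h ^ 2) * (2 * Cf * M * (Cg * ℓ)) := by
    rw [ee]
    have := G.en_nonneg (Tr.liftS uh)
    have := G.en_nonneg (Tr.liftS gh)
    gcongr
  have k3 : B * M * h * (∫ x, ‖G.gd (ER Tr g gh) x‖ ∂G.mu) ≤ B * M * h * (Cg * (h * ℓ)) := by gcongr
  have k4 : A * M * h ^ 2 * (∫ x, ‖ER Tr g gh x‖ ∂G.mu) ≤ A * M * h * (Cg * (h * ℓ)) := by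
    have q1 : 0 ≤ ∫ x, ‖ER Tr g gh x‖ ∂G.mu := integral_nonneg fun _ => norm_nonneg _
    have q2 : h ^ 2 ≤ h := by nlinarith
    gcongr
  have k5 : h ^ 2 * G.en (fun x => Tr.liftS I x - u x) ≤ h ^ 2 * ((A + B) * Q * M) := by gcongr
  have k6 : h ^ 2 * G.en (fun y => Tr.liftS I y - Tr.liftS uh y) ≤
      h ^ 2 * (((A + B + 2) * Q + 2 * Cf) * M) := by gcongr
  have sy1 := form_symm (G := G) u (Tr.liftS gh)
  have sy2 := form_symm (G := G) (Tr.liftS uh) (Tr.liftS gh)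
  have a1 := (abs_le.1 d1).1
  have a4 := (abs_le.1 e4).2
  have a5 := (abs_le.1 e5).2
  have a6 := (abs_le.1 e6).1
  have a8 := (abs_le.1 e8).1
  have a9 := (abs_le.1 e9).2
  have tot : c0 * γ ^ 2 / 128 * |I x - uh x| ≤ C1 * (h ^ 2 * ℓ * M) := by
    have b1 : c0 * γ ^ 2 / 128 * |I x - uh x| ≤
      (A * M * h ^ 2 * (G.L * (G.L + 1) ^ 2) + h ^ 2 * ((A + B) * Q * M)) * 1 +
      (B * M * h * (Cg * (h * ℓ)) + A * M * h * (Cg * (h * ℓ))) +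
      (10 * (E0 * h ^ 2) * (Cf * M * (Cg * ℓ)) + 60 * (E0 * h ^ 2) * (2 * Cf * M * (Cg * ℓ)))
      + h ^ 2 * (((A + B + 2) * Q + 2 * Cf) * M) * 1 := by linarith
    refine b1.trans ?_
    calc _ ≤ (A * M * h ^ 2 * (G.L * (G.L + 1) ^ 2) + h ^ 2 * ((A + B) * Q * M)) * ℓ +
      (B * M * h * (Cg * (h * ℓ)) + A * M * h * (Cg * (h * ℓ))) +
      (10 * (E0 * h ^ 2) * (Cf * M * (Cg * ℓ)) + 60 * (E0 * h ^ 2) * (2 * Cf * M * (Cg * ℓ)))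
      + h ^ 2 * (((A + B + 2) * Q + 2 * Cf) * M) * ℓ := by gcongr
      _ = _ := by rw [hC1]; ring
  have cpos : 0 < c0 * γ ^ 2 / 128 := by positivity
  have tot2 : |I x - uh x| ≤ C1 / (c0 * γ ^ 2 / 128) * (h ^ 2 * ℓ * M) := by
    rw [div_mul_eq_mul_div, le_div_iff₀ cpos]; linarith
  have fin1 : A * M * h ^ 2 ≤ A * (h ^ 2 * ℓ * M) := by
    have : A * M * h ^ 2 * 1 ≤ A * M * h ^ 2 * ℓ := by gcongr
    linarith
  have fin2 : |u (G.a x) - uh x| ≤ |I x - u (G.a x)| + |I x - uh x| := by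
    rw [abs_sub_comm (I x) (u (G.a x))]; exact abs_sub_le _ _ _
  rw [add_mul]
  linarith

end FE
end PartN26

section PartN27
namespace GeoMk
variable (Srf : SmoothSurface)

/-- orthogonality to the normal of derivatives of maps into the surface -/
lemma normal_range {a : E3 → E3} {s : E3} (hs : s ∈ Srf.S) (ha : DifferentiableAt ℝ a s)
    (has : a s = s) (hm : ∀ᶠ x in 𝓝 s, a x ∈ Srf.S) (v : E3) : ⟪Srf.n s, fderiv ℝ a s v⟫ = 0 := by
  obtain ⟨U, F, hU, hsU, hF, hSU, hg, ht⟩ := Srf.localLevel s hs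
  obtain ⟨t, ht⟩ := ht s ⟨hs, hsU⟩
  have hg := hg s hsU
  have hFd : DifferentiableAt ℝ F s := (hF.differentiable (by simp)) s
  have h1 : HasFDerivAt (F ∘ a) ((fderiv ℝ F s).comp (fderiv ℝ a s)) s := by
    refine HasFDerivAt.comp s ?_ ha.hasFDerivAt
    rw [has]; exact hFd.hasFDerivAt
  have h2 : F ∘ a =ᶠ[𝓝 s] fun _ => 0 := by
    have : ∀ᶠ x in 𝓝 s, a x ∈ U := by
      refine ha.continuousAt ?_
      rw [has]; exact hU.mem_nhds hsU
    filter_upwards [hm, this] with x h3 h4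
    have : a x ∈ Srf.S ∩ U := ⟨h3, h4⟩
    rw [hSU] at this
    exact this.2
  have h3 : HasFDerivAt (F ∘ a) (0 : E3 →L[ℝ] ℝ) s := (hasFDerivAt_const (0:ℝ) s).congr_of_eventuallyEq h2
  have h4 := DFunLike.congr_fun (h1.unique h3) v
  simp only [ContinuousLinearMap.comp_apply, zero_apply] at h4
  rw [← inner_gradient', ht, real_inner_smul_left] at h4
  rcases mul_eq_zero.1 h4 with h5 | h5
  · rw [h5, zero_smul] at ht; exact absurd ht hg
  · exact h5

/-- the surface is close to its tangent plane -/
lemma near_tangent {s : E3} (hs : s ∈ Srf.S) {v : E3} (hv : ⟪Srf.n s, v⟫ = 0) {ε : ℝ} (hε : 0 < ε)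
    (hε1 : ε ≤ 1) : ∀ᶠ τ in 𝓝[>] (0:ℝ), ∃ y ∈ Srf.S, ‖s + τ • v - y‖ ≤ ε * τ := by
  obtain ⟨U, F, hU, hsU, hF, hSU, hg, ht⟩ := Srf.localLevel s hs
  obtain ⟨t, ht⟩ := ht s ⟨hs, hsU⟩
  have hg := hg s hsU
  have t0 : t ≠ 0 := by rintro rfl; rw [zero_smul] at ht; exact hg ht
  have hn := Srf.n_unit s hs
  have hFd : DifferentiableAt ℝ F s := (hF.differentiable (by simp)) s
  have hF0 : F s = 0 := by
    have : s ∈ Srf.S ∩ U := ⟨hs, hsU⟩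
    rw [hSU] at this; exact this.2
  set δ := |t| * ε / (2 * (‖v‖ + 1)) with hδ
  have tp : 0 < |t| := abs_pos.2 t0
  have δ0 : 0 < δ := by positivity
  have h1 := hFd.hasFDerivAt.isLittleO.def δ0
  obtain ⟨r, r0, hr⟩ := Metric.eventually_nhds_iff.1 (h1.and (hU.mem_nhds hsU))
  have h2 : ∀ᶠ τ in 𝓝[>] (0:ℝ), τ < r / (‖v‖ + 1) :=
    mem_nhdsWithin_of_mem_nhds (Iio_mem_nhds (by positivity))
  filter_upwards [h2, self_mem_nhdsWithin] with τ hτ hτ0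
  have hτ0 : 0 < τ := hτ0
  have key : ∀ σ : ℝ, |σ| ≤ ε * τ → (s + τ • v + σ • Srf.n s) ∈ U ∧
      |F (s + τ • v + σ • Srf.n s) - t * σ| ≤ |t| * ε * τ / 2 := by
    intro σ hσ
    have e1 : ‖s + τ • v + σ • Srf.n s - s‖ ≤ τ * (‖v‖ + 1) := by
      have : s + τ • v + σ • Srf.n s - s = τ • v + σ • Srf.n s := by abel
      rw [this]
      refine (norm_add_le _ _).trans ?_
      rw [norm_smul, norm_smul, hn, Real.norm_of_nonneg hτ0.le, Real.norm_eq_abs]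
      nlinarith
    have e2 : dist (s + τ • v + σ • Srf.n s) s < r := by
      rw [dist_eq_norm]
      refine e1.trans_lt ?_
      rwa [lt_div_iff₀ (by positivity)] at hτ
    obtain ⟨e3, e4⟩ := hr e2
    refine ⟨e4, ?_⟩
    have e5 : fderiv ℝ F s (s + τ • v + σ • Srf.n s - s) = t * σ := by
      rw [← inner_gradient', ht, real_inner_smul_left]
      have : s + τ • v + σ • Srf.n s - s = τ • v + σ • Srf.n s := by abel
      rw [this, inner_add_right, real_inner_smul_right, real_inner_smul_right, hv,
        real_inner_self_eq_norm_sq, hn]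
      ring
    rw [e5, hF0, sub_zero, Real.norm_eq_abs] at e3
    refine e3.trans ?_
    calc δ * _ ≤ δ * (τ * (‖v‖ + 1)) := by gcongr
      _ = _ := by rw [hδ]; field_simp
  have hc : Continuous fun σ : ℝ => F (s + τ • v + σ • Srf.n s) := by
    have := hF.continuous
    fun_prop
  have hiv := intermediate_value_uIcc (a := -(ε * τ)) (b := ε * τ) hc.continuousOn
  have hετ : 0 < ε * τ := by positivity
  have k1 := (abs_le.1 (key (ε * τ) (by rw [abs_of_pos hετ])).2)
  have k2 := (abs_le.1 (key (-(ε * τ)) (by rw [abs_neg, abs_of_pos hετ])).2)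
  have hmem : (0:ℝ) ∈ uIcc (F (s + τ • v + (-(ε * τ)) • Srf.n s)) (F (s + τ • v + (ε * τ) • Srf.n s)) := by
    rw [mem_uIcc]
    rcases lt_or_gt_of_ne t0 with h | h
    · right
      rw [abs_of_neg h] at k1 k2
      have := mul_pos (neg_pos.2 h) hετ
      constructor <;> linarith [k1.1, k1.2, k2.1, k2.2]
    · left
      rw [abs_of_pos h] at k1 k2
      have := mul_pos h hετ
      constructor <;> linarith [k1.1, k1.2, k2.1, k2.2]
  obtain ⟨σ, hσ, h0⟩ := hiv hmem
  rw [uIcc_of_le (by linarith)] at hσ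
  have hσa : |σ| ≤ ε * τ := abs_le.2 hσ
  refine ⟨s + τ • v + σ • Srf.n s, ?_, ?_⟩
  · have : s + τ • v + σ • Srf.n s ∈ {y ∈ U | F y = 0} := ⟨(key σ hσa).1, h0⟩
    rw [← hSU] at this; exact this.1
  · have : s + τ • v - (s + τ • v + σ • Srf.n s) = - (σ • Srf.n s) := by abel
    rw [this, norm_neg, norm_smul, hn, mul_one]; exact hσa

/-- comparison along a ray -/
lemma ray_bound {a : E3 → E3} {s v : E3} (ha : DifferentiableAt ℝ a s) (has : a s = s) {ε : ℝ}
    (h : ∀ᶠ τ in 𝓝[>] (0:ℝ), ‖s + τ • v - a (s + τ • v)‖ ≤ ε * τ) : ‖v - fderiv ℝ a s v‖ ≤ ε := by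
  have h1 : HasDerivAt (fun τ : ℝ => s + τ • v) v 0 := by
    simpa using ((hasDerivAt_id (0:ℝ)).smul_const v).const_add s
  have h2 : HasDerivAt (fun τ : ℝ => a (s + τ • v)) (fderiv ℝ a s v) 0 := by
    refine HasFDerivAt.comp_hasDerivAt (l := a) (f := fun τ : ℝ => s + τ • v) 0 ?_ h1
    simpa using ha.hasFDerivAt
  have h3 := (h1.sub h2).tendsto_slope_zero_right
  refine le_of_tendsto h3.norm ?_
  filter_upwards [h, self_mem_nhdsWithin] with τ hτ h0
  have h0 : 0 < τ := h0
  simp only [zero_add, zero_smul, add_zero, has, sub_self, sub_zero, Pi.sub_apply]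
  rw [norm_smul, norm_inv, Real.norm_of_nonneg h0.le, inv_mul_le_iff₀ h0]
  linarith

/-- the derivative of the closest point projection -/
lemma proj {a : E3 → E3} {s : E3} (hs : s ∈ Srf.S) (ha : DifferentiableAt ℝ a s)
    (has : a s = s) (hm : ∀ᶠ x in 𝓝 s, a x ∈ Srf.S ∧ ∀ y ∈ Srf.S, dist x (a x) ≤ dist x y) (v : E3) :
    fderiv ℝ a s v = v - ⟪Srf.n s, v⟫ • Srf.n s := by
  have hr := normal_range Srf hs ha has (hm.mono fun _ h => h.1)
  have hn := Srf.n_unit s hs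
  have hray : ∀ w : E3, Tendsto (fun τ : ℝ => s + τ • w) (𝓝[>] 0) (𝓝 s) := by
    intro w
    have : Continuous fun τ : ℝ => s + τ • w := by fun_prop
    have h := this.tendsto 0
    simp only [zero_smul, add_zero] at h
    exact h.mono_left nhdsWithin_le_nhds
  have tan : ∀ w, ⟪Srf.n s, w⟫ = 0 → fderiv ℝ a s w = w := by
    intro w hw
    have : ‖w - fderiv ℝ a s w‖ ≤ 0 := by
      refine le_of_forall_pos_le_add fun ε hε => ?_
      rw [zero_add]
      have hm1 : 0 < min ε 1 := lt_min hε one_pos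
      refine le_trans ?_ (min_le_left ε 1)
      refine ray_bound ha has ?_
      filter_upwards [near_tangent Srf hs hw hm1 (min_le_right _ _), (hray w).eventually hm] with τ h1 h2
      obtain ⟨y, hy, h3⟩ := h1
      have := h2.2 y hy
      rw [dist_eq_norm, dist_eq_norm] at this
      exact this.trans h3
    rw [norm_le_zero_iff, sub_eq_zero] at this
    exact this.symm
  have nrmn : fderiv ℝ a s (Srf.n s) = 0 := by
    have h1 : ‖Srf.n s - fderiv ℝ a s (Srf.n s)‖ ≤ 1 := by
      refine ray_bound ha has ?_
      filter_upwards [(hray (Srf.n s)).eventually hm, self_mem_nhdsWithin] with τ h2 h0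
      have h0 : 0 < τ := h0
      have := h2.2 s hs
      rw [dist_eq_norm, dist_eq_norm] at this
      refine this.trans (le_of_eq ?_)
      rw [add_sub_cancel_left, norm_smul, hn, Real.norm_of_nonneg h0.le]; ring
    have h2 := hr (Srf.n s)
    have h3 := norm_sub_sq_real (Srf.n s) (fderiv ℝ a s (Srf.n s))
    rw [h2, hn] at h3
    have h4 : ‖Srf.n s - fderiv ℝ a s (Srf.n s)‖ ^ 2 ≤ 1 := by
      have := norm_nonneg (Srf.n s - fderiv ℝ a s (Srf.n s)); nlinarith
    have h5 : ‖fderiv ℝ a s (Srf.n s)‖ ^ 2 ≤ 0 := by linarith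
    have : ‖fderiv ℝ a s (Srf.n s)‖ = 0 := by nlinarith [sq_nonneg ‖fderiv ℝ a s (Srf.n s)‖]
    exact norm_eq_zero.1 this
  have hd : v = (v - ⟪Srf.n s, v⟫ • Srf.n s) + ⟪Srf.n s, v⟫ • Srf.n s := by abel
  have h0 : ⟪Srf.n s, v - ⟪Srf.n s, v⟫ • Srf.n s⟫ = 0 := by
    rw [inner_sub_right, real_inner_smul_right, real_inner_self_eq_norm_sq, hn]; ring
  calc fderiv ℝ a s v = fderiv ℝ a s (v - ⟪Srf.n s, v⟫ • Srf.n s) + ⟪Srf.n s, v⟫ • fderiv ℝ a s (Srf.n s) := by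
        conv_lhs => rw [hd]
        rw [map_add, map_smul]
    _ = _ := by rw [tan _ h0, nrmn, smul_zero, add_zero]

/-- upper Ahlfors regularity at small scales -/
lemma ahl_small {a : E3 → E3} (hda : Differentiable ℝ a) {L : ℝ} (hL : 0 < L)
    (lip : ∀ x y, ‖fderiv ℝ a x - fderiv ℝ a y‖ ≤ L * ‖x - y‖)
    (fix : ∀ s ∈ Srf.S, a s = s)
    (proj : ∀ s ∈ Srf.S, ∀ v, fderiv ℝ a s v = v - ⟪Srf.n s, v⟫ • Srf.n s)
    {z : E3} (hz : z ∈ Srf.S) {r : ℝ} (hr : 0 ≤ r) (hr1 : L * r ≤ 1 / 2) :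
    μH[2] (Srf.S ∩ closedBall z r) ≤ ENNReal.ofReal (4 * c0 * r ^ 2) := by
  have hn := Srf.n_unit z hz
  have hn0 : Srf.n z ≠ 0 := by intro h; rw [h, norm_zero] at hn; exact zero_ne_one hn
  have h1 : ∀ x ∈ Srf.S ∩ closedBall z r, ∀ y ∈ Srf.S ∩ closedBall z r,
      dist x y ≤ 2 * dist (fderiv ℝ a z x) (fderiv ℝ a z y) := by
    rintro x ⟨hx, hxr⟩ y ⟨hy, hyr⟩
    have e1 := (convex_closedBall z r).norm_image_sub_le_of_norm_hasFDerivWithin_le'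
      (f := a) (f' := fun w => fderiv ℝ a w) (C := L * r) (φ := fderiv ℝ a z)
      (fun w _ => (hda w).hasFDerivAt.hasFDerivWithinAt)
      (fun w hw => by
        refine (lip w z).trans ?_
        have : ‖w - z‖ ≤ r := by simpa [dist_eq_norm] using hw
        gcongr) hyr hxr
    rw [fix x hx, fix y hy, map_sub] at e1
    rw [dist_eq_norm, dist_eq_norm]
    have e2 : ‖x - y‖ ≤ ‖x - y - (fderiv ℝ a z x - fderiv ℝ a z y)‖ + ‖fderiv ℝ a z x - fderiv ℝ a z y‖ := by
      simpa using norm_add_le (x - y - (fderiv ℝ a z x - fderiv ℝ a z y)) (fderiv ℝ a z x - fderiv ℝ a z y)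
    have e3 : L * r * ‖x - y‖ ≤ 1 / 2 * ‖x - y‖ := by gcongr
    linarith
  have h2 := haus_le_image (by norm_num) h1
  refine h2.trans ?_
  have hf : Module.finrank ℝ (EuclideanSpace ℝ (Fin 2)) = Module.finrank ℝ ((ℝ ∙ Srf.n z)ᗮ : Submodule ℝ E3) := by
    have : Fact (Module.finrank ℝ E3 = 2 + 1) := ⟨by simp⟩
    rw [Submodule.finrank_orthogonal_span_singleton (n := 2) hn0]; simp
  let e : EuclideanSpace ℝ (Fin 2) ≃ₗᵢ[ℝ] ((ℝ ∙ Srf.n z)ᗮ : Submodule ℝ E3) :=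
    (stdOrthonormalBasis ℝ (EuclideanSpace ℝ (Fin 2))).equiv (stdOrthonormalBasis ℝ _)
      (finCongr hf)
  let f : EuclideanSpace ℝ (Fin 2) → E3 := fun x => fderiv ℝ a z z + (e x : E3)
  have hiso : Isometry f := by
    refine Isometry.of_dist_eq fun a b => ?_
    simp only [f, dist_eq_norm, add_sub_add_left_eq_sub]
    rw [← Submodule.coe_sub, ← map_sub, ← Submodule.coe_norm, LinearIsometryEquiv.norm_map]
  have hsub : fderiv ℝ a z '' (Srf.S ∩ closedBall z r) ⊆ f '' closedBall 0 r := by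
    rintro _ ⟨x, ⟨hx, hxr⟩, rfl⟩
    have hk : fderiv ℝ a z (x - z) ∈ (ℝ ∙ Srf.n z)ᗮ := by
      rw [Submodule.mem_orthogonal_singleton_iff_inner_right, proj z hz, inner_sub_right,
        real_inner_smul_right, real_inner_self_eq_norm_sq, hn]; ring
    refine ⟨e.symm ⟨_, hk⟩, ?_, ?_⟩
    · rw [mem_closedBall_zero_iff, LinearIsometryEquiv.norm_map, Submodule.coe_norm]
      have hxz : ‖x - z‖ ≤ r := by simpa [dist_eq_norm] using hxr
      refine le_trans ?_ hxz
      have e1 := norm_sub_sq_real (x - z) (⟪Srf.n z, x - z⟫ • Srf.n z)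
      rw [real_inner_smul_right, norm_smul, hn, real_inner_comm (Srf.n z) (x - z), Real.norm_eq_abs, mul_one, sq_abs] at e1
      simp only [proj z hz]
      refine le_of_sq_le_sq ?_ (norm_nonneg _)
      rw [e1]
      nlinarith [sq_nonneg ⟪Srf.n z, x - z⟫]
    · simp only [f, LinearIsometryEquiv.apply_symm_apply, map_sub]
      abel
  calc _ ≤ ENNReal.ofReal (2 ^ 2) * μH[2] (f '' closedBall 0 r) := by gcongr
    _ = ENNReal.ofReal (2 ^ 2) * ENNReal.ofReal (c0 * r ^ 2) := by
      rw [hiso.hausdorffMeasure_image (Or.inl (by norm_num)), haus_ball hr]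
    _ = _ := by rw [← ENNReal.ofReal_mul (by norm_num)]; congr 1; ring

lemma ahl {a : E3 → E3} (hda : Differentiable ℝ a) {L : ℝ} (hL : 0 < L)
    (lip : ∀ x y, ‖fderiv ℝ a x - fderiv ℝ a y‖ ≤ L * ‖x - y‖)
    (fix : ∀ s ∈ Srf.S, a s = s)
    (proj : ∀ s ∈ Srf.S, ∀ v, fderiv ℝ a s v = v - ⟪Srf.n s, v⟫ • Srf.n s) :
    ∃ C : ℝ, ∀ z ∈ Srf.S, ∀ r, 0 ≤ r →
      μH[2] (Srf.S ∩ closedBall z r) ≤ ENNReal.ofReal (C * r ^ 2) := by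
  set r0 := 1 / (2 * L) with hr0
  have r0p : 0 < r0 := by positivity
  have hLr : L * r0 = 1 / 2 := by rw [hr0]; field_simp
  have sm := fun z (hz : z ∈ Srf.S) r (hr : 0 ≤ r) (hr1 : r ≤ r0) =>
    ahl_small Srf hda hL lip fix proj hz hr (by
      calc L * r ≤ L * r0 := by gcongr
        _ ≤ _ := hLr.le)
  have hfin : μH[2] Srf.S < ⊤ := by
    refine Srf.compact.measure_lt_top_of_nhdsWithin fun z hz => ?_
    refine ⟨Srf.S ∩ closedBall z r0, inter_mem_nhdsWithin _ (closedBall_mem_nhds z r0p), ?_⟩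
    exact (sm z hz r0 r0p.le le_rfl).trans_lt ENNReal.ofReal_lt_top
  refine ⟨max (4 * c0) ((μH[2] Srf.S).toReal / r0 ^ 2), fun z hz r hr => ?_⟩
  rcases le_total r r0 with h | h
  · refine (sm z hz r hr h).trans (ENNReal.ofReal_le_ofReal ?_)
    gcongr
    exact le_max_left _ _
  · refine (measure_mono inter_subset_left).trans ?_
    refine (ENNReal.ofReal_toReal hfin.ne).symm.le.trans (ENNReal.ofReal_le_ofReal ?_)
    calc (μH[2] Srf.S).toReal = (μH[2] Srf.S).toReal / r0 ^ 2 * r0 ^ 2 := by field_simp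
      _ ≤ max (4 * c0) ((μH[2] Srf.S).toReal / r0 ^ 2) * r0 ^ 2 := by gcongr; exact le_max_right _ _
      _ ≤ _ := by
        have := c0_pos
        have : 0 ≤ max (4 * c0) ((μH[2] Srf.S).toReal / r0 ^ 2) := le_max_of_le_left (by positivity)
        gcongr

end GeoMk
end PartN27

section PartN28
namespace GeoMk
variable (Srf : SmoothSurface)

open scoped Manifold ContDiff in
/-- global smooth extension -/
lemma smooth_ext {F : Type*} [NormedAddCommGroup F] [NormedSpace ℝ F] {f : E3 → F} {V : Set E3}
    (hV : IsOpen V) (hSV : Srf.S ⊆ V) (hf : ContDiffOn ℝ (⊤ : ℕ∞) f V) :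
    ∃ g : E3 → F, ContDiff ℝ (⊤ : ℕ∞) g ∧ HasCompactSupport g ∧
      ∃ ρ > 0, ∀ s ∈ Srf.S, ∀ x, ‖x - s‖ < ρ → x ∈ V ∧ g x = f x := by
  obtain ⟨δ, δ0, hδ⟩ := Srf.compact.exists_cthickening_subset_open hV hSV
  have hcomp : IsCompact (cthickening δ Srf.S) := Srf.compact.cthickening
  have h_intg : Srf.S ⊆ interior (cthickening δ Srf.S) :=
    (self_subset_thickening δ0 _).trans
      (interior_maximal (thickening_subset_cthickening _ _) isOpen_thickening)
  obtain ⟨χ, h1, h2, h3⟩ := exists_contMDiffMap_one_nhds_of_subset_interior (n := (⊤ : ℕ∞))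
    (I := 𝓘(ℝ, E3)) Srf.compact.isClosed h_intg
  have hχ : ContDiff ℝ (⊤ : ℕ∞) χ := χ.contMDiff.contDiff
  refine ⟨fun x => χ x • f x, ?_, ?_, ?_⟩
  · rw [contDiff_iff_contDiffAt]
    intro x
    by_cases hx : x ∈ cthickening δ Srf.S
    · exact hχ.contDiffAt.smul (hf.contDiffAt (hV.mem_nhds (hδ hx)))
    · have : (fun x => χ x • f x) =ᶠ[𝓝 x] fun _ => 0 := by
        filter_upwards [hcomp.isClosed.isOpen_compl.mem_nhds hx] with y hy
        rw [h2 y hy, zero_smul]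
      exact contDiffAt_const.congr_of_eventuallyEq this
  · refine HasCompactSupport.intro hcomp fun x hx => ?_
    rw [h2 x hx, zero_smul]
  · obtain ⟨W, hW, hSW, hW1⟩ := eventually_nhdsSet_iff_exists.1 h1
    obtain ⟨ρ, ρ0, hρ⟩ := Srf.compact.exists_thickening_subset_open (hW.inter hV) (subset_inter hSW hSV)
    refine ⟨ρ, ρ0, fun s hs x hx => ?_⟩
    have : x ∈ W ∩ V := hρ (mem_thickening_iff.2 ⟨s, hs, by rwa [dist_eq_norm]⟩)
    refine ⟨this.2, ?_⟩
    show χ x • f x = f x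
    rw [hW1 x this.1, one_smul]

lemma exists_geo {γ h : ℝ} (Tr : Triangulation Srf γ h) : ∃ G : Geo Srf,
    ∀ s ∈ Srf.S, ∀ x, ‖x - s‖ < G.ρ → x ∈ Tr.N ∧ G.a x = Tr.a x := by
  obtain ⟨a, hsm, hcs, ρ, ρ0, hρ⟩ := smooth_ext Srf Tr.N_open Tr.S_sub Tr.a_smooth
  have fix : ∀ s ∈ Srf.S, a s = s := by
    intro s hs
    obtain ⟨h1, h2⟩ := hρ s hs s (by simpa using ρ0)
    rw [h2]
    have := Tr.a_nearest s h1 s hs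
    rw [dist_self] at this
    exact (dist_le_zero.1 this).symm
  have hd : Differentiable ℝ a := hsm.differentiable (by simp)
  have prj : ∀ s ∈ Srf.S, ∀ v, fderiv ℝ a s v = v - ⟪Srf.n s, v⟫ • Srf.n s := by
    intro s hs v
    refine proj Srf hs (hd s) (fix s hs) ?_ v
    filter_upwards [ball_mem_nhds s ρ0] with x hx
    rw [mem_ball, dist_eq_norm] at hx
    obtain ⟨h1, h2⟩ := hρ s hs x hx
    rw [h2]
    exact ⟨Tr.a_mem x h1, Tr.a_nearest x h1⟩
  have hs1 : ContDiff ℝ 1 (fderiv ℝ a) :=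
    hsm.fderiv_right (WithTop.coe_le_coe.2 (le_top : (1 + 1 : ℕ∞) ≤ ⊤))
  have hcs1 : HasCompactSupport (fderiv ℝ a) := hcs.fderiv ℝ
  obtain ⟨C1, hC1⟩ := hcs1.exists_bound_of_continuous hs1.continuous
  obtain ⟨C2, hC2⟩ := ContDiff.lipschitzWith_of_hasCompactSupport hcs1 hs1 one_ne_zero
  have lip : ∀ x y, ‖fderiv ℝ a x - fderiv ℝ a y‖ ≤ ((C2 : ℝ) + 1) * ‖x - y‖ := by
    intro x y
    have := hC2.dist_le_mul x y
    rw [dist_eq_norm, dist_eq_norm] at this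
    nlinarith [norm_nonneg (x - y)]
  obtain ⟨C3, hC3⟩ := ahl Srf hd (by positivity) lip fix prj
  set L := max (max C1 1) (max ((C2 : ℝ) + 1) C3) with hL
  refine ⟨⟨a, min ρ 1, L, lt_min ρ0 one_pos, min_le_right _ _,
    (le_max_right _ _).trans (le_max_left _ _), hsm,
    fun x => (hC1 x).trans ((le_max_left _ _).trans (le_max_left _ _)),
    fun x y => (lip x y).trans ?_, fix, ?_, prj, ?_⟩, ?_⟩
  · have : ((C2 : ℝ) + 1) ≤ L := (le_max_left _ _).trans (le_max_right _ _)
    gcongr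
  · intro s hs x hx
    obtain ⟨h1, h2⟩ := hρ s hs x (hx.trans_le (min_le_left _ _))
    rw [h2]; exact Tr.a_mem x h1
  · intro z hz r hr
    refine (hC3 z hz r hr).trans (ENNReal.ofReal_le_ofReal ?_)
    have : C3 ≤ L := (le_max_right _ _).trans (le_max_right _ _)
    gcongr
  · intro s hs x hx
    exact hρ s hs x (hx.trans_le (min_le_left _ _))

variable {Srf}

lemma gamma_le {γ h : ℝ} (h0 : 0 < h) (g0 : 0 < γ) (Tr : Triangulation Srf γ h) : γ ≤ 1 := by
  obtain ⟨t, ht⟩ := Tr.T_nonempty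
  obtain ⟨y, hy, hd⟩ := Tr.disk t ht
  have hne : t.2.1 - t.1 ≠ 0 := by
    intro hc
    have := (Tr.indep t ht).injective (a₁ := 1) (a₂ := 0) (by simpa using sub_eq_zero.1 hc)
    exact absurd this (by decide)
  set k := t.2.1 - t.1 with hk
  have kd : k ∈ dirOf t := tri_sub_dir (verts_sub_tri t (by simp [vertsOf])) (verts_sub_tri t (by simp [vertsOf]))
  have kn : 0 < ‖k‖ := norm_pos_iff.2 hne
  have hw : (γ * h / ‖k‖) • k ∈ dirOf t := Submodule.smul_mem _ _ kd
  have hn : ‖(γ * h / ‖k‖) • k‖ = γ * h := by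
    rw [norm_smul, Real.norm_of_nonneg (by positivity)]; field_simp
  have hm : (γ * h / ‖k‖) • k + y ∈ triOf t := by
    refine hd ⟨?_, AffineSubspace.vadd_mem_of_mem_direction hw (tri_sub_plane t hy)⟩
    rw [mem_closedBall, dist_eq_norm, add_sub_cancel_right, hn]
  have h1 := dist_le_diam_of_mem (tri_compact t).isBounded hm hy
  rw [dist_eq_norm, add_sub_cancel_right, hn] at h1
  have := h1.trans (Tr.diam_le t ht)
  nlinarith

lemma nearest_eq {γ γ' h h' : ℝ} (Tr : Triangulation Srf γ h) (Tr' : Triangulation Srf γ' h') {x : E3}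
    (hx : x ∈ Tr.N) (hx' : x ∈ Tr'.N) : Tr.a x = Tr'.a x :=
  Tr'.a_unique x hx' _ (Tr.a_mem x hx)
    (le_antisymm (Tr.a_nearest x hx _ (Tr'.a_mem x hx')) (Tr'.a_nearest x hx' _ (Tr.a_mem x hx)))

end GeoMk
end PartN28

section PartN29
namespace GeoMk
variable {Srf : SmoothSurface}

lemma smooth_rep {f : E3 → ℝ} (hf : SmoothNear f Srf.S) :
    ∃ g : E3 → ℝ, ContDiff ℝ (⊤ : ℕ∞) g ∧ EqOn g f Srf.S := by
  obtain ⟨V, hV, hSV, hfV⟩ := hf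
  obtain ⟨g, hg, -, ρ, ρ0, h⟩ := smooth_ext Srf hV hSV hfV
  exact ⟨g, hg, fun s hs => (h s hs s (by simpa using ρ0)).2⟩

lemma final (Srf : SmoothSurface) (γ₀ : ℝ) (hγ₀ : 0 < γ₀) :
    ∃ c > 0, ∃ h₀ > 0, h₀ < 1 ∧
      ∀ h : ℝ, 0 < h → h ≤ h₀ →
        ∀ Tr : Triangulation Srf γ₀ h, ∀ f u uh : E3 → ℝ,
          SmoothNear f Srf.S →
          IsSolution Srf f u →
          Tr.IsDiscreteSolution f uh →
          ∀ M : ℝ,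
            (∀ x ∈ Srf.S,
              |u x| + ‖Srf.grad u x‖ +
                Real.sqrt (∑ i : Fin 3, ‖Srf.grad (fun y => Srf.grad u y i) x‖ ^ 2) ≤ M) →
            ∀ x ∈ Tr.Sh, |u (Tr.a x) - uh x| ≤ c * h ^ 2 * |Real.log h| * M := by
  by_cases hex : ∃ h' : ℝ, Nonempty (Triangulation Srf γ₀ h')
  swap
  · exact ⟨1, one_pos, 1 / 2, by norm_num, by norm_num, fun h _ _ Tr => (hex ⟨h, ⟨Tr⟩⟩).elim⟩
  obtain ⟨h', ⟨Tr'⟩⟩ := hex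
  obtain ⟨G, hG⟩ := exists_geo Srf Tr'
  obtain ⟨C, C0, hC⟩ := FE.main_e G hγ₀
  have hL := G.L_one
  have hρ := G.ρ_pos
  have hr2 : 0 < G.r2 := Geo.r2_pos (G := G)
  have hL6 : (0 : ℝ) < 10 ^ 4 * G.L ^ 6 := by positivity
  refine ⟨C + 1, by positivity, min (min (G.ρ * γ₀ ^ 2 / (10 ^ 4 * G.L ^ 6)) (G.r2 / (G.L + 1)))
    (min (Real.exp (-1)) (G.ρ / 2)), ?_, ?_, ?_⟩
  · have : 0 < Real.exp (-1) := Real.exp_pos _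
    positivity
  · refine lt_of_le_of_lt ((min_le_right _ _).trans (min_le_left _ _)) ?_
    rw [Real.exp_lt_one_iff]; norm_num
  intro h h0 hh Tr f u uh hf hu huh M hM x hx
  have hh1 := (hh.trans (min_le_left _ _)).trans (min_le_left _ _)
  have hh2 := (hh.trans (min_le_left _ _)).trans (min_le_right _ _)
  have hh3 := (hh.trans (min_le_right _ _)).trans (min_le_left _ _)
  have hh4 := (hh.trans (min_le_right _ _)).trans (min_le_right _ _)
  have eqa : EqOn Tr.a G.a Tr.Sh := by
    intro y hy
    have hyN : y ∈ Tr.N := Tr.Sh_sub hy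
    obtain ⟨t, ht, hyt⟩ := mem_iUnion₂.1 hy
    have hv : t.1 ∈ vertsOf t := by simp [vertsOf]
    have hd := dist_le_diam_of_mem (tri_compact t).isBounded hyt (verts_sub_tri t hv)
    rw [dist_eq_norm] at hd
    have hd2 := Tr.diam_le t ht
    obtain ⟨h1, h2⟩ := hG t.1 (Tr.verts_on t ht hv) y (by linarith)
    rw [h2]
    exact nearest_eq Tr Tr' hyN h1
  have F : FE G Tr := by
    refine ⟨h0, hγ₀, gamma_le h0 hγ₀ Tr, ?_, eqa⟩
    rw [le_div_iff₀ hL6] at hh1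
    linarith
  have hs2 : (G.L + 1) * h ≤ G.r2 := by
    rw [le_div_iff₀ (by linarith)] at hh2
    linarith
  have hlog : 1 ≤ - Real.log h := by
    have := Real.log_le_log h0 hh3
    rw [Real.log_exp] at this
    linarith
  obtain ⟨u', hu', ue⟩ := smooth_rep hu.1
  obtain ⟨f', hf', fe⟩ := smooth_rep hf
  have hSm : MeasurableSet Srf.S := Srf.compact.isClosed.measurableSet
  have amem : ∀ y ∈ Tr.Sh, Tr.a y ∈ Srf.S := fun y hy => Tr.a_mem y (Tr.Sh_sub hy)
  have gu : ∀ y ∈ Srf.S, Srf.grad u y = G.gd u' y := fun y hy => by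
    rw [Geo.gd_eq_grad (G := G) u hy, Geo.gd_congr (G := G) ue hy]
  have ggu : ∀ (i : Fin 3), ∀ y ∈ Srf.S,
      Srf.grad (fun y => Srf.grad u y i) y = G.gd (fun y => G.gd u' y i) y := fun i y hy => by
    rw [Geo.gd_eq_grad (G := G) _ hy]
    refine Geo.gd_congr (G := G) (fun z hz => ?_) hy
    show Srf.grad u z i = G.gd u' z i
    rw [gu z hz]
  have b1 : ∀ y ∈ Srf.S, |u' y| ≤ M := fun y hy => by
    have := hM y hy
    rw [ue hy]
    linarith [norm_nonneg (Srf.grad u y),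
      Real.sqrt_nonneg (∑ i : Fin 3, ‖Srf.grad (fun y => Srf.grad u y i) y‖ ^ 2)]
  have b2 : ∀ y ∈ Srf.S, ‖G.gd u' y‖ ≤ M := fun y hy => by
    have := hM y hy
    rw [← gu y hy]
    linarith [abs_nonneg (u y),
      Real.sqrt_nonneg (∑ i : Fin 3, ‖Srf.grad (fun y => Srf.grad u y i) y‖ ^ 2)]
  have b3 : ∀ i : Fin 3, ∀ y ∈ Srf.S, ‖G.gd (fun y => G.gd u' y i) y‖ ≤ M := fun i y hy => by
    have := hM y hy
    rw [← ggu i y hy]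
    have h1 : ‖Srf.grad (fun y => Srf.grad u y i) y‖ ≤
        Real.sqrt (∑ i : Fin 3, ‖Srf.grad (fun y => Srf.grad u y i) y‖ ^ 2) := by
      refine Real.le_sqrt_of_sq_le ?_
      exact Finset.single_le_sum (f := fun i : Fin 3 => ‖Srf.grad (fun y => Srf.grad u y i) y‖ ^ 2)
        (fun j _ => sq_nonneg _) (Finset.mem_univ i)
    linarith [abs_nonneg (u y), norm_nonneg (Srf.grad u y)]
  have M0 : 0 ≤ M := (abs_nonneg _).trans (b1 _ (amem x hx))
  have key := hC F hs2 hlog u' f' uh hu' hf' M b1 b2 b3 ?_ huh.1 ?_ x hx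
  · rw [← eqa hx, ue (amem x hx)] at key
    rw [abs_of_nonpos (by linarith : Real.log h ≤ 0)]
    refine key.trans ?_
    have : 0 ≤ h ^ 2 * (- Real.log h) * M := by
      have : 0 ≤ - Real.log h := by linarith
      positivity
    nlinarith
  · intro φ hφ
    have h1 := hu.2 φ hφ
    rw [Geo.form_eq (G := G), Geo.form_congr (G := G) ue.symm (fun _ _ => rfl : EqOn φ φ Srf.S)] at h1
    rw [h1]
    refine setIntegral_congr_fun hSm fun y hy => ?_
    simp only [fe hy]
  · intro v hv
    rw [huh.2 v hv]
    have hm : MeasurableSet Tr.Sh :=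
      Finset.measurableSet_biUnion _ fun t _ => (tri_compact t).isClosed.measurableSet
    refine setIntegral_congr_fun hm fun y hy => ?_
    simp only [fe (amem y hy)]

end GeoMk
end PartN29

end Development

/-- **L^∞-error estimate.** For a compact orientable closed smooth surface `S ⊂ ℝ³` there are
constants `c > 0` and `h₀ ∈ (0,1)`, depending only on `S` and `γ₀`, such that for every
admissible quasi-uniform triangulation with `h ≤ h₀` the solution `u` of `−Δ_S u + u = f`
and the (lifted) discrete solution satisfy
`sup_S |u − U_h| ≤ c h² |log h| ‖u‖_{W^{2,∞}(S)}`. -/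
theorem linf_error_estimate (Srf : SmoothSurface) (γ₀ : ℝ) (hγ₀ : 0 < γ₀) :
    ∃ c > 0, ∃ h₀ > 0, h₀ < 1 ∧
      ∀ h : ℝ, 0 < h → h ≤ h₀ →
        ∀ Tr : Triangulation Srf γ₀ h, ∀ f u uh : E3 → ℝ,
          SmoothNear f Srf.S →
          IsSolution Srf f u →
          Tr.IsDiscreteSolution f uh →
          ∀ M : ℝ,
            (∀ x ∈ Srf.S,
              |u x| + ‖Srf.grad u x‖ +
                Real.sqrt (∑ i : Fin 3, ‖Srf.grad (fun y => Srf.grad u y i) x‖ ^ 2) ≤ M) →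
            ∀ x ∈ Tr.Sh, |u (Tr.a x) - uh x| ≤ c * h ^ 2 * |Real.log h| * M := by
  exact GeoMk.final Srf γ₀ hγ₀

end
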